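/- Let M be a compact topological n-manifold. Then there exists a constant C (depending on M alone) such that for every prime p and every elementary abelian p-group E acting continuously and effectively on M, the set Stab(E,M) of stabilizer subgroups is finite with |Stab(E,M)| ≤ C. -/

import Mathlib

open Topology Filter
open Set (univ Iio subset_univ inter_subset_right finite_singleton inter_subset_left mem_iInter
  mem_univ empty_subset toFinite image_mono)
open Module (End)
open Submodule (smul_mem mem_sup_left mem_sup_right mem_inf mem_span_singleton mkQ_apply)
open LinearMap (range proj comp_apply id_apply proj_apply)
open Finset (Ico notMem_empty sum_eq_zero mem_range mem_insert card_image_le sum_range_succ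
  single_le_sum mem_image sum_le_card_nsmul mem_filter sum_congr)
open Function (iterate_succ_apply update_of_ne update Injective comp_def)
open Pi (single_eq_of_ne)
open List (mem_cons_self replicate map_cons)
open Fintype (ofFinite)
open Metric (infDist)
open MulAction (orbitRel)
open Subtype (dist_eq val_injective)
open Subgroup (closure_le zpowers)

namespace SmithTheory

noncomputable section

set_option linter.unusedSectionVars false

variable {n : ℕ} {X I k : Type*} [Field k] {V : Type*} [AddCommGroup V] [Module k V]

section
variable {W Y Y' : Type*} [AddCommGroup W] [Module k W] [AddCommGroup Y] [Module k Y] [AddCommGroup Y'] [Module k Y']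

/-- The rank of a linear map as an extended natural number. -/
def rk (f : W →ₗ[k] Y) : ℕ∞ := Module.length k (range f)

theorem rk_le_of_ker_le {f : W →ₗ[k] Y} {g : W →ₗ[k] Y'} (h : LinearMap.ker f ≤ LinearMap.ker g) :
    rk g ≤ rk f := by
  have e := f.quotKerEquivRange
  let φ : (W ⧸ LinearMap.ker f) →ₗ[k] range g :=
    (LinearMap.ker f).liftQ g.rangeRestrict (by simpa [LinearMap.ker_rangeRestrict] using h)
  have hφ : Function.Surjective φ := by
    rintro ⟨_, x, rfl⟩
    exact ⟨Submodule.Quotient.mk x, by rfl⟩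
  exact Module.length_le_of_surjective (φ ∘ₗ e.symm.toLinearMap)
    (hφ.comp e.symm.surjective)

theorem rk_le_of_range_le {f : W →ₗ[k] Y} {g : V →ₗ[k] Y}
    (h : range f ≤ range g) : rk f ≤ rk g :=
  Module.length_le_of_injective (Submodule.inclusion h) (Submodule.inclusion_injective h)

theorem rk_prod (f : W →ₗ[k] Y) (g : W →ₗ[k] Y') :
    rk (f.prod g) = rk (g ∘ₗ (LinearMap.ker f).subtype) + rk f := by
  let R := range (f.prod g)
  let π : R →ₗ[k] range f :=
    ((LinearMap.fst k Y Y').comp R.subtype).codRestrict _ (by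
      rintro ⟨_, x, rfl⟩; exact ⟨x, rfl⟩)
  let ι : range (g ∘ₗ (LinearMap.ker f).subtype) →ₗ[k] R :=
    ((LinearMap.inr k Y Y').comp (Submodule.subtype _)).codRestrict _ (by
      rintro ⟨_, ⟨x, hx⟩, rfl⟩
      exact ⟨x, by simpa using hx⟩)
  refine Module.length_eq_add_of_exact ι π ?_ ?_ ?_
  · rintro ⟨a, ha⟩ ⟨b, hb⟩ h
    have := congrArg (fun z : R => z.1.2) h
    exact Subtype.ext this
  · rintro ⟨_, x, rfl⟩
    exact ⟨⟨_, x, rfl⟩, rfl⟩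
  · rintro ⟨_, x, rfl⟩
    constructor
    · intro h
      have h1 : f x = 0 := congrArg Subtype.val h
      exact ⟨⟨g x, ⟨x, h1⟩, rfl⟩, Subtype.ext (by simp [ι, h1])⟩
    · rintro ⟨⟨_, ⟨y, hy⟩, rfl⟩, h⟩
      have h1 : (0 : Y) = f x := congrArg (fun z : R => z.1.1) h
      exact Subtype.ext h1.symm

/-- The dimension of the image of `Z` in the quotient by `B`. -/
def rd (Z B : Submodule k V) : ℕ∞ := rk (B.mkQ ∘ₗ Z.subtype)

theorem rd_eq_zero {Z B : Submodule k V} : rd Z B = 0 ↔ Z ≤ B := by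
  unfold rd rk
  rw [Module.length_eq_zero_iff, Submodule.subsingleton_iff_eq_bot, LinearMap.range_eq_bot]
  constructor
  · intro h x hx
    have := LinearMap.congr_fun h ⟨x, hx⟩
    simpa using this
  · intro h
    ext ⟨x, hx⟩
    simpa using h hx

variable {V₁ V₂ V₃ : Type*} [AddCommGroup V₁] [Module k V₁] [AddCommGroup V₂] [Module k V₂]
  [AddCommGroup V₃] [Module k V₃]

theorem rd_le_add {Z₁ B₁ : Submodule k V₁} {Z₂ B₂ : Submodule k V₂} {Z₃ B₃ : Submodule k V₃}
    (f : V₁ →ₗ[k] V₂) (g : V₂ →ₗ[k] V₃)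
    (hf : ∀ x ∈ Z₁, x ∈ B₁ → f x ∈ B₂) (hg : ∀ x ∈ Z₂, g x ∈ Z₃)
    (hex : ∀ x ∈ Z₂, g x ∈ B₃ → ∃ y ∈ Z₁, x - f y ∈ B₂) :
    rd Z₂ B₂ ≤ rd Z₁ B₁ + rd Z₃ B₃ := by
  set α : Z₂ →ₗ[k] V₃ ⧸ B₃ := B₃.mkQ ∘ₗ g ∘ₗ Z₂.subtype
  set β : Z₂ →ₗ[k] V₂ ⧸ B₂ := B₂.mkQ ∘ₗ Z₂.subtype
  have h1 : rk β ≤ rk (α.prod β) := rk_le_of_ker_le (by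
    intro x hx
    exact (Prod.ext_iff.1 hx).2)
  have h2 : rk α ≤ rd Z₃ B₃ := rk_le_of_range_le (by
    rintro _ ⟨x, rfl⟩
    exact ⟨⟨g x, hg x x.2⟩, rfl⟩)
  have h3 : rk (β ∘ₗ (LinearMap.ker α).subtype) ≤ rk (B₂.mkQ ∘ₗ f ∘ₗ Z₁.subtype) :=
    rk_le_of_range_le (by
      rintro _ ⟨⟨x, hx⟩, rfl⟩
      have hx' : g x ∈ B₃ := by simpa [α] using hx
      obtain ⟨y, hy, hxy⟩ := hex x x.2 hx'
      refine ⟨⟨y, hy⟩, ?_⟩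
      simp only [comp_apply, Submodule.subtype_apply, mkQ_apply, β]
      exact ((Submodule.Quotient.eq _).2 hxy).symm)
  have h4 : rk (B₂.mkQ ∘ₗ f ∘ₗ Z₁.subtype) ≤ rd Z₁ B₁ := rk_le_of_ker_le (by
    rintro ⟨x, hx⟩ h
    have h' : x ∈ B₁ := by simpa using h
    simpa using hf x hx h')
  calc rd Z₂ B₂ = rk β := rfl
    _ ≤ rk (α.prod β) := h1
    _ = _ := rk_prod α β
    _ ≤ _ := add_le_add (h3.trans h4) h2

theorem rd_add_le {Z₁ B₁ : Submodule k V₁} {Z₂ B₂ : Submodule k V₂} {Z₃ B₃ : Submodule k V₃}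
    (f : V₁ →ₗ[k] V₂) (g : V₂ →ₗ[k] V₃)
    (hf : ∀ x ∈ Z₁, f x ∈ Z₂) (hf' : ∀ x ∈ Z₁, f x ∈ B₂ → x ∈ B₁)
    (hgf : ∀ x ∈ Z₁, g (f x) ∈ B₃) (hg : ∀ x ∈ Z₂, x ∈ B₂ → g x ∈ B₃)
    (hs : ∀ z ∈ Z₃, ∃ x ∈ Z₂, z - g x ∈ B₃) :
    rd Z₁ B₁ + rd Z₃ B₃ ≤ rd Z₂ B₂ := by
  set α : Z₂ →ₗ[k] V₃ ⧸ B₃ := B₃.mkQ ∘ₗ g ∘ₗ Z₂.subtype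
  set β : Z₂ →ₗ[k] V₂ ⧸ B₂ := B₂.mkQ ∘ₗ Z₂.subtype
  have h1 : rk (α.prod β) ≤ rk β := rk_le_of_ker_le (by
    rintro ⟨x, hx⟩ h
    have h' : x ∈ B₂ := by simpa [β] using h
    have : g x ∈ B₃ := hg x hx h'
    simp [α, β, this, h'])
  have h2 : rd Z₃ B₃ ≤ rk α := rk_le_of_range_le (by
    rintro _ ⟨⟨z, hz⟩, rfl⟩
    obtain ⟨x, hx, hxz⟩ := hs z hz
    exact ⟨⟨x, hx⟩, ((Submodule.Quotient.eq _).2 hxz).symm⟩)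
  have h3 : rk (B₂.mkQ ∘ₗ f ∘ₗ Z₁.subtype) ≤ rk (β ∘ₗ (LinearMap.ker α).subtype) :=
    rk_le_of_range_le (by
      rintro _ ⟨⟨x, hx⟩, rfl⟩
      exact ⟨⟨⟨f x, hf x hx⟩, by simpa [α] using hgf x hx⟩, rfl⟩)
  have h4 : rd Z₁ B₁ ≤ rk (B₂.mkQ ∘ₗ f ∘ₗ Z₁.subtype) := rk_le_of_ker_le (by
    rintro ⟨x, hx⟩ h
    have h' : f x ∈ B₂ := by simpa using h
    simpa using hf' x hx h')
  calc _ ≤ _ := add_le_add (h4.trans h3) h2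
    _ = rk (α.prod β) := (rk_prod α β).symm
    _ ≤ _ := h1

theorem rd_le_of_surj {Z₁ B₁ : Submodule k V₁} {Z₂ B₂ : Submodule k V₂} (f : V₁ →ₗ[k] V₂)
    (hf : ∀ x ∈ Z₁, x ∈ B₁ → f x ∈ B₂) (hs : ∀ x ∈ Z₂, ∃ y ∈ Z₁, x - f y ∈ B₂) :
    rd Z₂ B₂ ≤ rd Z₁ B₁ := by
  have := rd_le_add (Z₃ := (⊤ : Submodule k V₂)) (B₃ := ⊤) f LinearMap.id hf
    (fun _ _ => trivial) (fun x hx _ => hs x hx)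
  simpa [(rd_eq_zero (Z := (⊤ : Submodule k V₂)) (B := ⊤)).2 le_rfl] using this

theorem rd_le_of_inj {Z₂ B₂ : Submodule k V₂} {Z₃ B₃ : Submodule k V₃} (g : V₂ →ₗ[k] V₃)
    (hg : ∀ x ∈ Z₂, g x ∈ Z₃) (hi : ∀ x ∈ Z₂, g x ∈ B₃ → x ∈ B₂) :
    rd Z₂ B₂ ≤ rd Z₃ B₃ := by
  have := rd_le_add (Z₁ := (⊥ : Submodule k V₂)) (B₁ := B₂) (B₂ := B₂) LinearMap.id g
    (fun x _ h => h) hg (fun x hx h => ⟨0, by simp, by simpa using hi x hx h⟩)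
  simpa [(rd_eq_zero (Z := (⊥ : Submodule k V₂)) (B := B₂)).2 bot_le] using this

theorem rd_mono {Z Z' B B' : Submodule k V} (hZ : Z ≤ Z') (hB : B' ≤ B) : rd Z B ≤ rd Z' B' :=
  (rd_le_of_inj (B₃ := B) LinearMap.id (fun _ h => hZ h) (fun _ _ h => h)).trans
    (rd_le_of_surj LinearMap.id (fun _ _ h => hB h) (fun x hx => ⟨x, hx, by simp⟩))

end

section
variable {V' : Type*} [AddCommGroup V'] [Module k V'] {d : V →ₗ[k] V} {d' : V' →ₗ[k] V'}

/-- A graded family of subspaces stable under the differential, trivial in degree zero. -/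
structure IsCx (d : V →ₗ[k] V) (K : ℕ → Submodule k V) : Prop where
  zero : K 0 = ⊥
  mem : ∀ {m x}, x ∈ K m → d x ∈ K (m + 1)

/-- The dimension of the cohomology of `K / L` in degree `m`. -/
def hc (d : V →ₗ[k] V) (K L : ℕ → Submodule k V) (m : ℕ) : ℕ∞ :=
  rd (K m ⊓ (L (m + 1)).comap d) ((K (m - 1)).map d ⊔ L m)

theorem mem_bd {K L : ℕ → Submodule k V} {m : ℕ} {z : V} :
    z ∈ (K m).map d ⊔ L (m + 1) ↔ ∃ y ∈ K m, z - d y ∈ L (m + 1) := by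
  rw [Submodule.mem_sup]
  constructor
  · rintro ⟨_, ⟨y, hy, rfl⟩, l, hl, rfl⟩
    exact ⟨y, hy, by simpa using hl⟩
  · rintro ⟨y, hy, h⟩
    exact ⟨d y, ⟨y, hy, rfl⟩, _, h, by abel⟩

theorem mem_bd' {K L : ℕ → Submodule k V} {m : ℕ} {z : V} :
    z ∈ (K (m - 1)).map d ⊔ L m ↔ ∃ y ∈ K (m - 1), z - d y ∈ L m := by
  rw [Submodule.mem_sup]
  constructor
  · rintro ⟨_, ⟨y, hy, rfl⟩, l, hl, rfl⟩
    exact ⟨y, hy, by simpa using hl⟩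
  · rintro ⟨y, hy, h⟩
    exact ⟨d y, ⟨y, hy, rfl⟩, _, h, by abel⟩

theorem hc_eq_zero {K L : ℕ → Submodule k V} {m : ℕ} :
    hc d K L m = 0 ↔ ∀ z ∈ K m, d z ∈ L (m + 1) → ∃ y ∈ K (m - 1), z - d y ∈ L m := by
  unfold hc
  rw [rd_eq_zero]
  constructor
  · intro h z hz hdz
    exact mem_bd'.1 (h ⟨hz, hdz⟩)
  · rintro h z ⟨hz, hdz⟩
    exact mem_bd'.2 (h z hz hdz)

theorem IsCx.hc_zero {K L : ℕ → Submodule k V} (hK : IsCx d K) : hc d K L 0 = 0 := by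
  rw [hc_eq_zero]
  intro z hz _
  rw [hK.zero, Submodule.mem_bot] at hz
  exact ⟨0, by simp, by simp [hz]⟩

variable {K L J : ℕ → Submodule k V}

theorem hc_succ {K L : ℕ → Submodule k V} {m : ℕ} : hc d K L (m + 1) =
    rd (K (m + 1) ⊓ (L (m + 2)).comap d) ((K m).map d ⊔ L (m + 1)) := rfl

theorem hc_le_add (dd : ∀ x, d (d x) = 0)
    (hLK : ∀ m, L m ≤ K m) (hKJ : ∀ m, K m ≤ J m) (m : ℕ) :
    hc d J L m ≤ hc d K L m + hc d J K m := by
  refine rd_le_add LinearMap.id LinearMap.id ?_ ?_ ?_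
  · rintro x - hx
    obtain ⟨y, hy, h⟩ := mem_bd'.1 hx
    exact mem_bd'.2 ⟨y, hKJ _ hy, h⟩
  · rintro x ⟨hx, hdx⟩
    exact ⟨hx, hLK _ hdx⟩
  · rintro x ⟨hx, hdx⟩ hxb
    obtain ⟨y, hy, h⟩ := mem_bd'.1 hxb
    refine ⟨x - d y, ⟨h, ?_⟩, mem_bd'.2 ⟨y, hy, ?_⟩⟩
    · simpa [dd] using hdx
    · simp

theorem hc_le_add' (dd : ∀ x, d (d x) = 0)
    (hLK : ∀ m, L m ≤ K m) (hKJ : ∀ m, K m ≤ J m) (m : ℕ) :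
    hc d J K m ≤ hc d J L m + hc d K L (m + 1) := by
  rw [hc_succ]
  refine rd_le_add LinearMap.id d ?_ ?_ ?_
  · rintro x ⟨hx, hdx⟩ hxb
    obtain ⟨y, hy, h⟩ := mem_bd'.1 hxb
    exact mem_bd'.2 ⟨y, hy, hLK _ h⟩
  · rintro x ⟨hx, hdx⟩
    exact ⟨hdx, by simp [dd]⟩
  · rintro x ⟨hx, hdx⟩ hxb
    obtain ⟨y, hy, h⟩ := mem_bd.1 hxb
    refine ⟨x - y, ⟨sub_mem hx (hKJ _ hy), by simpa using h⟩,
      mem_bd'.2 ⟨0, by simp, by simpa using hy⟩⟩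

theorem hc_succ_le_add (dd : ∀ x, d (d x) = 0)
    (hLK : ∀ m, L m ≤ K m) (hKJ : ∀ m, K m ≤ J m) (m : ℕ) :
    hc d K L (m + 1) ≤ hc d J L (m + 1) + hc d J K m := by
  rw [add_comm (hc d J L (m + 1)), hc_succ, hc_succ]
  refine rd_le_add d LinearMap.id ?_ ?_ ?_
  · rintro x ⟨hx, hdx⟩ hxb
    obtain ⟨y, hy, h⟩ := mem_bd'.1 hxb
    refine mem_bd.2 ⟨x - d y, h, ?_⟩
    simp [dd]
  · rintro x ⟨hx, hdx⟩
    exact ⟨hKJ _ hx, hdx⟩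
  · rintro x ⟨hx, hdx⟩ hxb
    obtain ⟨y, hy, h⟩ := mem_bd.1 hxb
    refine ⟨y, ⟨hy, ?_⟩, mem_bd.2 ⟨0, by simp, ?_⟩⟩
    · have : d y = x - (x - d y) := by abel
      change d y ∈ K (m + 1)
      rw [this]
      exact sub_mem hx (hLK _ h)
    · simpa using h

/-- A linear map inducing a degreewise isomorphism `K / L ≃ K' / L'`. -/
structure SqIso (d : V →ₗ[k] V) (d' : V' →ₗ[k] V') (φ : V →ₗ[k] V')
    (K L : ℕ → Submodule k V) (K' L' : ℕ → Submodule k V') : Prop where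
  comm : ∀ x, φ (d x) = d' (φ x)
  map : ∀ {m x}, x ∈ K m → φ x ∈ K' m
  iff : ∀ {m x}, x ∈ K m → (φ x ∈ L' m ↔ x ∈ L m)
  surj : ∀ {m y}, y ∈ K' m → ∃ x ∈ K m, y - φ x ∈ L' m

theorem SqIso.hc_eq {φ : V →ₗ[k] V'} {K' L' : ℕ → Submodule k V'} (h : SqIso d d' φ K L K' L')
    (hK : IsCx d K) (hK' : IsCx d' K') (hL' : IsCx d' L') (m : ℕ) :
    hc d K L m = hc d' K' L' m := by
  cases m with
  | zero => rw [hK.hc_zero, hK'.hc_zero]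
  | succ m =>
  rw [hc_succ, hc_succ]
  apply le_antisymm
  · refine rd_le_of_inj φ ?_ ?_
    · rintro x ⟨hx, hdx⟩
      exact ⟨h.map hx, by simpa [← h.comm] using (h.iff (hK.mem hx)).2 hdx⟩
    · rintro x ⟨hx, hdx⟩ hb
      obtain ⟨y, hy, hxy⟩ := mem_bd.1 hb
      obtain ⟨z, hz, hyz⟩ := h.surj hy
      refine mem_bd.2 ⟨z, hz, (h.iff (sub_mem hx (hK.mem hz))).1 ?_⟩
      have : φ (x - d z) = (φ x - d' y) + d' (y - φ z) := by simp [h.comm]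
      rw [this]
      exact add_mem hxy (hL'.mem hyz)
  · refine rd_le_of_surj φ ?_ ?_
    · rintro x ⟨hx, hdx⟩ hb
      obtain ⟨y, hy, hxy⟩ := mem_bd.1 hb
      refine mem_bd.2 ⟨φ y, h.map hy, ?_⟩
      rw [← h.comm, ← map_sub]
      exact (h.iff (sub_mem hx (hK.mem hy))).2 hxy
    · rintro y ⟨hy, hdy⟩
      obtain ⟨x, hx, hxy⟩ := h.surj hy
      refine ⟨x, ⟨hx, ?_⟩, mem_bd.2 ⟨0, by simp, by simpa using hxy⟩⟩
      refine (h.iff (hK.mem hx)).1 ?_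
      rw [h.comm]
      have : d' (φ x) = d' y - d' (y - φ x) := by simp
      rw [this]
      exact sub_mem hdy (hL'.mem hxy)

theorem hc_direct {A B : ℕ → Submodule k V} (hA : IsCx d A) (hB : IsCx d B) (hJ : IsCx d J)
    (hLA : ∀ m, L m ≤ A m) (hLB : ∀ m, L m ≤ B m) (hAJ : ∀ m, A m ≤ J m) (hBJ : ∀ m, B m ≤ J m)
    (hAB : ∀ m, A m ⊓ B m ≤ L m) (hs : ∀ m, J m ≤ A m ⊔ B m) (m : ℕ) :
    hc d A L m + hc d B L m ≤ hc d J L m := by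
  have key : ∀ m, hc d J A m = hc d B L m := by
    intro m
    have : SqIso d d LinearMap.id B L J A :=
      ⟨fun _ => rfl, fun h => hBJ _ h, fun {m x} h => ⟨fun h' => hAB _ ⟨h', h⟩, fun h' => hLA _ h'⟩,
        fun {m y} h => by
          obtain ⟨a, ha, b, hb, rfl⟩ := Submodule.mem_sup.1 (hs _ h)
          exact ⟨b, hb, by simpa using ha⟩⟩
    exact (this.hc_eq hB hJ hA m).symm
  cases m with
  | zero => simp [hA.hc_zero, hB.hc_zero]
  | succ m =>
  rw [← key, hc_succ, hc_succ, hc_succ]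
  refine rd_add_le LinearMap.id LinearMap.id ?_ ?_ ?_ ?_ ?_
  · rintro x ⟨hx, hdx⟩
    exact ⟨hAJ _ hx, hdx⟩
  · rintro x ⟨hx, hdx⟩ hb
    obtain ⟨y, hy, h⟩ := mem_bd.1 hb
    obtain ⟨a, ha, b, hb, rfl⟩ := Submodule.mem_sup.1 (hs _ hy)
    refine mem_bd.2 ⟨a, ha, hAB _ ⟨sub_mem hx (hA.mem ha), ?_⟩⟩
    have : x - d a = (x - d (a + b)) + d b := by rw [map_add]; abel
    rw [this]
    exact add_mem (hLB _ h) (hB.mem hb)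
  · rintro x ⟨hx, hdx⟩
    exact mem_bd.2 ⟨0, by simp, by simpa using hx⟩
  · rintro x ⟨hx, hdx⟩ hb
    obtain ⟨y, hy, h⟩ := mem_bd.1 hb
    exact mem_bd.2 ⟨y, hy, hLA _ h⟩
  · rintro x ⟨hx, hdx⟩
    obtain ⟨a, ha, b, hb, rfl⟩ := Submodule.mem_sup.1 (hs _ hx)
    have : d b = d (a + b) - d a := by simp
    exact ⟨b, ⟨hBJ _ hb, hAB _ ⟨by rw [this]; exact sub_mem hdx (hA.mem ha), hB.mem hb⟩⟩,
      mem_bd.2 ⟨0, by simp, by simpa using ha⟩⟩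

end

section
variable {V' : Type*} [AddCommGroup V'] [Module k V'] {d α β : V →ₗ[k] V} {d' α' β' : V' →ₗ[k] V'}

/-- The alternating sequence of the operators `α, β, α, β, …`. -/
def alt (α β : V →ₗ[k] V) (a : ℕ) : V →ₗ[k] V := if Even a then α else β

/-- The total differential of the periodic resolution with operators `α, β`. -/
def totD (d α β : V →ₗ[k] V) : (ℕ → V) →ₗ[k] (ℕ → V) :=
  LinearMap.pi fun a => (-1 : k) ^ a • (d ∘ₗ proj a) +
    (match a with
      | 0 => 0
      | a + 1 => alt α β a ∘ₗ proj a)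

@[simp] theorem totD_zero (F : ℕ → V) : totD d α β F 0 = d (F 0) := by
  simp [totD]

@[simp] theorem totD_succ (F : ℕ → V) (a : ℕ) :
    totD d α β F (a + 1) = (-1 : k) ^ (a + 1) • d (F (a + 1)) + alt α β a (F a) := by
  simp [totD]

/-- The total complex of a graded family. -/
def tot (K : ℕ → Submodule k V) (m : ℕ) : Submodule k (ℕ → V) :=
  ⨅ a, (K (m - a)).comap (proj a)

theorem mem_tot {K : ℕ → Submodule k V} {m : ℕ} {F : ℕ → V} :
    F ∈ tot K m ↔ ∀ a, F a ∈ K (m - a) := by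
  simp [tot]

/-- A pair of operators commuting with the differential and annihilating each other. -/
structure IsOp (d α β : V →ₗ[k] V) : Prop where
  da : ∀ x, d (α x) = α (d x)
  db : ∀ x, d (β x) = β (d x)
  ab : ∀ x, α (β x) = 0
  ba : ∀ x, β (α x) = 0

/-- A graded family stable under two operators. -/
structure OpSt (α β : V →ₗ[k] V) (K : ℕ → Submodule k V) : Prop where
  a : ∀ {m x}, x ∈ K m → α x ∈ K m
  b : ∀ {m x}, x ∈ K m → β x ∈ K m

theorem IsOp.d_alt (h : IsOp d α β) (a : ℕ) (x : V) : d (alt α β a x) = alt α β a (d x) := by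
  unfold alt; split_ifs
  exacts [h.da x, h.db x]

theorem IsOp.alt_alt (h : IsOp d α β) (a : ℕ) (x : V) : alt α β (a + 1) (alt α β a x) = 0 := by
  unfold alt
  by_cases ha : Even a
  · simp [ha, Nat.even_add_one, h.ba]
  · simp [ha, Nat.even_add_one, h.ab]

theorem OpSt.alt {K : ℕ → Submodule k V} (h : OpSt α β K) (a : ℕ) {m : ℕ} {x : V} (hx : x ∈ K m) :
    alt α β a x ∈ K m := by
  unfold SmithTheory.alt; split_ifs
  exacts [h.a hx, h.b hx]

theorem totD_totD (dd : ∀ x, d (d x) = 0) (h : IsOp d α β) (F : ℕ → V) :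
    totD d α β (totD d α β F) = 0 := by
  funext a
  match a with
  | 0 => simp [dd]
  | 1 => simp [dd, h.d_alt]
  | a + 2 =>
    simp only [totD_succ, map_add, map_smul, dd, h.d_alt, h.alt_alt, smul_zero, zero_add, add_zero,
      Pi.zero_apply]
    rw [pow_succ]
    simp

theorem tot_isCx {K : ℕ → Submodule k V} (hK : IsCx d K) (h : OpSt α β K) :
    IsCx (totD d α β) (tot K) where
  zero := by
    rw [eq_bot_iff]
    intro F hF
    rw [mem_tot] at hF
    rw [Submodule.mem_bot]
    funext a
    simpa [hK.zero] using hF a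
  mem := by
    intro m F hF
    rw [mem_tot] at hF ⊢
    have h1 : ∀ a, d (F a) ∈ K (m + 1 - a) := by
      intro a
      by_cases ha : a ≤ m
      · rw [Nat.sub_add_comm ha]
        exact hK.mem (hF a)
      · have := hF a
        rw [Nat.sub_eq_zero_of_le (by omega), hK.zero, Submodule.mem_bot] at this
        simp [this]
    intro a
    cases a with
    | zero => simpa using h1 0
    | succ a =>
      rw [totD_succ]
      refine add_mem (smul_mem _ _ (h1 _)) ?_
      rw [Nat.add_sub_add_right]
      exact h.alt a (hF a)

theorem tot_mono {K L : ℕ → Submodule k V} (h : ∀ m, L m ≤ K m) (m : ℕ) : tot L m ≤ tot K m := by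
  intro F hF
  rw [mem_tot] at hF ⊢
  exact fun a => h _ (hF a)

/-- The lift of an operator to sequences. -/
def lft (φ : V →ₗ[k] V') : (ℕ → V) →ₗ[k] (ℕ → V') := φ.compLeft ℕ

@[simp] theorem lft_apply (φ : V →ₗ[k] V') (F : ℕ → V) (a : ℕ) : lft φ F a = φ (F a) := rfl

theorem lft_totD {γ : V →ₗ[k] V'} (hd : ∀ x, γ (d x) = d' (γ x)) (ha : ∀ x, γ (α x) = α' (γ x))
    (hb : ∀ x, γ (β x) = β' (γ x)) (F : ℕ → V) :
    lft γ (totD d α β F) = totD d' α' β' (lft γ F) := by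
  funext a
  cases a with
  | zero => simp [hd]
  | succ a =>
    have : γ (alt α β a (F a)) = alt α' β' a (γ (F a)) := by
      unfold alt; split_ifs
      exacts [ha _, hb _]
    simp [hd, this]

theorem SqIso.tot {K L : ℕ → Submodule k V} {K' L' : ℕ → Submodule k V'} {φ : V →ₗ[k] V'}
    (h : SqIso d d' φ K L K' L') (ha : ∀ x, φ (α x) = α' (φ x)) (hb : ∀ x, φ (β x) = β' (φ x)) :
    SqIso (totD d α β) (totD d' α' β') (lft φ) (tot K) (tot L) (tot K') (tot L') where
  comm := lft_totD h.comm ha hb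
  map := by
    intro m F hF
    rw [mem_tot] at hF ⊢
    exact fun a => h.map (hF a)
  iff := by
    intro m F hF
    rw [mem_tot] at hF
    rw [mem_tot, mem_tot]
    exact forall_congr' fun a => h.iff (hF a)
  surj := by
    intro m F hF
    rw [mem_tot] at hF
    choose G hG hG' using fun a => h.surj (hF a)
    exact ⟨G, mem_tot.2 hG, mem_tot.2 hG'⟩

theorem single_mem_tot {K : ℕ → Submodule k V} {m a : ℕ} {x : V} (hx : x ∈ K (m - a)) :
    (Pi.single a x : ℕ → V) ∈ tot K m := by
  rw [mem_tot]
  intro b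
  by_cases hb : b = a
  · subst hb; simpa using hx
  · simp [hb]

theorem totD_single_of_ne {a b : ℕ} (x : V) (h : b ≠ a) (h' : b ≠ a + 1) :
    totD d α β (Pi.single a x) b = 0 := by
  cases b with
  | zero => rw [totD_zero, single_eq_of_ne h, map_zero]
  | succ b =>
    rw [totD_succ, single_eq_of_ne h, single_eq_of_ne (by omega)]; simp

theorem totD_single_self (a : ℕ) (x : V) :
    totD d α β (Pi.single a x) a = (-1 : k) ^ a • d x := by
  cases a with
  | zero => simp
  | succ a => rw [totD_succ, Pi.single_eq_same, single_eq_of_ne (by omega)]; simp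

theorem totD_single_succ (a : ℕ) (x : V) :
    totD d α β (Pi.single a x) (a + 1) = alt α β a x := by
  rw [totD_succ, Pi.single_eq_same, single_eq_of_ne (by omega)]; simp

/-- The part of `tot K` whose first `a` entries lie in `L`. -/
def totF (K L : ℕ → Submodule k V) (a m : ℕ) : Submodule k (ℕ → V) :=
  tot K m ⊓ ⨅ b : Fin a, (L (m - b)).comap (proj (b : ℕ))

theorem mem_totF {K L : ℕ → Submodule k V} {a m : ℕ} {F : ℕ → V} :
    F ∈ totF K L a m ↔ F ∈ tot K m ∧ ∀ b < a, F b ∈ L (m - b) := by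
  simp only [totF, mem_inf, Submodule.mem_iInf, Submodule.mem_comap,
    proj_apply]
  exact and_congr_right fun _ => ⟨fun h b hb => h ⟨b, hb⟩, fun h b => h b b.2⟩

section
variable {K L : ℕ → Submodule k V}

theorem totF_zero : totF K L 0 = tot K := by
  funext m; ext F; simp [mem_totF]

theorem tot_le_totF (h : ∀ m, L m ≤ K m) (a m : ℕ) : tot L m ≤ totF K L a m := by
  intro F hF
  exact mem_totF.2 ⟨tot_mono h m hF, fun b _ => mem_tot.1 hF b⟩

theorem totF_succ_le (a m : ℕ) : totF K L (a + 1) m ≤ totF K L a m := by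
  intro F hF
  rw [mem_totF] at hF ⊢
  exact ⟨hF.1, fun b hb => hF.2 b (by omega)⟩

end
end

section
variable {d α β : V →ₗ[k] V} {K L : ℕ → Submodule k V}

theorem IsCx.mem_sub (hK : IsCx d K) {m a : ℕ} {x : V} (hx : x ∈ K (m - a)) :
    d x ∈ K (m + 1 - a) := by
  by_cases ha : a ≤ m
  · rw [Nat.sub_add_comm ha]
    exact hK.mem hx
  · rw [Nat.sub_eq_zero_of_le (by omega), hK.zero, Submodule.mem_bot] at hx
    simp [hx]

theorem neg_one_pow_smul_mem {S : Submodule k V} {a : ℕ} {x : V} :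
    (-1 : k) ^ a • x ∈ S ↔ x ∈ S :=
  S.smul_mem_iff (pow_ne_zero _ (by simp))

theorem single_mem_totF {m a : ℕ} {x : V} (hx : x ∈ K (m - a)) :
    (Pi.single a x : ℕ → V) ∈ totF K L a m := by
  refine mem_totF.2 ⟨single_mem_tot hx, fun b hb => ?_⟩
  rw [single_eq_of_ne hb.ne]
  exact zero_mem _

/-- A periodic complex: a pair of complexes with compatible operators. -/
structure PCx (d α β : V →ₗ[k] V) (K L : ℕ → Submodule k V) : Prop where
  dd : ∀ x, d (d x) = 0
  op : IsOp d α β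
  cK : IsCx d K
  cL : IsCx d L
  oK : OpSt α β K
  oL : OpSt α β L
  le : ∀ m, L m ≤ K m

theorem PCx.DD (h : PCx d α β K L) (F : ℕ → V) : totD d α β (totD d α β F) = 0 :=
  totD_totD h.dd h.op F

theorem totF_eq_tot (hK : IsCx d K) (hLK : ∀ m, L m ≤ K m) {a m : ℕ} (h : m ≤ a) :
    totF K L a m = tot L m := by
  refine le_antisymm (fun F hF => ?_) (tot_le_totF hLK a m)
  rw [mem_totF] at hF
  refine mem_tot.2 fun b => ?_
  by_cases hb : b < a
  · exact hF.2 b hb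
  · have := mem_tot.1 hF.1 b
    rw [Nat.sub_eq_zero_of_le (by omega), hK.zero, Submodule.mem_bot] at this
    rw [this]; exact zero_mem _

theorem PCx.hc_totF_step (h : PCx d α β K L) (a m : ℕ) :
    hc (totD d α β) (totF K L a) (totF K L (a + 1)) m ≤ hc d K L (m - a) := by
  by_cases ham : m ≤ a
  · rw [hc_eq_zero.2]
    · exact zero_le
    · intro z hz _
      refine ⟨0, zero_mem _, ?_⟩
      rw [map_zero, sub_zero, totF_eq_tot h.cK h.le (by omega : m ≤ a + 1)]
      rwa [totF_eq_tot h.cK h.le ham] at hz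
  obtain ⟨j, rfl⟩ : ∃ j, m = a + (j + 1) := ⟨m - a - 1, by omega⟩
  rw [show a + (j + 1) - a = j + 1 by omega, hc_succ]
  refine rd_le_of_inj (proj a) ?_ ?_
  · rintro F ⟨hF, hDF⟩
    rw [SetLike.mem_coe, mem_totF] at hF
    rw [SetLike.mem_coe, Submodule.mem_comap, mem_totF] at hDF
    have h1 := hDF.2 a (by omega)
    refine ⟨by simpa using mem_tot.1 hF.1 a, ?_⟩
    rw [SetLike.mem_coe, Submodule.mem_comap, proj_apply]
    cases a with
    | zero => simpa using h1
    | succ a =>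
      rw [totD_succ] at h1
      have h2 := h.oL.alt a (hF.2 a (by omega))
      rw [show a + 1 + (j + 1) + 1 - (a + 1) = j + 2 by omega] at h1
      rw [show a + 1 + (j + 1) - a = j + 2 by omega] at h2
      exact neg_one_pow_smul_mem.1 ((Submodule.add_mem_iff_left _ h2).1 h1)
  · rintro F ⟨hF, hDF⟩ hb
    obtain ⟨y, hy, hyF⟩ := mem_bd.1 hb
    rw [SetLike.mem_coe, mem_totF] at hF
    refine mem_bd'.2 ⟨Pi.single a ((-1 : k) ^ a • y), single_mem_totF ?_, ?_⟩
    · rw [show a + (j + 1) - 1 - a = j by omega]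
      exact smul_mem _ _ hy
    · have hs : (Pi.single a ((-1 : k) ^ a • y) : ℕ → V) ∈ tot K (a + j) :=
        single_mem_tot (smul_mem _ _ (by rwa [show a + j - a = j by omega]))
      refine mem_totF.2 ⟨sub_mem hF.1 ((tot_isCx h.cK h.oK).mem hs), fun b hb => ?_⟩
      rw [Pi.sub_apply]
      by_cases hba : b = a
      · subst hba
        rw [totD_single_self, map_smul, smul_smul, ← mul_pow]
        simpa [show b + (j + 1) - b = j + 1 by omega] using hyF
      · rw [totD_single_of_ne _ hba (by omega), sub_zero]
        exact hF.2 b (by omega)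

/-- Partial sums. -/
def Pre (h : ℕ → ℕ∞) (m : ℕ) : ℕ∞ := ∑ j ∈ Finset.range (m + 1), h j

theorem Pre_eq (h : ℕ → ℕ∞) (m : ℕ) : Pre h m = ∑ a ∈ Finset.range (m + 1), h (m - a) := by
  unfold Pre
  rw [← Finset.sum_range_reflect]
  rfl

theorem PCx.hc_tot_eq_totF_last (h : PCx d α β K L) (m : ℕ) :
    hc (totD d α β) (totF K L (m + 1)) (tot L) m = 0 := by
  rw [hc_eq_zero]
  intro z hz _
  exact ⟨0, zero_mem _, by simpa [totF_eq_tot h.cK h.le] using hz⟩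

theorem PCx.hc_tot_le (h : PCx d α β K L) (m : ℕ) :
    hc (totD d α β) (tot K) (tot L) m ≤ Pre (hc d K L) m := by
  have key : ∀ N, hc (totD d α β) (tot K) (tot L) m ≤
      hc (totD d α β) (totF K L N) (tot L) m + ∑ a ∈ Finset.range N, hc d K L (m - a) := by
    intro N
    induction N with
    | zero => simp [totF_zero]
    | succ N ih =>
      rw [sum_range_succ]
      refine ih.trans ?_
      have := (hc_le_add (L := tot L) h.DD (tot_le_totF h.le (N + 1)) (totF_succ_le N) m).trans
        (add_le_add_right (h.hc_totF_step N m) _)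
      calc _ ≤ _ := add_le_add_left this _
        _ = _ := by ring
  have := key (m + 1)
  rwa [h.hc_tot_eq_totF_last, zero_add, ← Pre_eq] at this

theorem PCx.le_hc_totF (h : PCx d α β K L) (ha : ∀ {m x}, x ∈ K m → α x ∈ L m)
    (hb : ∀ {m x}, x ∈ K m → β x ∈ L m) (a m : ℕ) :
    hc (totD d α β) (totF K L (a + 1)) (tot L) m + hc d K L (m - a) ≤
      hc (totD d α β) (totF K L a) (tot L) m := by
  have hal : ∀ (a) {m x}, x ∈ K m → alt α β a x ∈ L m := by
    intro a m x hx; unfold alt; split_ifs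
    exacts [ha hx, hb hx]
  by_cases ham : m ≤ a
  · rw [Nat.sub_eq_zero_of_le ham, h.cK.hc_zero, add_zero, hc_eq_zero.2]
    · exact zero_le
    · intro z hz _
      exact ⟨0, zero_mem _, by simpa [totF_eq_tot h.cK h.le (by omega : m ≤ a + 1)] using hz⟩
  obtain ⟨j, rfl⟩ : ∃ j, m = a + (j + 1) := ⟨m - a - 1, by omega⟩
  rw [show a + (j + 1) - a = j + 1 by omega, hc_succ]
  have e2 : a + j + 1 - a = j + 1 := by omega
  refine rd_add_le LinearMap.id (proj a) ?_ ?_ ?_ ?_ ?_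
  · rintro F ⟨hF, hDF⟩
    exact ⟨totF_succ_le _ _ hF, hDF⟩
  · rintro F ⟨hF, hDF⟩ hb
    obtain ⟨Y, hY, hYF⟩ := mem_bd'.1 hb
    rw [SetLike.mem_coe, mem_totF] at hF
    have hY' := mem_totF.1 hY
    have e3 : a + (j + 1) - 1 = a + j := by omega
    rw [e3] at hY'
    have hYa := mem_tot.1 hY'.1 a
    rw [show a + j - a = j by omega] at hYa
    refine mem_bd'.2 ⟨Y - Pi.single a (Y a), mem_totF.2 ⟨?_, fun b hb => ?_⟩, ?_⟩
    · exact sub_mem (by rw [e3]; exact hY'.1) (single_mem_tot (by rw [e3]; exact mem_tot.1 hY'.1 a))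
    · by_cases hba : b = a
      · subst hba; simp
      · simpa [hba] using (mem_totF.1 hY).2 b (by omega)
    · refine mem_tot.2 fun b => ?_
      by_cases hba : b = a
      · subst hba
        rw [Pi.sub_apply]
        refine sub_mem (hF.2 b (by omega)) ?_
        rw [map_sub, Pi.sub_apply, totD_single_self]
        cases b with
        | zero => simp
        | succ b =>
          rw [totD_succ, add_sub_cancel_left]
          have := hal b (mem_tot.1 hY'.1 b)
          rwa [show b + 1 + j - b = b + 1 + (j + 1) - (b + 1) by omega] at this
      · have h1 := mem_tot.1 hYF b
        rw [map_sub, ← sub_add, Pi.add_apply]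
        refine add_mem h1 ?_
        by_cases hba' : b = a + 1
        · subst hba'
          rw [totD_single_succ]
          have := hal a hYa
          rwa [show j = a + (j + 1) - (a + 1) by omega] at this
        · rw [totD_single_of_ne _ hba hba']; exact zero_mem _
  · rintro F ⟨hF, hDF⟩
    refine mem_bd.2 ⟨0, zero_mem _, ?_⟩
    simpa [e2] using (mem_totF.1 hF).2 a (by omega)
  · rintro F ⟨hF, hDF⟩ hb
    obtain ⟨Y, hY, hYF⟩ := mem_bd'.1 hb
    have hY' := (mem_totF.1 hY).1
    rw [show a + (j + 1) - 1 = a + j by omega] at hY'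
    have h1 := mem_tot.1 hYF a
    have hYa := mem_tot.1 hY' a
    rw [show a + j - a = j by omega] at hYa
    rw [show a + (j + 1) - a = j + 1 by omega, Pi.sub_apply] at h1
    refine mem_bd.2 ⟨(-1 : k) ^ a • Y a, smul_mem _ _ hYa, ?_⟩
    rw [map_smul]
    cases a with
    | zero => simpa using h1
    | succ a =>
      rw [totD_succ, ← sub_sub] at h1
      have h2 := hal a (mem_tot.1 hY' a)
      rw [show a + 1 + j - a = j + 1 by omega] at h2
      exact (Submodule.sub_mem_iff_left _ h2).1 h1
  · rintro z ⟨hz, hdz⟩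
    have hz' : z ∈ K (a + (j + 1) - a) := by rwa [show a + (j + 1) - a = j + 1 by omega]
    refine ⟨Pi.single a z, ⟨single_mem_totF hz', mem_tot.2 fun b => ?_⟩,
      mem_bd.2 ⟨0, zero_mem _, by simp⟩⟩
    by_cases hba : b = a
    · subst hba
      rw [totD_single_self, show b + (j + 1) + 1 - b = j + 1 + 1 by omega]
      exact smul_mem _ _ hdz
    · by_cases hba' : b = a + 1
      · subst hba'
        rw [totD_single_succ, show a + (j + 1) + 1 - (a + 1) = j + 1 by omega]
        exact hal a hz
      · rw [totD_single_of_ne _ hba hba']; exact zero_mem _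

theorem PCx.le_hc_tot (h : PCx d α β K L) (ha : ∀ {m x}, x ∈ K m → α x ∈ L m)
    (hb : ∀ {m x}, x ∈ K m → β x ∈ L m) (m : ℕ) :
    Pre (hc d K L) m ≤ hc (totD d α β) (tot K) (tot L) m := by
  have key : ∀ N, ∑ a ∈ Finset.range N, hc d K L (m - a) +
      hc (totD d α β) (totF K L N) (tot L) m ≤ hc (totD d α β) (tot K) (tot L) m := by
    intro N
    induction N with
    | zero => simp [totF_zero]
    | succ N ih =>
      rw [sum_range_succ]
      refine le_trans ?_ ih
      calc _ = ∑ a ∈ Finset.range N, hc d K L (m - a) +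
          (hc (totD d α β) (totF K L (N + 1)) (tot L) m + hc d K L (m - N)) := by ring
        _ ≤ _ := add_le_add_right (h.le_hc_totF ha hb N m) _
  rw [Pre_eq]
  exact le_self_add.trans (key (m + 1))

end

section
variable {d α β : V →ₗ[k] V} {K L : ℕ → Submodule k V}

theorem PCx.clear (h : PCx d α β K L) {D₀ : ℕ} (hD : ∀ i, D₀ < i → hc d K L i = 0) {m A : ℕ}
    (hA : D₀ + A ≤ m) {G : ℕ → V} (hG : G ∈ tot K m)
    (hDG : ∀ b < A, totD d α β G b ∈ L (m + 1 - b)) :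
    ∃ Y ∈ tot K (m - 1), G - totD d α β Y ∈ totF K L A m := by
  induction A with
  | zero => exact ⟨0, zero_mem _, by simpa [totF_zero] using hG⟩
  | succ A ih =>
    obtain ⟨Y, hY, hYG⟩ := ih (by omega) fun b hb => hDG b (by omega)
    have h0 : hc (totD d α β) (totF K L A) (totF K L (A + 1)) m = 0 := by
      have := h.hc_totF_step A m
      rw [hD _ (by omega)] at this
      exact le_antisymm this zero_le
    obtain ⟨Y', hY', hYG'⟩ := hc_eq_zero.1 h0 _ hYG (mem_totF.2
      ⟨(tot_isCx h.cK h.oK).mem (mem_totF.1 hYG).1, fun b hb => by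
        rw [map_sub, h.DD, sub_zero]; exact hDG b hb⟩)
    refine ⟨Y + Y', add_mem hY (mem_totF.1 hY').1, ?_⟩
    rwa [map_add, ← sub_sub]

/-- Shift of sequences. -/
def sft (r : ℕ) : (ℕ → V) →ₗ[k] (ℕ → V) :=
  LinearMap.pi fun a => if r ≤ a then proj (a - r) else 0

theorem sft_add (r a : ℕ) (F : ℕ → V) : sft (k := k) r F (a + r) = F a := by simp [sft]

theorem sft_of_lt {r a : ℕ} (h : a < r) (F : ℕ → V) : sft (k := k) r F a = 0 := by
  simp [sft, h.not_ge]

theorem alt_add_two_mul (α β : V →ₗ[k] V) (M a : ℕ) : alt α β (a + 2 * M) = alt α β a := by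
  simp [alt, Nat.even_add]

theorem sft_mem_tot {m r : ℕ} {F : ℕ → V} (hF : F ∈ tot K m) : sft (k := k) r F ∈ tot K (m + r) := by
  refine mem_tot.2 fun b => ?_
  by_cases hb : b < r
  · rw [sft_of_lt (k := k) hb]; exact zero_mem _
  · obtain ⟨a, rfl⟩ : ∃ a, b = a + r := ⟨b - r, by omega⟩
    rw [sft_add (k := k), Nat.add_sub_add_right]
    exact mem_tot.1 hF a

theorem sft_totD (M : ℕ) (F : ℕ → V) :
    totD d α β (sft (k := k) (2 * M) F) = sft (k := k) (2 * M) (totD d α β F) := by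
  funext b
  by_cases hb : b < 2 * M
  · rw [sft_of_lt hb]
    cases b with
    | zero => rw [totD_zero, sft_of_lt hb, map_zero]
    | succ b => rw [totD_succ, sft_of_lt hb, sft_of_lt (by omega)]; simp
  · obtain ⟨a, rfl⟩ : ∃ a, b = a + 2 * M := ⟨b - 2 * M, by omega⟩
    rw [sft_add]
    cases a with
    | zero =>
      rw [totD_zero]
      cases M with
      | zero => simp [sft]
      | succ M =>
        rw [show 0 + 2 * (M + 1) = (2 * M + 1) + 1 by omega, totD_succ,
          show (2 * M + 1) + 1 = 0 + 2 * (M + 1) by omega, sft_add, sft_of_lt (by omega)]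
        simp [pow_mul]
    | succ a =>
      rw [show a + 1 + 2 * M = (a + 2 * M) + 1 by omega, totD_succ, sft_add,
        show (a + 2 * M) + 1 = (a + 1) + 2 * M by omega, sft_add, totD_succ, alt_add_two_mul,
        pow_add _ (a + 1) (2 * M), pow_mul]
      simp

/-- If every cohomology class is annihilated by a shift, the cohomology vanishes above the
cohomological dimension. -/
theorem PCx.hc_tot_eq_zero (h : PCx d α β K L) {D₀ : ℕ} (hD : ∀ i, D₀ < i → hc d K L i = 0)
    (hs : ∀ m, ∀ z ∈ tot K m, totD d α β z ∈ tot L (m + 1) →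
      ∃ M, ∃ Y ∈ tot K (m + 2 * M - 1), sft (k := k) (2 * M) z - totD d α β Y ∈ tot L (m + 2 * M))
    {m : ℕ} (hm : D₀ < m) : hc (totD d α β) (tot K) (tot L) m = 0 := by
  rw [hc_eq_zero]
  intro z hz hdz
  obtain ⟨M, Y, hY, hYz⟩ := hs m z hz hdz
  obtain ⟨Y₂, hY₂, hYY⟩ := h.clear (A := 2 * M) hD (by omega) hY (by
    intro b hb
    have := mem_tot.1 hYz b
    rw [Pi.sub_apply, sft_of_lt hb, zero_sub, neg_mem_iff] at this
    rwa [show m + 2 * M - 1 + 1 = m + 2 * M by omega])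
  set Y' := Y - totD d α β Y₂ with hY'
  have hY'z : sft (k := k) (2 * M) z - totD d α β Y' ∈ tot L (m + 2 * M) := by
    rwa [hY', map_sub, h.DD, sub_zero]
  refine ⟨fun a => Y' (a + 2 * M), mem_tot.2 fun a => ?_, mem_tot.2 fun a => ?_⟩
  · have := mem_tot.1 (mem_totF.1 hYY).1 (a + 2 * M)
    rwa [show m + 2 * M - 1 - (a + 2 * M) = m - 1 - a by omega] at this
  · have h1 := mem_tot.1 hY'z (a + 2 * M)
    rw [Nat.add_sub_add_right, Pi.sub_apply, sft_add] at h1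
    rw [Pi.sub_apply]
    cases a with
    | zero =>
      rw [totD_zero]
      cases M with
      | zero => simpa using h1
      | succ M =>
        have h2 := h.oL.alt (2 * M + 1) ((mem_totF.1 hYY).2 (2 * M + 1) (by omega))
        rw [show m + 2 * (M + 1) - 1 - (2 * M + 1) = m by omega] at h2
        rw [show 0 + 2 * (M + 1) = (2 * M + 1) + 1 by omega, totD_succ,
          Nat.sub_zero, ← sub_sub] at h1
        have h3 := (Submodule.sub_mem_iff_left _ h2).1 h1
        rw [show (-1 : k) ^ (2 * M + 1 + 1) = 1 by
          rw [show 2 * M + 1 + 1 = 2 * (M + 1) by ring, pow_mul]; simp, one_smul] at h3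
        simpa [show 0 + 2 * (M + 1) = 2 * M + 1 + 1 by ring] using h3
    | succ a =>
      rw [show a + 1 + 2 * M = (a + 2 * M) + 1 by omega, totD_succ, alt_add_two_mul,
        show a + 2 * M + 1 = a + 1 + 2 * M by omega, pow_add _ (a + 1) (2 * M), pow_mul] at h1
      rw [totD_succ]
      simpa using h1

/-- Freeness of `K / L` with respect to the pair `α, β`. -/
structure Free (α β : V →ₗ[k] V) (K L : ℕ → Submodule k V) : Prop where
  a : ∀ {m x}, x ∈ K m → α x ∈ L m → ∃ y ∈ K m, x - β y ∈ L m
  b : ∀ {m x}, x ∈ K m → β x ∈ L m → ∃ y ∈ K m, x - α y ∈ L m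

/-- The elements annihilated by `α` modulo `L`. -/
def fixd (α : V →ₗ[k] V) (K L : ℕ → Submodule k V) (m : ℕ) : Submodule k V :=
  K m ⊓ (L m).comap α

theorem mem_fixd {m : ℕ} {x : V} : x ∈ fixd α K L m ↔ x ∈ K m ∧ α x ∈ L m := Iff.rfl

/-- Sequences concentrated in the initial entry modulo `L`. -/
def iot (α : V →ₗ[k] V) (K L : ℕ → Submodule k V) (m : ℕ) : Submodule k (ℕ → V) :=
  (fixd α K L m).comap (proj 0) ⊓ ⨅ a : ℕ, (L (m - (a + 1))).comap (proj (a + 1))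

theorem mem_iot {m : ℕ} {F : ℕ → V} :
    F ∈ iot α K L m ↔ F 0 ∈ fixd α K L m ∧ ∀ a, F (a + 1) ∈ L (m - (a + 1)) := by
  simp [iot]

theorem iot_sqIso :
    SqIso (totD d α β) d (proj 0) (iot α K L) (tot L) (fixd α K L) L where
  comm := fun F => by simp
  map := fun hF => (mem_iot.1 hF).1
  iff := by
    intro m F hF
    rw [mem_iot] at hF
    refine ⟨fun h0 => mem_tot.2 fun a => ?_, fun h0 => mem_tot.1 h0 0⟩
    cases a with
    | zero => exact h0
    | succ a => exact hF.2 a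
  surj := by
    intro m y hy
    exact ⟨Pi.single 0 y, mem_iot.2 ⟨by simpa using hy, fun a => by simp⟩, by simp⟩

variable (h : PCx d α β K L)
include h

theorem PCx.fixd_isCx : IsCx d (fixd α K L) where
  zero := by rw [eq_bot_iff, ← h.cK.zero]; exact inf_le_left
  mem := fun hx => ⟨h.cK.mem hx.1, by
    rw [SetLike.mem_coe, Submodule.mem_comap, ← h.op.da]; exact h.cL.mem hx.2⟩

theorem PCx.le_fixd (m : ℕ) : L m ≤ fixd α K L m := fun _ hx => ⟨h.le m hx, h.oL.a hx⟩

theorem PCx.iot_le_tot (m : ℕ) : iot α K L m ≤ tot K m := by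
  intro F hF
  rw [mem_iot] at hF
  refine mem_tot.2 fun a => ?_
  cases a with
  | zero => exact hF.1.1
  | succ a => exact h.le _ (hF.2 a)

theorem PCx.tot_le_iot (m : ℕ) : tot L m ≤ iot α K L m := by
  intro F hF
  rw [mem_tot] at hF
  exact mem_iot.2 ⟨h.le_fixd m (hF 0), fun a => hF _⟩

theorem PCx.iot_isCx : IsCx (totD d α β) (iot α K L) where
  zero := by
    rw [eq_bot_iff, ← (tot_isCx h.cK h.oK).zero]
    exact h.iot_le_tot 0
  mem := by
    intro m F hF
    rw [mem_iot] at hF ⊢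
    refine ⟨by rw [totD_zero]; exact h.fixd_isCx.mem hF.1, fun a => ?_⟩
    rw [totD_succ]
    refine add_mem (smul_mem _ _ (h.cL.mem_sub (hF.2 a))) ?_
    rw [Nat.add_sub_add_right]
    cases a with
    | zero => simpa [alt] using hF.1.2
    | succ a => exact h.oL.alt _ (hF.2 a)

theorem PCx.exists_sub_mem_iot (hf : Free α β K L) {m : ℕ} {F : ℕ → V} (hF : F ∈ tot K m)
    (hDF : ∀ a, totD d α β F (a + 1) ∈ L (m - a)) :
    ∃ Y ∈ tot K (m - 1), F - totD d α β Y ∈ iot α K L m := by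
  have hfa : ∀ (a) {m x}, x ∈ K m → alt α β (a + 1) x ∈ L m → ∃ y ∈ K m, x - alt α β a y ∈ L m := by
    intro a m x hx hax
    unfold alt at hax ⊢
    by_cases ha : Even a
    · simp only [Nat.even_add_one, ha, not_true_eq_false, if_false, if_true] at hax ⊢
      exact hf.b hx hax
    · simp only [Nat.even_add_one, ha, not_false_eq_true, if_false, if_true] at hax ⊢
      exact hf.a hx hax
  have key : ∀ N, ∃ Y ∈ tot K (m - 1), ∀ a, m - N ≤ a + 1 →
      (F - totD d α β Y) (a + 1) ∈ L (m - (a + 1)) := by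
    intro N
    induction N with
    | zero =>
      refine ⟨0, zero_mem _, fun a ha => ?_⟩
      have := mem_tot.1 hF (a + 1)
      rw [map_zero, sub_zero]
      rw [Nat.sub_eq_zero_of_le (by omega), h.cK.zero, Submodule.mem_bot] at this
      rw [this]; exact zero_mem _
    | succ N ih =>
      obtain ⟨Y, hY, hYF⟩ := ih
      by_cases hb : m ≤ N + 1
      · exact ⟨Y, hY, fun a _ => hYF a (by omega)⟩
      obtain ⟨b, hbm⟩ : ∃ b, m - (N + 1) = b + 1 := ⟨m - (N + 1) - 1, by omega⟩
      have hm1 : m - 1 + 1 = m := by omega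
      set F' := F - totD d α β Y with hF'
      have hF'K : F' ∈ tot K m :=
        sub_mem hF (by have := (tot_isCx h.cK h.oK).mem hY; rwa [hm1] at this)
      have h1 : totD d α β F' (b + 1 + 1) ∈ L (m - (b + 1)) := by
        rw [hF', map_sub, h.DD, sub_zero]; exact hDF _
      rw [totD_succ] at h1
      have h2 := h.cL.mem_sub (hYF (b + 1) (by omega))
      rw [Nat.add_sub_add_right] at h2
      obtain ⟨y, hy, hyF⟩ := hfa b (mem_tot.1 hF'K (b + 1))
        ((Submodule.add_mem_iff_right _ (smul_mem _ _ h2)).1 h1)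
      refine ⟨Y + Pi.single b y, add_mem hY (single_mem_tot ?_), fun a ha => ?_⟩
      · rwa [show m - 1 - b = m - (b + 1) by omega]
      · rw [map_add, ← sub_sub, ← hF', Pi.sub_apply]
        by_cases hab : a = b
        · subst hab
          rwa [totD_single_succ]
        · rw [totD_single_of_ne _ (by omega) (by omega), sub_zero]
          exact hYF a (by omega)
  obtain ⟨Y, hY, hYF⟩ := key m
  by_cases hm0 : m = 0
  · subst hm0
    rw [(tot_isCx h.cK h.oK).zero, Submodule.mem_bot] at hF
    exact ⟨0, zero_mem _, by simp [hF]⟩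
  have hm1 : m - 1 + 1 = m := by omega
  have hF'K : F - totD d α β Y ∈ tot K m :=
        sub_mem hF (by have := (tot_isCx h.cK h.oK).mem hY; rwa [hm1] at this)
  refine ⟨Y, hY, mem_iot.2 ⟨⟨mem_tot.1 hF'K 0, ?_⟩, fun a => hYF a (by omega)⟩⟩
  have h1 : totD d α β (F - totD d α β Y) (0 + 1) ∈ L (m - 0) := by
    rw [map_sub, h.DD, sub_zero]; exact hDF _
  rw [totD_succ] at h1
  have h2 := h.cL.mem_sub (hYF 0 (by omega))
  rw [Nat.add_sub_add_right] at h2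
  have h3 := (Submodule.add_mem_iff_right _ (smul_mem _ _ h2)).1 h1
  simpa [alt] using h3

theorem PCx.hc_tot_iot (hf : Free α β K L) (m : ℕ) :
    hc (totD d α β) (tot K) (iot α K L) m = 0 := by
  rw [hc_eq_zero]
  intro F hF hDF
  refine h.exists_sub_mem_iot hf hF fun a => ?_
  have := (mem_iot.1 hDF).2 a
  rwa [Nat.add_sub_add_right] at this

theorem PCx.hc_tot_eq_fixd (hf : Free α β K L) (m : ℕ) :
    hc (totD d α β) (tot K) (tot L) m = hc d (fixd α K L) L m := by
  rw [← (iot_sqIso (β := β)).hc_eq h.iot_isCx h.fixd_isCx h.cL]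
  refine le_antisymm ?_ ?_
  · have := hc_le_add h.DD h.tot_le_iot h.iot_le_tot m
    rwa [h.hc_tot_iot hf, add_zero] at this
  · cases m with
    | zero => rw [h.iot_isCx.hc_zero]; exact zero_le
    | succ m =>
      have := hc_succ_le_add h.DD h.tot_le_iot h.iot_le_tot m
      rwa [h.hc_tot_iot hf, add_zero] at this

end

universe u v
section
variable {k : Type u} [Field k]

theorem lft_pow {V : Type v} [AddCommGroup V] [Module k V] (t : End k V) (n : ℕ) :
    lft (t ^ n) = (lft t : End k (ℕ → V)) ^ n := by
  induction n with
  | zero => rfl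
  | succ n ih => rw [pow_succ, pow_succ, ← ih]; rfl

/-- A family of commuting operators whose `p`-th powers vanish. -/
structure Fam {V : Type v} [AddCommGroup V] [Module k V] (p : ℕ) (d : End k V)
    (t : ℕ → End k V) : Prop where
  dd : ∀ x, d (d x) = 0
  dt : ∀ i, Commute d (t i)
  tt : ∀ i j, Commute (t i) (t j)
  tp : ∀ i, t i ^ p = 0
  p0 : p ≠ 0

/-- A graded family stable under a family of operators. -/
def St {V : Type v} [AddCommGroup V] [Module k V] (t : ℕ → End k V)
    (K : ℕ → Submodule k V) : Prop := ∀ i {m x}, x ∈ K m → t i x ∈ K m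

/-- The total differential with respect to `t` and `t ^ (p - 1)`. -/
abbrev totP {V : Type v} [AddCommGroup V] [Module k V] (p : ℕ) (d t : End k V) :
    End k (ℕ → V) := totD d t (t ^ (p - 1))

/-- The dimension of the cohomology of the iterated total complex. -/
def hT (p : ℕ) : (q : ℕ) → {V : Type v} → [AddCommGroup V] → [Module k V] →
    (d : End k V) → (t : ℕ → End k V) → (K L : ℕ → Submodule k V) → ℕ → ℕ∞
  | 0, _, _, _, d, _, K, L => hc d K L
  | q + 1, _, _, _, d, t, K, L =>
    hT p q (totP p d (t 0)) (fun i => lft (t (i + 1))) (tot K) (tot L)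

variable {V : Type v} [AddCommGroup V] [Module k V] {p : ℕ} {d : End k V}
  {t : ℕ → End k V} {K L J : ℕ → Submodule k V}

theorem Fam.isOp (h : Fam p d t) (i : ℕ) : IsOp d (t i) (t i ^ (p - 1)) where
  da := fun x => LinearMap.congr_fun (h.dt i).eq x
  db := fun x => LinearMap.congr_fun ((h.dt i).pow_right _).eq x
  ab := fun x => by
    rw [← End.mul_apply, mul_pow_sub_one h.p0, h.tp]; rfl
  ba := fun x => by
    rw [← End.mul_apply, pow_sub_one_mul h.p0, h.tp]; rfl

theorem St.pow (h : St t K) (i n : ℕ) {m : ℕ} {x : V} (hx : x ∈ K m) : (t i ^ n) x ∈ K m := by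
  induction n with
  | zero => exact hx
  | succ n ih => rw [pow_succ', End.mul_apply]; exact h i ih

theorem St.opSt (h : St t K) (i : ℕ) : OpSt (t i) (t i ^ (p - 1)) K := ⟨h i, h.pow i _⟩

theorem Fam.lift (h : Fam p d t) : Fam p (totP p d (t 0)) (fun i => lft (t (i + 1))) where
  dd := totD_totD h.dd (h.isOp 0)
  dt := fun i => by
    refine LinearMap.ext fun F => ?_
    exact (lft_totD (γ := t (i + 1)) (d' := d) (α' := t 0) (β' := t 0 ^ (p - 1))
      (fun x => LinearMap.congr_fun (h.dt (i + 1)).eq.symm x)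
      (fun x => LinearMap.congr_fun (h.tt (i + 1) 0).eq x)
      (fun x => LinearMap.congr_fun ((h.tt (i + 1) 0).pow_right _).eq x) F).symm
  tt := fun i j => by
    refine LinearMap.ext fun F => funext fun a => ?_
    exact LinearMap.congr_fun (h.tt (i + 1) (j + 1)).eq (F a)
  tp := fun i => by rw [← lft_pow, h.tp]; rfl
  p0 := h.p0

theorem St.lift (h : St t K) : St (fun i => lft (t (i + 1))) (tot K) := by
  intro i m F hF
  rw [mem_tot] at hF ⊢
  exact fun a => h (i + 1) (hF a)

/-- A subcomplex stable under a commuting family of operators. -/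
structure SCx (d : End k V) (t : ℕ → End k V) (K : ℕ → Submodule k V) : Prop where
  cx : IsCx d K
  st : St t K

theorem Fam.pcx (h : Fam p d t) (hK : SCx d t K) (hL : SCx d t L) (le : ∀ m, L m ≤ K m) :
    PCx d (t 0) (t 0 ^ (p - 1)) K L :=
  ⟨h.dd, h.isOp 0, hK.cx, hL.cx, hK.st.opSt 0, hL.st.opSt 0, le⟩

theorem Fam.totC (h : Fam p d t) (hK : SCx d t K) :
    SCx (totP p d (t 0)) (fun i => lft (t (i + 1))) (tot K) :=
  ⟨tot_isCx hK.cx (hK.st.opSt 0), hK.st.lift⟩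

theorem Fam.hT_le_add (h : Fam p d t) (hLK : ∀ m, L m ≤ K m) (hKJ : ∀ m, K m ≤ J m) (q m : ℕ) :
    hT p q d t J L m ≤ hT p q d t K L m + hT p q d t J K m := by
  induction q generalizing V with
  | zero => exact hc_le_add h.dd hLK hKJ m
  | succ q ih => exact ih h.lift (tot_mono hLK) (tot_mono hKJ)

theorem Fam.hT_le_add' (h : Fam p d t) (hLK : ∀ m, L m ≤ K m) (hKJ : ∀ m, K m ≤ J m) (q m : ℕ) :
    hT p q d t J K m ≤ hT p q d t J L m + hT p q d t K L (m + 1) := by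
  induction q generalizing V with
  | zero => exact hc_le_add' h.dd hLK hKJ m
  | succ q ih => exact ih h.lift (tot_mono hLK) (tot_mono hKJ)

theorem Fam.hT_succ_le_add (h : Fam p d t) (hLK : ∀ m, L m ≤ K m) (hKJ : ∀ m, K m ≤ J m)
    (q m : ℕ) : hT p q d t K L (m + 1) ≤ hT p q d t J L (m + 1) + hT p q d t J K m := by
  induction q generalizing V with
  | zero => exact hc_succ_le_add h.dd hLK hKJ m
  | succ q ih => exact ih h.lift (tot_mono hLK) (tot_mono hKJ)

theorem Pre_mono {f g : ℕ → ℕ∞} (h : f ≤ g) : Pre f ≤ Pre g := fun _ =>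
  Finset.sum_le_sum fun j _ => h j

theorem Pre_iter_mono (q : ℕ) {f g : ℕ → ℕ∞} (h : f ≤ g) : Pre^[q] f ≤ Pre^[q] g := by
  induction q generalizing f g with
  | zero => exact h
  | succ q ih => rw [iterate_succ_apply, iterate_succ_apply]; exact ih (Pre_mono h)

theorem Fam.hT_le (h : Fam p d t) (hK : SCx d t K) (hL : SCx d t L) (le : ∀ m, L m ≤ K m)
    (q : ℕ) : hT p q d t K L ≤ Pre^[q] (hc d K L) := by
  induction q generalizing V with
  | zero => exact le_rfl
  | succ q ih =>
    rw [iterate_succ_apply]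
    exact (ih h.lift (h.totC hK) (h.totC hL) (tot_mono le)).trans
      (Pre_iter_mono q fun m => (h.pcx hK hL le).hc_tot_le m)

theorem Fam.le_hT (h : Fam p d t) (hp : 2 ≤ p) (hK : SCx d t K) (hL : SCx d t L)
    (le : ∀ m, L m ≤ K m) (ht : ∀ i {m x}, x ∈ K m → t i x ∈ L m)
    (q : ℕ) : Pre^[q] (hc d K L) ≤ hT p q d t K L := by
  induction q generalizing V with
  | zero => exact le_rfl
  | succ q ih =>
    rw [iterate_succ_apply]
    refine (Pre_iter_mono q fun m => (h.pcx hK hL le).le_hc_tot (ht 0) ?_ m).trans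
      (ih h.lift (h.totC hK) (h.totC hL) (tot_mono le) fun i m F hF => ?_)
    · intro m x hx
      rw [show p - 1 = (p - 2) + 1 by omega, pow_succ, End.mul_apply]
      exact hL.st.pow 0 _ (ht 0 hx)
    · exact mem_tot.2 fun a => ht (i + 1) (mem_tot.1 hF a)

theorem Pre_iter_zero (q : ℕ) : Pre^[q] (fun _ => 0) = fun _ => 0 :=
  Function.iterate_fixed (by funext m; simp [Pre]) q

theorem Fam.hT_eq_zero (h : Fam p d t) (hK : SCx d t K) (hL : SCx d t L) (le : ∀ m, L m ≤ K m)
    (h0 : ∀ m, hc d K L m = 0) (q m : ℕ) : hT p q d t K L m = 0 := by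
  have := h.hT_le hK hL le q m
  rw [show hc d K L = fun _ => 0 from funext h0, Pre_iter_zero] at this
  exact le_antisymm this zero_le

theorem hT_sqIso {V' : Type v} [AddCommGroup V'] [Module k V'] {d' : End k V'}
    {t' : ℕ → End k V'} {K' L' : ℕ → Submodule k V'} (h : Fam p d t) (h' : Fam p d' t')
    {φ : V →ₗ[k] V'}
    (hφ : SqIso d d' φ K L K' L') (ht : ∀ i x, φ (t i x) = t' i (φ x))
    (hK : SCx d t K) (hK' : SCx d' t' K') (hL' : SCx d' t' L') (q m : ℕ) :
    hT p q d t K L m = hT p q d' t' K' L' m := by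
  induction q generalizing V V' with
  | zero => exact hφ.hc_eq hK.cx hK'.cx hL'.cx m
  | succ q ih =>
    have hp : ∀ n x, φ ((t 0 ^ n) x) = (t' 0 ^ n) (φ x) := by
      intro n
      induction n with
      | zero => intro x; rfl
      | succ n ihn => intro x; rw [pow_succ, pow_succ, End.mul_apply, ihn, ht]; rfl
    exact ih h.lift h'.lift (hφ.tot (ht 0) (hp _)) (fun i F => funext fun a => ht (i + 1) (F a))
      (h.totC hK) (h'.totC hK') (h'.totC hL')

theorem Fam.fixd_sCx (h : Fam p d t) (hK : SCx d t K) (hL : SCx d t L) (le : ∀ m, L m ≤ K m) (j : ℕ) :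
    SCx d t (fixd (t j) K L) where
  cx := PCx.fixd_isCx (β := t j ^ (p - 1))
    ⟨h.dd, h.isOp j, hK.cx, hL.cx, hK.st.opSt j, hL.st.opSt j, le⟩
  st := fun i m x hx => ⟨hK.st i hx.1, by
    have := hL.st i hx.2
    rwa [SetLike.mem_coe, Submodule.mem_comap, ← End.mul_apply, (h.tt j i).eq]⟩

theorem Fam.tail (h : Fam p d t) : Fam p d (fun i => t (i + 1)) :=
  ⟨h.dd, fun i => h.dt _, fun i j => h.tt _ _, fun i => h.tp _, h.p0⟩

theorem SCx.tail (h : SCx d t K) : SCx d (fun i => t (i + 1)) K := ⟨h.cx, fun i => h.st (i + 1)⟩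

theorem Fam.hT_free (h : Fam p d t) (hK : SCx d t K) (hL : SCx d t L) (le : ∀ m, L m ≤ K m)
    (hf : Free (t 0) (t 0 ^ (p - 1)) K L) (q m : ℕ) :
    hT p (q + 1) d t K L m = hT p q d (fun i => t (i + 1)) (fixd (t 0) K L) L m := by
  have P := h.pcx hK hL le
  have hι : SCx (totP p d (t 0)) (fun i => lft (t (i + 1))) (iot (t 0) K L) := by
    refine ⟨P.iot_isCx, fun i m F hF => ?_⟩
    rw [mem_iot] at hF ⊢
    exact ⟨(h.fixd_sCx hK hL le 0).st (i + 1) hF.1, fun a => hL.st (i + 1) (hF.2 a)⟩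
  have z := h.lift.hT_eq_zero (h.totC hK) hι P.iot_le_tot (P.hc_tot_iot hf) q
  have e : hT p (q + 1) d t K L m =
      hT p q (totP p d (t 0)) (fun i => lft (t (i + 1))) (iot (t 0) K L) (tot L) m := by
    refine le_antisymm ?_ ?_
    · have := h.lift.hT_le_add P.tot_le_iot P.iot_le_tot q m
      rwa [z, add_zero] at this
    · cases m with
      | zero =>
        refine le_trans (h.lift.hT_le hι (h.totC hL) P.tot_le_iot q 0) ?_
        have : ∀ (q : ℕ) (f : ℕ → ℕ∞), Pre^[q] f 0 = f 0 := by
          intro q f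
          induction q generalizing f with
          | zero => rfl
          | succ q ih => rw [iterate_succ_apply, ih]; simp [Pre]
        rw [this, hι.cx.hc_zero]; exact zero_le
      | succ m =>
        have := h.lift.hT_succ_le_add P.tot_le_iot P.iot_le_tot q m
        rwa [z, add_zero] at this
  rw [e]
  exact hT_sqIso h.lift h.tail iot_sqIso (fun i F => rfl) hι (h.fixd_sCx hK hL le 0).tail hL.tail q m

end

section
variable {p : ℕ}
  {d : End k V} {t : ℕ → End k V} {K L J : ℕ → Submodule k V}

theorem Fam.exists_invariant (h : Fam p d t) {Q : ℕ} (hQ : ∀ i, Q ≤ i → t i = 0)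
    {Z B : Submodule k V} (hZ : ∀ i, ∀ x ∈ Z, t i x ∈ Z) (hB : ∀ i, ∀ x ∈ B, t i x ∈ B)
    (hZB : ¬ Z ≤ B) : ∃ z ∈ Z, z ∉ B ∧ ∀ i, t i z ∈ B := by
  have key : ∀ n, ∃ z ∈ Z, z ∉ B ∧ ∀ i < n, t i z ∈ B := by
    intro n
    induction n with
    | zero =>
      obtain ⟨z, hz, hzB⟩ := SetLike.not_le_iff_exists.1 hZB
      exact ⟨z, hz, hzB, by simp⟩
    | succ n ih =>
      obtain ⟨z, hz, hzB, hi⟩ := ih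
      have hpw : ∀ e, (t n ^ e) z ∈ Z := by
        intro e
        induction e with
        | zero => exact hz
        | succ e ihe => rw [pow_succ', End.mul_apply]; exact hZ n _ ihe
      have hpB : ∀ e, ∀ x ∈ B, (t n ^ e) x ∈ B := by
        intro e x hx
        induction e with
        | zero => exact hx
        | succ e ihe => rw [pow_succ', End.mul_apply]; exact hB n _ ihe
      have hex : ∃ e, (t n ^ e) z ∈ B := ⟨p, by rw [h.tp]; exact zero_mem _⟩
      classical
      set e := Nat.find hex with he
      have h1 := Nat.find_spec hex
      rw [← he] at h1
      obtain ⟨e', he'⟩ : ∃ e', e = e' + 1 :=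
        ⟨e - 1, by
          have : e ≠ 0 := fun h0 => hzB (by rw [h0] at h1; exact h1)
          omega⟩
      refine ⟨(t n ^ e') z, hpw e', Nat.find_min hex (by omega), fun i hin => ?_⟩
      rcases Nat.lt_succ_iff_lt_or_eq.1 hin with hin | rfl
      · rw [← End.mul_apply, ((h.tt i n).pow_right e').eq]
        exact hpB _ _ (hi i hin)
      · rw [← End.mul_apply, ← pow_succ', ← he']; exact h1
  obtain ⟨z, hz, hzB, hi⟩ := key Q
  refine ⟨z, hz, hzB, fun i => ?_⟩
  by_cases hiQ : i < Q
  · exact hi i hiQ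
  · rw [hQ i (by omega)]; exact zero_mem _

/-- Truncation of a pair of complexes at a degree, with a prescribed term there. -/
def trunc (K L : ℕ → Submodule k V) (i₀ : ℕ) (S : Submodule k V) (m : ℕ) : Submodule k V :=
  if m < i₀ then K m else if m = i₀ then S else L m

theorem trunc_lt {i₀ m : ℕ} {S : Submodule k V} (h : m < i₀) : trunc K L i₀ S m = K m := by
  simp [trunc, h]

theorem trunc_eq {i₀ : ℕ} {S : Submodule k V} : trunc K L i₀ S i₀ = S := by
  simp [trunc]

theorem trunc_gt {i₀ m : ℕ} {S : Submodule k V} (h : i₀ < m) : trunc K L i₀ S m = L m := by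
  simp [trunc, h.not_gt, h.ne']

theorem trunc_sCx (hK : SCx d t K) (hL : SCx d t L) {i : ℕ} {S : Submodule k V}
    (hS : (K i).map d ≤ S) (hS' : S ≤ (L (i + 2)).comap d) (hSt : ∀ j, ∀ x ∈ S, t j x ∈ S) :
    SCx d t (trunc K L (i + 1) S) where
  cx :=
    { zero := by rw [trunc_lt (by omega), hK.cx.zero]
      mem := by
        intro m x hx
        rcases lt_trichotomy m (i + 1) with hm | rfl | hm
        · rw [trunc_lt hm] at hx
          rcases (show m + 1 ≤ i + 1 by omega).lt_or_eq with hm' | hm'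
          · rw [trunc_lt hm']; exact hK.cx.mem hx
          · obtain rfl : m = i := by omega
            rw [trunc_eq]; exact hS ⟨x, hx, rfl⟩
        · rw [trunc_eq] at hx
          rw [trunc_gt (by omega)]; exact hS' hx
        · rw [trunc_gt hm] at hx
          rw [trunc_gt (by omega)]; exact hL.cx.mem hx }
  st := by
    intro j m x hx
    rcases lt_trichotomy m (i + 1) with hm | rfl | hm
    · rw [trunc_lt hm] at hx ⊢; exact hK.st j hx
    · rw [trunc_eq] at hx ⊢; exact hSt j x hx
    · rw [trunc_gt hm] at hx ⊢; exact hL.st j hx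

theorem trunc_mono {i₀ : ℕ} {S S' : Submodule k V} (h : S ≤ S') (m : ℕ) :
    trunc K L i₀ S m ≤ trunc K L i₀ S' m := by
  unfold trunc; split_ifs <;> [exact le_rfl; exact h; exact le_rfl]

theorem Fam.bottom (h : Fam p d t) (hp : 2 ≤ p) {Q : ℕ} (hQ : ∀ i, Q ≤ i → t i = 0)
    (hK : SCx d t K) (hL : SCx d t L) (le : ∀ m, L m ≤ K m) {i₀ : ℕ}
    (h0 : ∀ j < i₀, hc d K L j = 0) (h1 : hc d K L i₀ ≠ 0) (q m : ℕ) :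
    Pre^[q] (Pi.single i₀ 1) (m + 1) ≤ hT p q d t K L (m + 1) +
      Pre^[q] (fun j => if j < i₀ then 0 else hc d K L j) m := by
  obtain ⟨i, rfl⟩ : ∃ i, i₀ = i + 1 := by
    cases i₀ with
    | zero => exact absurd hK.cx.hc_zero h1
    | succ i => exact ⟨i, rfl⟩
  set S₀ : Submodule k V := (K i).map d ⊔ L (i + 1) with hS₀
  have hS₀t : ∀ j, ∀ x ∈ S₀, t j x ∈ S₀ := by
    intro j x hx
    obtain ⟨y, hy, hyx⟩ := mem_bd.1 hx
    refine mem_bd.2 ⟨t j y, hK.st j hy, ?_⟩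
    rw [← End.mul_apply, (h.dt j).eq, End.mul_apply, ← map_sub]
    exact hL.st j hyx
  obtain ⟨z, ⟨hzK, hzL⟩, hzB, hzt⟩ := h.exists_invariant hQ
    (Z := K (i + 1) ⊓ (L (i + 2)).comap d) (B := S₀)
    (fun j x hx => ⟨hK.st j hx.1, by
      rw [SetLike.mem_coe, Submodule.mem_comap, ← End.mul_apply, (h.dt j).eq]
      exact hL.st j hx.2⟩) hS₀t (fun hle => h1 (by rw [hc_succ, rd_eq_zero]; exact hle))
  set S₁ : Submodule k V := S₀ ⊔ Submodule.span k {z} with hS₁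
  have hS01 : S₀ ≤ S₁ := le_sup_left
  have hS₁t : ∀ j, ∀ x ∈ S₁, t j x ∈ S₀ := by
    intro j
    have : S₁ ≤ S₀.comap (t j) := sup_le (fun x hx => hS₀t j x hx)
      ((Submodule.span_singleton_le_iff_mem _ _).2 (hzt j))
    exact fun x hx => this hx
  have hS₁d : S₁ ≤ (L (i + 2)).comap d := by
    refine sup_le (sup_le ?_ fun x hx => hL.cx.mem hx)
      ((Submodule.span_singleton_le_iff_mem _ _).2 hzL)
    rintro _ ⟨y, _, rfl⟩
    rw [Submodule.mem_comap, h.dd]; exact zero_mem _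
  have hS₁K : S₁ ≤ K (i + 1) := by
    refine sup_le (sup_le ?_ (le _)) ((Submodule.span_singleton_le_iff_mem _ _).2 hzK)
    rintro _ ⟨y, hy, rfl⟩
    exact hK.cx.mem hy
  set L₀ := trunc K L (i + 1) S₀ with hL₀
  set L₁ := trunc K L (i + 1) S₁ with hL₁
  have c0 : SCx d t L₀ := trunc_sCx hK hL le_sup_left (hS01.trans hS₁d) hS₀t
  have c1 : SCx d t L₁ := trunc_sCx hK hL (le_sup_left.trans hS01) hS₁d
    fun j x hx => hS01 (hS₁t j x hx)
  have l0 : ∀ m, L m ≤ L₀ m := by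
    intro m
    rcases lt_trichotomy m (i + 1) with hm | rfl | hm
    · rw [hL₀, trunc_lt hm]; exact le m
    · rw [hL₀, trunc_eq]; exact le_sup_right
    · rw [hL₀, trunc_gt hm]
  have l01 : ∀ m, L₀ m ≤ L₁ m := trunc_mono hS01
  have l1 : ∀ m, L₁ m ≤ K m := by
    intro m
    rcases lt_trichotomy m (i + 1) with hm | rfl | hm
    · rw [hL₁, trunc_lt hm]
    · rw [hL₁, trunc_eq]; exact hS₁K
    · rw [hL₁, trunc_gt hm]; exact le m
  have a0 : ∀ m, hc d L₀ L m = 0 := by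
    intro m
    rw [hc_eq_zero]
    intro x hx hdx
    rcases lt_trichotomy m (i + 1) with hm | rfl | hm
    · rw [hL₀, trunc_lt hm] at hx
      rw [hL₀, trunc_lt (by omega)]
      exact hc_eq_zero.1 (h0 m hm) x hx hdx
    · rw [hL₀, trunc_eq] at hx
      rw [hL₀, Nat.add_sub_cancel, trunc_lt (by omega)]
      exact mem_bd.1 hx
    · rw [hL₀, trunc_gt hm] at hx
      exact ⟨0, zero_mem _, by simpa using hx⟩
  have e1 : (Pi.single (i + 1) 1 : ℕ → ℕ∞) ≤ hc d L₁ L₀ := by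
    intro m
    by_cases hm : m = i + 1
    · subst hm
      rw [Pi.single_eq_same]
      refine Order.one_le_iff_ne_zero.2 fun hz0 => hzB ?_
      have hz1 : z ∈ L₁ (i + 1) := by
        rw [hL₁, trunc_eq]
        exact le_sup_right (a := S₀) (Submodule.mem_span_singleton_self z)
      obtain ⟨y, hy, hyz⟩ := hc_eq_zero.1 hz0 z hz1 (l0 _ hzL)
      rw [hL₁, Nat.add_sub_cancel, trunc_lt (by omega)] at hy
      rw [hL₀, trunc_eq] at hyz
      have := add_mem hyz (le_sup_left (b := L (i + 1)) (Submodule.mem_map_of_mem (f := d) hy) : d y ∈ S₀)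
      simpa using this
    · rw [single_eq_of_ne hm]; exact zero_le
  have b1 : Pre^[q] (Pi.single (i + 1) 1) (m + 1) ≤ hT p q d t L₁ L (m + 1) := by
    have t1 := (Pre_iter_mono q e1).trans (h.le_hT hp c1 c0 l01 (fun j m x hx => by
      rcases lt_trichotomy m (i + 1) with hm | rfl | hm
      · rw [hL₁, trunc_lt hm] at hx
        rw [hL₀, trunc_lt hm]; exact hK.st j hx
      · rw [hL₁, trunc_eq] at hx
        rw [hL₀, trunc_eq]; exact hS₁t j x hx
      · rw [hL₁, trunc_gt hm] at hx
        rw [hL₀, trunc_gt hm]; exact hL.st j hx) q)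
    refine (t1 (m + 1)).trans ?_
    have := h.hT_le_add' l0 l01 q (m + 1)
    rwa [h.hT_eq_zero c0 hL l0 a0, add_zero] at this
  refine b1.trans ((h.hT_succ_le_add (fun m => (l0 m).trans (l01 m)) l1 q m).trans ?_)
  refine add_le_add_right ((h.hT_le hK c1 l1 q m).trans (Pre_iter_mono q (fun j => ?_) m)) _
  dsimp only
  split_ifs with hj
  · rw [hc_eq_zero.2]
    intro x hx _
    refine ⟨0, zero_mem _, ?_⟩
    rw [hL₁, trunc_lt hj]; simpa using hx
  · refine (hc_le_add' h.dd (fun m => (l0 m).trans (l01 m)) l1 j).trans ?_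
    have : hc d L₁ L (j + 1) = 0 := by
      rw [hc_eq_zero]
      intro x hx _
      rw [hL₁, trunc_gt (by omega)] at hx
      exact ⟨0, zero_mem _, by simpa using hx⟩
    rw [this, add_zero]

theorem le_Pre (f : ℕ → ℕ∞) (m : ℕ) : f m ≤ Pre f m :=
  single_le_sum (f := f) (fun _ _ => zero_le) (Finset.self_mem_range_succ m)

theorem le_Pre_iter (q : ℕ) (f : ℕ → ℕ∞) (m : ℕ) : f m ≤ Pre^[q] f m := by
  induction q generalizing f with
  | zero => exact le_rfl
  | succ q ih => rw [iterate_succ_apply]; exact (le_Pre f m).trans (ih _)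

theorem Pre_iter_eq_zero {f : ℕ → ℕ∞} {i : ℕ} (h : ∀ j < i, f j = 0) (q : ℕ) :
    ∀ j < i, Pre^[q] f j = 0 := by
  induction q generalizing f with
  | zero => exact h
  | succ q ih =>
    rw [iterate_succ_apply]
    exact ih fun j hj => sum_eq_zero fun l hl => h l (by rw [mem_range] at hl; omega)

/-- The lowest nonvanishing cohomology survives in the iterated total complex. -/
theorem Fam.low (h : Fam p d t) (hp : 2 ≤ p) {Q : ℕ} (hQ : ∀ i, Q ≤ i → t i = 0)
    (hK : SCx d t K) (hL : SCx d t L) (le : ∀ m, L m ≤ K m) {i₀ : ℕ}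
    (h0 : ∀ j < i₀, hc d K L j = 0) (h1 : hc d K L i₀ ≠ 0) (q : ℕ) :
    hT p q d t K L i₀ ≠ 0 := by
  cases i₀ with
  | zero => exact absurd hK.cx.hc_zero h1
  | succ i =>
    have := h.bottom hp hQ hK hL le h0 h1 q i
    rw [Pre_iter_eq_zero (i := i + 1) (fun j hj => by simp [hj]) q i (by omega), add_zero] at this
    have h2 := (le_Pre_iter q (Pi.single (i + 1) 1) (i + 1)).trans this
    rw [Pi.single_eq_same] at h2
    exact Order.one_le_iff_ne_zero.1 h2

theorem Pre_succ (f : ℕ → ℕ∞) (m : ℕ) : Pre f (m + 1) = Pre f m + f (m + 1) :=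
  sum_range_succ _ _

theorem Pre_iter_single (q i m : ℕ) :
    Pre^[q + 1] (Pi.single i 1) (i + m) = ((q + 1).multichoose m : ℕ) := by
  induction q generalizing m with
  | zero =>
    simp only [Nat.reduceAdd, Function.iterate_one, Nat.multichoose_one, Nat.cast_one]
    unfold Pre
    rw [Finset.sum_pi_single']
    simp
  | succ q ih =>
    rw [Function.iterate_succ_apply']
    induction m with
    | zero =>
      have h0 : ∀ j < i, Pre^[q + 1] (Pi.single i 1) j = 0 :=
        Pre_iter_eq_zero (fun j hj => by simp [hj.ne]) _
      unfold Pre at h0 ⊢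
      rw [sum_range_succ, sum_eq_zero, zero_add]
      · exact (ih 0).trans (by simp)
      · intro j hj
        exact h0 j (by simpa using hj)
    | succ m ihm =>
      rw [← add_assoc i m 1, Pre_succ, ihm, add_assoc i m 1, ih,
        Nat.multichoose_succ_succ (q + 1) m, Nat.cast_add, add_comm]

theorem Pre_le_mul {f : ℕ → ℕ∞} {i : ℕ} {b : ℕ∞} (h : ∀ j < i, f j = 0) (hb : ∀ m, Pre f m ≤ b) :
    Pre f ≤ fun m => b * Pre (Pi.single i 1) m := by
  intro m
  by_cases hm : m < i
  · rw [show Pre f m = 0 from Pre_iter_eq_zero h 1 m hm]; exact zero_le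
  · have : Pre (Pi.single i 1) m = 1 := by
      unfold Pre
      rw [Finset.sum_pi_single', if_pos (by simp; omega)]
    dsimp only
    rw [this, mul_one]; exact hb m

theorem Pre_iter_mul (q : ℕ) (b : ℕ∞) (f : ℕ → ℕ∞) :
    Pre^[q] (fun m => b * f m) = fun m => b * Pre^[q] f m := by
  induction q generalizing f with
  | zero => rfl
  | succ q ih =>
    rw [iterate_succ_apply, iterate_succ_apply, ← ih]
    congr 1; funext m; unfold Pre; rw [Finset.mul_sum]

/-- A bound for the rank of a group acting freely on a pair with bounded cohomology. -/
theorem Fam.rank_le (h : Fam p d t) (hp : 2 ≤ p) {q : ℕ} (hQ : ∀ i, q ≤ i → t i = 0)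
    (hK : SCx d t K) (hL : SCx d t L) (le : ∀ m, L m ≤ K m) {D₀ b : ℕ}
    (hD : ∀ i, D₀ < i → hT p q d t K L i = 0) (hb : ∀ m, Pre (hc d K L) m ≤ b)
    (h1 : ∃ i, hc d K L i ≠ 0) : q ≤ b * (D₀ + 1) := by
  classical
  cases q with
  | zero => exact Nat.zero_le _
  | succ q =>
    set i₀ := Nat.find h1 with hi₀
    have key := h.bottom hp hQ hK hL le (i₀ := i₀)
      (fun j hj => by simpa using Nat.find_min h1 hj) (Nat.find_spec h1) (q + 1) (i₀ + D₀)
    rw [hD _ (by omega), zero_add, add_assoc, Pre_iter_single] at key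
    have k2 : Pre^[q + 1] (fun j => if j < i₀ then 0 else hc d K L j) (i₀ + D₀) ≤
        b * ((q + 1).multichoose D₀ : ℕ) := by
      rw [← Pre_iter_single q i₀]
      have h2 := Pre_le_mul (f := fun j => if j < i₀ then 0 else hc d K L j) (i := i₀) (b := b)
        (fun j hj => by simp [hj]) (fun m => le_trans (Pre_mono (fun j => by
          dsimp only; split_ifs <;> [exact zero_le; exact le_rfl]) m) (hb m))
      have h3 := Pre_iter_mono q h2 (i₀ + D₀)
      rw [Pre_iter_mul] at h3
      rw [iterate_succ_apply, iterate_succ_apply]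
      exact h3
    have k3 := key.trans k2
    have k4 : (q + 1).multichoose (D₀ + 1) ≤ b * (q + 1).multichoose D₀ := by exact_mod_cast k3
    rw [Nat.multichoose_eq, Nat.multichoose_eq, show q + 1 + (D₀ + 1) - 1 = q + D₀ + 1 by omega,
      show q + 1 + D₀ - 1 = q + D₀ by omega] at k4
    have k5 := Nat.add_one_mul_choose_eq (q + D₀) D₀
    have k6 : 0 < (q + D₀).choose D₀ := Nat.choose_pos (by omega)
    have k7 : (q + D₀ + 1) * (q + D₀).choose D₀ ≤ (b * (D₀ + 1)) * (q + D₀).choose D₀ := by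
      rw [k5]
      calc _ ≤ b * (q + D₀).choose D₀ * (D₀ + 1) := Nat.mul_le_mul_right _ k4
        _ = _ := by ring
    have := Nat.le_of_mul_le_mul_right k7 k6
    omega

end

section
variable {d α β : V →ₗ[k] V} {J K L : ℕ → Submodule k V}

theorem IsOp.swap (h : IsOp d α β) : IsOp d β α := ⟨h.db, h.da, h.ba, h.ab⟩

theorem OpSt.swap (h : OpSt α β K) : OpSt β α K := ⟨h.b, h.a⟩

theorem PCx.swap (h : PCx d α β K L) : PCx d β α K L :=
  ⟨h.dd, h.op.swap, h.cK, h.cL, h.oK.swap, h.oL.swap, h.le⟩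

theorem Free.swap (h : Free α β K L) : Free β α K L := ⟨h.b, h.a⟩

theorem PCx.hc_fixd_quot (h : PCx d α β K L) (hf : Free α β K L) (m : ℕ) :
    hc d K (fixd α K L) m = hc d (fixd β K L) L m := by
  refine SqIso.hc_eq (φ := α) ⟨fun x => (h.op.da x).symm, ?_, ?_, ?_⟩ h.cK h.swap.fixd_isCx h.cL m
  · intro m x hx
    exact mem_fixd.2 ⟨h.oK.a hx, by rw [h.op.ba]; exact zero_mem _⟩
  · intro m x hx
    exact ⟨fun h' => mem_fixd.2 ⟨hx, h'⟩, fun h' => h'.2⟩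
  · intro m y hy
    exact hf.b hy.1 hy.2

theorem fixd_le (m : ℕ) : fixd α K L m ≤ K m := inf_le_left

/-- The basic Smith inequality. -/
theorem PCx.smith_step (h : PCx d α β K L) (hf : Free α β K L) (hJ : PCx d α β J L)
    (hKJ : ∀ m, K m ≤ J m)
    (hs : ∀ m, ∀ x ∈ J m, ∃ y ∈ J m, β y ∈ L m ∧ x - y ∈ K m) (m : ℕ) :
    hc d (fixd α K L) L m + hc d J K m ≤ hc d J L m + hc d (fixd β K L) L (m + 1) := by
  have h1 := hc_le_add' h.dd h.swap.le_fixd (fun m => (fixd_le m).trans (hKJ m)) m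
  refine le_trans ?_ h1
  have h2 : hc d J K m = hc d (fixd β J L) (fixd β K L) m := by
    symm
    have hq : SqIso d d LinearMap.id (fixd β J L) (fixd β K L) J K := by
      refine ⟨fun _ => rfl, ?_, ?_, ?_⟩
      · intro m x hx
        exact (mem_fixd.1 hx).1
      · intro m x hx
        exact ⟨fun h' => mem_fixd.2 ⟨h', (mem_fixd.1 hx).2⟩, fun h' => (mem_fixd.1 h').1⟩
      · intro m x hx
        obtain ⟨y, hy, h1, h2⟩ := hs m x hx
        exact ⟨y, mem_fixd.2 ⟨hy, h1⟩, h2⟩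
    exact hq.hc_eq hJ.swap.fixd_isCx hJ.cK h.cK m
  rw [h2, ← h.swap.hc_fixd_quot hf.swap]
  refine hc_direct h.cK hJ.swap.fixd_isCx hJ.cK fixd_le
    (fun m x hx => ⟨hKJ m hx.1, hx.2⟩) hKJ fixd_le (fun m x hx => ⟨hx.1, hx.2.2⟩) ?_ m
  intro m x hx
  obtain ⟨y, hy, h1, h2⟩ := hs m x hx
  rw [← sub_add_cancel x y]
  exact add_mem (mem_sup_left h2) (mem_sup_right ⟨hy, h1⟩)

/-- A weighted sum of the dimensions in degrees at most `D`. -/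
def wt (D : ℕ) (f : ℕ → ℕ∞) : ℕ∞ := ∑ i ∈ Finset.range (D + 1), ∑ j ∈ Ico i (D + 1), f j

theorem smith_sum {D : ℕ} {σ τ f a : ℕ → ℕ∞} (h1 : ∀ i, σ i + f i ≤ a i + τ (i + 1))
    (h2 : ∀ i, τ i + f i ≤ a i + σ (i + 1)) (hσ : σ (D + 1) = 0) (hτ : τ (D + 1) = 0)
    (j : ℕ) (hj : j ≤ D + 1) :
    σ (D + 1 - j) + ∑ i ∈ Ico (D + 1 - j) (D + 1), f i ≤
      ∑ i ∈ Ico (D + 1 - j) (D + 1), a i ∧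
    τ (D + 1 - j) + ∑ i ∈ Ico (D + 1 - j) (D + 1), f i ≤
      ∑ i ∈ Ico (D + 1 - j) (D + 1), a i := by
  induction j with
  | zero => simp [hσ, hτ]
  | succ j ih =>
    obtain ⟨i1, i2⟩ := ih (by omega)
    set i := D + 1 - (j + 1) with hi
    have e : D + 1 - j = i + 1 := by omega
    rw [e] at i1 i2
    rw [Finset.sum_eq_sum_Ico_succ_bot (by omega : i < D + 1),
      Finset.sum_eq_sum_Ico_succ_bot (by omega : i < D + 1)]
    constructor
    · calc _ = (σ i + f i) + ∑ i ∈ Ico (i + 1) (D + 1), f i := by ring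
        _ ≤ (a i + τ (i + 1)) + ∑ i ∈ Ico (i + 1) (D + 1), f i := by exact add_le_add_left (h1 i) _
        _ = a i + (τ (i + 1) + ∑ i ∈ Ico (i + 1) (D + 1), f i) := by ring
        _ ≤ _ := by gcongr
    · calc _ = (τ i + f i) + ∑ i ∈ Ico (i + 1) (D + 1), f i := by ring
        _ ≤ (a i + σ (i + 1)) + ∑ i ∈ Ico (i + 1) (D + 1), f i := by exact add_le_add_left (h2 i) _
        _ = a i + (σ (i + 1) + ∑ i ∈ Ico (i + 1) (D + 1), f i) := by ring
        _ ≤ _ := by gcongr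

theorem wt_le_of_smith {D : ℕ} {σ τ f a : ℕ → ℕ∞} (h1 : ∀ i, σ i + f i ≤ a i + τ (i + 1))
    (h2 : ∀ i, τ i + f i ≤ a i + σ (i + 1)) (hσ : σ (D + 1) = 0) (hτ : τ (D + 1) = 0) :
    wt D f + ∑ i ∈ Finset.range (D + 1), σ i ≤ wt D a := by
  unfold wt
  rw [← Finset.sum_add_distrib]
  refine Finset.sum_le_sum fun i hi => ?_
  rw [mem_range] at hi
  have := (smith_sum h1 h2 hσ hτ (D + 1 - i) (by omega)).1
  rwa [show D + 1 - (D + 1 - i) = i by omega, add_comm] at this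

/-- The Smith inequalities for a pair on which the operators act freely. -/
theorem PCx.smith (h : PCx d α β K L) (hf : Free α β K L) (hJ : PCx d α β J L)
    (hKJ : ∀ m, K m ≤ J m)
    (hs : ∀ m, ∀ x ∈ J m, ∃ y ∈ J m, α y ∈ L m ∧ β y ∈ L m ∧ x - y ∈ K m) {D : ℕ}
    (hD : ∀ i, D < i → hc d K L i = 0)
    (hD' : ∀ i, D < i → hc (totD d α β) (tot K) (tot L) i = 0) :
    wt D (hc d J K) ≤ wt D (hc d J L) ∧
      (wt D (hc d J L) ≠ ⊤ → wt D (hc d J K) = wt D (hc d J L) → ∀ i, hc d K L i = 0) := by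
  have hσ : ∀ i, D < i → hc d (fixd α K L) L i = 0 := fun i hi => by
    rw [← h.hc_tot_eq_fixd hf]; exact hD' i hi
  have hτ : ∀ i, D < i → hc d (fixd β K L) L i = 0 := fun i hi => by
    rw [← h.hc_fixd_quot hf]
    have := hc_le_add' h.dd h.le_fixd (fun m => fixd_le m) i
    rw [hD i hi, hσ _ (by omega), zero_add] at this
    exact le_antisymm this zero_le
  have h1 := h.smith_step hf hJ hKJ (fun m x hx => by
    obtain ⟨y, hy, -, h2, h3⟩ := hs m x hx; exact ⟨y, hy, h2, h3⟩)
  have h2 := h.swap.smith_step hf.swap hJ.swap hKJ (fun m x hx => by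
    obtain ⟨y, hy, h2, -, h3⟩ := hs m x hx; exact ⟨y, hy, h2, h3⟩)
  have k1 := wt_le_of_smith h1 h2 (hσ _ (Nat.lt_succ_self _)) (hτ _ (Nat.lt_succ_self _))
  have k2 := wt_le_of_smith h2 h1 (hτ _ (Nat.lt_succ_self _)) (hσ _ (Nat.lt_succ_self _))
  refine ⟨le_self_add.trans k1, fun hfin heq i => ?_⟩
  by_cases hi : D < i
  · exact hD i hi
  · rw [heq] at k1 k2
    have z : ∀ f : ℕ → ℕ∞, wt D (hc d J L) + ∑ i ∈ Finset.range (D + 1), f i ≤ wt D (hc d J L) →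
        f i = 0 := by
      intro f hf
      have : ∑ i ∈ Finset.range (D + 1), f i = 0 := by
        refine le_antisymm ?_ zero_le
        rw [← add_zero (wt D (hc d J L)), add_assoc, zero_add] at hf
        exact (ENat.add_le_add_iff_left hfin).1 hf
      exact Finset.sum_eq_zero_iff.1 this i (by rw [mem_range]; omega)
    have e1 := z _ k1
    have e2 := z _ k2
    have := hc_le_add h.dd h.le_fixd (fun m => fixd_le m) i
    rw [h.hc_fixd_quot hf, e1, e2, zero_add] at this
    exact le_antisymm this zero_le

end

section
variable {t : End k V}
  {K L : ℕ → Submodule k V}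

/-- For a nilpotent operator one half of freeness implies the other one. -/
theorem Free.of_ker {p : ℕ} (hp : 2 ≤ p) (hK : ∀ m, ∀ x ∈ K m, t x ∈ K m)
    (h : ∀ m, ∀ x ∈ K m, t x ∈ L m → ∃ y ∈ K m, x - (t ^ (p - 1)) y ∈ L m) :
    Free t (t ^ (p - 1)) K L := by
  refine ⟨fun {m x} hx hx' => h m x hx hx', ?_⟩
  have key : ∀ j, j ≤ p → ∀ m, ∀ x ∈ K m, (t ^ j) x ∈ L m →
      ∃ y ∈ K m, x - (t ^ (p - j)) y ∈ L m := by
    intro j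
    have hpow : ∀ (i : ℕ) (N : ℕ → Submodule k V), (∀ m, ∀ x ∈ N m, t x ∈ N m) →
        ∀ m, ∀ x ∈ N m, (t ^ i) x ∈ N m := by
      intro i N hN m
      induction i with
      | zero => intro x hx; simpa using hx
      | succ i ih => intro x hx; rw [pow_succ', End.mul_apply]; exact hN _ _ (ih x hx)
    induction j with
    | zero =>
      intro _ m x _ hx'
      refine ⟨0, zero_mem _, by simpa using hx'⟩
    | succ j ih =>
      intro hj m x hx hx'
      rw [pow_succ', End.mul_apply] at hx'
      obtain ⟨y, hy, hy'⟩ := h m _ (hpow j K hK m x hx) hx'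
      have e : (t ^ (p - 1)) y = (t ^ j) ((t ^ (p - (j + 1))) y) := by
        rw [← End.mul_apply, ← pow_add]; congr 2; omega
      rw [e, ← map_sub] at hy'
      obtain ⟨z, hz, hz'⟩ := ih (by omega) m _ (sub_mem hx (hpow _ K hK m y hy)) hy'
      refine ⟨y + t z, add_mem hy (hK _ _ hz), ?_⟩
      have e2 : (t ^ (p - j)) z = (t ^ (p - (j + 1))) (t z) := by
        rw [← End.mul_apply, ← pow_succ]; congr 2; omega
      rw [map_add, ← e2]
      convert hz' using 1
      abel
  intro m x hx hx'
  obtain ⟨y, hy, h2⟩ := key (p - 1) (by omega) m x hx hx'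
  refine ⟨y, hy, ?_⟩
  rwa [show p - (p - 1) = 1 by omega, pow_one] at h2

end

section
variable {Y : Type*}

/-- The alternating sum over the omissions of an entry of a list. -/
def dA : List X → (List X → k) → k
  | [], _ => 0
  | x :: l, f => f l - dA l fun m => f (x :: m)

theorem dA_congr (l : List X) : ∀ {f g : List X → k} {a : k},
    (∀ l', (∀ y ∈ l', y ∈ l) → l'.length + 1 = l.length → f l' = a * g l') →
    dA l f = a * dA l g := by
  induction l with
  | nil => intro f g a _; simp [dA]
  | cons x l ih =>
    intro f g a h
    rw [dA, dA, h l (fun y hy => List.mem_cons_of_mem _ hy) rfl, mul_sub]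
    congr 1
    refine ih fun l' hl' hlen => h _ ?_ (by simp [hlen])
    intro y hy
    rcases List.mem_cons.1 hy with rfl | hy
    · exact mem_cons_self
    · exact List.mem_cons_of_mem _ (hl' y hy)

theorem dA_eq_zero {l : List X} {f : List X → k}
    (h : ∀ l', (∀ y ∈ l', y ∈ l) → l'.length + 1 = l.length → f l' = 0) : dA l f = 0 := by
  have := dA_congr (g := f) (a := 0) l (f := f) fun l' h1 h2 => by rw [h l' h1 h2, zero_mul]
  rwa [zero_mul] at this

theorem dA_add (l : List X) : ∀ f g : List X → k, dA l (f + g) = dA l f + dA l g := by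
  induction l with
  | nil => intro f g; simp [dA]
  | cons x l ih =>
    intro f g
    have : dA l (fun m => (f + g) (x :: m)) = _ := ih (fun m => f (x :: m)) fun m => g (x :: m)
    rw [dA, dA, dA, this, Pi.add_apply]; ring

theorem dA_smul (l : List X) (a : k) (f : List X → k) : dA l (a • f) = a * dA l f :=
  dA_congr l fun _ _ _ => rfl

theorem dA_sub (l : List X) (f g : List X → k) : dA l (f - g) = dA l f - dA l g := by
  rw [sub_eq_add_neg, dA_add, ← neg_one_smul k g, dA_smul]; ring

theorem dA_dA (l : List X) : ∀ f : List X → k, dA l (fun m => dA m f) = 0 := by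
  induction l with
  | nil => intro f; rfl
  | cons x l ih =>
    intro f
    have : (fun m => dA (x :: m) f) = f - fun m => dA m fun m' => f (x :: m') := rfl
    rw [dA, this, dA_sub, ih, sub_zero, sub_self]

theorem dA_map (r : X → Y) (l : List X) : ∀ f : List Y → k,
    dA (l.map r) f = dA l fun m => f (m.map r) := by
  induction l with
  | nil => intro f; rfl
  | cons x l ih => intro f; rw [map_cons, dA, dA, ih]; rfl

/-- The prism operator of a self-map. -/
def hA (r : X → X) : List X → (List X → k) → k
  | [], _ => 0
  | x :: l, f => f (x :: (x :: l).map r) - hA r l fun m => f (x :: m)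

theorem hA_congr (r : X → X) (l : List X) : ∀ {f g : List X → k} {a : k},
    (∀ l', (∀ y ∈ l', y ∈ l ∨ ∃ z ∈ l, y = r z) → l'.length = l.length + 1 → f l' = a * g l') →
    hA r l f = a * hA r l g := by
  induction l with
  | nil => intro f g a _; simp [hA]
  | cons x l ih =>
    intro f g a h
    rw [hA, hA, h _ _ (by simp), mul_sub]
    · congr 1
      refine ih fun l' hl' hlen => h _ ?_ (by simp [hlen])
      intro y hy
      rcases List.mem_cons.1 hy with rfl | hy
      · exact Or.inl mem_cons_self
      · rcases hl' y hy with h | ⟨z, hz, h⟩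
        · exact Or.inl (List.mem_cons_of_mem _ h)
        · exact Or.inr ⟨z, List.mem_cons_of_mem _ hz, h⟩
    · intro y hy
      rcases List.mem_cons.1 hy with rfl | hy
      · exact Or.inl mem_cons_self
      · obtain ⟨z, hz, rfl⟩ := List.mem_map.1 hy
        exact Or.inr ⟨z, hz, rfl⟩

theorem hA_add (r : X → X) (l : List X) : ∀ f g : List X → k,
    hA r l (f + g) = hA r l f + hA r l g := by
  induction l with
  | nil => intro f g; simp [hA]
  | cons x l ih =>
    intro f g
    have : hA r l (fun m => (f + g) (x :: m)) = _ := ih (fun m => f (x :: m)) fun m => g (x :: m)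
    rw [hA, hA, hA, this, Pi.add_apply]; ring

theorem hA_smul (r : X → X) (l : List X) (a : k) (f : List X → k) :
    hA r l (a • f) = a * hA r l f :=
  hA_congr r l fun _ _ _ => rfl

theorem hA_sub (r : X → X) (l : List X) (f g : List X → k) :
    hA r l (f - g) = hA r l f - hA r l g := by
  rw [sub_eq_add_neg, hA_add, ← neg_one_smul k g, hA_smul]; ring

theorem dA_hA (r : X → X) (l : List X) : ∀ f : List X → k,
    dA l (fun m => hA r m f) + hA r l (fun m => dA m f) = f (l.map r) - f l := by
  induction l with
  | nil => intro f; simp [dA, hA]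
  | cons x l ih =>
    intro f
    have e1 : (fun m => hA r (x :: m) f) =
        (fun m => f (x :: r x :: m.map r)) - fun m => hA r m fun m' => f (x :: m') := rfl
    have e2 : (fun m => dA (x :: m) f) = f - fun m => dA m fun m' => f (x :: m') := rfl
    have e3 := dA_map r l fun m => f (x :: r x :: m)
    have e4 := ih fun m => f (x :: m)
    rw [dA, hA, e1, e2, dA_sub, hA_sub, map_cons, dA, dA, ← e3]
    linear_combination e4

end

section
variable {Y J : Type*}

/-- The operators on cochains. -/
abbrev COp (I X k : Type*) [Field k] := End k (I → List X → k)

/-- The coboundary operator. -/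
def cd : COp I X k where
  toFun f c l := dA l (f c)
  map_add' f g := by ext c l; exact dA_add l _ _
  map_smul' a f := by ext c l; exact dA_smul l a _

theorem cd_apply (f : I → List X → k) (c : I) (l : List X) : cd f c l = dA l (f c) := rfl

theorem cd_cd (f : I → List X → k) : cd (cd f) = 0 := by
  ext c l; exact dA_dA l _

/-- The pull-back of cochains. -/
def pb (σ : J → I) (r : Y → X) : (I → List X → k) →ₗ[k] (J → List Y → k) where
  toFun f c l := f (σ c) (l.map r)
  map_add' _ _ := rfl
  map_smul' _ _ := rfl

theorem pb_apply (σ : J → I) (r : Y → X) (f : I → List X → k) (c : J) (l : List Y) :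
    pb σ r f c l = f (σ c) (l.map r) := rfl

theorem cd_pb (σ : J → I) (r : Y → X) (f : I → List X → k) : cd (pb σ r f) = pb σ r (cd f) := by
  ext c l; exact (dA_map r l _).symm

/-- The prism operator on cochains. -/
def prism (r : X → X) : COp I X k where
  toFun f c l := hA r l (f c)
  map_add' f g := by ext c l; exact hA_add r l _ _
  map_smul' a f := by ext c l; exact hA_smul r l a _

theorem prism_apply (r : X → X) (f : I → List X → k) (c : I) (l : List X) :
    prism r f c l = hA r l (f c) := rfl

theorem cd_prism (r : X → X) (f : I → List X → k) :
    cd (prism r f) + prism r (cd f) = pb id r f - f := by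
  ext c l; exact dA_hA r l _

/-- Multiplication by a function of the tuple. -/
def mulOp (φ : List X → k) : COp I X k where
  toFun f c l := φ l * f c l
  map_add' f g := by ext c l; simp [mul_add]
  map_smul' a f := by ext c l; simp [mul_left_comm]

theorem mulOp_apply (φ : List X → k) (f : I → List X → k) (c : I) (l : List X) :
    mulOp φ f c l = φ l * f c l := rfl

end

section
variable [TopologicalSpace X]

/-- The filter of lists contained in `A` and close to `x`. -/
def nl (x : X) (A : Set X) : Filter (List X) := (𝓝[A] x).smallSets.comap fun l => {y | y ∈ l}

theorem eventually_nl {x : X} {A : Set X} {P : List X → Prop} :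
    (∀ᶠ l in nl x A, P l) ↔ ∃ U, IsOpen U ∧ x ∈ U ∧ ∀ l, (∀ y ∈ l, y ∈ U ∧ y ∈ A) → P l := by
  rw [nl, eventually_comap, eventually_smallSets]
  constructor
  · rintro ⟨s, hs, h⟩
    obtain ⟨U, hU, hxU, hUs⟩ := mem_nhdsWithin.1 hs
    exact ⟨U, hU, hxU, fun l hl => h _ (fun y hy => hUs (hl y hy)) l rfl⟩
  · rintro ⟨U, hU, hxU, h⟩
    refine ⟨U ∩ A, mem_nhdsWithin.2 ⟨U, hU, hxU, le_rfl⟩, ?_⟩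
    rintro t ht l rfl
    exact h l fun y hy => ht hy

theorem eventually_nl_sub {x : X} {A : Set X} {P : List X → Prop} (h : ∀ᶠ l in nl x A, P l) :
    ∀ᶠ l in nl x A, ∀ l', (∀ y ∈ l', y ∈ l) → P l' := by
  obtain ⟨U, hU, hx, h⟩ := eventually_nl.1 h
  exact eventually_nl.2 ⟨U, hU, hx, fun l hl l' hl' => h l' fun y hy => hl y (hl' y hy)⟩

theorem eventually_nl_mem {x : X} {A U : Set X} (h : U ∈ 𝓝 x) :
    ∀ᶠ l in nl x A, ∀ y ∈ l, y ∈ U ∧ y ∈ A := by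
  obtain ⟨V, hVU, hV, hx⟩ := mem_nhds_iff.1 h
  exact eventually_nl.2 ⟨V, hV, hx, fun l hl y hy => ⟨hVU (hl y hy).1, (hl y hy).2⟩⟩

theorem nl_mono {x : X} {A B : Set X} (h : A ⊆ B) : nl x A ≤ nl x B := fun s hs => by
  obtain ⟨U, hU, hx, h'⟩ := eventually_nl.1 (show ∀ᶠ l in nl x B, l ∈ s from hs)
  exact eventually_nl.2 ⟨U, hU, hx, fun l hl => h' l fun y hy => ⟨(hl y hy).1, h (hl y hy).2⟩⟩

theorem eventually_nl_nhds {x : X} {A : Set X} {P : List X → Prop} (h : ∀ᶠ l in nl x A, P l) :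
    ∀ᶠ y in 𝓝 x, ∀ᶠ l in nl y A, P l := by
  obtain ⟨U, hU, hx, h⟩ := eventually_nl.1 h
  filter_upwards [hU.mem_nhds hx] with y hy
  exact eventually_nl.2 ⟨U, hU, hy, h⟩

/-- A system of local coefficients of rank one. -/
structure CoefSys (X : Type*) [TopologicalSpace X] (I : Type*) (k : Type*) [Field k] where
  core : I → Set X
  dom : I → Set X
  deg : X → I → I → k
  core_closed : ∀ c, IsClosed (core c)
  dom_open : ∀ c, IsOpen (dom c)
  core_sub : ∀ c, core c ⊆ dom c
  cover : ∀ x, ∃ c, x ∈ core c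
  deg_self : ∀ {x c}, x ∈ dom c → deg x c c = 1
  deg_mul : ∀ {x c c' c''}, x ∈ dom c → x ∈ dom c' → x ∈ dom c'' →
    deg x c c' * deg x c' c'' = deg x c c''
  deg_loc : ∀ {x c c'}, x ∈ dom c → x ∈ dom c' → ∀ᶠ y in 𝓝 x, deg y c c' = deg x c c'

variable (S : CoefSys X I k)

namespace CoefSys

/-- The sections of the coefficient system. -/
def Homog (f : I → List X → k) : Prop := ∀ c c' x, x ∈ S.core c → x ∈ S.core c' →
  ∀ᶠ l in nl x univ, f c l = S.deg x c c' * f c' l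

/-- Vanishing at `x` on the tuples in `A`. -/
def VanAt (x : X) (A : Set X) (f : I → List X → k) : Prop :=
  ∀ c, x ∈ S.core c → ∀ᶠ l in nl x A, f c l = 0

/-- The complex of cochains subject to vanishing conditions. -/
def Cpl (Ψ : Set (Set X × Set X)) (m : ℕ) : Submodule k (I → List X → k) where
  carrier := {f | (∀ c l, (l.length ≠ m ∨ l = []) → f c l = 0) ∧ S.Homog f ∧
    ∀ P ∈ Ψ, ∀ x ∈ P.1, S.VanAt x P.2 f}
  zero_mem' := ⟨fun _ _ _ => rfl, fun _ _ _ _ _ => Eventually.of_forall fun _ => by simp,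
    fun _ _ _ _ _ _ => Eventually.of_forall fun _ => rfl⟩
  add_mem' := by
    rintro f g ⟨f1, f2, f3⟩ ⟨g1, g2, g3⟩
    refine ⟨fun c l h => by simp [f1 c l h, g1 c l h], fun c c' x h h' => ?_,
      fun P hP x hx c hc => ?_⟩
    · filter_upwards [f2 c c' x h h', g2 c c' x h h'] with l e1 e2
      simp only [Pi.add_apply, e1, e2, mul_add]
    · filter_upwards [f3 P hP x hx c hc, g3 P hP x hx c hc] with l e1 e2
      simp [e1, e2]
  smul_mem' := by
    rintro a f ⟨f1, f2, f3⟩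
    refine ⟨fun c l h => by simp [f1 c l h], fun c c' x h h' => ?_,
      fun P hP x hx c hc => ?_⟩
    · filter_upwards [f2 c c' x h h'] with l e1
      simp only [Pi.smul_apply, e1, smul_eq_mul, mul_left_comm]
    · filter_upwards [f3 P hP x hx c hc] with l e1
      simp [e1]

variable {S} {Ψ Φ : Set (Set X × Set X)} {m : ℕ} {f : I → List X → k}

theorem mem_Cpl : f ∈ S.Cpl Ψ m ↔ (∀ c l, (l.length ≠ m ∨ l = []) → f c l = 0) ∧ S.Homog f ∧
    ∀ P ∈ Ψ, ∀ x ∈ P.1, S.VanAt x P.2 f := Iff.rfl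

theorem VanAt.mono {x : X} {A B : Set X} (h : S.VanAt x B f) (hAB : A ⊆ B) : S.VanAt x A f :=
  fun c hc => (h c hc).filter_mono (nl_mono hAB)

theorem VanAt.of_one (hf : S.Homog f) {x : X} {A : Set X} {c : I} (hc : x ∈ S.core c)
    (h : ∀ᶠ l in nl x A, f c l = 0) : S.VanAt x A f := by
  intro c' hc'
  filter_upwards [h, (hf c' c x hc' hc).filter_mono (nl_mono (subset_univ A))] with l h1 h2
  rw [h2, h1, mul_zero]

theorem eventually_core [Finite I] (S : CoefSys X I k) (x : X) :
    ∀ᶠ y in 𝓝 x, ∀ c, y ∈ S.core c → x ∈ S.core c := by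
  rw [eventually_all]
  intro c
  by_cases hx : x ∈ S.core c
  · exact Eventually.of_forall fun _ _ => hx
  · filter_upwards [(S.core_closed c).isOpen_compl.mem_nhds hx] with y hy h
    exact absurd h hy

theorem VanAt.nhds [Finite I] {x : X} {A : Set X} (h : S.VanAt x A f) :
    ∀ᶠ y in 𝓝 x, S.VanAt y A f := by
  have h' : ∀ᶠ y in 𝓝 x, ∀ c, x ∈ S.core c → ∀ᶠ l in nl y A, f c l = 0 := by
    rw [eventually_all]
    intro c
    by_cases hx : x ∈ S.core c
    · filter_upwards [eventually_nl_nhds (h c hx)] with y hy _ using hy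
    · exact Eventually.of_forall fun _ h => absurd h hx
  filter_upwards [h', S.eventually_core x] with y h1 h2 c hc
  exact h1 c (h2 c hc)

theorem Cpl_anti (h : Ψ ⊆ Φ) (m : ℕ) : S.Cpl Φ m ≤ S.Cpl Ψ m :=
  fun _ hf => ⟨hf.1, hf.2.1, fun P hP => hf.2.2 P (h hP)⟩

theorem Homog.cd (hf : S.Homog f) : S.Homog (cd f) := by
  intro c c' x h h'
  filter_upwards [eventually_nl_sub (hf c c' x h h')] with l hl
  exact dA_congr l fun l' h1 _ => hl l' h1

theorem VanAt.cd {x : X} {A : Set X} (hf : S.VanAt x A f) : S.VanAt x A (cd f) := by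
  intro c h
  filter_upwards [eventually_nl_sub (hf c h)] with l hl
  exact dA_eq_zero fun l' h1 _ => hl l' h1

theorem Cpl_isCx : IsCx cd (S.Cpl Ψ) where
  zero := by
    rw [eq_bot_iff]
    intro f hf
    rw [Submodule.mem_bot]
    ext c l
    refine hf.1 c l ?_
    cases l with
    | nil => exact Or.inr rfl
    | cons x l => left; simp
  mem := by
    intro m f hf
    refine ⟨fun c l hl => ?_, hf.2.1.cd, fun P hP x hx => (hf.2.2 P hP x hx).cd⟩
    refine dA_eq_zero fun l' _ hlen => hf.1 c l' ?_
    rcases hl with hl | rfl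
    · left; omega
    · simp at hlen

theorem Homog.mulOp (hf : S.Homog f) (φ : List X → k) : S.Homog (mulOp φ f) := by
  intro c c' x h h'
  filter_upwards [hf c c' x h h'] with l hl
  rw [mulOp_apply, mulOp_apply, hl, mul_left_comm]

theorem VanAt.mulOp {x : X} {A : Set X} (hf : S.VanAt x A f) (φ : List X → k) :
    S.VanAt x A (mulOp φ f) := by
  intro c h
  filter_upwards [hf c h] with l hl
  rw [mulOp_apply, hl, mul_zero]

theorem mulOp_mem (hf : f ∈ S.Cpl Ψ m) (φ : List X → k) : mulOp φ f ∈ S.Cpl Ψ m :=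
  ⟨fun c l hl => by rw [mulOp_apply, hf.1 c l hl, mul_zero], hf.2.1.mulOp φ,
    fun P hP x hx => (hf.2.2 P hP x hx).mulOp φ⟩

end CoefSys
end

section
variable [PseudoMetricSpace X]

theorem eventually_nl_metric {x : X} {A : Set X} {P : List X → Prop} :
    (∀ᶠ l in nl x A, P l) ↔ ∃ ε > 0, ∀ l, (∀ y ∈ l, dist y x < ε ∧ y ∈ A) → P l := by
  rw [eventually_nl]
  constructor
  · rintro ⟨U, hU, hx, h⟩
    obtain ⟨ε, hε, hεU⟩ := Metric.isOpen_iff.1 hU x hx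
    exact ⟨ε, hε, fun l hl => h l fun y hy => ⟨hεU (hl y hy).1, (hl y hy).2⟩⟩
  · rintro ⟨ε, hε, h⟩
    exact ⟨Metric.ball x ε, Metric.isOpen_ball, Metric.mem_ball_self hε, h⟩

theorem exists_uniform_radius {T : Set X} (hT : IsCompact T) {A : Set X} {P : X → List X → Prop}
    (h : ∀ x ∈ T, ∃ U, IsOpen U ∧ x ∈ U ∧ ∀ y ∈ U, y ∈ T → ∀ l, (∀ z ∈ l, z ∈ U ∧ z ∈ A) → P y l) :
    ∃ ε > 0, ∀ x ∈ T, ∀ l, (∀ y ∈ l, dist y x < ε ∧ y ∈ A) → P x l := by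
  choose! U hU hxU hP using h
  obtain ⟨ε, hε, h⟩ := lebesgue_number_lemma_of_metric (ι := T) (c := fun x => U x) hT
    (fun x => hU x x.2) (fun x hx => Set.mem_iUnion.2 ⟨⟨x, hx⟩, hxU x hx⟩)
  refine ⟨ε, hε, fun x hx l hl => ?_⟩
  obtain ⟨i, hi⟩ := h x hx
  exact hP i i.2 x (hi (Metric.mem_ball_self hε)) hx l fun z hz => ⟨hi (hl z hz).1, (hl z hz).2⟩

theorem exists_pos_forall {ι : Type*} [Finite ι] {P : ι → ℝ → Prop}
    (hP : ∀ i {a b}, 0 < a → a ≤ b → P i b → P i a) (h : ∀ i, ∃ ε > 0, P i ε) :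
    ∃ ε > 0, ∀ i, P i ε := by
  choose ε h0 h1 using h
  cases nonempty_fintype ι
  obtain hι | hι := isEmpty_or_nonempty ι
  · exact ⟨1, one_pos, fun i => (IsEmpty.false i).elim⟩
  · refine ⟨Finset.univ.inf' Finset.univ_nonempty ε, (Finset.lt_inf'_iff _).2 fun i _ => h0 i, ?_⟩
    intro i
    exact hP i ((Finset.lt_inf'_iff _).2 fun i _ => h0 i) (Finset.inf'_le _ (Finset.mem_univ i))
      (h1 i)

variable [CompactSpace X] [Finite I] {S : CoefSys X I k}
  {f : I → List X → k}

namespace CoefSys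

theorem Homog.uniform (hf : S.Homog f) : ∃ ε > 0, ∀ c c' x, x ∈ S.core c → x ∈ S.core c' →
    ∀ l, (∀ y ∈ l, dist y x < ε) → f c l = S.deg x c c' * f c' l := by
  have : ∃ ε > 0, ∀ i : I × I, ∀ x ∈ S.core i.1 ∩ S.core i.2, ∀ l,
      (∀ y ∈ l, dist y x < ε ∧ y ∈ univ) → f i.1 l = S.deg x i.1 i.2 * f i.2 l := by
    refine exists_pos_forall (fun i a b _ hab h x hx l hl => h x hx l fun y hy =>
      ⟨(hl y hy).1.trans_le hab, trivial⟩) fun i => ?_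
    refine exists_uniform_radius
      ((S.core_closed i.1).inter (S.core_closed i.2)).isCompact fun x hx => ?_
    obtain ⟨U, hU, hxU, h⟩ := eventually_nl.1 (hf i.1 i.2 x hx.1 hx.2)
    obtain ⟨W, hW, hWo, hxW⟩ := mem_nhds_iff.1 (S.deg_loc (S.core_sub _ hx.1) (S.core_sub _ hx.2))
    refine ⟨U ∩ W, hU.inter hWo, ⟨hxU, hxW⟩, fun y hy _ l hl => ?_⟩
    rw [hW hy.2]
    exact h l fun z hz => ⟨(hl z hz).1.1, trivial⟩
  obtain ⟨ε, hε, h⟩ := this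
  exact ⟨ε, hε, fun c c' x hx hx' l hl => h (c, c') x ⟨hx, hx'⟩ l fun y hy => ⟨hl y hy, trivial⟩⟩

theorem VanAt.uniform {T A : Set X} (hT : IsClosed T) (hf : ∀ x ∈ T, S.VanAt x A f) :
    ∃ ε > 0, ∀ x ∈ T, ∀ c, x ∈ S.core c → ∀ l, (∀ y ∈ l, dist y x < ε ∧ y ∈ A) → f c l = 0 := by
  have : ∃ ε > 0, ∀ c : I, ∀ x ∈ T ∩ S.core c, ∀ l,
      (∀ y ∈ l, dist y x < ε ∧ y ∈ A) → f c l = 0 := by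
    refine exists_pos_forall (fun i a b _ hab h x hx l hl => h x hx l fun y hy =>
      ⟨(hl y hy).1.trans_le hab, (hl y hy).2⟩) fun c => ?_
    refine exists_uniform_radius (hT.inter (S.core_closed c)).isCompact fun x hx => ?_
    obtain ⟨U, hU, hxU, h⟩ := eventually_nl.1 (hf x hx.1 c hx.2)
    exact ⟨U, hU, hxU, fun y _ _ l hl => h l hl⟩
  obtain ⟨ε, hε, h⟩ := this
  exact ⟨ε, hε, fun x hx c hc l hl => h c x ⟨hx, hc⟩ l hl⟩

/-- Cochains may be pulled back along self-maps sufficiently close to the identity. -/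
theorem exists_snap_radius {Ψ : Set (Set X × Set X)} (hΨ : Ψ.Finite)
    (hcl : ∀ P ∈ Ψ, IsClosed P.1) {m : ℕ} (hf : f ∈ S.Cpl Ψ m) :
    ∃ ε > 0, ∀ r : X → X, (∀ x, dist (r x) x < ε) → (∀ P ∈ Ψ, ∀ x ∈ P.2, r x ∈ P.2) →
      pb id r f ∈ S.Cpl Ψ m ∧ prism r f ∈ S.Cpl Ψ (m - 1) ∧
      ∀ O A B : Set X, IsOpen O → (∀ x ∈ O, x ∈ B → r x ∈ A) → (univ, A) ∈ Ψ →
        ∀ x ∈ O, S.VanAt x B (pb id r f) := by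
  obtain ⟨ε₁, h1, hε₁⟩ := hf.2.1.uniform
  have : ∃ ε > 0, ∀ P : Ψ, ∀ x ∈ P.1.1, ∀ c, x ∈ S.core c → ∀ l,
      (∀ y ∈ l, dist y x < ε ∧ y ∈ P.1.2) → f c l = 0 := by
    have := hΨ.to_subtype
    refine exists_pos_forall (fun i a b _ hab h x hx c hc l hl => h x hx c hc l fun y hy =>
      ⟨(hl y hy).1.trans_le hab, (hl y hy).2⟩) fun P => ?_
    exact VanAt.uniform (hcl _ P.2) fun x hx => hf.2.2 _ P.2 x hx
  obtain ⟨ε₂, h2, hε₂⟩ := this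
  refine ⟨min ε₁ ε₂ / 2, by positivity, fun r hr hrA => ?_⟩
  have e : ∀ x y, dist y x < min ε₁ ε₂ / 2 → dist y x < ε₁ ∧ dist y x < ε₂ ∧
      dist (r y) x < ε₁ ∧ dist (r y) x < ε₂ := by
    intro x y h
    have a1 := hr y
    have a2 := dist_triangle (r y) y x
    have a3 := min_le_left ε₁ ε₂
    have a4 := min_le_right ε₁ ε₂
    have a5 : (0:ℝ) ≤ dist y x := dist_nonneg
    refine ⟨?_, ?_, ?_, ?_⟩ <;> linarith
  have hpos : (0:ℝ) < min ε₁ ε₂ / 2 := by positivity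
  refine ⟨⟨?_, ?_, ?_⟩, ⟨?_, ?_, ?_⟩, ?_⟩
  · intro c l hl
    refine hf.1 _ _ (by simpa using hl)
  · intro c c' x hx hx'
    refine eventually_nl_metric.2 ⟨_, hpos, fun l hl => ?_⟩
    refine hε₁ c c' x hx hx' _ fun y hy => ?_
    obtain ⟨z, hz, rfl⟩ := List.mem_map.1 hy
    exact (e x z (hl z hz).1).2.2.1
  · intro P hP x hx c hc
    refine eventually_nl_metric.2 ⟨_, hpos, fun l hl => ?_⟩
    refine hε₂ ⟨P, hP⟩ x hx c hc _ fun y hy => ?_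
    obtain ⟨z, hz, rfl⟩ := List.mem_map.1 hy
    exact ⟨(e x z (hl z hz).1).2.2.2, hrA P hP z (hl z hz).2⟩
  · intro c l hl
    rcases hl with hl | rfl
    · rw [prism_apply, ← zero_mul (hA r l (f c))]
      refine hA_congr r l fun l' _ hlen => ?_
      rw [zero_mul]
      exact hf.1 c l' (Or.inl (by omega))
    · rfl
  · intro c c' x hx hx'
    refine eventually_nl_metric.2 ⟨_, hpos, fun l hl => ?_⟩
    refine hA_congr r l fun l' hl' _ => hε₁ c c' x hx hx' _ fun y hy => ?_
    rcases hl' y hy with h | ⟨z, hz, rfl⟩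
    · exact (e x y (hl y h).1).1
    · exact (e x z (hl z hz).1).2.2.1
  · intro P hP x hx c hc
    refine eventually_nl_metric.2 ⟨_, hpos, fun l hl => ?_⟩
    rw [prism_apply, ← zero_mul (hA r l (f c))]
    refine hA_congr r l fun l' hl' _ => ?_
    rw [zero_mul]
    refine hε₂ ⟨P, hP⟩ x hx c hc _ fun y hy => ?_
    rcases hl' y hy with h | ⟨z, hz, rfl⟩
    · exact ⟨(e x y (hl y h).1).2.1, (hl y h).2⟩
    · exact ⟨(e x z (hl z hz).1).2.2.2, hrA P hP z (hl z hz).2⟩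
  · intro O A B hO hOA hA x hx c hc
    obtain ⟨δ, hδ, hδO⟩ := Metric.isOpen_iff.1 hO x hx
    refine eventually_nl_metric.2 ⟨_, lt_min hpos hδ, fun l hl => ?_⟩
    refine hε₂ ⟨_, hA⟩ x trivial c hc _ fun y hy => ?_
    obtain ⟨z, hz, rfl⟩ := List.mem_map.1 hy
    have hz' := (lt_min_iff.1 (hl z hz).1)
    exact ⟨(e x z hz'.1).2.2.2, hOA z (hδO hz'.2) (hl z hz).2⟩

end CoefSys
end

section
variable {d : V →ₗ[k] V}

theorem hc_second_iso {A B C J : ℕ → Submodule k V} (hA : IsCx d A) (hJ : IsCx d J)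
    (hB : IsCx d B) (hAJ : ∀ m, A m ≤ J m) (hC : ∀ m, ∀ x ∈ A m, (x ∈ B m ↔ x ∈ C m))
    (hs : ∀ m, J m ≤ B m ⊔ A m) (m : ℕ) : hc d A C m = hc d J B m := by
  have h : SqIso d d LinearMap.id A C J B := by
    refine ⟨fun _ => rfl, fun hx => hAJ _ hx, fun {m x} hx => hC m x hx, ?_⟩
    intro m y hy
    obtain ⟨b, hb, a, ha, rfl⟩ := Submodule.mem_sup.1 (hs m hy)
    exact ⟨a, ha, by simpa using hb⟩
  exact h.hc_eq hA hJ hB m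

end

section
variable [TopologicalSpace X]

namespace CoefSys

/-- Cochains vanishing on the tuples in `A`. -/
def rel (S : CoefSys X I k) (A : Set X) : ℕ → Submodule k (I → List X → k) :=
  S.Cpl {(univ, A)}

/-- Cochains with support in `U`. -/
def cs (S : CoefSys X I k) (U : Set X) : ℕ → Submodule k (I → List X → k) :=
  S.Cpl {(Uᶜ, univ)}

/-- Locally zero cochains. -/
def nul (S : CoefSys X I k) : ℕ → Submodule k (I → List X → k) :=
  S.Cpl {(univ, univ)}

variable {S : CoefSys X I k} {m : ℕ} {f : I → List X → k} {Ψ : Set (Set X × Set X)}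

theorem mem_rel {A : Set X} : f ∈ S.rel A m ↔ (∀ c l, (l.length ≠ m ∨ l = []) → f c l = 0) ∧
    S.Homog f ∧ ∀ x, S.VanAt x A f := by
  rw [rel, mem_Cpl]; simp

theorem mem_cs {U : Set X} : f ∈ S.cs U m ↔ (∀ c l, (l.length ≠ m ∨ l = []) → f c l = 0) ∧
    S.Homog f ∧ ∀ x, x ∉ U → S.VanAt x univ f := by
  rw [cs, mem_Cpl]; simp

theorem mem_nul : f ∈ S.nul m ↔ (∀ c l, (l.length ≠ m ∨ l = []) → f c l = 0) ∧
    S.Homog f ∧ ∀ x, S.VanAt x univ f := by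
  rw [nul, mem_Cpl]; simp

theorem rel_univ : S.rel univ = S.nul := rfl

theorem cs_empty : S.cs ∅ = S.nul := by rw [cs, nul, Set.compl_empty]

theorem nul_le (m : ℕ) : S.nul m ≤ S.Cpl Ψ m := fun _ hf =>
  ⟨hf.1, hf.2.1, fun _ _ x _ => ((mem_nul.1 hf).2.2 x).mono (subset_univ _)⟩

theorem rel_anti {A B : Set X} (h : A ⊆ B) (m : ℕ) : S.rel B m ≤ S.rel A m := fun _ hf => by
  rw [mem_rel] at hf ⊢
  exact ⟨hf.1, hf.2.1, fun x => (hf.2.2 x).mono h⟩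

theorem cs_mono {U V : Set X} (h : U ⊆ V) (m : ℕ) : S.cs U m ≤ S.cs V m := fun _ hf => by
  rw [mem_cs] at hf ⊢
  exact ⟨hf.1, hf.2.1, fun x hx => hf.2.2 x fun h' => hx (h h')⟩

theorem cs_inf {U V : Set X} (m : ℕ) : S.cs U m ⊓ S.cs V m = S.cs (U ∩ V) m := by
  ext f
  simp only [mem_inf, mem_cs, Set.mem_inter_iff, not_and_or]
  constructor
  · rintro ⟨⟨h1, h2, h3⟩, -, -, h4⟩
    exact ⟨h1, h2, fun x hx => hx.elim (h3 x) (h4 x)⟩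
  · rintro ⟨h1, h2, h3⟩
    exact ⟨⟨h1, h2, fun x hx => h3 x (Or.inl hx)⟩, h1, h2, fun x hx => h3 x (Or.inr hx)⟩

theorem VanAt.of_notMem {x : X} {A : Set X} (h : x ∉ closure A) (hf : ∀ c, f c [] = 0) :
    S.VanAt x A f := by
  intro c _
  refine eventually_nl.2 ⟨(closure A)ᶜ, isClosed_closure.isOpen_compl, h, fun l hl => ?_⟩
  cases l with
  | nil => exact hf c
  | cons y l =>
    obtain ⟨h1, h2⟩ := hl y mem_cons_self
    exact absurd (subset_closure h2) h1

theorem cs_le_rel {U A : Set X} (h : closure A ⊆ Uᶜ) (m : ℕ) : S.cs U m ≤ S.rel A m := by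
  intro f hf
  rw [mem_cs] at hf
  refine mem_rel.2 ⟨hf.1, hf.2.1, fun x => ?_⟩
  by_cases hx : x ∈ closure A
  · exact (hf.2.2 x (h hx)).mono (subset_univ _)
  · exact VanAt.of_notMem hx fun c => hf.1 c _ (Or.inr rfl)

theorem exists_support [Finite I] (S : CoefSys X I k) (f : I → List X → k) :
    IsOpen {x | S.VanAt x univ f} :=
  isOpen_iff_mem_nhds.2 fun _ hx => VanAt.nhds hx

open Classical in
/-- The indicator of the tuples starting in `P`. -/
def hdInd (k : Type*) [Field k] (P : Set X) : List X → k
  | [] => 0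
  | x :: _ => if x ∈ P then 1 else 0

theorem vanAt_hdInd {x : X} {P : Set X} (h : Pᶜ ∈ 𝓝 x) : S.VanAt x univ
    (mulOp (hdInd k P) f) := by
  intro c _
  filter_upwards [eventually_nl_mem h] with l hl
  rw [mulOp_apply]
  cases l with
  | nil => exact zero_mul _
  | cons y l =>
    have := (hl y mem_cons_self).1
    rw [CoefSys.hdInd, if_neg this, zero_mul]

theorem vanAt_sub_hdInd {x : X} {P : Set X} (h : P ∈ 𝓝 x) (hf : ∀ c, f c [] = 0) :
    S.VanAt x univ (f - mulOp (CoefSys.hdInd k P) f) := by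
  intro c _
  filter_upwards [eventually_nl_mem h] with l hl
  rw [Pi.sub_apply, Pi.sub_apply, mulOp_apply]
  cases l with
  | nil => simp [hf]
  | cons y l =>
    have := (hl y mem_cons_self).1
    rw [CoefSys.hdInd, if_pos this, one_mul, sub_self]

theorem hc_cs_eq_zero_of_exhaust [Finite I] [CompactSpace X] {U : Set X}
    (h : ∀ T, IsCompact T → T ⊆ U → ∃ W, T ⊆ W ∧ W ⊆ U ∧ hc cd (S.cs W) S.nul m = 0) :
    hc cd (S.cs U) S.nul m = 0 := by
  rw [hc_eq_zero]
  intro z hz hdz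
  have hz' := mem_cs.1 hz
  obtain ⟨W, h1, h2, h3⟩ := h {x | S.VanAt x univ z}ᶜ
    (S.exists_support z).isClosed_compl.isCompact
    (fun x hx => by_contra fun h => hx (hz'.2.2 x h))
  rw [hc_eq_zero] at h3
  obtain ⟨y, hy, hyz⟩ := h3 z (mem_cs.2 ⟨hz'.1, hz'.2.1, fun x hx => by_contra fun h => hx (h1 h)⟩) hdz
  exact ⟨y, cs_mono h2 _ hy, hyz⟩

end CoefSys
end

section
variable [PseudoMetricSpace X]
  {S : CoefSys X I k} {m : ℕ} {f : I → List X → k}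
namespace CoefSys

theorem cs_union_le {U V : Set X} (hU : IsOpen U) (hV : IsOpen V) (m : ℕ) :
    S.cs (U ∪ V) m ≤ S.cs U m ⊔ S.cs V m := by
  intro f hf
  have hf' := mem_cs.1 hf
  have h0 : ∀ c, f c [] = 0 := fun c => hf'.1 c _ (Or.inr rfl)
  have hf2 : f ∈ S.Cpl ∅ m := ⟨hf.1, hf.2.1, fun _ h => absurd h (Set.notMem_empty _)⟩
  by_cases hUe : (Uᶜ).Nonempty
  swap
  · rw [Set.not_nonempty_iff_eq_empty, Set.compl_empty_iff] at hUe
    rw [hUe] at hf ⊢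
    rw [Set.univ_union] at hf
    exact mem_sup_left hf
  by_cases hVe : (Vᶜ).Nonempty
  swap
  · rw [Set.not_nonempty_iff_eq_empty, Set.compl_empty_iff] at hVe
    rw [hVe] at hf ⊢
    rw [Set.union_univ] at hf
    exact mem_sup_right hf
  let P : Set X := {x | infDist x Vᶜ < infDist x Uᶜ}
  have hm := mulOp_mem hf2 (CoefSys.hdInd k P)
  have hcU := Metric.continuous_infDist_pt (Uᶜ)
  have hcV := Metric.continuous_infDist_pt (Vᶜ)
  have key : mulOp (CoefSys.hdInd k P) f ∈ S.cs U m ∧ f - mulOp (CoefSys.hdInd k P) f ∈ S.cs V m := by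
    constructor
    · refine mem_cs.2 ⟨hm.1, hm.2.1, fun x hx => ?_⟩
      by_cases hxV : x ∈ V
      · refine vanAt_hdInd ?_
        have e1 : infDist x Uᶜ = 0 := Metric.infDist_zero_of_mem hx
        have e2 : 0 < infDist x Vᶜ :=
          (hV.isClosed_compl.notMem_iff_infDist_pos hVe).1 (by simpa using hxV)
        filter_upwards [(isOpen_lt hcU hcV).mem_nhds (show x ∈ {y | _ < _} by
          rw [Set.mem_ofPred_eq, e1]; exact e2)] with y hy
        exact not_lt.2 (le_of_lt hy)
      · exact VanAt.mulOp (hf'.2.2 x (by simp [hxV]; exact hx)) _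
    · have hm2 := sub_mem hf2 hm
      refine mem_cs.2 ⟨hm2.1, hm2.2.1, fun x hx => ?_⟩
      by_cases hxU : x ∈ U
      · refine vanAt_sub_hdInd ?_ h0
        have e1 : infDist x Vᶜ = 0 := Metric.infDist_zero_of_mem hx
        have e2 : 0 < infDist x Uᶜ :=
          (hU.isClosed_compl.notMem_iff_infDist_pos hUe).1 (by simpa using hxU)
        exact (isOpen_lt hcV hcU).mem_nhds (show x ∈ {y | _ < _} by
          rw [Set.mem_ofPred_eq, e1]; exact e2)
      · have hx1 := hf'.2.2 x (by simp [hxU]; exact hx)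
        intro c hc
        filter_upwards [hx1 c hc, hx1.mulOp (CoefSys.hdInd k P) c hc] with l e1 e2
        rw [Pi.sub_apply, Pi.sub_apply, e1, e2, sub_zero]
  rw [← add_sub_cancel (mulOp (CoefSys.hdInd k P) f) f]
  exact Submodule.add_mem_sup key.1 key.2

theorem hc_cs_union {U V : Set X} (hU : IsOpen U) (hV : IsOpen V) (m : ℕ) :
    hc cd (S.cs (U ∪ V)) S.nul m ≤
      hc cd (S.cs U) S.nul m + (hc cd (S.cs V) S.nul m + hc cd (S.cs (U ∩ V)) S.nul (m + 1)) := by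
  have h1 := hc_le_add (d := cd) cd_cd (L := S.nul) (K := S.cs U) (J := S.cs (U ∪ V)) nul_le
    (cs_mono Set.subset_union_left) m
  have h2 := hc_le_add' (d := cd) cd_cd (L := S.nul) (K := S.cs (U ∩ V)) (J := S.cs V) nul_le
    (cs_mono inter_subset_right) m
  have h3 : hc cd (S.cs V) (S.cs (U ∩ V)) m = hc cd (S.cs (U ∪ V)) (S.cs U) m := by
    refine hc_second_iso Cpl_isCx Cpl_isCx Cpl_isCx (cs_mono Set.subset_union_right) ?_
      (cs_union_le hU hV) m
    intro m x hx
    rw [← cs_inf, mem_inf]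
    exact ⟨fun h => ⟨h, hx⟩, fun h => h.1⟩
  rw [← h3] at h1
  exact h1.trans (by gcongr)

end CoefSys
end

section
variable [PseudoMetricSpace X] [CompactSpace X] {G : Type*} [Group G] [Finite G]
  [MulAction G X]

/-- Equivariant maps close to the identity pushing a neighbourhood of `A` in `B` into `A`. -/
theorem exists_snap (hc : ∀ g : G, Continuous fun x : X => g • x) {A B : Set X}
    (hA : ∀ g : G, ∀ x ∈ A, g • x ∈ A) (hB : ∀ g : G, ∀ x ∈ B, g • x ∈ B) 
    (hst : ∀ x ∈ B, x ∉ A → ∀ a ∈ A, ∀ g : G, g • x = x → g • a = a) {ε : ℝ} (hε : 0 < ε) :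
    ∃ r : X → X, ∃ O : Set X, (∀ x, dist (r x) x < ε) ∧ (∀ x ∈ A, r x = x) ∧
      (∀ x, r x = x ∨ r x ∈ A) ∧ (∀ g : G, ∀ x, r (g • x) = g • r x) ∧ IsOpen O ∧ A ⊆ O ∧
      (∀ x ∈ O, x ∈ B → r x ∈ A) ∧ (∀ x ∉ B, r x = x) ∧ ∀ g : G, ∀ x ∈ O, g • x ∈ O := by
  classical
  obtain ⟨δ, hδ, hδε⟩ : ∃ δ > 0, ∀ g : G, ∀ y z : X, dist y z < δ → dist (g • y) (g • z) < ε := by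
    refine exists_pos_forall (fun g a b _ hab h y z hyz => h y z (hyz.trans_le hab)) fun g => ?_
    obtain ⟨δ, h1, h2⟩ := Metric.uniformContinuous_iff.1
      (CompactSpace.uniformContinuous_of_continuous (hc g)) ε hε
    exact ⟨δ, h1, fun y z h => h2 h⟩
  set O : Set X := ⋂ g : G, (fun x => g • x) ⁻¹' Metric.thickening δ A with hO
  have hOo : IsOpen O := isOpen_iInter_of_finite fun g => Metric.isOpen_thickening.preimage (hc g)
  have hOg : ∀ (g : G) (x : X), x ∈ O → g • x ∈ O := by
    intro g x hx
    simp only [hO, mem_iInter, Set.mem_preimage] at hx ⊢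
    intro h
    rw [← mul_smul]; exact hx _
  have hAO : A ⊆ O := fun x hx => mem_iInter.2 fun g =>
    Metric.self_subset_thickening hδ _ (hA g x hx)
  have h1 : ∀ x : X, ∃ a, x ∈ O → a ∈ A ∧ dist x a < δ := by
    intro x
    by_cases hx : x ∈ O
    · obtain ⟨a, ha, h⟩ := Metric.mem_thickening_iff.1 (mem_iInter.1 hx 1)
      simp only [one_smul] at h
      exact ⟨a, fun _ => ⟨ha, h⟩⟩
    · exact ⟨x, fun h => absurd h hx⟩
  choose a ha using h1
  set rep : X → X := fun x => (Quotient.mk (orbitRel G X) x).out with hrep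
  have hrep1 : ∀ (g : G) x, rep (g • x) = rep x := fun g x => by
    simp only [hrep]
    congr 1
    exact Quotient.sound (MulAction.orbitRel_apply.2 ⟨g, rfl⟩)
  have hrep2 : ∀ x, ∃ g : G, g • rep x = x := fun x => by
    have : (orbitRel G X).r (rep x) x := Quotient.exact (Quotient.out_eq _)
    obtain ⟨g, hg⟩ := MulAction.orbitRel_apply.1 this
    exact ⟨g⁻¹, by rw [← hg]; exact inv_smul_smul _ _⟩
  choose γ hγ using hrep2
  have inv : ∀ {P : Set X}, (∀ g : G, ∀ x ∈ P, g • x ∈ P) → ∀ (g : G) x, g • x ∈ P ↔ x ∈ P :=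
    fun {P} hP g x => ⟨fun h => by simpa using hP g⁻¹ _ h, hP g x⟩
  have iA := inv hA
  have iB := inv hB
  have iO := inv (P := O) hOg
  have rO : ∀ x, rep x ∈ O ↔ x ∈ O := fun x => by rw [← iO (γ x), hγ]
  have rA : ∀ x, rep x ∈ A ↔ x ∈ A := fun x => by rw [← iA (γ x), hγ]
  have rB : ∀ x, rep x ∈ B ↔ x ∈ B := fun x => by rw [← iB (γ x), hγ]
  refine ⟨fun x => if x ∈ O ∧ x ∈ B ∧ x ∉ A then γ x • a (rep x) else x, O, ?_, ?_, ?_, ?_, hOo, hAO,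
    ?_, ?_⟩
  · intro x
    dsimp only
    split_ifs with h
    · have := hδε (γ x) _ _ (ha _ ((rO x).2 h.1)).2
      rw [hγ, dist_comm] at this
      exact this
    · rwa [dist_self]
  · intro x hx
    exact if_neg fun h => h.2.2 hx
  · intro x
    dsimp only
    split_ifs with h
    · exact Or.inr (hA _ _ (ha _ ((rO x).2 h.1)).1)
    · exact Or.inl rfl
  · intro g x
    dsimp only
    by_cases h : x ∈ O ∧ x ∈ B ∧ x ∉ A
    · rw [if_pos h, if_pos (by rwa [iO, iB, iA]), hrep1, ← mul_smul]
      have h2 : ((g * γ x)⁻¹ * γ (g • x)) • rep x = rep x := by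
        rw [mul_smul, inv_smul_eq_iff, mul_smul, hγ, ← hrep1 g, hγ]
      have := hst (rep x) ((rB x).2 h.2.1) (fun h' => h.2.2 ((rA x).1 h')) (a (rep x))
        (ha _ ((rO x).2 h.1)).1 _ h2
      rwa [mul_smul, inv_smul_eq_iff] at this
    · rw [if_neg h, if_neg (by rwa [iO, iB, iA])]
  · intro x hx hxB
    dsimp only
    split_ifs with h
    · exact hA _ _ (ha _ ((rO x).2 h.1)).1
    · by_contra h'
      exact h ⟨hx, hxB, h'⟩
  · exact ⟨fun x hx => if_neg fun h => hx h.2.1, hOg⟩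

variable [Finite I] {S : CoefSys X I k}

namespace CoefSys

/-- Cohomology relative to a closed subset vanishes above the dimension. -/
theorem hc_rel_eq_zero {D : ℕ} (h : ∀ U : Set X, IsOpen U → ∀ i, D < i → hc cd (S.cs U) S.nul i = 0)
    {A : Set X} (hA : IsClosed A) {i : ℕ} (hi : D < i) : hc cd (S.rel A) S.nul i = 0 := by
  rw [hc_eq_zero]
  intro z hz hdz
  obtain ⟨ε, hε, h1⟩ := exists_snap_radius (Ψ := {(univ, A)}) (finite_singleton _)
    (by simp) hz
  obtain ⟨ε', hε', h2⟩ := exists_snap_radius (Ψ := {(univ, univ)}) (finite_singleton _)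
    (by simp) hdz
  have triv : ∀ (g : (⊥ : Subgroup (Equiv.Perm X))) (x : X), g • x = x := fun g x => by
    rw [Subsingleton.elim g 1, one_smul]
  obtain ⟨r, O, r1, r2, r3, -, hO, hAO, r5, -⟩ := exists_snap (G := (⊥ : Subgroup (Equiv.Perm X)))
    (fun g => by simp only [triv]; exact continuous_id)
    (A := A) (B := univ) (fun g x h => by rwa [triv]) (fun _ _ h => h)
    (fun _ _ _ _ _ g _ => triv g _) (lt_min hε hε')
  obtain ⟨p1, p2, p3⟩ := h1 r (fun x => (r1 x).trans_le (min_le_left _ _)) (by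
    rintro P rfl x hx
    rcases r3 x with h | h
    · rw [h]; exact hx
    · exact h)
  obtain ⟨q1, q2, -⟩ := h2 r (fun x => (r1 x).trans_le (min_le_right _ _)) (by
    rintro P rfl x hx; exact mem_univ _)
  have hU : pb id r z ∈ S.cs Aᶜ i := mem_cs.2 ⟨p1.1, p1.2.1, fun x hx =>
    p3 O A univ hO r5 rfl x (hAO (by simpa using hx))⟩
  obtain ⟨y, hy, hyz⟩ := hc_eq_zero.1 (h _ hA.isOpen_compl i hi) _ hU (by
    rw [cd_pb]; exact q1)
  refine ⟨y - prism r z, sub_mem (cs_le_rel (by rw [hA.closure_eq, compl_compl]) _ hy) p2, ?_⟩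
  have e : z - cd (y - prism r z) = (pb id r z - cd y) - prism r (cd z) := by
    rw [map_sub, eq_sub_of_add_eq (cd_prism r z)]
    abel
  rw [e]
  exact sub_mem hyz q2
end CoefSys
end

section
variable [PseudoMetricSpace X] [CompactSpace X]
  [Finite I] {S : CoefSys X I k}

namespace CoefSys

/-- Cochains vanishing on tuples in `A` may be replaced by cochains vanishing near `A`. -/
theorem hc_snap {Ψ : Set (Set X × Set X)} (hΨ : Ψ.Finite) (hcl : ∀ P ∈ Ψ, IsClosed P.1)
    {A B : Set X} (hA : IsClosed A) (hAB : A ⊆ B) (hP : ∀ P ∈ Ψ, A ⊆ P.2) (m : ℕ) :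
    hc cd (S.Cpl (insert (univ, A) Ψ)) (S.Cpl (insert (A, B) Ψ)) m = 0 := by
  rw [hc_eq_zero]
  intro z hz hdz
  obtain ⟨ε, hε, h1⟩ := exists_snap_radius (hΨ.insert (univ, A))
    (by rintro P (rfl | h); exacts [isClosed_univ, hcl _ h]) hz
  obtain ⟨ε', hε', h2⟩ := exists_snap_radius (hΨ.insert (A, B))
    (by rintro P (rfl | h); exacts [hA, hcl _ h]) hdz
  obtain ⟨δ, hδ, h3⟩ := VanAt.uniform (T := A) hA fun x _ => hz.2.2 _ (Set.mem_insert _ _) x trivial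
  have triv : ∀ (g : (⊥ : Subgroup (Equiv.Perm X))) (x : X), g • x = x := fun g x => by
    rw [Subsingleton.elim g 1, one_smul]
  obtain ⟨r, O, r1, r2, r3, -, hO, hAO, r5, -⟩ := exists_snap (G := (⊥ : Subgroup (Equiv.Perm X)))
    (fun g => by simp only [triv]; exact continuous_id)
    (A := A) (B := B) (fun g x h => by rwa [triv]) (fun g x h => by rwa [triv])
    (fun _ _ _ _ _ g _ => triv g _) (lt_min (half_pos hδ) (lt_min hε hε'))
  have r3' : ∀ {Q : Set X}, A ⊆ Q → ∀ x ∈ Q, r x ∈ Q := fun hQ x hx => by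
    rcases r3 x with h | h
    · rwa [h]
    · exact hQ h
  obtain ⟨p1, p2, -⟩ := h1 r
    (fun x => (r1 x).trans_le ((min_le_right _ _).trans (min_le_left _ _))) (by
    rintro P (rfl | h)
    · exact r3' le_rfl
    · exact r3' (hP P h))
  obtain ⟨q1, q2, -⟩ := h2 r
    (fun x => (r1 x).trans_le ((min_le_right _ _).trans (min_le_right _ _))) (by
    rintro P (rfl | h)
    · exact r3' hAB
    · exact r3' (hP P h))
  refine ⟨- prism r z, neg_mem p2, ?_⟩
  have e : z - cd (- prism r z) = pb id r z - prism r (cd z) := by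
    rw [map_neg, eq_sub_of_add_eq (cd_prism r z)]
    abel
  rw [e]
  refine sub_mem ⟨p1.1, p1.2.1, ?_⟩ q2
  rintro P (rfl | h)
  · intro x hx c hc
    obtain ⟨δ', hδ', hO'⟩ := Metric.isOpen_iff.1 hO x (hAO hx)
    refine eventually_nl_metric.2 ⟨_, lt_min hδ' (half_pos hδ), fun l hl => ?_⟩
    rw [pb_apply]
    refine h3 x hx c hc _ fun y hy => ?_
    obtain ⟨w, hw, rfl⟩ := List.mem_map.1 hy
    obtain ⟨w1, w2⟩ := hl w hw
    obtain ⟨w3, w4⟩ := lt_min_iff.1 w1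
    refine ⟨?_, r5 w (hO' w3) w2⟩
    have a1 := (r1 w).trans_le (min_le_left _ _)
    have a2 := dist_triangle (r w) w x
    linarith
  · exact p1.2.2 P (Set.mem_insert_of_mem _ h)

end CoefSys

/-- The constant coefficient system. -/
def plain (X : Type*) [TopologicalSpace X] (k : Type*) [Field k] : CoefSys X Unit k where
  core _ := univ
  dom _ := univ
  deg _ _ _ := 1
  core_closed _ := isClosed_univ
  dom_open _ := isOpen_univ
  core_sub _ := le_rfl
  cover _ := ⟨(), trivial⟩
  deg_self _ := rfl
  deg_mul _ _ _ := one_mul 1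
  deg_loc _ _ := Eventually.of_forall fun _ => rfl

open CoefSys

theorem plain_homog {X : Type*} [TopologicalSpace X] (f : Unit → List X → k) :
    (plain X k).Homog f := fun _ _ _ _ _ =>
  Eventually.of_forall fun _ => (one_mul _).symm

/-- Being a plain cochain, with a uniform radius for the vanishing conditions. -/
def UCpl (k : Type*) [Field k] (Ψ : Set (Set X × Set X)) (m : ℕ) (δ : ℝ)
    (f : Unit → List X → k) : Prop :=
  (∀ c l, (l.length ≠ m ∨ l = []) → f c l = 0) ∧
    ∀ P ∈ Ψ, ∀ x ∈ P.1, ∀ l, (∀ y ∈ l, dist y x < δ ∧ y ∈ P.2) → f () l = 0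

omit [CompactSpace X] in
theorem UCpl.mem {Ψ : Set (Set X × Set X)} {m : ℕ} {δ : ℝ} (hδ : 0 < δ) {f : Unit → List X → k}
    (h : UCpl k Ψ m δ f) : f ∈ (plain X k).Cpl Ψ m :=
  ⟨h.1, plain_homog f, fun P hP x hx _ _ => eventually_nl_metric.2 ⟨δ, hδ, h.2 P hP x hx⟩⟩

theorem exists_UCpl {Ψ : Set (Set X × Set X)} (hΨ : Ψ.Finite) (hcl : ∀ P ∈ Ψ, IsClosed P.1)
    {m : ℕ} {f : Unit → List X → k} (hf : f ∈ (plain X k).Cpl Ψ m) :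
    ∃ δ > 0, ∀ δ' ≤ δ, UCpl k Ψ m δ' f := by
  have := hΨ.to_subtype
  obtain ⟨δ, hδ, h⟩ : ∃ ε > 0, ∀ P : Ψ, ∀ x ∈ P.1.1, ∀ l,
      (∀ y ∈ l, dist y x < ε ∧ y ∈ P.1.2) → f () l = 0 := by
    refine exists_pos_forall (fun i a b _ hab h x hx l hl => h x hx l fun y hy =>
      ⟨(hl y hy).1.trans_le hab, (hl y hy).2⟩) fun P => ?_
    obtain ⟨ε, hε, h⟩ := VanAt.uniform (hcl _ P.2) fun x hx => hf.2.2 _ P.2 x hx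
    exact ⟨ε, hε, fun x hx l hl => h x hx () trivial l hl⟩
  exact ⟨δ, hδ, fun δ' hδ' => ⟨hf.1, fun P hP x hx l hl => h ⟨P, hP⟩ x hx l fun y hy =>
    ⟨(hl y hy).1.trans_le hδ', (hl y hy).2⟩⟩⟩

omit [CompactSpace X] in
theorem UCpl.pb {Ψ : Set (Set X × Set X)} {m : ℕ} {δ : ℝ} {f : Unit → List X → k}
    (h : UCpl k Ψ m δ f) {r : X → X} (hr : ∀ x y, dist (r x) (r y) ≤ dist x y)
    (h1 : ∀ P ∈ Ψ, ∀ x ∈ P.1, r x ∈ P.1) (h2 : ∀ P ∈ Ψ, ∀ x ∈ P.2, r x ∈ P.2) :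
    UCpl k Ψ m δ (pb id r f) := by
  refine ⟨fun c l hl => h.1 _ _ (by simpa using hl), fun P hP x hx l hl => ?_⟩
  refine h.2 P hP (r x) (h1 P hP x hx) _ fun y hy => ?_
  obtain ⟨w, hw, rfl⟩ := List.mem_map.1 hy
  exact ⟨(hr _ _).trans_lt (hl w hw).1, h2 P hP w (hl w hw).2⟩

omit [CompactSpace X] in
theorem UCpl.prism {Ψ : Set (Set X × Set X)} {m : ℕ} {δ : ℝ} {f : Unit → List X → k}
    (h : UCpl k Ψ m δ f) {r : X → X} (hr : ∀ x, dist (r x) x < δ / 2)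
    (h2 : ∀ P ∈ Ψ, ∀ x ∈ P.2, r x ∈ P.2) (hδ : 0 < δ) :
    UCpl k Ψ (m - 1) (δ / 2) (prism r f) := by
  refine ⟨fun c l hl => ?_, fun P hP x hx l hl => ?_⟩
  · rcases hl with hl | rfl
    · rw [prism_apply, ← zero_mul (hA r l (f c))]
      refine hA_congr r l fun l' _ hlen => ?_
      rw [zero_mul]
      exact h.1 c l' (Or.inl (by omega))
    · rfl
  · rw [prism_apply, ← zero_mul (hA r l (f ()))]
    refine hA_congr r l fun l' hl' _ => ?_
    rw [zero_mul]
    refine h.2 P hP x hx _ fun y hy => ?_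
    rcases hl' y hy with h | ⟨w, hw, rfl⟩
    · exact ⟨(hl y h).1.trans (half_lt_self hδ), (hl y h).2⟩
    · have := hr w
      have := (hl w hw).1
      have := dist_triangle (r w) w x
      exact ⟨by linarith, h2 P hP w (hl w hw).2⟩

/-- A complex contracted by a flow of non-expansive maps is acyclic. -/
theorem hc_flow {Ψ Φ : Set (Set X × Set X)} (hΨ : Ψ.Finite) (hcl : ∀ P ∈ Ψ, IsClosed P.1)
    (hΦ : Φ.Finite) (hcl' : ∀ P ∈ Φ, IsClosed P.1)
    (hr : ∀ ε : ℝ, 0 < ε → ∃ r : X → X, (∀ x, dist (r x) x < ε) ∧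
      (∀ x y, dist (r x) (r y) ≤ dist x y) ∧
      (∀ P ∈ Ψ ∪ Φ, (∀ x ∈ P.1, r x ∈ P.1) ∧ ∀ x ∈ P.2, r x ∈ P.2) ∧
      ∃ N : ℕ, ∀ P' ∈ Φ, ∀ x ∈ P'.1, ∃ P ∈ Ψ, r^[N] x ∈ P.1 ∧ ∀ y ∈ P'.2, r^[N] y ∈ P.2) (m : ℕ) :
    hc cd ((plain X k).Cpl Ψ) ((plain X k).Cpl Φ) m = 0 := by
  rw [hc_eq_zero]
  intro z hz hdz
  obtain ⟨δ₁, h1, u1⟩ := exists_UCpl hΨ hcl hz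
  obtain ⟨δ₂, h2, u2⟩ := exists_UCpl hΦ hcl' hdz
  have hδ : 0 < min δ₁ δ₂ := lt_min h1 h2
  replace u1 := u1 _ (min_le_left δ₁ δ₂)
  replace u2 := u2 _ (min_le_right δ₁ δ₂)
  obtain ⟨r, r1, r2, r3, N, r4⟩ := hr (min δ₁ δ₂ / 2) (half_pos hδ)
  have key : ∀ j : ℕ, UCpl k Ψ m (min δ₁ δ₂) (pb id r^[j] z) ∧
      UCpl k Φ (m + 1) (min δ₁ δ₂) (cd (pb id r^[j] z)) ∧
      ∃ y ∈ (plain X k).Cpl Ψ (m - 1), pb id r^[j] z - z - cd y ∈ (plain X k).Cpl Φ m := by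
    intro j
    induction j with
    | zero =>
      have : pb id r^[0] z = z := by ext c l; simp [pb_apply]
      rw [this]
      exact ⟨u1, u2, 0, zero_mem _, by simp⟩
    | succ j ih =>
      obtain ⟨i1, i2, y, hy, hyz⟩ := ih
      have e : pb id r^[j + 1] z = pb id r (pb id r^[j] z) := by
        ext c l; simp [pb_apply]
      rw [e, cd_pb]
      refine ⟨i1.pb r2 (fun P hP => (r3 P (Or.inl hP)).1) (fun P hP => (r3 P (Or.inl hP)).2),
        i2.pb r2 (fun P hP => (r3 P (Or.inr hP)).1) (fun P hP => (r3 P (Or.inr hP)).2),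
        y + prism r (pb id r^[j] z), add_mem hy ?_, ?_⟩
      · exact (i1.prism r1 (fun P hP => (r3 P (Or.inl hP)).2) hδ).mem (half_pos hδ)
      · have h3 := (i2.prism r1 (fun P hP => (r3 P (Or.inr hP)).2) hδ).mem (half_pos hδ)
        have h4 := cd_prism r (pb id r^[j] z)
        have : pb id r (pb id r^[j] z) - z - cd (y + prism r (pb id r^[j] z)) =
            (pb id r^[j] z - z - cd y) + prism r (cd (pb id r^[j] z)) := by
          rw [map_add, eq_sub_of_add_eq h4]; abel
        rw [this]
        exact add_mem hyz h3
  have hd : ∀ (j : ℕ) (x y : X), dist (r^[j] x) (r^[j] y) ≤ dist x y := by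
    intro j
    induction j with
    | zero => exact fun _ _ => le_rfl
    | succ j ih => exact fun x y => (ih _ _).trans (r2 x y)
  obtain ⟨n1, -, y, hy, hyz⟩ := key N
  have hN : pb id r^[N] z ∈ (plain X k).Cpl Φ m := by
    refine UCpl.mem hδ ⟨n1.1, fun P' hP' x hx l hl => ?_⟩
    obtain ⟨P, hP, p1, p2⟩ := r4 P' hP' x hx
    refine u1.2 P hP _ p1 _ fun y hy => ?_
    obtain ⟨w, hw, rfl⟩ := List.mem_map.1 hy
    exact ⟨(hd N _ _).trans_lt (hl w hw).1, p2 w (hl w hw).2⟩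
  refine ⟨-y, neg_mem hy, ?_⟩
  have : z - cd (-y) = pb id r^[N] z - (pb id r^[N] z - z - cd y) := by rw [map_neg]; abel
  rw [this]
  exact sub_mem hN hyz

end

open CoefSys

/-- The indicator of the tuples contained in `P`. -/
def inInd (k : Type*) [Field k] (P : Set X) (l : List X) : k :=
  by classical exact if ∀ y ∈ l, y ∈ P then 1 else 0

theorem inInd_of {P : Set X} {l : List X} (h : ∀ y ∈ l, y ∈ P) :
    inInd k P l = 1 := by
  rw [inInd, if_pos h]

theorem inInd_of_not {P : Set X} {l : List X}
    (h : ¬ ∀ y ∈ l, y ∈ P) : inInd k P l = 0 := by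
  rw [inInd, if_neg h]

section
variable [TopologicalSpace X] {S : CoefSys X I k}
  {x : X} {A P : Set X} {f : I → List X → k}

theorem CoefSys.VanAt.mulInd (h : S.VanAt x P f) : S.VanAt x A (SmithTheory.mulOp (inInd k P) f) := by
  intro c hc
  obtain ⟨U, hU, hx, h'⟩ := eventually_nl.1 (h c hc)
  refine eventually_nl.2 ⟨U, hU, hx, fun l hl => ?_⟩
  rw [mulOp_apply]
  by_cases hP : ∀ y ∈ l, y ∈ P
  · rw [h' l fun y hy => ⟨(hl y hy).1, hP y hy⟩, mul_zero]
  · rw [inInd_of_not hP, zero_mul]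

theorem vanAt_sub_inInd : S.VanAt x P (f - mulOp (inInd k P) f) := by
  intro c _
  refine eventually_nl.2 ⟨univ, isOpen_univ, trivial, fun l hl => ?_⟩
  rw [Pi.sub_apply, Pi.sub_apply, mulOp_apply, inInd_of fun y hy => (hl y hy).2, one_mul, sub_self]

theorem CoefSys.VanAt.sub {g : I → List X → k} (hf : S.VanAt x A f) (hg : S.VanAt x A g) :
    S.VanAt x A (f - g) := by
  intro c hc
  filter_upwards [hf c hc, hg c hc] with l h1 h2
  rw [Pi.sub_apply, Pi.sub_apply, h1, h2, sub_zero]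

theorem plain_vanAt {x : X} {A : Set X} {f : Unit → List X → k} :
    (plain X k).VanAt x A f ↔ ∀ᶠ l in nl x A, f () l = 0 :=
  ⟨fun h => h () trivial, fun h _ _ => h⟩

end

section
variable [PseudoMetricSpace X] [CompactSpace X]

/-- A function along which the space can be contracted. -/
structure Slab (u : X → ℝ) (Y R : Set X) : Prop where
  cont : Continuous u
  clY : IsClosed Y
  opR : IsOpen R
  flow : ∀ ε : ℝ, 0 < ε → ∃ r : X → X, (∀ x, dist (r x) x < ε) ∧
    (∀ x y, dist (r x) (r y) ≤ dist x y) ∧ (∀ x ∈ Y, r x ∈ Y) ∧ (∀ x ∉ R, r x ∉ R) ∧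
    (∀ x, u (r x) ≤ u x) ∧ ∃ N : ℕ, ∀ x, u (r^[N] x) ≤ 0

/-- The upper part. -/
def upp (u : X → ℝ) (R : Set X) (a : ℝ) : Set X := {x | a < u x} ∩ R
/-- The slab. -/
def slb (u : X → ℝ) (R : Set X) (a b : ℝ) : Set X := {x | a < u x ∧ u x < b} ∩ R
/-- The lower half. -/
def low (u : X → ℝ) (Y : Set X) (b : ℝ) : Set X := {x | u x ≤ b} ∩ Y
/-- The slice. -/
def slc (u : X → ℝ) (Y : Set X) (b : ℝ) : Set X := {x | u x = b} ∩ Y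

variable {u : X → ℝ} {Y R : Set X} {a a' b : ℝ} (h : Slab u Y R)
include h

theorem Slab.acyclic (ha : 0 ≤ a) (m : ℕ) :
    hc cd ((plain X k).Cpl {((upp u R a)ᶜ, low u Y b)}) ((plain X k).rel (low u Y b)) m = 0 := by
  refine hc_flow (finite_singleton _) ?_ (finite_singleton _) (by simp) ?_ m
  · rintro P rfl
    exact ((isOpen_lt continuous_const h.cont).inter h.opR).isClosed_compl
  · intro ε hε
    obtain ⟨r, r1, r2, r3, r4, r5, N, r6⟩ := h.flow ε hε
    have hl : ∀ x ∈ low u Y b, r x ∈ low u Y b := fun x hx => ⟨(r5 x).trans hx.1, r3 x hx.2⟩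
    refine ⟨r, r1, r2, ?_, N, ?_⟩
    · rintro P (rfl | rfl)
      · refine ⟨fun x hx hx' => ?_, hl⟩
        by_cases hR : x ∈ R
        · exact hx ⟨lt_of_lt_of_le hx'.1 (r5 x), hR⟩
        · exact r4 x hR hx'.2
      · exact ⟨fun _ _ => trivial, hl⟩
    · rintro P rfl x -
      refine ⟨_, rfl, fun hx => ?_, ?_⟩
      · exact absurd (r6 x) (not_le.2 (lt_of_le_of_lt ha hx.1))
      · intro y hy
        clear r6
        induction N generalizing y with
        | zero => exact hy
        | succ N ih => exact ih _ (hl y hy)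

omit [CompactSpace X] in
theorem Slab.clow : IsClosed (low u Y b) := (isClosed_le h.cont continuous_const).inter h.clY
omit [CompactSpace X] in
theorem Slab.cslc : IsClosed (slc u Y b) := (isClosed_eq h.cont continuous_const).inter h.clY

omit [CompactSpace X] in
theorem Slab.vanAt_of_lt {x : X} (hx : u x < b) {f : Unit → List X → k}
    (hf : (plain X k).VanAt x (low u Y b) f) : (plain X k).VanAt x Y f := by
  rw [plain_vanAt] at hf ⊢
  obtain ⟨U, hU, hxU, h'⟩ := eventually_nl.1 hf
  refine eventually_nl.2 ⟨U ∩ {x | u x < b}, hU.inter (isOpen_lt h.cont continuous_const),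
    ⟨hxU, hx⟩, fun l hl => h' l fun y hy => ⟨(hl y hy).1.1, show u y ≤ b from le_of_lt (hl y hy).1.2, (hl y hy).2⟩⟩

theorem Slab.hc_slice (ha : 0 ≤ a) (hab : a < b) (m : ℕ) :
    hc cd ((plain X k).Cpl {((slb u R a b)ᶜ, Y)}) ((plain X k).rel Y) (m + 1) =
      hc cd ((plain X k).Cpl {(Rᶜ, slc u Y b)}) ((plain X k).rel (slc u Y b)) m := by
  have hsl : slc u Y b ⊆ low u Y b := fun x hx => ⟨le_of_eq hx.1, hx.2⟩
  have cu : IsClosed (upp u R a)ᶜ :=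
    ((isOpen_lt continuous_const h.cont).inter h.opR).isClosed_compl
  set K' := (plain X k).Cpl (insert (univ, slc u Y b) {((upp u R a)ᶜ, low u Y b)}) with hK'
  set K₀ := (plain X k).Cpl (insert (slc u Y b, low u Y b) {((upp u R a)ᶜ, low u Y b)}) with hK₀
  set KP := (plain X k).Cpl {((upp u R a)ᶜ, low u Y b)} with hKP
  set LP := (plain X k).rel (low u Y b) with hLP
  have e1 : SqIso cd cd LinearMap.id ((plain X k).Cpl {((slb u R a b)ᶜ, Y)})
      ((plain X k).rel Y) K₀ LP := by
    refine ⟨fun _ => rfl, ?_, ?_, ?_⟩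
    · rintro m x ⟨f1, f2, f3⟩
      have f4 := f3 _ rfl
      refine ⟨f1, f2, ?_⟩
      rintro P (rfl | rfl) y hy
      · exact (f4 y fun h => (ne_of_lt h.1.2) hy.1).mono fun _ h => h.2
      · exact (f4 y fun h => hy ⟨h.1.1, h.2⟩).mono fun _ h => h.2
    · rintro m x ⟨f1, f2, f3⟩
      have f4 := f3 _ rfl
      rw [id_apply, mem_rel, mem_rel]
      refine ⟨fun ⟨_, _, g⟩ => ⟨f1, f2, fun y => ?_⟩, fun ⟨_, _, g⟩ => ⟨f1, f2, fun y => (g y).mono fun _ h => h.2⟩⟩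
      rcases lt_or_ge (u y) b with hy | hy
      · exact h.vanAt_of_lt hy (g y)
      · exact f4 y fun h => not_lt.2 hy h.1.2
    · rintro m f ⟨f1, f2, f3⟩
      have f3a := f3 _ (Set.mem_insert _ _)
      have f3b := f3 _ (Set.mem_insert_of_mem _ rfl)
      refine ⟨mulOp (inInd k (low u Y b)) f, ⟨fun c l hl => by rw [mulOp_apply, f1 c l hl, mul_zero],
        plain_homog _, ?_⟩, mem_rel.2 ⟨fun c l hl => by simp [mulOp_apply, f1 c l hl],
          plain_homog _, fun x => ?_⟩⟩
      · rintro P rfl x hx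
        refine VanAt.mulInd ?_
        rcases lt_trichotomy (u x) b with h1 | h1 | h1
        · exact f3b x fun h => hx ⟨⟨h.1, h1⟩, h.2⟩
        · by_cases hY : x ∈ Y
          · exact f3a x ⟨h1, hY⟩
          · exact VanAt.of_notMem (by rw [h.clow.closure_eq]; exact fun h => hY h.2)
              fun c => f1 c _ (Or.inr rfl)
        · exact VanAt.of_notMem (by rw [h.clow.closure_eq]; exact fun h => not_lt.2 h.1 h1)
            fun c => f1 c _ (Or.inr rfl)
      · exact vanAt_sub_inInd
  have e2 : SqIso cd cd LinearMap.id KP K' ((plain X k).Cpl {(Rᶜ, slc u Y b)})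
      ((plain X k).rel (slc u Y b)) := by
    refine ⟨fun _ => rfl, ?_, ?_, ?_⟩
    · rintro m x ⟨f1, f2, f3⟩
      refine ⟨f1, f2, ?_⟩
      rintro P rfl y hy
      exact (f3 _ rfl y fun h => hy h.2).mono hsl
    · rintro m x ⟨f1, f2, f3⟩
      rw [id_apply, mem_rel]
      refine ⟨fun ⟨_, _, g⟩ => ⟨f1, f2, ?_⟩, fun ⟨_, _, g⟩ => ⟨f1, f2, fun y => g _ (Set.mem_insert _ _) y trivial⟩⟩
      rintro P (rfl | rfl) y hy
      · exact g y
      · exact f3 _ rfl y hy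
    · rintro m f ⟨f1, f2, f3⟩
      refine ⟨mulOp (inInd k (slc u Y b)) f, ⟨fun c l hl => by rw [mulOp_apply, f1 c l hl, mul_zero],
        plain_homog _, ?_⟩, mem_rel.2 ⟨fun c l hl => by simp [mulOp_apply, f1 c l hl],
          plain_homog _, fun x => vanAt_sub_inInd⟩⟩
      rintro P rfl x hx
      refine VanAt.mulInd ?_
      by_cases hR : x ∈ R
      · refine VanAt.of_notMem (by
          rw [h.cslc.closure_eq]
          exact fun h' => hx ⟨lt_of_lt_of_eq hab h'.1.symm, hR⟩) fun c => f1 c _ (Or.inr rfl)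
      · exact f3 _ rfl x hR
  have l1 : ∀ m, LP m ≤ K₀ m := fun m f hf => by
    rw [mem_rel] at hf
    refine ⟨hf.1, hf.2.1, ?_⟩
    rintro P (rfl | rfl) x - <;> exact hf.2.2 x
  have l2 : ∀ m, K₀ m ≤ K' m := fun m f hf => by
    refine ⟨hf.1, hf.2.1, ?_⟩
    rintro P (rfl | rfl) x hx
    · by_cases hs : x ∈ slc u Y b
      · exact (hf.2.2 _ (Set.mem_insert _ _) x hs).mono hsl
      · exact VanAt.of_notMem (by rwa [h.cslc.closure_eq]) fun c => hf.1 c _ (Or.inr rfl)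
    · exact hf.2.2 _ (Set.mem_insert_of_mem _ rfl) x hx
  have l3 : ∀ m, K' m ≤ KP m := fun m => Cpl_anti (Set.subset_insert _ _) m
  have z1 : ∀ m, hc cd K' K₀ m = 0 := hc_snap (finite_singleton _)
    (by rintro P rfl; exact cu) h.cslc hsl (by rintro P rfl; exact hsl)
  have z2 : ∀ m, hc cd KP LP m = 0 := h.acyclic ha
  rw [e1.hc_eq Cpl_isCx Cpl_isCx Cpl_isCx, ← e2.hc_eq Cpl_isCx Cpl_isCx Cpl_isCx]
  apply le_antisymm
  · have i1 := hc_succ_le_add (d := cd) cd_cd l1 l2 m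
    have i2 := hc_succ_le_add (d := cd) cd_cd (fun m => (l1 m).trans (l2 m)) l3 m
    rw [z1, add_zero] at i1
    rw [z2, zero_add] at i2
    exact i1.trans i2
  · have i1 := hc_le_add' (d := cd) cd_cd (fun m => (l1 m).trans (l2 m)) l3 m
    have i2 := hc_le_add (d := cd) cd_cd l1 l2 (m + 1)
    rw [z1, add_zero] at i2
    rw [z2, zero_add] at i1
    exact i1.trans i2

/-- Lowering the lower end of a slab does not change the cohomology. -/
theorem Slab.hc_lower (ha : 0 ≤ a) (haa : a ≤ a') (hab : a' < b) (m : ℕ) :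
    hc cd ((plain X k).Cpl {((slb u R a b)ᶜ, Y)}) ((plain X k).Cpl {((slb u R a' b)ᶜ, Y)}) m = 0 := by
  have e1 : SqIso cd cd LinearMap.id ((plain X k).Cpl {((slb u R a b)ᶜ, Y)})
      ((plain X k).Cpl {((slb u R a' b)ᶜ, Y)}) ((plain X k).Cpl {((upp u R a)ᶜ, low u Y b)})
      ((plain X k).Cpl {((upp u R a')ᶜ, low u Y b)}) := by
    refine ⟨fun _ => rfl, ?_, ?_, ?_⟩
    · rintro m x ⟨f1, f2, f3⟩
      refine ⟨f1, f2, ?_⟩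
      rintro P rfl y hy
      exact (f3 _ rfl y fun h => hy ⟨h.1.1, h.2⟩).mono fun _ h => h.2
    · rintro m x ⟨f1, f2, f3⟩
      refine ⟨fun ⟨_, _, g⟩ => ⟨f1, f2, ?_⟩, fun ⟨_, _, g⟩ => ⟨f1, f2, ?_⟩⟩
      · rintro P rfl y hy
        rcases lt_or_ge (u y) b with hb | hb
        · exact h.vanAt_of_lt hb (g _ rfl y fun h => hy ⟨⟨h.1, hb⟩, h.2⟩)
        · exact f3 _ rfl y fun h => not_lt.2 hb h.1.2
      · rintro P rfl y hy
        exact (g _ rfl y fun h => hy ⟨h.1.1, h.2⟩).mono fun _ h => h.2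
    · rintro m f ⟨f1, f2, f3⟩
      obtain ⟨c, hc1, hc2⟩ := exists_between hab
      have g1 : ∀ c' l, (l.length ≠ m ∨ l = []) →
        mulOp (hdInd k {x | u x < c}) (mulOp (inInd k (low u Y b)) f) c' l = 0 :=
        fun c' l hl => by rw [mulOp_apply, mulOp_apply, f1 c' l hl, mul_zero, mul_zero]
      refine ⟨mulOp (hdInd k {x | u x < c}) (mulOp (inInd k (low u Y b)) f), ⟨g1,
        plain_homog _, ?_⟩, ⟨fun c' l hl => by
          rw [id_apply, Pi.sub_apply, Pi.sub_apply, g1 c' l hl, f1 c' l hl, sub_zero],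
          plain_homog _, ?_⟩⟩
      · rintro P rfl x hx
        rcases lt_or_ge (u x) b with hb | hb
        · exact (VanAt.mulInd (f3 _ rfl x fun h => hx ⟨⟨h.1, hb⟩, h.2⟩)).mulOp _
        · refine (vanAt_hdInd ?_).mono (subset_univ _)
          filter_upwards [(isOpen_lt continuous_const h.cont).mem_nhds (hc2.trans_le hb)] with y hy
          exact not_lt.2 (le_of_lt hy)
      · rintro P rfl x hx
        rw [id_apply]
        by_cases hxa : x ∈ upp u R a
        · have hu : u x < c := lt_of_le_of_lt (not_lt.1 fun h' => hx ⟨h', hxa.2⟩) hc1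
          have v1 : (plain X k).VanAt x (low u Y b) (f - mulOp (inInd k (low u Y b)) f) :=
            vanAt_sub_inInd
          have v2 : (plain X k).VanAt x univ (mulOp (inInd k (low u Y b)) f -
            mulOp (hdInd k {x | u x < c}) (mulOp (inInd k (low u Y b)) f)) :=
            vanAt_sub_hdInd ((isOpen_lt h.cont continuous_const).mem_nhds hu) fun c' => by
              rw [mulOp_apply, f1 _ _ (Or.inr rfl), mul_zero]
          intro c' hc'
          filter_upwards [v1 c' hc', v2.mono (subset_univ _) c' hc'] with l e1 e2
          simp only [Pi.sub_apply] at e1 e2 ⊢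
          linear_combination e1 + e2
        · have := f3 _ rfl x hxa
          exact this.sub ((VanAt.mulInd this).mulOp _)
  rw [e1.hc_eq Cpl_isCx Cpl_isCx Cpl_isCx]
  have l1 : ∀ m, (plain X k).Cpl {((upp u R a')ᶜ, low u Y b)} m ≤
      (plain X k).Cpl {((upp u R a)ᶜ, low u Y b)} m := fun m f hf => by
    refine ⟨hf.1, hf.2.1, ?_⟩
    rintro P rfl x hx
    exact hf.2.2 _ rfl x fun h => hx ⟨lt_of_le_of_lt haa h.1, h.2⟩
  have l0 : ∀ m, (plain X k).rel (low u Y b) m ≤ (plain X k).Cpl {((upp u R a')ᶜ, low u Y b)} m :=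
    fun m f hf => by
    refine ⟨hf.1, hf.2.1, ?_⟩
    rintro P rfl x hx
    exact (mem_rel.1 hf).2.2 x
  have := hc_le_add' (d := cd) cd_cd l0 l1 m
  rw [h.acyclic ha, h.acyclic (ha.trans haa)] at this
  simpa using this

end

section

theorem rd_eq_one {Z B : Submodule k V} :
    rd Z B = 1 ↔ ∃ z ∈ Z, z ∉ B ∧ Z ≤ k ∙ z ⊔ B := by
  unfold rd rk
  rw [Module.length_eq_one_iff]
  constructor
  · intro h
    have hnt : Nontrivial (range (B.mkQ ∘ₗ Z.subtype)) := IsSimpleModule.nontrivial k _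
    obtain ⟨⟨_, z, rfl⟩, hv⟩ := exists_ne (0 : range (B.mkQ ∘ₗ Z.subtype))
    have hz : (z : V) ∉ B := fun hz => hv (Subtype.ext (by simpa using hz))
    refine ⟨z, z.2, hz, fun y hy => ?_⟩
    obtain ⟨a, ha⟩ := IsSimpleModule.toSpanSingleton_surjective k hv
      ⟨B.mkQ y, ⟨y, hy⟩, rfl⟩
    have ha' : a • B.mkQ (z : V) = B.mkQ y := congrArg Subtype.val ha
    rw [← map_smul, ← sub_eq_zero, ← map_sub, mkQ_apply,
      Submodule.Quotient.mk_eq_zero] at ha'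
    have : y = a • (z : V) - (a • (z : V) - y) := by abel
    rw [this]
    exact sub_mem (mem_sup_left (smul_mem _ _ (Submodule.mem_span_singleton_self _)))
      (mem_sup_right ha')
  · rintro ⟨z, hz, hzB, hle⟩
    have hnt : Nontrivial (range (B.mkQ ∘ₗ Z.subtype)) := by
      refine ⟨⟨⟨B.mkQ z, ⟨z, hz⟩, rfl⟩, 0, fun h => hzB ?_⟩⟩
      simpa using congrArg Subtype.val h
    have key : ∀ w : range (B.mkQ ∘ₗ Z.subtype), ∃ a : k, w.1 = a • B.mkQ z := by
      rintro ⟨_, y, rfl⟩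
      obtain ⟨u, hu, v, hv, huv⟩ := Submodule.mem_sup.1 (hle y.2)
      obtain ⟨a, rfl⟩ := mem_span_singleton.1 hu
      refine ⟨a, ?_⟩
      have : B.mkQ v = 0 := by simpa using hv
      show B.mkQ (y : V) = _
      rw [← huv, map_add, this, add_zero, map_smul]
    rw [isSimpleModule_iff_toSpanSingleton_surjective]
    refine ⟨hnt, fun w hw w' => ?_⟩
    obtain ⟨a, ha⟩ := key w
    obtain ⟨b, hb⟩ := key w'
    have ha0 : a ≠ 0 := by
      rintro rfl
      exact hw (Subtype.ext (by simpa using ha))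
    refine ⟨b * a⁻¹, Subtype.ext ?_⟩
    rw [hb]
    simp [ha, smul_smul, ha0]

end

section

open unitInterval

/-- The cube. -/
abbrev Cube (n : ℕ) := Fin n → unitInterval

theorem coord_slab (v : I → I) (hv : ∀ s t, dist (v s) (v t) = dist s t) (hvv : ∀ t, v (v t) = t)
    (j : Fin n) {Y R : Set (Cube n)} (hY : IsClosed Y) (hR : IsOpen R)
    (iY : ∀ x ∈ Y, ∀ t, update x j t ∈ Y)
    (iR : ∀ x ∈ R, ∀ t, update x j t ∈ R) :
    Slab (fun x : Cube n => (v (x j) : ℝ)) Y R where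
  cont := by
    have : Continuous v := (Isometry.of_dist_eq hv).continuous
    fun_prop
  clY := hY
  opR := hR
  flow := by
    intro ε hε
    have hm : ∀ t : I, max ((t : ℝ) - ε / 2) 0 ∈ I := fun t =>
      ⟨le_max_right _ _, max_le (by have := t.2.2; linarith) zero_le_one⟩
    let dec : I → I := fun t => ⟨max ((t : ℝ) - ε / 2) 0, hm t⟩
    have d1 : ∀ t, dist (dec t) t ≤ ε / 2 := fun t => by
      rw [dist_eq, Real.dist_eq, abs_le]
      have := t.2.1
      show -(ε / 2) ≤ max ((t : ℝ) - ε / 2) 0 - t ∧ max ((t : ℝ) - ε / 2) 0 - t ≤ ε / 2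
      constructor
      · have := le_max_left ((t : ℝ) - ε / 2) 0; linarith
      · rcases max_choice ((t : ℝ) - ε / 2) 0 with h | h <;> rw [h] <;> linarith
    have d2 : ∀ s t, dist (dec s) (dec t) ≤ dist s t := fun s t => by
      rw [dist_eq, dist_eq, Real.dist_eq, Real.dist_eq]
      have := abs_max_sub_max_le_abs ((s : ℝ) - ε / 2) (t - ε / 2) 0
      rwa [sub_sub_sub_cancel_right] at this
    have d3 : ∀ t, (dec t : ℝ) ≤ t := fun t => max_le (by linarith) t.2.1
    let r : Cube n → Cube n := fun x => update x j (v (dec (v (x j))))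
    have rj : ∀ x, r x j = v (dec (v (x j))) := fun x => by simp [r]
    have ri : ∀ x i, i ≠ j → r x i = x i := fun x i hi => by simp [r, hi]
    refine ⟨r, fun x => ?_, fun x y => ?_, fun x hx => iY x hx _, fun x hx h => hx ?_,
      fun x => ?_, ?_⟩
    · refine lt_of_le_of_lt ((dist_pi_le_iff (half_pos hε).le).2 fun i => ?_) (half_lt_self hε)
      by_cases hi : i = j
      · subst hi
        rw [rj]
        nth_rewrite 2 [← hvv (x i)]
        rw [hv]
        exact d1 _
      · rw [ri x i hi, dist_self]; exact (half_pos hε).le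
    · refine (dist_pi_le_iff dist_nonneg).2 fun i => ?_
      by_cases hi : i = j
      · subst hi
        rw [rj, rj, hv]
        exact (d2 _ _).trans ((hv _ _).trans_le (dist_le_pi_dist x y i))
      · rw [ri x i hi, ri y i hi]; exact dist_le_pi_dist x y i
    · have := iR _ h (x j)
      simpa [r] using this
    · simp only [rj, hvv]
      exact d3 _
    · have step : ∀ N x, (v (r^[N] x j) : ℝ) ≤ max ((v (x j) : ℝ) - N * (ε / 2)) 0 := by
        intro N
        induction N with
        | zero => intro x; simp
        | succ N ih =>
          intro x
          rw [Function.iterate_succ_apply']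
          simp only [rj, hvv]
          show max ((v (r^[N] x j) : ℝ) - ε / 2) 0 ≤ _
          refine max_le ?_ (le_max_right _ _)
          have := ih x
          push_cast
          rcases le_max_iff.1 this with h | h
          · exact le_max_of_le_left (by linarith)
          · exact le_max_of_le_right (by linarith)
      obtain ⟨N, hN⟩ := exists_nat_gt (1 / (ε / 2))
      refine ⟨N, fun x => (step N x).trans (max_le ?_ le_rfl)⟩
      rw [div_lt_iff₀ (half_pos hε)] at hN
      have := (v (x j)).2.2
      linarith

/-- Open boxes with some of the coordinates left free. -/
def bx (a b : Fin n → ℝ) (T : Finset (Fin n)) : Set (Cube n) :=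
  {x | ∀ i ∉ T, a i < x i ∧ (x i : ℝ) < b i}

/-- Closed coordinate faces. -/
def fc (b : Fin n → ℝ) (T : Finset (Fin n)) : Set (Cube n) := {x | ∀ i ∈ T, (x i : ℝ) = b i}

theorem isOpen_bx (a b : Fin n → ℝ) (T : Finset (Fin n)) : IsOpen (bx a b T) := by
  have : bx a b T = ⋂ i, {x | i ∉ T → a i < x i ∧ (x i : ℝ) < b i} := by ext; simp [bx]
  rw [this]
  refine isOpen_iInter_of_finite fun i => ?_
  by_cases hi : i ∈ T
  · simp [hi]
  · simp only [hi, not_false_eq_true, forall_const]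
    exact (isOpen_lt continuous_const (f := fun _ => a i) (g := fun x : Cube n => (x i : ℝ)) (by fun_prop)).inter
      (isOpen_lt (f := fun x : Cube n => (x i : ℝ)) (by fun_prop) continuous_const)

theorem isClosed_fc (b : Fin n → ℝ) (T : Finset (Fin n)) : IsClosed (fc b T) := by
  have : fc b T = ⋂ i, {x | i ∈ T → (x i : ℝ) = b i} := by ext; simp [fc]
  rw [this]
  refine isClosed_iInter fun i => ?_
  by_cases hi : i ∈ T
  · simp only [hi, forall_const]
    exact isClosed_eq (by fun_prop) continuous_const
  · simp [hi]

theorem cube_slab {a b : Fin n → ℝ} {T : Finset (Fin n)} {j : Fin n} (hj : j ∉ T) (v : I → I)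
    (hv : ∀ s t, dist (v s) (v t) = dist s t) (hvv : ∀ t, v (v t) = t) :
    Slab (fun x : Cube n => (v (x j) : ℝ)) (fc b T) (bx a b (insert j T)) := by
  refine coord_slab v hv hvv j (isClosed_fc _ _) (isOpen_bx _ _ _) (fun x hx t i hi => ?_)
    fun x hx t i hi => ?_
  · rw [update_of_ne (by rintro rfl; exact hj hi)]; exact hx i hi
  · rw [update_of_ne (by rintro rfl; exact hi (Finset.mem_insert_self _ _))]; exact hx i hi

theorem hc_point (b : Fin n → ℝ) (hb : ∀ i, b i ∈ I) {a : Fin n → ℝ} (m : ℕ) :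
    hc cd ((plain (Cube n) k).Cpl {((bx a b Finset.univ)ᶜ, fc b Finset.univ)})
      ((plain (Cube n) k).rel (fc b Finset.univ)) m = if m = 1 then 1 else 0 := by
  let o : Cube n := fun i => ⟨b i, hb i⟩
  have ho : o ∈ fc b Finset.univ := fun i _ => rfl
  have ho' : ∀ y ∈ fc b Finset.univ, y = o := fun y hy => funext fun i => Subtype.ext (hy i (Finset.mem_univ i))
  have hbx : (bx a b (Finset.univ : Finset (Fin n)))ᶜ = ∅ := by
    rw [Set.compl_empty_iff]; ext x; simp [bx]
  have hL : ∀ {m : ℕ} {f : Unit → List (Cube n) → k}, (∀ c l, (l.length ≠ m ∨ l = []) → f c l = 0) →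
      f () (replicate m o) = 0 → f ∈ (plain (Cube n) k).rel (fc b Finset.univ) m := by
    intro m f h1 h2
    refine mem_rel.2 ⟨h1, plain_homog _, fun x => plain_vanAt.2 ?_⟩
    refine eventually_nl.2 ⟨univ, isOpen_univ, trivial, fun l hl => ?_⟩
    by_cases hm : l.length = m
    · rw [← h2, ← hm]
      congr 1
      exact List.eq_replicate_iff.2 ⟨rfl, fun y hy => ho' y (hl y hy).2⟩
    · exact h1 _ _ (Or.inl hm)
  have hL' : ∀ {m : ℕ} {f : Unit → List (Cube n) → k},
      f ∈ (plain (Cube n) k).rel (fc b Finset.univ) m → f () (replicate m o) = 0 := by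
    intro m f hf
    obtain ⟨U, -, hU, h⟩ := eventually_nl.1 (plain_vanAt.1 ((mem_rel.1 hf).2.2 o))
    refine h _ fun y hy => ?_
    rw [List.eq_of_mem_replicate hy]
    exact ⟨hU, ho⟩
  have hK : ∀ {m : ℕ} {f : Unit → List (Cube n) → k}, (∀ c l, (l.length ≠ m ∨ l = []) → f c l = 0) →
      f ∈ (plain (Cube n) k).Cpl {((bx a b Finset.univ)ᶜ, fc b Finset.univ)} m := fun h =>
    ⟨h, plain_homog _, by rintro P rfl x hx; rw [hbx] at hx; exact absurd hx (Set.notMem_empty _)⟩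
  have hda : ∀ (m : ℕ) (f : List (Cube n) → k), dA (replicate (m + 1) o) f =
      if Even m then f (replicate m o) else 0 := by
    intro m
    induction m with
    | zero => intro f; simp [dA]
    | succ m ih =>
      intro f
      rw [List.replicate_succ, dA, ih, ← List.replicate_succ]
      by_cases h : Even m <;> simp [h, Nat.even_add_one]
  have hd : ∀ (m : ℕ) (f : Unit → List (Cube n) → k), cd f () (replicate (m + 1) o) =
      if Even m then f () (replicate m o) else 0 := fun m f => hda m _
  split_ifs with h1
  · subst h1
    rw [hc, rd_eq_one]
    have z1 : ∀ (c : Unit) (l : List (Cube n)), (l.length ≠ 1 ∨ l = []) →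
      (if l.length = 1 then (1 : k) else 0) = 0 := by
        rintro c l (h | rfl)
        · rw [if_neg h]
        · simp
    let z : Unit → List (Cube n) → k := fun _ l => if l.length = 1 then 1 else 0
    have hzK := hK (f := z) z1
    have hB : ((plain (Cube n) k).Cpl {((bx a b Finset.univ)ᶜ, fc b Finset.univ)} (1 - 1)).map cd ⊔
        (plain (Cube n) k).rel (fc b Finset.univ) 1 = (plain (Cube n) k).rel (fc b Finset.univ) 1 := by
      rw [Nat.sub_self, Cpl_isCx.zero, Submodule.map_bot, bot_sup_eq]
    rw [hB]
    refine ⟨z, ⟨hzK, hL (Cpl_isCx.mem hzK).1 (by rw [hd]; simp)⟩, fun h => ?_, fun f hf => ?_⟩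
    · have := hL' h
      simp [z] at this
    · have : f = f () [o] • z + (f - f () [o] • z) := by abel
      rw [this]
      refine add_mem (mem_sup_left (smul_mem _ _ (Submodule.mem_span_singleton_self _)))
        (mem_sup_right (hL (sub_mem hf.1 (smul_mem _ _ hzK)).1 ?_))
      simp [z]
  · obtain rfl | ⟨m, rfl⟩ : m = 0 ∨ ∃ j, m = j + 1 := by cases m <;> simp
    · exact Cpl_isCx.hc_zero
    rw [hc_eq_zero]
    intro f hf hdf
    by_cases hm : Even m
    · have hm0 : m ≠ 0 := by rintro rfl; exact h1 rfl
      have y1 : ∀ (c : Unit) (l : List (Cube n)), (l.length ≠ m ∨ l = []) →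
        (if l.length = m then f () (replicate (m + 1) o) else 0) = 0 := by
          rintro c l (h | rfl)
          · rw [if_neg h]
          · rw [if_neg]; exact fun h => hm0 h.symm
      let y : Unit → List (Cube n) → k := fun _ l =>
        if l.length = m then f () (replicate (m + 1) o) else 0
      have hy := hK (f := y) y1
      refine ⟨y, hy, hL (sub_mem hf (Cpl_isCx.mem hy)).1 ?_⟩
      simp [hd, hm, y]
    · refine ⟨0, zero_mem _, ?_⟩
      rw [map_zero, sub_zero]
      have := hL' hdf
      rw [hd, if_pos (by simpa [Nat.even_add_one] using hm)] at this
      exact hL hf.1 this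

/-- Cohomology of faces with compact supports. -/
theorem hc_face {a b : Fin n → ℝ} (ha : ∀ i, 0 ≤ a i) (hab : ∀ i, a i < b i) (hb : ∀ i, b i ≤ 1) :
    ∀ (j : ℕ) (T : Finset (Fin n)), T.card + j = n → ∀ m,
    hc cd ((plain (Cube n) k).Cpl {((bx a b T)ᶜ, fc b T)})
      ((plain (Cube n) k).rel (fc b T)) m = if m = j + 1 then 1 else 0 := by
  intro j
  induction j with
  | zero =>
    intro T hT m
    obtain rfl : T = Finset.univ := Finset.eq_univ_of_card T (by simpa using hT)
    exact hc_point b (fun i => ⟨(ha i).trans (hab i).le, hb i⟩) m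
  | succ j ih =>
    intro T hT m
    obtain ⟨i, hi⟩ : ∃ i, i ∉ T := by
      by_contra! h
      have := (Finset.eq_univ_iff_forall (s := T)).2 h
      rw [this, Finset.card_univ, Fintype.card_fin] at hT
      omega
    obtain rfl | ⟨m, rfl⟩ : m = 0 ∨ ∃ j, m = j + 1 := by cases m <;> simp
    · rw [Cpl_isCx.hc_zero, if_neg (by omega)]
    have hs := cube_slab (a := a) (b := b) hi id (fun _ _ => rfl) fun _ => rfl
    have := hs.hc_slice (k := k) (ha i) (hab i) m
    have e1 : slb (fun x : Cube n => ((id (x i) : I) : ℝ)) (bx a b (insert i T)) (a i) (b i) = bx a b T := by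
      ext x
      simp only [slb, bx, mem_insert, not_or, id]
      constructor
      · rintro ⟨h1, h2⟩ l hl
        by_cases h : l = i
        · subst h; exact h1
        · exact h2 l ⟨h, hl⟩
      · exact fun h => ⟨h i hi, fun l hl => h l hl.2⟩
    have e2 : slc (fun x : Cube n => ((id (x i) : I) : ℝ)) (fc b T) (b i) = fc b (insert i T) := by
      ext x; simp [slc, fc]
    rw [e1, e2, ih (insert i T) (by rw [Finset.card_insert_of_notMem hi]; omega)] at this
    rw [this]
    simp

/-- The open box. -/
def box (a b : Fin n → ℝ) : Set (Cube n) := {x | ∀ i, a i < x i ∧ (x i : ℝ) < b i}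

theorem box_eq (a b : Fin n → ℝ) : box a b = bx a b ∅ := by ext; simp [box, bx]

theorem isOpen_box (a b : Fin n → ℝ) : IsOpen (box a b) := by rw [box_eq]; exact isOpen_bx _ _ _

theorem hc_box {a b : Fin n → ℝ} (ha : ∀ i, 0 ≤ a i) (hab : ∀ i, a i < b i) (hb : ∀ i, b i ≤ 1)
    (m : ℕ) : hc cd ((plain (Cube n) k).cs (box a b)) ((plain (Cube n) k).nul) m =
      if m = n + 1 then 1 else 0 := by
  have := hc_face (k := k) ha hab hb n ∅ (by simp) m
  have e : fc b ∅ = univ := by ext; simp [fc]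
  rwa [← box_eq, e] at this

theorem box_mono {a b a' b' : Fin n → ℝ} (h1 : ∀ i, a' i ≤ a i) (h2 : ∀ i, b i ≤ b' i) :
    box a b ⊆ box a' b' := fun _ hx i => ⟨(h1 i).trans_lt (hx i).1, (hx i).2.trans_le (h2 i)⟩

theorem hc_box_lower {a b a' : Fin n → ℝ} (j : Fin n) (h0 : 0 ≤ a' j) (h1 : a' j ≤ a j)
    (h2 : a j < b j) (he : ∀ i, i ≠ j → a' i = a i) (m : ℕ) :
    hc cd ((plain (Cube n) k).cs (box a' b)) ((plain (Cube n) k).cs (box a b)) m = 0 := by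
  have hs := cube_slab (a := a) (b := b) (notMem_empty j) id (fun _ _ => rfl) fun _ => rfl
  have := hs.hc_lower (k := k) h0 h1 h2 m
  have e : ∀ c : Fin n → ℝ, (∀ i, i ≠ j → c i = a i) →
      slb (fun x : Cube n => ((id (x j) : I) : ℝ)) (bx a b (insert j ∅)) (c j) (b j) = box c b := by
    intro c hc
    ext x
    simp only [slb, bx, box, id]
    constructor
    · rintro ⟨h3, h4⟩ i
      by_cases h : i = j
      · subst h; exact h3
      · rw [hc i h]; exact h4 i (by simpa using h)
    · refine fun h => ⟨h j, fun i hi => ?_⟩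
      rw [← hc i (by simpa using hi)]; exact h i
  have e2 : fc b ∅ = univ := by ext; simp [fc]
  rwa [e a fun _ _ => rfl, e a' he, e2] at this

theorem hc_box_upper {a b b' : Fin n → ℝ} (j : Fin n) (h0 : b' j ≤ 1) (h1 : b j ≤ b' j)
    (h2 : a j < b j) (he : ∀ i, i ≠ j → b' i = b i) (m : ℕ) :
    hc cd ((plain (Cube n) k).cs (box a b')) ((plain (Cube n) k).cs (box a b)) m = 0 := by
  have hs := cube_slab (a := a) (b := b) (notMem_empty j) unitInterval.symm
    (fun s t => by
      rw [dist_eq, dist_eq, unitInterval.coe_symm_eq, unitInterval.coe_symm_eq,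
        dist_sub_left]) unitInterval.symm_symm
  have := hs.hc_lower (k := k) (a := 1 - b' j) (a' := 1 - b j) (b := 1 - a j)
    (by linarith) (by linarith) (by linarith) m
  have e : ∀ c : Fin n → ℝ, (∀ i, i ≠ j → c i = b i) →
      slb (fun x : Cube n => ((unitInterval.symm (x j) : I) : ℝ)) (bx a b (insert j ∅)) (1 - c j)
        (1 - a j) = box a c := by
    intro c hc
    ext x
    simp only [slb, bx, box, unitInterval.coe_symm_eq]
    constructor
    · rintro ⟨⟨h3, h3'⟩, h4⟩ i
      by_cases h : i = j
      · subst h; constructor <;> linarith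
      · rw [hc i h]; exact h4 i (by simpa using h)
    · refine fun h => ⟨⟨?_, ?_⟩, fun i hi => ?_⟩
      · have := (h j).2; linarith
      · have := (h j).1; linarith
      · rw [← hc i (by simpa using hi)]; exact h i
  have e2 : fc b ∅ = univ := by ext; simp [fc]
  rwa [e b fun _ _ => rfl, e b' he, e2] at this

/-- Nested boxes have the same cohomology with compact supports. -/
theorem hc_box_box {a b a' b' : Fin n → ℝ} (h0 : ∀ i, 0 ≤ a' i) (h1 : ∀ i, a' i ≤ a i)
    (h2 : ∀ i, a i < b i) (h3 : ∀ i, b i ≤ b' i) (h4 : ∀ i, b' i ≤ 1) (m : ℕ) :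
    hc cd ((plain (Cube n) k).cs (box a' b')) ((plain (Cube n) k).cs (box a b)) m = 0 := by
  classical
  have key : ∀ T : Finset (Fin n), hc cd ((plain (Cube n) k).cs (box (T.piecewise a' a) (T.piecewise b' b)))
      ((plain (Cube n) k).cs (box a b)) m = 0 := by
    intro T
    induction T using Finset.induction_on with
    | empty =>
      rw [Finset.piecewise_empty, Finset.piecewise_empty, hc_eq_zero]
      exact fun z hz _ => ⟨0, zero_mem _, by simpa using hz⟩
    | insert j T hj ih =>
      have ea : ∀ f g : Fin n → ℝ, (insert j T).piecewise f g j = f j := fun f g => by simp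
      have eb : ∀ f g : Fin n → ℝ, T.piecewise f g j = g j := fun f g => by simp [hj]
      have ec : ∀ f g : Fin n → ℝ, ∀ i, i ≠ j → (insert j T).piecewise f g i = T.piecewise f g i :=
        fun f g i hi => by simp [Finset.piecewise, hi]
      have ed : ∀ i, (insert j T).piecewise a' a i ≤ T.piecewise a' a i := fun i => by
        by_cases hi : i = j
        · subst hi; rw [ea, eb]; exact h1 i
        · exact (ec _ _ i hi).le
      have ee : ∀ i, T.piecewise b' b i ≤ (insert j T).piecewise b' b i := fun i => by
        by_cases hi : i = j
        · subst hi; rw [ea, eb]; exact h3 i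
        · exact (ec _ _ i hi).ge
      have ef : ∀ i, T.piecewise a' a i ≤ a i := fun i => by
        by_cases hi : i ∈ T <;> simp [hi, h1]
      have eg : ∀ i, b i ≤ T.piecewise b' b i := fun i => by
        by_cases hi : i ∈ T <;> simp [hi, h3]
      have s1 := hc_box_lower (k := k) (a := T.piecewise a' a) (b := T.piecewise b' b)
        (a' := (insert j T).piecewise a' a) j (by rw [ea]; exact h0 j) (ed j)
        (by rw [eb, eb]; exact h2 j) (ec _ _) m
      have s2 := hc_box_upper (k := k) (a := (insert j T).piecewise a' a) (b := T.piecewise b' b)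
        (b' := (insert j T).piecewise b' b) j (by rw [ea]; exact h4 j) (ee j)
        (by rw [ea, eb]; exact (h1 j).trans_lt (h2 j)) (ec _ _) m
      have t1 := hc_le_add (d := cd) cd_cd (J := (plain (Cube n) k).cs (box ((insert j T).piecewise a' a) (T.piecewise b' b)))
        (cs_mono (S := plain (Cube n) k) (box_mono ef eg)) (cs_mono (box_mono ed fun _ => le_rfl)) m
      have t2 := hc_le_add (d := cd) cd_cd (J := (plain (Cube n) k).cs (box ((insert j T).piecewise a' a) ((insert j T).piecewise b' b)))
        (cs_mono (S := plain (Cube n) k) (box_mono (fun i => (ed i).trans (ef i)) eg))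
        (cs_mono (box_mono (fun _ => le_rfl) ee)) m
      rw [ih, s1, add_zero] at t1
      rw [s2, add_zero] at t2
      exact le_antisymm (t2.trans t1) zero_le
  have := key Finset.univ
  simpa using this

end

section
variable {V' : Type*} [AddCommGroup V'] [Module k V'] {d : V →ₗ[k] V} {d' : V' →ₗ[k] V'}

/-- The cocycles of a quotient complex. -/
def cyc (d : V →ₗ[k] V) (K L : ℕ → Submodule k V) (m : ℕ) : Submodule k V :=
  K m ⊓ (L (m + 1)).comap d

/-- The coboundaries of a quotient complex. -/
def bdy (d : V →ₗ[k] V) (K L : ℕ → Submodule k V) (m : ℕ) : Submodule k V :=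
  (K (m - 1)).map d ⊔ L m

theorem mem_bdy {K L : ℕ → Submodule k V} {m : ℕ} {z : V} :
    z ∈ bdy d K L m ↔ ∃ y ∈ K (m - 1), z - d y ∈ L m := by
  rw [bdy, Submodule.mem_sup]
  constructor
  · rintro ⟨_, ⟨y, hy, rfl⟩, w, hw, rfl⟩
    exact ⟨y, hy, by simpa using hw⟩
  · rintro ⟨y, hy, h⟩
    exact ⟨d y, ⟨y, hy, rfl⟩, _, h, by abel⟩

theorem hc_eq_rd (d : V →ₗ[k] V) (K L : ℕ → Submodule k V) (m : ℕ) :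
    hc d K L m = rd (cyc d K L m) (bdy d K L m) := rfl

/-- A linear map inducing an isomorphism of quotient complexes. -/
structure WSq (d : V →ₗ[k] V) (d' : V' →ₗ[k] V') (φ : V →ₗ[k] V')
    (K L : ℕ → Submodule k V) (K' L' : ℕ → Submodule k V') : Prop where
  comm : ∀ {m x}, x ∈ K m → φ (d x) - d' (φ x) ∈ L' (m + 1)
  map : ∀ {m x}, x ∈ K m → φ x ∈ K' m
  iff : ∀ {m x}, x ∈ K m → (φ x ∈ L' m ↔ x ∈ L m)
  surj : ∀ {m y}, y ∈ K' m → ∃ x ∈ K m, y - φ x ∈ L' m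

variable {φ : V →ₗ[k] V'} {K L : ℕ → Submodule k V} {K' L' : ℕ → Submodule k V'} {m : ℕ}

theorem WSq.map_cyc (h : WSq d d' φ K L K' L') (hK : IsCx d K) {x : V} (hx : x ∈ cyc d K L m) :
    φ x ∈ cyc d' K' L' m := by
  refine ⟨h.map hx.1, ?_⟩
  have := sub_mem ((h.iff (hK.mem hx.1)).2 hx.2) (h.comm hx.1)
  simpa using this

theorem WSq.surj_cyc (h : WSq d d' φ K L K' L') (hK : IsCx d K) (hL' : IsCx d' L') {y : V'}
    (hy : y ∈ cyc d' K' L' m) : ∃ x ∈ cyc d K L m, y - φ x ∈ L' m := by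
  obtain ⟨x, hx, hxy⟩ := h.surj hy.1
  refine ⟨x, ⟨hx, ?_⟩, hxy⟩
  refine (h.iff (hK.mem hx)).1 ?_
  have : φ (d x) = d' y - d' (y - φ x) + (φ (d x) - d' (φ x)) := by simp
  rw [this]
  exact add_mem (sub_mem hy.2 (hL'.mem hxy)) (h.comm hx)

theorem WSq.map_bdy (h : WSq d d' φ K L K' L') (hK : IsCx d K) {x : V}
    (hxK : x ∈ K (m + 1)) (hx : x ∈ bdy d K L (m + 1)) : φ x ∈ bdy d' K' L' (m + 1) := by
  obtain ⟨y, hy, hxy⟩ := mem_bdy.1 hx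
  refine mem_bdy.2 ⟨φ y, h.map hy, ?_⟩
  have : φ x - d' (φ y) = φ (x - d y) + (φ (d y) - d' (φ y)) := by simp
  rw [this]
  exact add_mem ((h.iff (sub_mem hxK (hK.mem hy))).2 hxy) (h.comm hy)

theorem WSq.bdy_of_map (h : WSq d d' φ K L K' L') (hK : IsCx d K) (hL' : IsCx d' L')
    {x : V} (hx : x ∈ K (m + 1)) (hb : φ x ∈ bdy d' K' L' (m + 1)) : x ∈ bdy d K L (m + 1) := by
  obtain ⟨y, hy, hxy⟩ := mem_bdy.1 hb
  obtain ⟨z, hz, hyz⟩ := h.surj hy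
  refine mem_bdy.2 ⟨z, hz, (h.iff (sub_mem hx (hK.mem hz))).1 ?_⟩
  have : φ (x - d z) = (φ x - d' y) + d' (y - φ z) - (φ (d z) - d' (φ z)) := by
    simp only [map_sub]; abel
  rw [this]
  exact sub_mem (add_mem hxy (hL'.mem hyz)) (h.comm hz)

theorem WSq.hc_eq (h : WSq d d' φ K L K' L') (hK : IsCx d K) (hK' : IsCx d' K') (hL' : IsCx d' L')
    (m : ℕ) : hc d K L m = hc d' K' L' m := by
  cases m with
  | zero => rw [hK.hc_zero, hK'.hc_zero]
  | succ m =>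
  apply le_antisymm
  · exact rd_le_of_inj φ (fun x hx => h.map_cyc hK hx) fun x hx => h.bdy_of_map hK hL' hx.1
  · refine rd_le_of_surj φ (fun x hx => h.map_bdy hK hx.1) fun y hy => ?_
    obtain ⟨x, hx, hxy⟩ := h.surj_cyc hK hL' hy
    exact ⟨x, hx, mem_bdy.2 ⟨0, zero_mem _, by simpa using hxy⟩⟩

end

section

/-- The nonempty open boxes of the cube. -/
def IsBox (B : Set (Cube n)) : Prop :=
  ∃ a b : Fin n → ℝ, (∀ i, 0 ≤ a i) ∧ (∀ i, a i < b i) ∧ (∀ i, b i ≤ 1) ∧ B = box a b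

/-- The interior of the cube. -/
def inte (n : ℕ) : Set (Cube n) := box (fun _ => 0) fun _ => 1

theorem IsBox.isOpen {B : Set (Cube n)} (h : IsBox B) : IsOpen B := by
  obtain ⟨a, b, -, -, -, rfl⟩ := h
  exact isOpen_box a b

theorem isBox_inte : IsBox (inte n) :=
  ⟨_, _, fun _ => le_rfl, fun _ => zero_lt_one, fun _ => le_rfl, rfl⟩

theorem IsBox.sub {B : Set (Cube n)} (h : IsBox B) : B ⊆ inte n := by
  obtain ⟨a, b, h1, -, h3, rfl⟩ := h
  exact box_mono h1 h3

theorem IsBox.hc_eq {B : Set (Cube n)} (h : IsBox B) (m : ℕ) :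
    hc cd ((plain (Cube n) k).cs B) (plain (Cube n) k).nul m = if m = n + 1 then 1 else 0 := by
  obtain ⟨a, b, h1, h2, h3, rfl⟩ := h
  exact hc_box h1 h2 h3 m

theorem IsBox.hc_inte {B : Set (Cube n)} (h : IsBox B) (m : ℕ) :
    hc cd ((plain (Cube n) k).cs (inte n)) ((plain (Cube n) k).cs B) m = 0 := by
  obtain ⟨a, b, h1, h2, h3, rfl⟩ := h
  exact hc_box_box (fun _ => le_rfl) h1 h2 h3 (fun _ => le_rfl) m

theorem IsBox.inter {B B' : Set (Cube n)} (h : IsBox B) (h' : IsBox B') :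
    IsBox (B ∩ B') ∨ B ∩ B' = ∅ := by
  obtain ⟨a, b, h1, h2, h3, rfl⟩ := h
  obtain ⟨a', b', h1', h2', h3', rfl⟩ := h'
  have e : box a b ∩ box a' b' = box (fun i => max (a i) (a' i)) fun i => min (b i) (b' i) := by
    ext x
    simp only [box, Set.mem_inter_iff, Set.mem_ofPred_eq, max_lt_iff, lt_min_iff]
    exact ⟨fun h i => ⟨⟨(h.1 i).1, (h.2 i).1⟩, (h.1 i).2, (h.2 i).2⟩,
      fun h => ⟨fun i => ⟨(h i).1.1, (h i).2.1⟩, fun i => ⟨(h i).1.2, (h i).2.2⟩⟩⟩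
  rw [e]
  by_cases hlt : ∀ i, max (a i) (a' i) < min (b i) (b' i)
  · exact Or.inl ⟨_, _, fun i => (h1 i).trans (le_max_left _ _), hlt,
      fun i => (min_le_left _ _).trans (h3 i), rfl⟩
  · push Not at hlt
    obtain ⟨i, hi⟩ := hlt
    refine Or.inr (Set.eq_empty_of_forall_notMem fun x hx => ?_)
    exact absurd ((hx i).1.trans (hx i).2) (not_lt.2 hi)

/-- Every point of an open subset of the interior has a small box around it. -/
theorem exists_isBox {x : Cube n} {U : Set (Cube n)} (hU : U ∈ 𝓝 x) (hx : x ∈ inte n) :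
    ∃ B, IsBox B ∧ x ∈ B ∧ B ⊆ U := by
  obtain ⟨ε, hε, h⟩ := Metric.mem_nhds_iff.1 hU
  refine ⟨box (fun i => max 0 ((x i : ℝ) - ε / 2)) fun i => min 1 (x i + ε / 2),
    ⟨_, _, fun _ => le_max_left _ _, fun i => ?_, fun _ => min_le_left _ _, rfl⟩, fun i => ?_, ?_⟩
  · have := hx i
    rw [max_lt_iff, lt_min_iff, lt_min_iff]
    refine ⟨⟨zero_lt_one, ?_⟩, ?_, ?_⟩ <;> linarith [this.1, this.2]
  · have := hx i
    rw [max_lt_iff, lt_min_iff]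
    refine ⟨⟨this.1, ?_⟩, this.2, ?_⟩ <;> linarith
  · intro y hy
    refine h (lt_of_le_of_lt ((dist_pi_le_iff (half_pos hε).le).2 fun i => ?_) (half_lt_self hε))
    have := hy i
    rw [max_lt_iff, lt_min_iff] at this
    rw [dist_eq, Real.dist_eq, abs_le]
    constructor <;> linarith [this.1.2, this.2.2]

/-- A uniform bound for the cohomology of finite unions of boxes. -/
theorem hc_boxes_le (F : Finset (Set (Cube n))) (hF : ∀ B ∈ F, IsBox B) : ∃ c : ℕ,
    ∀ (k : Type) [Field k] (m : ℕ),
      hc cd ((plain (Cube n) k).cs (⋃ B ∈ F, B)) (plain (Cube n) k).nul m ≤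
        if n + 1 < m then (0 : ℕ∞) else (c : ℕ∞) := by
  classical
  induction hN : F.card using Nat.strong_induction_on generalizing F with
  | _ N ih =>
  subst hN
  rcases F.eq_empty_or_nonempty with rfl | ⟨B, hB⟩
  · refine ⟨0, fun k _ m => ?_⟩
    have : (⋃ B ∈ (∅ : Finset (Set (Cube n))), B) = ∅ := by simp
    rw [this, cs_empty, hc_eq_zero.2 fun z hz _ => ⟨0, zero_mem _, by simpa using hz⟩]
    exact zero_le
  · set F' := F.erase B with hF'
    have hc' : F'.card < F.card := Finset.card_erase_lt_of_mem hB
    obtain ⟨c, hc⟩ := ih _ hc' F' (fun B hB => hF B (Finset.mem_of_mem_erase hB)) rfl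
    set G := (F'.image (B ∩ ·)).erase ∅ with hG
    have hGc : G.card < F.card := (Finset.card_erase_le.trans card_image_le).trans_lt hc'
    obtain ⟨c', hc'⟩ := ih _ hGc G (fun D hD => by
      obtain ⟨h1, h2⟩ := Finset.mem_erase.1 hD
      obtain ⟨B', hB', rfl⟩ := mem_image.1 h2
      exact ((hF B hB).inter (hF B' (Finset.mem_of_mem_erase hB'))).resolve_right h1) rfl
    refine ⟨1 + (c + c'), fun k _ m => ?_⟩
    have e : (⋃ B ∈ F, B) = B ∪ ⋃ B ∈ F', B := by
      rw [← Finset.insert_erase hB, Finset.set_biUnion_insert]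
    have e2 : B ∩ (⋃ B ∈ F', B) = ⋃ B ∈ G, B := by
      ext x
      simp only [Set.mem_inter_iff, Set.mem_iUnion, hG, Finset.mem_erase, mem_image,
        exists_prop]
      constructor
      · rintro ⟨h1, D, hD, hx⟩
        exact ⟨B ∩ D, ⟨Set.nonempty_iff_ne_empty.1 ⟨x, h1, hx⟩, D, hD, rfl⟩, h1, hx⟩
      · rintro ⟨_, ⟨-, D, hD, rfl⟩, hx⟩
        exact ⟨hx.1, D, hD, hx.2⟩
    have i1 := hc_cs_union (S := plain (Cube n) k) (hF B hB).isOpen (V := ⋃ B ∈ F', B)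
      (isOpen_biUnion fun D hD => (hF D (Finset.mem_of_mem_erase hD)).isOpen) m
    rw [← e, e2, (hF B hB).hc_eq] at i1
    have i2 := hc k m
    have i3 := hc' k (m + 1)
    refine i1.trans ?_
    by_cases hm : n + 1 < m
    · rw [if_pos hm] at i2 ⊢
      rw [if_pos (by omega)] at i3
      rw [if_neg (by omega), nonpos_iff_eq_zero.1 i2, nonpos_iff_eq_zero.1 i3, add_zero, add_zero]
    · rw [if_neg hm] at i2 ⊢
      have i3' := i3.trans (show (if n + 1 < m + 1 then (0 : ℕ∞) else c') ≤ c' by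
        split_ifs <;> simp)
      push_cast
      gcongr
      split_ifs <;> simp

/-- A compact subset of an open subset is contained in a finite union of boxes. -/
theorem exists_boxes {T U : Set (Cube n)} (hT : IsCompact T) (hU : IsOpen U) (hTU : T ⊆ U)
    (hUi : U ⊆ inte n) : ∃ F : Finset (Set (Cube n)), (∀ B ∈ F, IsBox B) ∧ T ⊆ ⋃ B ∈ F, B ∧
      (⋃ B ∈ F, B) ⊆ U := by
  classical
  obtain ⟨F, hF, hTF⟩ := hT.elim_finite_subcover_image (b := {B | IsBox B ∧ B ⊆ U}) (c := id)
    (fun B hB => hB.1.isOpen) (fun x hx => by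
      obtain ⟨B, h1, h2, h3⟩ := exists_isBox (hU.mem_nhds (hTU hx)) (hUi (hTU hx))
      exact Set.mem_iUnion₂.2 ⟨B, ⟨h1, h3⟩, h2⟩)
  refine ⟨hTF.1.toFinset, fun B hB => (hF (by simpa using hB)).1, fun x hx => ?_, ?_⟩
  · obtain ⟨B, hB, h⟩ := Set.mem_iUnion₂.1 (hTF.2 hx)
    exact Set.mem_iUnion₂.2 ⟨B, by simpa using hB, h⟩
  · exact Set.iUnion₂_subset fun B hB => (hF (by simpa using hB)).2

theorem hc_open_cube {k : Type} [Field k] {U : Set (Cube n)} (hU : IsOpen U) (hUi : U ⊆ inte n) {m : ℕ}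
    (hm : n + 1 < m) : hc cd ((plain (Cube n) k).cs U) (plain (Cube n) k).nul m = 0 := by
  refine hc_cs_eq_zero_of_exhaust fun T hT hTU => ?_
  obtain ⟨F, h1, h2, h3⟩ := exists_boxes hT hU hTU hUi
  obtain ⟨c, hc⟩ := hc_boxes_le F h1
  refine ⟨_, h2, h3, ?_⟩
  have := hc k m
  rw [if_pos hm] at this
  exact nonpos_iff_eq_zero.1 this

/-- The integration functional. -/
theorem exists_integral (n : ℕ) (k : Type*) [Field k] :
    ∃ μ : (Unit → List (Cube n) → k) →ₗ[k] k,
      (∀ f ∈ bdy cd ((plain (Cube n) k).cs (inte n)) (plain (Cube n) k).nul (n + 1), μ f = 0) ∧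
      ∀ B : Set (Cube n), IsBox B →
        (∃ z ∈ cyc cd ((plain (Cube n) k).cs B) (plain (Cube n) k).nul (n + 1), μ z ≠ 0) ∧
        ∀ z ∈ cyc cd ((plain (Cube n) k).cs B) (plain (Cube n) k).nul (n + 1), μ z = 0 →
          z ∈ bdy cd ((plain (Cube n) k).cs B) (plain (Cube n) k).nul (n + 1) := by
  have h1 := (isBox_inte (n := n)).hc_eq (k := k) (n + 1)
  rw [if_pos rfl, hc_eq_rd, rd_eq_one] at h1
  obtain ⟨z₀, hz₀, hz₀', h1⟩ := h1
  obtain ⟨μ, hμ, hB⟩ := Submodule.exists_le_ker_of_notMem hz₀'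
  refine ⟨μ, fun f hf => hB hf, fun B hb => ?_⟩
  have hsub : (plain (Cube n) k).cs B ≤ (plain (Cube n) k).cs (inte n) := cs_mono hb.sub
  have key : ∃ z ∈ cyc cd ((plain (Cube n) k).cs B) (plain (Cube n) k).nul (n + 1), μ z ≠ 0 := by
    obtain ⟨y, hy, hzy⟩ := hc_eq_zero.1 (hb.hc_inte (k := k) (n + 1)) z₀ hz₀.1 (nul_le _ hz₀.2)
    refine ⟨z₀ - cd y, ⟨hzy, ?_⟩, ?_⟩
    · show cd (z₀ - cd y) ∈ (plain (Cube n) k).nul _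
      rw [map_sub, cd_cd, sub_zero]
      exact hz₀.2
    · have : μ (cd y) = 0 := hB (mem_bdy.2 ⟨y, hy, by simp⟩)
      rwa [map_sub, this, sub_zero]
  refine ⟨key, fun z hz hz0 => ?_⟩
  obtain ⟨z', hz', hz0'⟩ := key
  have h2 := hb.hc_eq (k := k) (n + 1)
  rw [if_pos rfl, hc_eq_rd, rd_eq_one] at h2
  obtain ⟨w, hw, hw', h2⟩ := h2
  have hbd : bdy cd ((plain (Cube n) k).cs B) (plain (Cube n) k).nul (n + 1) ≤ LinearMap.ker μ := by
    intro f hf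
    obtain ⟨y, hy, h⟩ := mem_bdy.1 hf
    exact hB (mem_bdy.2 ⟨y, hsub _ hy, h⟩)
  obtain ⟨_, ha, b, hbb, hab⟩ := Submodule.mem_sup.1 (h2 hz)
  obtain ⟨a, rfl⟩ := mem_span_singleton.1 ha
  obtain ⟨_, ha', b', hbb', hab'⟩ := Submodule.mem_sup.1 (h2 hz')
  obtain ⟨a', rfl⟩ := mem_span_singleton.1 ha'
  have e1 : a * μ w = 0 := by
    rw [← hz0, ← hab, map_add, show μ b = 0 from hbd hbb, map_smul, smul_eq_mul, add_zero]
  have e2 : μ w ≠ 0 := by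
    intro h
    rw [← hab', map_add, show μ b' = 0 from hbd hbb', map_smul, h] at hz0'
    simp at hz0'
  obtain rfl : a = 0 := (mul_eq_zero.1 e1).resolve_right e2
  rw [← hab, zero_smul, zero_add]
  exact hbb

end

section
variable [TopologicalSpace X] {S : CoefSys X I k}
  {Y : Type*} [TopologicalSpace Y]

theorem eventually_cd {x : X} {A : Set X} {f : I → List X → k} {g : I → List X → k} {c c' : I}
    (h : ∀ᶠ l in nl x A, f c l = g c' l) : ∀ᶠ l in nl x A, cd f c l = cd g c' l := by
  filter_upwards [eventually_nl_sub h] with l hl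
  rw [cd_apply, cd_apply]
  rw [← one_mul (dA l (g c'))]
  exact dA_congr l fun l' hl' _ => by rw [hl l' hl', one_mul]

theorem eventually_map {e : Y → X} {y : Y} (he : ContinuousAt e y) {A : Set Y} {P : List X → Prop}
    (h : ∀ᶠ l in nl (e y) (e '' A), P l) : ∀ᶠ l in nl y A, P (l.map e) := by
  obtain ⟨U, hU, hx, h⟩ := eventually_nl.1 h
  filter_upwards [eventually_nl_mem (A := A) (he.preimage_mem_nhds (hU.mem_nhds hx))] with l hl
  refine h _ fun z hz => ?_
  obtain ⟨w, hw, rfl⟩ := List.mem_map.1 hz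
  exact ⟨(hl w hw).1, w, (hl w hw).2, rfl⟩

theorem eventually_of_map {e : Y → X} (he : IsEmbedding e) {y : Y} {A : Set Y}
    {P : List X → Prop} (h : ∀ᶠ l in nl y A, P (l.map e)) : ∀ᶠ l in nl (e y) (e '' A), P l := by
  obtain ⟨U, hU, hx, h⟩ := eventually_nl.1 h
  obtain ⟨W, hW, rfl⟩ := he.isOpen_iff.1 hU
  refine eventually_nl.2 ⟨W, hW, hx, fun l hl => ?_⟩
  have hl' : ∀ z ∈ l, ∃ w ∈ A, e w = z := fun z hz => (hl z hz).2
  obtain ⟨l', h1, rfl⟩ : ∃ l' : List Y, (∀ w ∈ l', w ∈ A) ∧ l'.map e = l := by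
    clear hl
    induction l with
    | nil => exact ⟨[], by simp, rfl⟩
    | cons z l ih =>
      obtain ⟨w, hw, hwz⟩ := hl' z (by simp)
      obtain ⟨l', h1, h2⟩ := ih fun z hz => hl' z (by simp [hz])
      exact ⟨w :: l', by simpa using ⟨hw, h1⟩, by simp [hwz, h2]⟩
  exact h _ fun w hw => ⟨(hl _ (List.mem_map_of_mem hw)).1, h1 w hw⟩

/-- The restriction of a cochain to a cell. -/
def cellMap (k : Type*) [Field k] (e : Y → X) (c : I) (A : Set Y) :
    (I → List X → k) →ₗ[k] (Unit → List Y → k) := mulOp (inInd k A) ∘ₗ pb (fun _ => c) e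

theorem cellMap_apply (e : Y → X) (c : I) (A : Set Y) (f : I → List X → k) (l : List Y) :
    cellMap k e c A f () l = inInd k A l * f c (l.map e) := rfl

variable {e : Y → X} {c : I} {A : Set Y} {U : Set X} {m : ℕ} {f : I → List X → k}

theorem cellMap_vanAt {y : Y} (hA : IsClosed A) (he : Continuous e)
    (hc : ∀ y ∈ A, e y ∈ S.core c) (hf : S.VanAt (e y) univ f) (h0 : f c [] = 0) :
    (plain Y k).VanAt y univ (cellMap k e c A f) := by
  rw [plain_vanAt]
  by_cases hy : y ∈ A
  · have := eventually_map (A := univ) he.continuousAt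
      ((hf c (hc y hy)).filter_mono (nl_mono (subset_univ (e '' univ))))
    filter_upwards [this] with l hl
    rw [cellMap_apply, hl, mul_zero]
  · filter_upwards [eventually_nl_mem (hA.isOpen_compl.mem_nhds hy)] with l hl
    rw [cellMap_apply]
    cases l with
    | nil => rw [List.map_nil, h0, mul_zero]
    | cons z l =>
      rw [inInd_of_not fun h => (hl z (by simp)).1 (h z (by simp)), zero_mul]

theorem cellMap_near {y : Y} (he : Continuous e) (hU : IsOpen U) (hUA : e ⁻¹' U ⊆ A)
    (hy : e y ∈ U) (f : I → List X → k) :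
    ∀ᶠ l in nl y univ, cellMap k e c A f () l = pb (fun _ => c) e f () l := by
  filter_upwards [eventually_nl_mem ((hU.preimage he).mem_nhds hy)] with l hl
  rw [cellMap_apply, inInd_of fun z hz => hUA (hl z hz).1, one_mul, pb_apply]

open Classical in
/-- Extension of a cochain of a cell by zero. -/
def cellExt (S : CoefSys X I k) (e : Y → X) (c : I) (A : Set Y)
    (g : Unit → List Y → k) (c' : I) : List X → k
  | [] => 0
  | z :: l => if h : ∀ w ∈ z :: l, ∃ y ∈ A, e y = w then
      S.deg z c' c * g () ((z :: l).pmap (fun w hw => (hw : ∃ y ∈ A, e y = w).choose) h) else 0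

theorem cellExt_map (he : Injective e) (g : Unit → List Y → k) (c' : I) (y : Y) (l : List Y)
    (h : ∀ w ∈ y :: l, w ∈ A) :
    cellExt S e c A g c' ((y :: l).map e) = S.deg (e y) c' c * g () (y :: l) := by
  have h' : ∀ w ∈ e y :: l.map e, ∃ y ∈ A, e y = w := by
    intro w hw
    rw [← map_cons, List.mem_map] at hw
    obtain ⟨z, hz, rfl⟩ := hw
    exact ⟨z, h z hz, rfl⟩
  rw [map_cons, cellExt, dif_pos h']
  congr 2
  have key : ∀ (l : List Y) (h : ∀ w ∈ l.map e, ∃ y ∈ A, e y = w),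
      (l.map e).pmap (fun w hw => (hw : ∃ y ∈ A, e y = w).choose) h = l := by
    intro l
    induction l with
    | nil => intro _; rfl
    | cons z l ih =>
      intro h
      have h0 := h (e z) (by simp)
      simp only [map_cons, List.pmap_cons]
      rw [ih, he h0.choose_spec.2]
  exact key (y :: l) h'

theorem cellExt_of_not (g : Unit → List Y → k) (c' : I) (l : List X)
    (h : l ≠ [] → ∃ w ∈ l, w ∉ e '' A) : cellExt S e c A g c' l = 0 := by
  cases l with
  | nil => rfl
  | cons z l =>
    rw [cellExt, dif_neg]
    intro h'
    obtain ⟨w, hw, hw'⟩ := h (by simp)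
    exact hw' (h' w hw)

theorem exists_map_of {l : List X} (h : ∀ w ∈ l, w ∈ e '' A) :
    ∃ l' : List Y, (∀ w ∈ l', w ∈ A) ∧ l'.map e = l := by
  induction l with
  | nil => exact ⟨[], by simp, rfl⟩
  | cons z l ih =>
    obtain ⟨w, hw, hwz⟩ := h z (by simp)
    obtain ⟨l', h1, h2⟩ := ih fun z hz => h z (by simp [hz])
    exact ⟨w :: l', by simpa using ⟨hw, h1⟩, by simp [hwz, h2]⟩

theorem cellExt_eq (he : Injective e) (g : Unit → List Y → k) {x : X} {c' c'' : I}
    (h1 : x ∈ S.dom c') (h2 : x ∈ S.dom c'') (hA : ∀ y ∈ A, e y ∈ S.core c) :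
    ∀ᶠ l in nl x univ, cellExt S e c A g c' l = S.deg x c' c'' * cellExt S e c A g c'' l := by
  filter_upwards [eventually_nl_mem ((S.dom_open c').mem_nhds h1),
    eventually_nl_mem ((S.dom_open c'').mem_nhds h2),
    eventually_nl_mem (S.deg_loc h1 h2)] with l e1 e2 e3
  by_cases h : ∀ w ∈ l, w ∈ e '' A
  · obtain ⟨l', h3, rfl⟩ := exists_map_of h
    cases l' with
    | nil => exact (mul_zero _).symm
    | cons y l' =>
      rw [cellExt_map he _ _ _ _ h3, cellExt_map he _ _ _ _ h3, ← mul_assoc,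
        ← (e3 (e y) (by simp)).1, S.deg_mul (e1 (e y) (by simp)).1 (e2 (e y) (by simp)).1]
      exact S.core_sub c (hA y (h3 y (by simp)))
  · push Not at h
    rw [cellExt_of_not _ _ _ fun _ => h, cellExt_of_not _ _ _ fun _ => h, mul_zero]

theorem cellExt_vanAt (he : IsClosedEmbedding e) (hA : IsClosed A) {g : Unit → List Y → k} {x : X}
    (hg : ∀ y ∈ A, e y = x → (plain Y k).VanAt y univ g) :
    S.VanAt x univ (cellExt S e c A g) := by
  intro c' _
  by_cases hx : x ∈ e '' A
  · obtain ⟨y, hy, rfl⟩ := hx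
    have h1 := (plain_vanAt.1 (hg y hy rfl)).filter_mono (nl_mono (subset_univ A))
    obtain ⟨W, hW, hyW, h⟩ := eventually_nl.1 (eventually_of_map he.isEmbedding
      (P := fun l => cellExt S e c A g c' l = 0) (y := y) (A := A) (by
        filter_upwards [h1, eventually_nl_mem (A := A) univ_mem] with l hl hl'
        cases l with
        | nil => rfl
        | cons z l =>
          rw [cellExt_map he.injective _ _ _ _ fun w hw => (hl' w hw).2, hl, mul_zero]))
    refine eventually_nl.2 ⟨W, hW, hyW, fun l hl => ?_⟩
    by_cases h' : ∀ w ∈ l, w ∈ e '' A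
    · exact h l fun w hw => ⟨(hl w hw).1, h' w hw⟩
    · push Not at h'
      exact cellExt_of_not _ _ _ fun _ => h'
  · filter_upwards [eventually_nl_mem ((he.isClosedMap _ hA).isOpen_compl.mem_nhds hx)] with l hl
    refine cellExt_of_not _ _ _ fun h => ?_
    obtain ⟨w, hw⟩ := List.exists_mem_of_ne_nil _ h
    exact ⟨w, hw, (hl w hw).1⟩

/-- The comparison of the complex of an open subset of a cell with the complex of an open subset
of the cube. -/
theorem cellMap_wsq (he : IsClosedEmbedding e) (hA : IsClosed A) (hc : ∀ y ∈ A, e y ∈ S.core c)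
    (hU : IsOpen U) (hUA : U ⊆ e '' A) :
    WSq cd cd (cellMap k e c A) (S.cs U) S.nul ((plain Y k).cs (e ⁻¹' U)) (plain Y k).nul := by
  have hUA' : e ⁻¹' U ⊆ A := fun y hy => by
    obtain ⟨z, hz, hzy⟩ := hUA hy
    rwa [← he.injective hzy]
  have hlen : ∀ {m f}, f ∈ S.cs U m → ∀ l : List Y, (l.length ≠ m ∨ l = []) →
      cellMap k e c A f () l = 0 := by
    intro m f hf l hl
    rw [cellMap_apply, (mem_cs.1 hf).1 c _ (by simpa using hl), mul_zero]
  have hmap : ∀ {m f}, f ∈ S.cs U m → cellMap k e c A f ∈ (plain Y k).cs (e ⁻¹' U) m :=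
    fun hf => mem_cs.2 ⟨fun _ => hlen hf, plain_homog _, fun y hy =>
      cellMap_vanAt hA he.continuous hc ((mem_cs.1 hf).2.2 _ hy) ((mem_cs.1 hf).1 c [] (Or.inr rfl))⟩
  refine ⟨fun {m f} hf => ?_, hmap, fun {m f} hf => ?_, fun {m g} hg => ?_⟩
  · have h1 := hmap (Cpl_isCx.mem hf)
    have h2 := Cpl_isCx.mem (hmap hf)
    refine mem_nul.2 ⟨(mem_cs.1 (sub_mem h1 h2)).1, plain_homog _, fun y => ?_⟩
    by_cases hy : e y ∈ U
    · rw [plain_vanAt]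
      have e1 := eventually_cd (cellMap_near (c := c) he.continuous hU hUA' hy f)
      filter_upwards [cellMap_near (c := c) he.continuous hU hUA' hy (cd f), e1] with l h1 h2
      rw [Pi.sub_apply, Pi.sub_apply, h1, h2, cd_pb, sub_self]
    · exact (mem_cs.1 (sub_mem h1 h2)).2.2 y hy
  · refine ⟨fun h => mem_nul.2 ⟨(mem_cs.1 hf).1, (mem_cs.1 hf).2.1, fun x => ?_⟩, fun h => ?_⟩
    · by_cases hx : x ∈ U
      · obtain ⟨y, hy, rfl⟩ := hUA hx
        refine VanAt.of_one (mem_cs.1 hf).2.1 (hc y hy) ?_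
        have := plain_vanAt.1 ((mem_nul.1 h).2.2 y)
        have h2 : ∀ᶠ l in nl y A, f c (l.map e) = 0 := by
          filter_upwards [this.filter_mono (nl_mono (subset_univ A)),
            eventually_nl_mem (A := A) univ_mem] with l hl hl'
          rwa [cellMap_apply, inInd_of fun w hw => (hl' w hw).2, one_mul] at hl
        obtain ⟨W, hW, hyW, h3⟩ := eventually_nl.1 (eventually_of_map he.isEmbedding
          (P := fun l => f c l = 0) h2)
        exact eventually_nl.2 ⟨W ∩ U, hW.inter hU, ⟨hyW, hx⟩, fun l hl => h3 l fun z hz =>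
          ⟨(hl z hz).1.1, hUA (hl z hz).1.2⟩⟩
      · exact (mem_cs.1 hf).2.2 x hx
    · exact mem_nul.2 ⟨fun _ => hlen hf, plain_homog _, fun y =>
      cellMap_vanAt hA he.continuous hc ((mem_nul.1 h).2.2 _) ((mem_cs.1 hf).1 c [] (Or.inr rfl))⟩
  · have hg' := mem_cs.1 hg
    have hx : cellExt S e c A g ∈ S.cs U m := by
      refine mem_cs.2 ⟨fun c' l hl => ?_, fun c' c'' x h1 h2 =>
        cellExt_eq he.injective g (S.core_sub _ h1) (S.core_sub _ h2) hc, fun x hx => ?_⟩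
      · by_cases h : ∀ w ∈ l, w ∈ e '' A
        · obtain ⟨l', h1, rfl⟩ := exists_map_of h
          cases l' with
          | nil => rfl
          | cons y l' =>
            rw [cellExt_map he.injective _ _ _ _ h1, hg'.1 () (y :: l') (by simpa using hl), mul_zero]
        · push Not at h
          exact cellExt_of_not _ _ _ fun _ => h
      · refine cellExt_vanAt he hA fun y _ hyx => hg'.2.2 y ?_
        rwa [← hyx] at hx
    refine ⟨_, hx, mem_nul.2 ⟨(mem_cs.1 (sub_mem hg (hmap hx))).1, plain_homog _, fun y => ?_⟩⟩
    by_cases hy : e y ∈ U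
    · rw [plain_vanAt]
      filter_upwards [eventually_nl_mem ((hU.preimage he.continuous).mem_nhds hy)] with l hl
      have hl' : ∀ w ∈ l, w ∈ A := fun w hw => hUA' (hl w hw).1
      rw [Pi.sub_apply, Pi.sub_apply, cellMap_apply, inInd_of hl', one_mul]
      cases l with
      | nil => rw [hg'.1 () [] (Or.inr rfl)]; simp [cellExt]
      | cons z l =>
        rw [cellExt_map he.injective _ _ _ _ hl', S.deg_self (S.core_sub _ (hc z (hl' z (by simp)))),
          one_mul, sub_self]
    · exact (mem_cs.1 (sub_mem hg (hmap hx))).2.2 y hy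

end

/-- The integration functional of the cube. -/
def intg (n : ℕ) (k : Type*) [Field k] : (Unit → List (Cube n) → k) →ₗ[k] k :=
  (exists_integral n k).choose

section

theorem intg_bdy {f : Unit → List (Cube n) → k} {V : Set (Cube n)} (hV : V ⊆ inte n)
    (hf : f ∈ bdy cd ((plain (Cube n) k).cs V) (plain (Cube n) k).nul (n + 1)) :
    intg n k f = 0 := by
  obtain ⟨y, hy, h⟩ := mem_bdy.1 hf
  exact (exists_integral n k).choose_spec.1 f (mem_bdy.2 ⟨y, cs_mono hV _ hy, h⟩)

theorem intg_nul {f : Unit → List (Cube n) → k} (hf : f ∈ (plain (Cube n) k).nul (n + 1)) :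
    intg n k f = 0 :=
  intg_bdy (empty_subset _) (mem_bdy.2 ⟨0, zero_mem _, by simpa using hf⟩)

theorem intg_box {B : Set (Cube n)} (hB : IsBox B) :
    (∃ z ∈ cyc cd ((plain (Cube n) k).cs B) (plain (Cube n) k).nul (n + 1), intg n k z ≠ 0) ∧
    ∀ z ∈ cyc cd ((plain (Cube n) k).cs B) (plain (Cube n) k).nul (n + 1), intg n k z = 0 →
      z ∈ bdy cd ((plain (Cube n) k).cs B) (plain (Cube n) k).nul (n + 1) :=
  (exists_integral n k).choose_spec.2 B hB

end

section
variable [TopologicalSpace X] {S : CoefSys X I k}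
  {n : ℕ} {e : Cube n → X} {c : I} {A : Set (Cube n)}

theorem isOpen_image (he : IsEmbedding e) (ho : IsOpen (e '' inte n)) {V : Set (Cube n)}
    (hV : IsOpen V) (hVi : V ⊆ inte n) : IsOpen (e '' V) := by
  obtain ⟨O, hO, rfl⟩ := he.isOpen_iff.1 hV
  have : e '' (e ⁻¹' O) = O ∩ e '' inte n := by
    ext x
    constructor
    · rintro ⟨y, hy, rfl⟩
      exact ⟨hy, y, hVi hy, rfl⟩
    · rintro ⟨h, y, -, rfl⟩
      exact ⟨y, h, rfl⟩
  rw [this]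
  exact hO.inter ho

theorem exists_local (he : IsClosedEmbedding e) (ho : IsOpen (e '' inte n)) (hA : IsClosed A)
    (hc : ∀ y ∈ A, e y ∈ S.core c) {O : Set (Cube n)} (hO : IsOpen O) (hOA : O ⊆ A)
    (hOi : O ⊆ inte n) {x : X} (hx : x ∈ e '' O) {W : Set X} (hW : W ∈ 𝓝 x) :
    ∃ U, IsOpen U ∧ x ∈ U ∧ U ⊆ W ∧ U ⊆ e '' O ∧
      (∃ z ∈ cyc cd (S.cs U) S.nul (n + 1), intg n k (cellMap k e c A z) ≠ 0) ∧
      (∀ z ∈ cyc cd (S.cs U) S.nul (n + 1), intg n k (cellMap k e c A z) = 0 →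
        z ∈ bdy cd (S.cs U) S.nul (n + 1)) ∧
      ∀ m, m ≠ n + 1 → SmithTheory.hc cd (S.cs U) S.nul m = 0 := by
  obtain ⟨y, hy, rfl⟩ := hx
  obtain ⟨B, hB, hyB, hBW⟩ := exists_isBox (inter_mem
    (he.continuous.continuousAt.preimage_mem_nhds hW) (hO.mem_nhds hy)) (hOi hy)
  have hpre : e ⁻¹' (e '' B) = B := Set.preimage_image_eq _ he.injective
  have hU := isOpen_image he.isEmbedding ho hB.isOpen hB.sub
  have hUO : e '' B ⊆ e '' O := image_mono fun z hz => (hBW hz).2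
  have h := cellMap_wsq (S := S) he hA hc hU (hUO.trans (image_mono hOA))
  rw [hpre] at h
  refine ⟨e '' B, hU, ⟨y, hyB, rfl⟩, ?_, hUO, ?_, fun z hz hz0 => ?_, fun m hm => ?_⟩
  · rintro _ ⟨z, hz, rfl⟩
    exact (hBW hz).1
  · obtain ⟨z', hz', h0⟩ := (intg_box (k := k) hB).1
    obtain ⟨z, hz, hzz⟩ := h.surj_cyc Cpl_isCx Cpl_isCx hz'
    refine ⟨z, hz, fun h1 => h0 ?_⟩
    have := intg_nul hzz
    rwa [map_sub, h1, sub_zero] at this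
  · exact h.bdy_of_map Cpl_isCx Cpl_isCx hz.1 ((intg_box hB).2 _ (h.map_cyc Cpl_isCx hz) hz0)
  · rw [h.hc_eq Cpl_isCx Cpl_isCx Cpl_isCx, hB.hc_eq, if_neg hm]

theorem intg_cellMap_bdy (he : IsClosedEmbedding e) (hA : IsClosed A)
    (hc : ∀ y ∈ A, e y ∈ S.core c) {U : Set X} (hU : IsOpen U) (hUA : U ⊆ e '' A)
    (hAi : A ∩ e ⁻¹' U ⊆ inte n) {z : I → List X → k} (hz : z ∈ S.cs U (n + 1))
    (hb : z ∈ bdy cd (S.cs U) S.nul (n + 1)) : intg n k (cellMap k e c A z) = 0 := by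
  have h := cellMap_wsq (S := S) he hA hc hU hUA
  refine intg_bdy (fun y hy => hAi ⟨?_, hy⟩) (h.map_bdy Cpl_isCx hz hb)
  obtain ⟨y', hy', h⟩ := hUA hy
  rwa [← he.injective h]

end

/-- An embedded cube whose interior is open. -/
structure Cell (n : ℕ) (M : Type*) [TopologicalSpace M] where
  toFun : Cube n → M
  cont : Continuous toFun
  inj : Injective toFun
  isOpen_inte : IsOpen (toFun '' inte n)

/-- The closed middle cube. -/
def mid (n : ℕ) : Set (Cube n) := {x | ∀ i, (1 / 4 : ℝ) ≤ x i ∧ (x i : ℝ) ≤ 3 / 4}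

/-- The open middle cube. -/
def omid (n : ℕ) : Set (Cube n) := box (fun _ => 1 / 4) fun _ => 3 / 4

theorem isClosed_mid (n : ℕ) : IsClosed (mid n) := by
  have : mid n = ⋂ i, {x : Cube n | (1 / 4 : ℝ) ≤ x i} ∩ {x : Cube n | (x i : ℝ) ≤ 3 / 4} := by
    ext x; simp [mid]
  rw [this]
  exact isClosed_iInter fun i => (isClosed_le continuous_const (by fun_prop)).inter
    (isClosed_le (by fun_prop) continuous_const)

theorem isOpen_omid (n : ℕ) : IsOpen (omid n) := isOpen_box _ _

theorem omid_sub (n : ℕ) : omid n ⊆ mid n := fun _ hx i => ⟨(hx i).1.le, (hx i).2.le⟩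

theorem mid_sub (n : ℕ) : mid n ⊆ inte n := fun x hx i =>
  ⟨by linarith [(hx i).1], by linarith [(hx i).2]⟩

namespace Cell
variable {M : Type*} [TopologicalSpace M]

/-- The open cell. -/
def dom (c : Cell n M) : Set M := c.toFun '' inte n

/-- The closed middle part of a cell. -/
def core (c : Cell n M) : Set M := c.toFun '' mid n

/-- The open middle part of a cell. -/
def ocore (c : Cell n M) : Set M := c.toFun '' omid n

theorem ocore_sub (c : Cell n M) : c.ocore ⊆ c.core := image_mono (omid_sub n)

theorem core_sub (c : Cell n M) : c.core ⊆ c.dom := image_mono (mid_sub n)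

variable [T2Space M]

theorem isClosedEmbedding (c : Cell n M) : IsClosedEmbedding c.toFun :=
  c.cont.isClosedEmbedding c.inj

theorem isClosed_core (c : Cell n M) : IsClosed c.core :=
  c.isClosedEmbedding.isClosedMap _ (isClosed_mid n)

theorem isOpen_ocore (c : Cell n M) : IsOpen c.ocore :=
  isOpen_image c.isClosedEmbedding.isEmbedding c.isOpen_inte (isOpen_omid n)
    ((omid_sub n).trans (mid_sub n))


/-- The restriction of a plain cochain to a cell. -/
def pull (k : Type*) [Field k] (c : Cell n M) :
    (Unit → List M → k) →ₗ[k] (Unit → List (Cube n) → k) := cellMap k c.toFun () univ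

/-- The proportionality of the integrals over two cells near a point. -/
def HasDeg (x : M) (c c' : Cell n M) (a : k) : Prop :=
  ∃ W, IsOpen W ∧ x ∈ W ∧ ∀ z ∈ cyc cd ((plain M k).cs W) (plain M k).nul (n + 1),
    a * intg n k (c.pull k z) = intg n k (c'.pull k z)

theorem exists_local (c : Cell n M) {x : M} (hx : x ∈ c.dom) {W : Set M} (hW : W ∈ 𝓝 x) :
    ∃ U, IsOpen U ∧ x ∈ U ∧ U ⊆ W ∧ U ⊆ c.dom ∧
      (∃ z ∈ cyc cd ((plain M k).cs U) (plain M k).nul (n + 1), intg n k (c.pull k z) ≠ 0) ∧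
      ∀ z ∈ cyc cd ((plain M k).cs U) (plain M k).nul (n + 1), intg n k (c.pull k z) = 0 →
        z ∈ bdy cd ((plain M k).cs U) (plain M k).nul (n + 1) :=
  have ⟨U, h1, h2, h3, h4, h5, h6, _⟩ := SmithTheory.exists_local (S := plain M k) (c := ())
    c.isClosedEmbedding c.isOpen_inte isClosed_univ (fun _ _ => trivial) isBox_inte.isOpen
    (subset_univ _) le_rfl hx hW
  ⟨U, h1, h2, h3, h4, h5, h6⟩

theorem HasDeg.unique {x : M} {c c' : Cell n M} {a b : k} (hx : x ∈ c.dom) (ha : HasDeg x c c' a)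
    (hb : HasDeg x c c' b) : a = b := by
  obtain ⟨W, hW, hxW, h1⟩ := ha
  obtain ⟨W', hW', hxW', h2⟩ := hb
  obtain ⟨U, -, -, hU, -, ⟨z, hz, h0⟩, -⟩ := c.exists_local (k := k) hx
    (inter_mem (hW.mem_nhds hxW) (hW'.mem_nhds hxW'))
  have e1 := h1 z ⟨cs_mono (fun y hy => (hU hy).1) _ hz.1, hz.2⟩
  have e2 := h2 z ⟨cs_mono (fun y hy => (hU hy).2) _ hz.1, hz.2⟩
  exact mul_right_cancel₀ h0 (e1.trans e2.symm)

theorem HasDeg.exists {x : M} {c c' : Cell n M} (hx : x ∈ c.dom) (hx' : x ∈ c'.dom) :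
    ∃ a : k, HasDeg x c c' a := by
  obtain ⟨U, hUo, hxU, hU, -, ⟨z₀, hz₀, h0⟩, h⟩ := c.exists_local (k := k) hx
    (c'.isOpen_inte.mem_nhds hx')
  refine ⟨intg n k (c'.pull k z₀) / intg n k (c.pull k z₀), U, hUo, hxU, fun z hz => ?_⟩
  set t := intg n k (c.pull k z) / intg n k (c.pull k z₀) with ht
  have hz' : z - t • z₀ ∈ cyc cd ((plain M k).cs U) (plain M k).nul (n + 1) :=
    sub_mem hz (smul_mem _ _ hz₀)
  have hb := h _ hz' (by rw [map_sub, map_smul, map_sub, map_smul, smul_eq_mul, ht]; field_simp; ring)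
  have := intg_cellMap_bdy (S := plain M k) (c := ()) c'.isClosedEmbedding isClosed_univ
    (fun _ _ => trivial) hUo (by rw [Set.image_univ]; exact hU.trans (Set.image_subset_range _ _))
    (fun y hy => by
      obtain ⟨y', hy', e⟩ := hU hy.2
      rwa [← c'.inj e]) hz'.1 hb
  change intg n k (c'.pull k (z - t • z₀)) = 0 at this
  rw [map_sub, map_sub, map_smul, map_smul, sub_eq_zero, smul_eq_mul] at this
  rw [this, ht]
  ring

theorem HasDeg.nhds {x : M} {c c' : Cell n M} {a : k} (h : HasDeg x c c' a) :
    ∀ᶠ y in 𝓝 x, HasDeg y c c' a := by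
  obtain ⟨W, hW, hx, h⟩ := h
  filter_upwards [hW.mem_nhds hx] with y hy
  exact ⟨W, hW, hy, h⟩

theorem HasDeg.self (x : M) (c : Cell n M) : HasDeg x c c (1 : k) :=
  ⟨univ, isOpen_univ, trivial, fun _ _ => one_mul _⟩

theorem HasDeg.mul {x : M} {c c' c'' : Cell n M} {a b : k} (ha : HasDeg x c c' a)
    (hb : HasDeg x c' c'' b) : HasDeg x c c'' (a * b) := by
  obtain ⟨W, hW, hxW, h1⟩ := ha
  obtain ⟨W', hW', hxW', h2⟩ := hb
  refine ⟨W ∩ W', hW.inter hW', ⟨hxW, hxW'⟩, fun z hz => ?_⟩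
  rw [← h2 z ⟨cs_mono inter_subset_right _ hz.1, hz.2⟩,
    ← h1 z ⟨cs_mono inter_subset_left _ hz.1, hz.2⟩]
  ring

open Classical in
/-- The local degree. -/
def deg (k : Type*) [Field k] (x : M) (c c' : Cell n M) : k :=
  if h : ∃ a : k, HasDeg x c c' a then h.choose else 0

theorem hasDeg_deg {x : M} {c c' : Cell n M} (hx : x ∈ c.dom) (hx' : x ∈ c'.dom) :
    HasDeg x c c' (deg k x c c') := by
  have h := HasDeg.exists (k := k) hx hx'
  rw [deg, dif_pos h]
  exact h.choose_spec

theorem deg_eq {x : M} {c c' : Cell n M} (hx : x ∈ c.dom) {a : k} (h : HasDeg x c c' a) :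
    deg k x c c' = a := by
  have h' : ∃ a : k, HasDeg x c c' a := ⟨a, h⟩
  rw [deg, dif_pos h']
  exact h'.choose_spec.unique hx h

end Cell

/-- The orientation system of a family of cells. -/
def cellSys {n : ℕ} {M : Type*} [TopologicalSpace M] [T2Space M] {I : Type*}
    (k : Type*) [Field k] (C : I → Cell n M) (h : ∀ x, ∃ c, x ∈ (C c).core) : CoefSys M I k where
  core c := (C c).core
  dom c := (C c).dom
  deg x c c' := Cell.deg k x (C c) (C c')
  core_closed c := (C c).isClosed_core
  dom_open c := (C c).isOpen_inte
  core_sub c := (C c).core_sub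
  cover := h
  deg_self hx := Cell.deg_eq hx (Cell.HasDeg.self _ _)
  deg_mul h1 h2 h3 := (Cell.deg_eq h1 ((Cell.hasDeg_deg h1 h2).mul (Cell.hasDeg_deg h2 h3))).symm
  deg_loc {x c c'} h1 h2 := by
    filter_upwards [(Cell.hasDeg_deg (k := k) h1 h2).nhds, (C c).isOpen_inte.mem_nhds h1] with y hy hy'
    exact Cell.deg_eq hy' hy

section

theorem rd_sup_le (Z Z' B : Submodule k V) : rd (Z ⊔ Z') B ≤ rd Z B + rd Z' B := by
  refine (rd_le_add (Z₁ := Z) (B₁ := B) (Z₃ := Z ⊔ Z') (B₃ := Z ⊔ B) LinearMap.id LinearMap.id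
    (fun x _ h => h) (fun x h => h) fun x _ h => ?_).trans (by
      gcongr
      refine rd_le_of_surj LinearMap.id (fun x _ h => mem_sup_right h) fun x hx => ?_
      obtain ⟨a, ha, b, hb, rfl⟩ := Submodule.mem_sup.1 hx
      exact ⟨b, hb, by simpa using mem_sup_left ha⟩)
  obtain ⟨a, ha, b, hb, h⟩ := Submodule.mem_sup.1 h
  exact ⟨a, ha, by simp at h ⊢; rw [← h]; simpa using hb⟩

end

namespace CoefSys
variable [TopologicalSpace X]

/-- Cocycles with support in `U`. -/
abbrev zc (S : CoefSys X I k) (U : Set X) (m : ℕ) : Submodule k (I → List X → k) :=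
  cyc cd (S.cs U) S.nul m

/-- Coboundaries with support in `U`. -/
abbrev bc (S : CoefSys X I k) (U : Set X) (m : ℕ) : Submodule k (I → List X → k) :=
  bdy cd (S.cs U) S.nul m

variable {S : CoefSys X I k} {U V : Set X} {m : ℕ}

theorem zc_mono (h : U ⊆ V) : S.zc U m ≤ S.zc V m := fun _ hz => ⟨cs_mono h _ hz.1, hz.2⟩

theorem bc_mono (h : U ⊆ V) : S.bc U m ≤ S.bc V m := fun z hz => by
  obtain ⟨y, hy, h'⟩ := mem_bdy.1 hz
  exact mem_bdy.2 ⟨y, cs_mono h _ hy, h'⟩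

theorem bc_le_zc : S.bc U (m + 1) ≤ S.zc U (m + 1) := fun z hz => by
  obtain ⟨y, hy, h⟩ := mem_bdy.1 hz
  rw [← sub_add_cancel z (cd y)]
  refine add_mem ⟨nul_le _ h, Cpl_isCx.mem h⟩ ⟨Cpl_isCx.mem hy, ?_⟩
  show cd (cd y) ∈ S.nul (m + 1 + 1)
  rw [cd_cd]
  exact zero_mem _

end CoefSys

section
variable {M : Type*} [MetricSpace M] [CompactSpace M]

section
variable {C : I → Cell n M}
  {h : ∀ x, ∃ c, x ∈ (C c).core}

theorem cellSys_wsq {c : I} {U : Set M} (hU : IsOpen U) (hUc : U ⊆ (C c).core) :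
    WSq cd cd (cellMap k (C c).toFun c (mid n)) ((cellSys k C h).cs U) (cellSys k C h).nul
      ((plain (Cube n) k).cs ((C c).toFun ⁻¹' U)) (plain (Cube n) k).nul :=
  cellMap_wsq (S := cellSys k C h) (C c).isClosedEmbedding (isClosed_mid n)
    (fun _ hy => ⟨_, hy, rfl⟩) hU hUc

theorem cellSys_hc_eq {c : I} {U : Set M} (hU : IsOpen U) (hUc : U ⊆ (C c).core) (m : ℕ) :
    hc cd ((cellSys k C h).cs U) (cellSys k C h).nul m =
      hc cd ((plain (Cube n) k).cs ((C c).toFun ⁻¹' U)) (plain (Cube n) k).nul m :=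
  (cellSys_wsq hU hUc).hc_eq Cpl_isCx Cpl_isCx Cpl_isCx m
end

theorem Cell.preimage_sub {c : Cell n M} {U : Set M} {O : Set (Cube n)}
    (hUc : U ⊆ c.toFun '' O) : c.toFun ⁻¹' U ⊆ O := fun y hy => by
  obtain ⟨z, hz, e⟩ := hUc hy
  rwa [← c.inj e]

/-- The cohomology with compact supports of open sets vanishes above the dimension. -/
theorem cellSys_hc_eq_zero {k I : Type} [Field k] [Finite I] {C : I → Cell n M}
    {h : ∀ x, ∃ c, x ∈ (C c).core} (ho : ∀ x, ∃ c, x ∈ (C c).ocore) {U : Set M} (hU : IsOpen U)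
    {m : ℕ} (hm : n + 1 < m) : hc cd ((cellSys k C h).cs U) (cellSys k C h).nul m = 0 := by
  classical
  have := ofFinite I
  suffices H : ∀ F : Finset I, ∀ U : Set M, IsOpen U → U ⊆ ⋃ c ∈ F, (C c).ocore → ∀ m, n + 1 < m →
      hc cd ((cellSys k C h).cs U) (cellSys k C h).nul m = 0 from
    H Finset.univ U hU (fun x _ => by simpa using ho x) m hm
  intro F
  induction F using Finset.induction_on with
  | empty =>
    intro U _ hUe m _
    obtain rfl : U = ∅ := by simpa [Set.subset_empty_iff] using hUe
    rw [cs_empty, hc_eq_zero]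
    exact fun z hz _ => ⟨0, zero_mem _, by simpa using hz⟩
  | insert c F _ ih =>
    intro U hU hUF m hm
    have e : U = (U ∩ (C c).ocore) ∪ (U ∩ ⋃ c ∈ F, (C c).ocore) := by
      rw [Finset.set_biUnion_insert] at hUF
      rw [← Set.inter_union_distrib_left, Set.inter_eq_left.2 hUF]
    have o1 := hU.inter (C c).isOpen_ocore
    have o2 : IsOpen (U ∩ ⋃ c ∈ F, (C c).ocore) :=
      hU.inter (isOpen_biUnion fun c _ => (C c).isOpen_ocore)
    have := hc_cs_union (S := cellSys k C h) o1 o2 m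
    rw [← e, ih _ o2 inter_subset_right m hm,
      ih _ (o1.inter o2) (inter_subset_right.trans inter_subset_right) (m + 1) (by omega),
      cellSys_hc_eq (c := c) o1 (inter_subset_right.trans (C c).ocore_sub),
      hc_open_cube (o1.preimage (C c).cont) _ hm] at this
    · simpa using this
    · exact (Cell.preimage_sub (inter_subset_right.trans (C c).ocore_sub)).trans (mid_sub n)

/-- The system extends a given family of cells. -/
def IsRankBound {N : ℕ} (C₀ : Fin N → Cell n M) (W U : Set M) (b : ℕ) : Prop :=
  ∀ (k I : Type) [Field k] (C : I → Cell n M) (h : ∀ x, ∃ c, x ∈ (C c).core)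
    (j : Fin N → I), (∀ i, C (j i) = C₀ i) → ∀ m,
    rd ((cellSys k C h).zc W m) ((cellSys k C h).bc U m) ≤ b

theorem exists_isRankBound_cell {N : ℕ} (C₀ : Fin N → Cell n M) (i : Fin N) {W U : Set M}
    (hU : IsOpen U) (hUi : U ⊆ (C₀ i).ocore) (hW : closure W ⊆ U) :
    ∃ b, IsRankBound C₀ W U b := by
  have hpre := (Cell.preimage_sub (hUi.trans (C₀ i).ocore_sub)).trans (mid_sub n)
  obtain ⟨F, hF, h1, h2⟩ := exists_boxes (T := (C₀ i).toFun ⁻¹' closure W)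
    (isClosed_closure.preimage (C₀ i).cont).isCompact (hU.preimage (C₀ i).cont)
    (Set.preimage_mono hW) hpre
  obtain ⟨b, hb⟩ := hc_boxes_le F hF
  refine ⟨b, fun k I _ C h j hj m => ?_⟩
  have hO : IsOpen (⋃ B ∈ F, B) := isOpen_biUnion fun B hB => (hF B hB).isOpen
  set N' := (C (j i)).toFun '' ⋃ B ∈ F, B with hN'
  have hNU : N' ⊆ U := by
    rintro _ ⟨y, hy, rfl⟩
    rw [hj i]
    exact h2 hy
  have hWN : W ⊆ N' := fun x hx => by
    obtain ⟨y, -, rfl⟩ := hUi (hW (subset_closure hx))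
    refine ⟨y, h1 (subset_closure hx), ?_⟩
    rw [hj i]
  have hNo : IsOpen N' := isOpen_image (C (j i)).isClosedEmbedding.isEmbedding (C (j i)).isOpen_inte
    hO (h2.trans hpre)
  have key := cellSys_hc_eq (k := k) (h := h) (c := j i) hNo
    (hNU.trans (by rw [hj i]; exact hUi.trans (C₀ i).ocore_sub)) m
  rw [Set.preimage_image_eq _ (C (j i)).inj] at key
  refine (rd_mono (zc_mono hWN) (bc_mono hNU)).trans ?_
  rw [← hc_eq_rd, key]
  refine (hb k m).trans ?_
  split_ifs <;> simp

theorem exists_isRankBound_union {N : ℕ} (C₀ : Fin N → Cell n M) {U₁ U₂ : Set M}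
    (o1 : IsOpen U₁) (o2 : IsOpen U₂)
    (h1 : ∀ W, closure W ⊆ U₁ → ∃ b, IsRankBound C₀ W U₁ b)
    (h2 : ∀ W, closure W ⊆ U₂ → ∃ b, IsRankBound C₀ W U₂ b)
    (h12 : ∀ V, IsOpen V → V ⊆ U₁ ∩ U₂ → ∀ W, closure W ⊆ V → ∃ b, IsRankBound C₀ W V b)
    {W : Set M} (hW : closure W ⊆ U₁ ∪ U₂) : ∃ b, IsRankBound C₀ W (U₁ ∪ U₂) b := by
  obtain ⟨W₁, oW₁, a1, a2⟩ := normal_exists_closure_subset (s := closure W \ U₂) (t := U₁)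
    (isClosed_closure.sdiff o2) o1 (fun x hx => (hW hx.1).resolve_right hx.2)
  obtain ⟨W₁', oW₁', a3, a4⟩ := normal_exists_closure_subset isClosed_closure o1 a2
  obtain ⟨W₁'', oW₁'', a5, a6⟩ := normal_exists_closure_subset isClosed_closure o1 a4
  obtain ⟨W₂, oW₂, b1, b2⟩ := normal_exists_closure_subset (s := closure W \ W₁) (t := U₂)
    (isClosed_closure.sdiff oW₁) o2 (fun x hx => by
      by_contra hx2
      exact hx.2 (a1 ⟨hx.1, hx2⟩))
  obtain ⟨W₂', oW₂', b3, b4⟩ := normal_exists_closure_subset isClosed_closure o2 b2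
  obtain ⟨r1, hr1⟩ := h1 W₁'' a6
  obtain ⟨r2, hr2⟩ := h2 W₂' b4
  obtain ⟨r3, hr3⟩ := h12 (W₁'' ∩ W₂') (oW₁''.inter oW₂')
    (Set.inter_subset_inter (subset_closure.trans a6) (subset_closure.trans b4)) (W₁' ∩ W₂)
    ((closure_inter_subset_inter_closure _ _).trans (Set.inter_subset_inter a5 b3))
  refine ⟨r1 + r2 + r3, fun k I _ C h j hj m => ?_⟩
  set S := cellSys k C h
  have s1 : W₁'' ⊆ U₁ ∪ U₂ := (subset_closure.trans a6).trans Set.subset_union_left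
  have s2 : W₂' ⊆ U₁ ∪ U₂ := (subset_closure.trans b4).trans Set.subset_union_right
  have step : rd (S.zc W m) (S.bc (U₁ ∪ U₂) m) ≤
      rd (S.zc W₁'' m ⊔ S.zc W₂' m) (S.bc (U₁ ∪ U₂) m) +
        rd (S.zc (W₁' ∩ W₂) (m + 1)) (S.bc (W₁'' ∩ W₂') (m + 1)) := by
    have key : ∀ z ∈ S.zc W m, mulOp (hdInd k (closure W₁)) z ∈ S.cs W₁' m ∧
        z - mulOp (hdInd k (closure W₁)) z ∈ S.cs W₂ m := by
      intro z hz
      have hz' := mem_cs.1 hz.1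
      have hz0 : ∀ c, z c [] = 0 := fun c => hz'.1 c _ (Or.inr rfl)
      have hm := mulOp_mem hz.1 (hdInd k (closure W₁))
      have hm2 := sub_mem hz.1 hm
      refine ⟨mem_cs.2 ⟨hm.1, hm.2.1, fun x hx => vanAt_hdInd ?_⟩,
        mem_cs.2 ⟨hm2.1, hm2.2.1, fun x hx => ?_⟩⟩
      · exact isClosed_closure.isOpen_compl.mem_nhds fun hx' => hx (a3 hx')
      · by_cases hx1 : x ∈ W₁
        · exact vanAt_sub_hdInd (mem_of_superset (oW₁.mem_nhds hx1) subset_closure) hz0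
        · have : x ∉ W := fun hxW => hx (b1 ⟨subset_closure hxW, hx1⟩)
          exact (hz'.2.2 x this).sub ((hz'.2.2 x this).mulOp _)
    refine rd_le_add LinearMap.id (cd ∘ₗ mulOp (hdInd k (closure W₁))) (fun x _ h => h)
      (fun z hz => ?_) fun z hz hg => ?_
    · obtain ⟨k1, k2⟩ := key z hz
      refine ⟨?_, ?_⟩
      · rw [← cs_inf]
        refine ⟨Cpl_isCx.mem k1, ?_⟩
        have : cd (mulOp (hdInd k (closure W₁)) z) =
          cd z - cd (z - mulOp (hdInd k (closure W₁)) z) := by simp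
        rw [comp_apply, this]
        exact sub_mem (nul_le _ hz.2) (Cpl_isCx.mem k2)
      · show cd (cd _) ∈ S.nul (m + 1 + 1)
        rw [cd_cd]
        exact zero_mem _
    · obtain ⟨k1, k2⟩ := key z hz
      obtain ⟨y, hy, hyz⟩ := mem_bdy.1 hg
      rw [Nat.add_sub_cancel, ← cs_inf] at hy
      refine ⟨z, ?_, by simp⟩
      rw [comp_apply] at hyz
      rw [show z = (mulOp (hdInd k (closure W₁)) z - y) +
        (z - mulOp (hdInd k (closure W₁)) z + y) by abel]
      refine Submodule.add_mem_sup ⟨sub_mem (cs_mono (subset_closure.trans a5) _ k1) hy.1, ?_⟩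
        ⟨add_mem (cs_mono (subset_closure.trans b3) _ k2) hy.2, ?_⟩
      · show cd _ ∈ S.nul (m + 1)
        rwa [map_sub]
      · show cd _ ∈ S.nul (m + 1)
        have : cd (z - mulOp (hdInd k (closure W₁)) z + y) =
          cd z - (cd (mulOp (hdInd k (closure W₁)) z) - cd y) := by simp; abel
        rw [this]
        exact sub_mem hz.2 hyz
  have q1 := hr1 k I C h j hj m
  have q2 := hr2 k I C h j hj m
  have q3 := hr3 k I C h j hj (m + 1)
  push_cast
  refine step.trans (add_le_add ((rd_sup_le _ _ _).trans (add_le_add ?_ ?_)) q3)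
  · exact (rd_mono le_rfl (bc_mono Set.subset_union_left)).trans q1
  · exact (rd_mono le_rfl (bc_mono Set.subset_union_right)).trans q2

/-- A uniform bound for the cohomology of the manifold. -/
theorem exists_hc_bound {N : ℕ} (C₀ : Fin N → Cell n M) (ho : ∀ x, ∃ c, x ∈ (C₀ c).ocore) :
    ∃ b : ℕ, ∀ (k I : Type) [Field k] (C : I → Cell n M) (h : ∀ x, ∃ c, x ∈ (C c).core)
      (j : Fin N → I), (∀ i, C (j i) = C₀ i) → ∀ m,
      hc cd ((cellSys k C h).cs univ) (cellSys k C h).nul m ≤ b := by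
  classical
  suffices H : ∀ F : Finset (Fin N), ∀ U : Set M, IsOpen U → U ⊆ ⋃ c ∈ F, (C₀ c).ocore →
      ∀ W, closure W ⊆ U → ∃ b, IsRankBound C₀ W U b from
    H Finset.univ univ isOpen_univ (fun x _ => by simpa using ho x) univ (subset_univ _)
  intro F
  induction F using Finset.induction_on with
  | empty =>
    intro U _ hUe W hW
    obtain rfl : U = ∅ := by simpa [Set.subset_empty_iff] using hUe
    refine ⟨0, fun k I _ C h j _ m => ?_⟩
    refine (rd_mono (zc_mono (subset_closure.trans hW)) le_rfl).trans ?_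
    rw [Nat.cast_zero, nonpos_iff_eq_zero, rd_eq_zero, zc, bc, cs_empty]
    exact fun z hz => mem_bdy.2 ⟨0, zero_mem _, by simpa using hz.1⟩
  | insert c F _ ih =>
    intro U hU hUF W hW
    have e : U = (U ∩ (C₀ c).ocore) ∪ (U ∩ ⋃ c ∈ F, (C₀ c).ocore) := by
      rw [Finset.set_biUnion_insert] at hUF
      rw [← Set.inter_union_distrib_left, Set.inter_eq_left.2 hUF]
    have o1 := hU.inter (C₀ c).isOpen_ocore
    have o2 : IsOpen (U ∩ ⋃ c ∈ F, (C₀ c).ocore) :=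
      hU.inter (isOpen_biUnion fun c _ => (C₀ c).isOpen_ocore)
    rw [e] at hW ⊢
    exact exists_isRankBound_union C₀ o1 o2
      (fun W hW => exists_isRankBound_cell C₀ c o1 inter_subset_right hW)
      (fun W hW => ih _ o2 inter_subset_right W hW)
      (fun V hV hVs W hW => ih V hV (hVs.trans (inter_subset_right.trans
        inter_subset_right)) W hW) hW

end

section

/-- Gluing linear functionals. -/
theorem exists_glue (A B C : Submodule k V) (f g : V →ₗ[k] k)
    (h : ∀ a ∈ A, ∀ b ∈ B, a + b ∈ C → f a + g b = 0) :
    ∃ ν : V →ₗ[k] k, (∀ a ∈ A, ν a = f a) ∧ (∀ b ∈ B, ν b = g b) ∧ ∀ c ∈ C, ν c = 0 := by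
  let T : A × B →ₗ[k] V ⧸ C := C.mkQ ∘ₗ (A.subtype.coprod B.subtype)
  let φ : A × B →ₗ[k] k := (f ∘ₗ A.subtype).coprod (g ∘ₗ B.subtype)
  have hφ : φ ∈ range T.dualMap := by
    rw [LinearMap.range_dualMap_eq_dualAnnihilator_ker, Submodule.mem_dualAnnihilator]
    rintro ⟨a, b⟩ hab
    have : (a : V) + b ∈ C := by
      simpa [T, ← Submodule.Quotient.mk_add, Submodule.Quotient.mk_eq_zero] using hab
    simpa [φ] using h a a.2 b b.2 this
  obtain ⟨ν, hν⟩ := hφ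
  refine ⟨ν ∘ₗ C.mkQ, fun a ha => ?_, fun b hb => ?_, fun c hc => ?_⟩
  · simpa [T, φ] using LinearMap.congr_fun hν (⟨a, ha⟩, 0)
  · simpa [T, φ] using LinearMap.congr_fun hν (0, ⟨b, hb⟩)
  · simp [(Submodule.Quotient.mk_eq_zero C).2 hc]

end

section
variable {M : Type*} [MetricSpace M] [CompactSpace M]
variable {k I : Type} [Field k] [Finite I] {C : I → Cell n M} {h : ∀ x, ∃ c, x ∈ (C c).core}

/-- The integral of a cochain over a cell. -/
def cellInt (k : Type) [Field k] (C : I → Cell n M) (c : I) :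
    (I → List M → k) →ₗ[k] k := intg n k ∘ₗ cellMap k (C c).toFun c (mid n)

theorem cellInt_bc {c : I} {U : Set M} (hU : IsOpen U) (hUc : U ⊆ (C c).core)
    {z : I → List M → k} (hz : z ∈ (cellSys k C h).bc U (n + 1)) : cellInt k C c z = 0 :=
  intg_cellMap_bdy (S := cellSys k C h) (C c).isClosedEmbedding (isClosed_mid n)
    (fun _ hy => ⟨_, hy, rfl⟩) hU hUc (inter_subset_left.trans (mid_sub n))
    (bc_le_zc hz).1 hz

theorem cellInt_local {c : I} {x : M} (hx : x ∈ (C c).ocore) {W : Set M} (hW : W ∈ 𝓝 x) :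
    ∃ U, IsOpen U ∧ x ∈ U ∧ U ⊆ W ∧ U ⊆ (C c).ocore ∧
      (∃ z ∈ (cellSys k C h).zc U (n + 1), cellInt k C c z ≠ 0) ∧
      (∀ z ∈ (cellSys k C h).zc U (n + 1), cellInt k C c z = 0 →
        z ∈ (cellSys k C h).bc U (n + 1)) ∧
      ∀ m, m ≠ n + 1 → hc cd ((cellSys k C h).cs U) (cellSys k C h).nul m = 0 :=
  exists_local (S := cellSys k C h) (c := c) (C c).isClosedEmbedding (C c).isOpen_inte
    (isClosed_mid n) (fun _ hy => ⟨_, hy, rfl⟩) (isOpen_omid n) (omid_sub n)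
    ((omid_sub n).trans (mid_sub n)) hx hW

theorem cellInt_eq {c c' : I} {W : Set M} (hW : IsOpen W) (hWc : W ⊆ (C c).core)
    (hWc' : W ⊆ (C c').core) {a : k} (ha : ∀ y ∈ W, (cellSys k C h).deg y c' c = a)
    {z : I → List M → k} (hz : z ∈ (cellSys k C h).zc W (n + 1)) :
    cellInt k C c' z = a * intg n k ((C c').pull k (cellMap k id c (C c).core z)) := by
  set S := cellSys k C h
  have w1 := cellMap_wsq (S := S) (e := (id : M → M)) (c := c) IsClosedEmbedding.id (C c).isClosed_core
    (fun _ hy => hy) hW (by rwa [Set.image_id])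
  rw [Set.preimage_id] at w1
  have hw := w1.map_cyc Cpl_isCx hz
  set w := cellMap k id c (C c).core z with hwdef
  have w2 := cellMap_wsq (S := plain M k) (e := (C c').toFun) (c := ()) (A := univ) (U := W)
    (C c').isClosedEmbedding isClosed_univ (fun _ _ => trivial) hW
    (by rw [Set.image_univ]; exact hWc'.trans (Set.image_subset_range _ _))
  have m1 : cellMap k (C c').toFun c' (mid n) z ∈ _ := (cellSys_wsq (h := h) hW hWc').map hz.1
  have m2 : (C c').pull k w ∈ _ := w2.map hw.1
  rw [← smul_eq_mul, ← map_smul, ← sub_eq_zero, cellInt, comp_apply, ← map_sub]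
  have m3 := sub_mem m1 (smul_mem _ a m2)
  refine intg_nul (mem_nul.2 ⟨(mem_cs.1 m3).1, plain_homog _, fun y => ?_⟩)
  by_cases hy : (C c').toFun y ∈ W
  · rw [plain_vanAt]
    have e1 := (mem_cs.1 hz.1).2.1 c' c _ (hWc' hy) (hWc hy)
    have e2 := eventually_map (e := (C c').toFun) (y := y) (A := univ) (C c').cont.continuousAt
      (e1.filter_mono (nl_mono (subset_univ _)))
    filter_upwards [e2, eventually_nl_mem ((hW.preimage (C c').cont).mem_nhds hy)] with l hl hl'
    have q1 : ∀ v ∈ l, v ∈ mid n := fun v hv =>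
      Cell.preimage_sub (c := C c') hWc' (hl' v hv).1
    have q2 : ∀ v ∈ l.map (C c').toFun, v ∈ (C c).core := fun v hv => by
      obtain ⟨u, hu, rfl⟩ := List.mem_map.1 hv
      exact hWc (hl' u hu).1
    rw [Pi.sub_apply, Pi.sub_apply, Pi.smul_apply, Pi.smul_apply, cellMap_apply, inInd_of q1,
      one_mul, Cell.pull, cellMap_apply, inInd_of (P := univ) (l := l)
        (fun _ _ => mem_univ _), one_mul, hwdef,
      cellMap_apply, inInd_of q2, one_mul, List.map_id, hl, ha _ hy, smul_eq_mul, sub_self]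
  · exact (mem_cs.1 m3).2.2 y hy

theorem cellInt_compat {c c' : I} {x : M} (hx : x ∈ (C c).ocore) (hx' : x ∈ (C c').ocore) :
    ∃ W, IsOpen W ∧ x ∈ W ∧ ∀ z ∈ (cellSys k C h).zc W (n + 1),
      cellInt k C c' z = cellInt k C c z := by
  set S := cellSys k C h
  have d := (C c).core_sub ((C c).ocore_sub hx)
  have d' := (C c').core_sub ((C c').ocore_sub hx')
  obtain ⟨W₀, hW₀, hxW₀, hd⟩ := Cell.hasDeg_deg (k := k) d' d
  obtain ⟨W₁, hW₁s, hW₁, hxW₁⟩ := mem_nhds_iff.1 (inter_mem (S.deg_loc (c := c') (c' := c) d' d)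
    (inter_mem ((C c).isOpen_ocore.mem_nhds hx) ((C c').isOpen_ocore.mem_nhds hx')))
  refine ⟨W₁ ∩ W₀, hW₁.inter hW₀, ⟨hxW₁, hxW₀⟩, fun z hz => ?_⟩
  have sc : W₁ ∩ W₀ ⊆ (C c).core := fun y hy => (C c).ocore_sub (hW₁s hy.1).2.1
  have sc' : W₁ ∩ W₀ ⊆ (C c').core := fun y hy => (C c').ocore_sub (hW₁s hy.1).2.2
  rw [cellInt_eq (hW₁.inter hW₀) sc sc' (fun y hy => (hW₁s hy.1).1) hz,
    cellInt_eq (hW₁.inter hW₀) sc sc (a := 1) (fun y hy => S.deg_self ((C c).core_sub (sc hy))) hz,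
    one_mul]
  refine hd _ ?_
  have w1 := cellMap_wsq (S := S) (e := (id : M → M)) (c := c) IsClosedEmbedding.id
    (C c).isClosed_core (fun _ hy => hy) (hW₁.inter hW₀) (by rwa [Set.image_id])
  rw [Set.preimage_id] at w1
  have hw := w1.map_cyc Cpl_isCx hz
  exact ⟨cs_mono inter_subset_right _ hw.1, hw.2⟩

variable (ho : ∀ x, ∃ c, x ∈ (C c).ocore)
include ho

theorem zc_union_le {U V : Set M} (hU : IsOpen U) (hV : IsOpen V) {z : I → List M → k}
    (hz : z ∈ (cellSys k C h).zc (U ∪ V) (n + 1)) :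
    ∃ a ∈ (cellSys k C h).zc U (n + 1), ∃ b ∈ (cellSys k C h).zc V (n + 1), z = a + b := by
  set S := cellSys k C h
  obtain ⟨a, ha, b, hb, rfl⟩ := Submodule.mem_sup.1 (cs_union_le hU hV _ hz.1)
  have h1 : cd a ∈ S.cs (U ∩ V) (n + 2) := by
    rw [← cs_inf]
    refine ⟨Cpl_isCx.mem ha, ?_⟩
    have : cd a = cd (a + b) - cd b := by simp
    rw [this]
    exact sub_mem (nul_le _ hz.2) (Cpl_isCx.mem hb)
  obtain ⟨y, hy, hyn⟩ := hc_eq_zero.1 (cellSys_hc_eq_zero (k := k) (h := h) ho (hU.inter hV)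
    (show n + 1 < n + 2 by omega)) (cd a) h1 (by rw [cd_cd]; exact zero_mem _)
  change y ∈ S.cs (U ∩ V) (n + 1) at hy
  rw [← cs_inf] at hy
  refine ⟨a - y, ⟨sub_mem ha hy.1, ?_⟩, b + y, ⟨add_mem hb hy.2, ?_⟩, by abel⟩
  · show cd (a - y) ∈ S.nul (n + 2)
    rwa [map_sub]
  · show cd (b + y) ∈ S.nul (n + 2)
    have : cd (b + y) = cd (a + b) - (cd a - cd y) := by simp
    rw [this]
    exact sub_mem hz.2 hyn

/-- A functional vanishing on coboundaries and on cocycles with small supports vanishes. -/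
theorem functional_eq_zero {W : Set M} {ν : (I → List M → k) →ₗ[k] k}
    (h0 : ∀ z ∈ (cellSys k C h).nul (n + 1), ν z = 0)
    (h1 : ∀ x ∈ W, ∃ O, IsOpen O ∧ x ∈ O ∧ ∀ z ∈ (cellSys k C h).zc O (n + 1), ν z = 0)
    {z : I → List M → k} (hz : z ∈ (cellSys k C h).zc W (n + 1)) : ν z = 0 := by
  set S := cellSys k C h
  let T : Set M := {x | S.VanAt x univ z}ᶜ
  have hT : IsClosed T := (exists_support S z).isClosed_compl
  have hTW : T ⊆ W := fun x hx => by
    by_contra hxW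
    exact hx ((mem_cs.1 hz.1).2.2 x hxW)
  have key : ∃ O, IsOpen O ∧ T ⊆ O ∧ ∀ z ∈ S.zc O (n + 1), ν z = 0 := by
    refine hT.isCompact.induction_on (p := fun T => ∃ O, IsOpen O ∧ T ⊆ O ∧
      ∀ z ∈ S.zc O (n + 1), ν z = 0) ?_ ?_ ?_ ?_
    · refine ⟨∅, isOpen_empty, le_rfl, fun z hz => h0 z ?_⟩
      have := hz.1
      rwa [cs_empty] at this
    · rintro s t hst ⟨O, h1, h2, h3⟩
      exact ⟨O, h1, hst.trans h2, h3⟩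
    · rintro s t ⟨O, h1, h2, h3⟩ ⟨O', h1', h2', h3'⟩
      refine ⟨O ∪ O', h1.union h1', Set.union_subset_union h2 h2', fun z hz => ?_⟩
      obtain ⟨a, ha, b, hb, rfl⟩ := zc_union_le ho h1 h1' hz
      rw [map_add, h3 a ha, h3' b hb, add_zero]
    · intro x hx
      obtain ⟨O, hO, hxO, h⟩ := h1 x (hTW hx)
      exact ⟨O, mem_nhdsWithin_of_mem_nhds (hO.mem_nhds hxO), O, hO, le_rfl, h⟩
  obtain ⟨O, -, hTO, h⟩ := key
  refine h z ⟨mem_cs.2 ⟨(mem_cs.1 hz.1).1, (mem_cs.1 hz.1).2.1, fun x hx => ?_⟩, hz.2⟩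
  by_contra hx'
  exact hx (hTO hx')

/-- A functional which is locally given by integration. -/
def IsFund (k : Type) [Field k] (C : I → Cell n M) (h : ∀ x, ∃ c, x ∈ (C c).core) (U : Set M)
    (ν : (I → List M → k) →ₗ[k] k) : Prop :=
  (∀ z ∈ (cellSys k C h).bc U (n + 1), ν z = 0) ∧
    ∀ x ∈ U, ∀ c, x ∈ (C c).ocore → ∃ W, IsOpen W ∧ x ∈ W ∧
      ∀ z ∈ (cellSys k C h).zc W (n + 1), ν z = cellInt k C c z

theorem IsFund.unique {U V : Set M} {ν ν' : (I → List M → k) →ₗ[k] k} (hν : IsFund k C h U ν) (hν' : IsFund k C h V ν') {z : I → List M → k}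
    (hz : z ∈ (cellSys k C h).zc (U ∩ V) (n + 1)) : ν z = ν' z := by
  rw [← sub_eq_zero, ← LinearMap.sub_apply]
  refine functional_eq_zero ho (h := h) (fun z hz => ?_) (fun x hx => ?_) hz
  · have hb : ∀ U, z ∈ (cellSys k C h).bc U (n + 1) := fun U =>
      mem_bdy.2 ⟨0, zero_mem _, by simpa using hz⟩
    rw [LinearMap.sub_apply, hν.1 z (hb U), hν'.1 z (hb V), sub_zero]
  · obtain ⟨c, hc⟩ := ho x
    obtain ⟨W, h1, h2, h3⟩ := hν.2 x hx.1 c hc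
    obtain ⟨W', h1', h2', h3'⟩ := hν'.2 x hx.2 c hc
    refine ⟨W ∩ W', h1.inter h1', ⟨h2, h2'⟩, fun z hz => ?_⟩
    rw [LinearMap.sub_apply, h3 z (zc_mono inter_subset_left hz),
      h3' z (zc_mono inter_subset_right hz), sub_self]

theorem IsFund.union {U V : Set M} {ν ν' : (I → List M → k) →ₗ[k] k} (hU : IsOpen U)
    (hV : IsOpen V) (hν : IsFund k C h U ν) (hν' : IsFund k C h V ν') :
    ∃ ν'', IsFund k C h (U ∪ V) ν'' := by
  set S := cellSys k C h
  obtain ⟨ν'', e1, e2, e3⟩ := exists_glue (S.zc U (n + 1)) (S.zc V (n + 1)) (S.bc (U ∪ V) (n + 1))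
    ν ν' (by
      intro a ha b hb hab
      obtain ⟨y, hy, hyn⟩ := mem_bdy.1 hab
      obtain ⟨y1, hy1, y2, hy2, rfl⟩ := Submodule.mem_sup.1 (cs_union_le hU hV _ hy)
      have f1 : ν (cd y1) = 0 := hν.1 _ (mem_bdy.2 ⟨y1, hy1, by simp⟩)
      have hn : ∀ V', a + b - cd (y1 + y2) ∈ S.zc V' (n + 1) := fun V' =>
        ⟨nul_le _ hyn, Cpl_isCx.mem hyn⟩
      have f2 : ν' (cd y2) = 0 := hν'.1 _ (mem_bdy.2 ⟨y2, hy2, by simp⟩)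
      have f3 : ν' (a + b - cd (y1 + y2)) = 0 := hν'.1 _ (mem_bdy.2 ⟨0, zero_mem _, by simpa using hyn⟩)
      have hz : ∀ {U'} {y' : I → List M → k}, y' ∈ S.cs U' n → cd y' ∈ S.zc U' (n + 1) := fun hy' =>
        ⟨Cpl_isCx.mem hy', by show cd (cd _) ∈ S.nul _; rw [cd_cd]; exact zero_mem _⟩
      have m1 : a - cd y1 ∈ S.zc (U ∩ V) (n + 1) := by
        have i1 := sub_mem ha (hz hy1)
        have i2 : a - cd y1 ∈ S.zc V (n + 1) := by
          have : a - cd y1 = (a + b - cd (y1 + y2)) - (b - cd y2) := by simp; abel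
          rw [this]
          exact sub_mem (hn V) (sub_mem hb (hz hy2))
        refine ⟨?_, i1.2⟩
        rw [← cs_inf]
        exact ⟨i1.1, i2.1⟩
      have := IsFund.unique ho hν hν' m1
      have e : ν' (a - cd y1) = ν' (a + b - cd (y1 + y2)) - (ν' b - ν' (cd y2)) := by
        rw [← map_sub, ← map_sub]; congr 1; simp; abel
      rw [e, f3, f2, map_sub, f1] at this
      rw [show ν a = _ from by simpa using this]
      simp)
  refine ⟨ν'', e3, fun x hx c hc => ?_⟩
  rcases hx with hx | hx
  · obtain ⟨W, h1, h2, h3⟩ := hν.2 x hx c hc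
    refine ⟨W ∩ U, h1.inter hU, ⟨h2, hx⟩, fun z hz => ?_⟩
    rw [e1 z (zc_mono inter_subset_right hz), h3 z (zc_mono inter_subset_left hz)]
  · obtain ⟨W, h1, h2, h3⟩ := hν'.2 x hx c hc
    refine ⟨W ∩ V, h1.inter hV, ⟨h2, hx⟩, fun z hz => ?_⟩
    rw [e2 z (zc_mono inter_subset_right hz), h3 z (zc_mono inter_subset_left hz)]

/-- The fundamental functional. -/
theorem exists_isFund : ∃ ν, IsFund k C h univ ν := by
  have key := (isCompact_univ (X := M)).induction_on
    (p := fun T => ∃ U, IsOpen U ∧ T ⊆ U ∧ ∃ ν, IsFund k C h U ν)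
    ⟨∅, isOpen_empty, le_rfl, 0, fun _ _ => rfl, fun x hx => absurd hx (Set.notMem_empty x)⟩
    (by
      rintro s t hst ⟨O, h1, h2, h3⟩
      exact ⟨O, h1, hst.trans h2, h3⟩)
    (by
      rintro s t ⟨O, h1, h2, ν, h3⟩ ⟨O', h1', h2', ν', h3'⟩
      exact ⟨O ∪ O', h1.union h1', Set.union_subset_union h2 h2', h3.union ho h1 h1' h3'⟩)
    (by
      intro x _
      obtain ⟨c, hc⟩ := ho x
      refine ⟨(C c).ocore, mem_nhdsWithin_of_mem_nhds ((C c).isOpen_ocore.mem_nhds hc), (C c).ocore,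
        (C c).isOpen_ocore, le_rfl, cellInt k C c,
        fun z hz => cellInt_bc (C c).isOpen_ocore (C c).ocore_sub hz, fun y hy c' hc' => ?_⟩
      exact cellInt_compat hc' hy)
  obtain ⟨U, -, hU, ν, hν⟩ := key
  rw [Set.univ_subset_iff.1 hU] at hν
  exact ⟨ν, hν⟩

/-- Small open sets have one-dimensional compactly supported cohomology, on which the fundamental
functional does not vanish. -/
theorem IsFund.exists_local {ν : (I → List M → k) →ₗ[k] k} (hν : IsFund k C h univ ν) {x : M}
    {W : Set M} (hW : W ∈ 𝓝 x) : ∃ U ⊆ W, IsOpen U ∧ x ∈ U ∧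
      (∃ z ∈ (cellSys k C h).zc U (n + 1), ν z ≠ 0) ∧
      (∀ z ∈ (cellSys k C h).zc U (n + 1), ν z = 0 → z ∈ (cellSys k C h).bc U (n + 1)) ∧
      ∀ m, m ≠ n + 1 → hc cd ((cellSys k C h).cs U) (cellSys k C h).nul m = 0 := by
  obtain ⟨c, hc⟩ := ho x
  obtain ⟨O, h1, h2, h3⟩ := hν.2 x trivial c hc
  obtain ⟨U, hUo, hx, hU, -, ⟨z, hz, h0⟩, h4, h5⟩ := cellInt_local (k := k) (h := h) hc
    (inter_mem hW (h1.mem_nhds h2))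
  have h6 : ∀ z ∈ (cellSys k C h).zc U (n + 1), ν z = cellInt k C c z := fun z hz =>
    h3 z (zc_mono (hU.trans inter_subset_right) hz)
  exact ⟨U, hU.trans inter_subset_left, hUo, hx, ⟨z, hz, by rwa [h6 z hz]⟩,
    fun z hz h => h4 z hz (by rwa [← h6 z hz]), h5⟩

end

section
variable {M : Type*} [TopologicalSpace M] [ChartedSpace (EuclideanSpace ℝ (Fin n)) M]

/-- The scaled cube around a point. -/
def scaled (v : EuclideanSpace ℝ (Fin n)) (ε : ℝ) (u : Cube n) : EuclideanSpace ℝ (Fin n) :=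
  WithLp.toLp 2 fun i => v i + ε * ((u i : ℝ) - 1 / 2)

theorem continuous_scaled (v : EuclideanSpace ℝ (Fin n)) (ε : ℝ) : Continuous (scaled v ε) := by
  unfold scaled
  fun_prop

theorem exists_scaled (v : EuclideanSpace ℝ (Fin n)) {T : Set (EuclideanSpace ℝ (Fin n))}
    (hT : T ∈ 𝓝 v) : ∃ ε > 0, ∀ u, scaled v ε u ∈ T := by
  have h : Continuous fun q : ℝ × Cube n => scaled v q.1 q.2 := by
    unfold scaled
    fun_prop
  have h0 : ∀ u, scaled v 0 u = v := fun u => by ext i; simp [scaled]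
  have := isCompact_univ.eventually_forall_of_forall_eventually (x₀ := (0 : ℝ))
    (K := (univ : Set (Cube n))) (P := fun ε u => scaled v ε u ∈ T)
    (fun u _ => h.continuousAt.preimage_mem_nhds (by
      rw [h0]; exact hT))
  obtain ⟨ε, h1, h2⟩ := (this.filter_mono (nhdsWithin_le_nhds (s := Set.Ioi 0))).and self_mem_nhdsWithin |>.exists
  exact ⟨ε, h2, fun u => h1 u trivial⟩

theorem isOpen_scaled (v : EuclideanSpace ℝ (Fin n)) {ε : ℝ} (hε : 0 < ε) :
    IsOpen (scaled v ε '' inte n) := by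
  have : scaled v ε '' inte n = ⋂ i, {w : EuclideanSpace ℝ (Fin n) |
      v i - ε / 2 < w i ∧ w i < v i + ε / 2} := by
    ext w
    simp only [Set.mem_image, mem_iInter, Set.mem_ofPred_eq]
    constructor
    · rintro ⟨u, hu, rfl⟩ i
      have h1 := (hu i).1
      have h2 := (hu i).2
      simp only [scaled]
      constructor <;> nlinarith
    · intro h
      have key : ∀ i, 0 < (w i - v i) / ε + 1 / 2 ∧ (w i - v i) / ε + 1 / 2 < 1 := fun i => by
        have e1 : (w i - v i) / ε < 1 / 2 := by
          rw [div_lt_iff₀ hε]; linarith [(h i).2]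
        have e2 : -(1 / 2) < (w i - v i) / ε := by
          rw [lt_div_iff₀ hε]; linarith [(h i).1]
        constructor <;> linarith
      refine ⟨fun i => ⟨(w i - v i) / ε + 1 / 2, (key i).1.le, (key i).2.le⟩, fun i => key i, ?_⟩
      ext i
      simp only [scaled]
      field_simp
      ring
  rw [this]
  refine isOpen_iInter_of_finite fun i => ?_
  have h : Continuous fun w : EuclideanSpace ℝ (Fin n) => w i := by fun_prop
  exact (isOpen_lt continuous_const h).inter (isOpen_lt h continuous_const)

theorem exists_cell (x : M) : ∃ c : Cell n M, x ∈ c.ocore := by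
  set φ := chartAt (EuclideanSpace ℝ (Fin n)) x
  have hx := mem_chart_target (EuclideanSpace ℝ (Fin n)) x
  obtain ⟨ε, hε, h⟩ := exists_scaled (φ x) (φ.open_target.mem_nhds hx)
  refine ⟨⟨fun u => φ.symm (scaled (φ x) ε u), ?_, ?_, ?_⟩, ?_⟩
  · exact φ.continuousOn_symm.comp_continuous (continuous_scaled _ _) h
  · intro u u' huu
    have := φ.symm.injOn (h u) (h u') huu
    ext i
    have := congrArg (fun w : EuclideanSpace ℝ (Fin n) => w i) this
    simp only [scaled] at this
    have h3 := mul_left_cancel₀ hε.ne' (add_left_cancel this)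
    linarith
  · have := φ.isOpen_image_symm_of_subset_target (isOpen_scaled (φ x) hε)
      (by rintro _ ⟨u, -, rfl⟩; exact h u)
    rwa [Set.image_image] at this
  · refine ⟨fun _ => ⟨1 / 2, by norm_num, by norm_num⟩, fun i => by norm_num, ?_⟩
    have : scaled (φ x) ε (fun _ => ⟨1 / 2, by norm_num, by norm_num⟩) = φ x := by
      ext i; simp [scaled]
    show φ.symm _ = x
    rw [this]
    exact φ.left_inv (mem_chart_source _ x)

theorem exists_cells [T2Space M] [CompactSpace M] :
    ∃ (N : ℕ) (C : Fin N → Cell n M), ∀ x, ∃ i, x ∈ (C i).ocore := by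
  choose c hc using exists_cell (n := n) (M := M)
  obtain ⟨t, ht⟩ := isCompact_univ.elim_finite_subcover (fun x => (c x).ocore)
    (fun x => (c x).isOpen_ocore) (fun x _ => Set.mem_iUnion.2 ⟨x, hc x⟩)
  refine ⟨t.card, fun i => c (t.equivFin.symm i), fun x => ?_⟩
  obtain ⟨y, hy, hxy⟩ := Set.mem_iUnion₂.1 (ht (mem_univ x))
  exact ⟨t.equivFin ⟨y, hy⟩, by simpa using hxy⟩

end

section
variable {G : Type*} [Group G] [MulAction G X] [MulAction G I]

/-- The action of a group on cochains. -/
def gop (g : G) : COp I X k := pb (fun c => g⁻¹ • c) (fun x => g⁻¹ • x)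

theorem gop_apply (g : G) (f : I → List X → k) (c : I) (l : List X) :
    gop g f c l = f (g⁻¹ • c) (l.map (g⁻¹ • ·)) := rfl

theorem gop_one : (gop (1 : G) : COp I X k) = 1 := by
  ext f c l
  simp [gop_apply]

theorem gop_mul (g h : G) :
    (gop (g * h) : COp I X k) = gop g * gop h := by
  ext f c l
  simp [gop_apply, mul_smul, comp_def]

theorem gop_pow (g : G) (n : ℕ) : (gop (g ^ n) : COp I X k) = gop g ^ n := by
  induction n with
  | zero => rw [pow_zero, pow_zero, gop_one]
  | succ n ih => rw [pow_succ, gop_mul, ih, pow_succ]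

theorem cd_gop (g : G) (f : I → List X → k) : cd (gop g f) = gop g (cd f) := cd_pb _ _ f

variable [TopologicalSpace X]

/-- A coefficient system with a group action. -/
structure IsEq (S : CoefSys X I k) (G : Type*) [Group G] [MulAction G X] [MulAction G I] : Prop where
  cont : ∀ g : G, Continuous fun x : X => g • x
  core : ∀ (g : G) {x c}, x ∈ S.core c → g • x ∈ S.core (g • c)
  deg : ∀ (g : G) {x c c'}, x ∈ S.core c → x ∈ S.core c' →
    S.deg (g • x) (g • c) (g • c') = S.deg x c c'
  deg_fix : ∀ (g : G) {x c}, g • x = x → x ∈ S.core c → S.deg x (g • c) c = 1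

variable {S : CoefSys X I k}

theorem IsEq.eventually (h : IsEq S G) (g : G) {x : X} {A B : Set X} {P : List X → Prop}
    (hAB : ∀ y ∈ B, g⁻¹ • y ∈ A) (hP : ∀ᶠ l in nl x A, P l) :
    ∀ᶠ l in nl (g • x) B, P (l.map (g⁻¹ • ·)) := by
  have : ∀ᶠ l in nl (g⁻¹ • g • x) ((g⁻¹ • ·) '' B), P l := by
    rw [inv_smul_smul]
    refine hP.filter_mono (nl_mono ?_)
    rintro _ ⟨y, hy, rfl⟩
    exact hAB y hy
  exact eventually_map (h.cont g⁻¹).continuousAt this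

theorem IsEq.vanAt (h : IsEq S G) (g : G) {x : X} {A B : Set X} {f : I → List X → k}
    (hAB : ∀ y ∈ B, g⁻¹ • y ∈ A) (hf : S.VanAt x A f) : S.VanAt (g • x) B (gop g f) := by
  intro c hc
  have hc' : x ∈ S.core (g⁻¹ • c) := by simpa using h.core g⁻¹ hc
  exact h.eventually g hAB (hf _ hc')

theorem IsEq.homog (h : IsEq S G) (g : G) {f : I → List X → k} (hf : S.Homog f) :
    S.Homog (gop g f) := by
  intro c c' x hc hc'
  have := h.eventually g (A := univ) (B := univ) (fun _ _ => mem_univ _) (hf _ _ _ (h.core g⁻¹ hc) (h.core g⁻¹ hc'))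
  rw [smul_inv_smul] at this
  filter_upwards [this] with l hl
  rw [gop_apply, hl, h.deg g⁻¹ hc hc', gop_apply]

/-- A family of vanishing conditions which is invariant under the group. -/
def InvCond (G : Type*) [Group G] [MulAction G X] (Ψ : Set (Set X × Set X)) : Prop :=
  ∀ P ∈ Ψ, ∀ g : G, (∀ x ∈ P.1, g • x ∈ P.1) ∧ ∀ x ∈ P.2, g • x ∈ P.2

theorem IsEq.gop_mem (h : IsEq S G) {Ψ : Set (Set X × Set X)} (hΨ : InvCond G Ψ) (g : G) {m : ℕ}
    {f : I → List X → k} (hf : f ∈ S.Cpl Ψ m) : gop g f ∈ S.Cpl Ψ m := by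
  refine ⟨fun c l hl => hf.1 _ _ (by simpa using hl), h.homog g hf.2.1, fun P hP x hx => ?_⟩
  have := h.vanAt g (B := P.2) (fun y hy => (hΨ P hP g⁻¹).2 y hy)
    (hf.2.2 P hP _ ((hΨ P hP g⁻¹).1 x hx))
  rwa [smul_inv_smul] at this

/-- The group acts trivially on the germs along the fixed points. -/
theorem IsEq.vanAt_sub (h : IsEq S G) (g : G) {x : X} {A : Set X} (hx : g • x = x)
    (hA : ∀ y ∈ A, g • y = y) {f : I → List X → k} (hf : S.Homog f) :
    S.VanAt x A (gop g f - f) := by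
  intro c hc
  have hx' : g⁻¹ • x = x := by rw [inv_smul_eq_iff, hx]
  have hc' : x ∈ S.core (g⁻¹ • c) := by simpa [hx'] using h.core g⁻¹ hc
  filter_upwards [(hf _ c x hc' hc).filter_mono (nl_mono (subset_univ A)),
    eventually_nl_mem (A := A) univ_mem] with l h1 h2
  have : l.map (g⁻¹ • ·) = l := by
    rw [List.map_congr_left (g := id) fun y hy => ?_, List.map_id]
    rw [id, inv_smul_eq_iff, hA y (h2 y hy).2]
  rw [Pi.sub_apply, Pi.sub_apply, gop_apply, this, h1, h.deg_fix g⁻¹ hx' hc, one_mul, sub_self]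

end

section
variable {G : Type*} [Group G] {M : Type*} [TopologicalSpace M] [T2Space M] [MulAction G M]

/-- The translate of a cell. -/
def Cell.tr (hc : ∀ g : G, Continuous fun x : M => g • x) (g : G) (c : Cell n M) : Cell n M where
  toFun u := g • c.toFun u
  cont := (hc g).comp c.cont
  inj _ _ h := c.inj (MulAction.injective g h)
  isOpen_inte := by
    have : (fun u => g • c.toFun u) '' inte n = (fun x => g⁻¹ • x) ⁻¹' (c.toFun '' inte n) := by
      ext x
      simp only [Set.mem_image, Set.mem_preimage]
      refine exists_congr fun u => and_congr_right fun _ => ?_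
      rw [eq_inv_smul_iff]
    rw [this]
    exact c.isOpen_inte.preimage (hc g⁻¹)

variable {hc : ∀ g : G, Continuous fun x : M => g • x} {g : G} {c c' : Cell n M} {x : M}

theorem Cell.smul_mem_image {T : Set (Cube n)} : g • x ∈ (c.tr hc g).toFun '' T ↔ x ∈ c.toFun '' T := by
  simp only [Set.mem_image]
  refine exists_congr fun u => and_congr_right fun _ => ?_
  exact (MulAction.injective g).eq_iff


theorem Cell.HasDeg.tr {a : k} (h : HasDeg x c c' a) : HasDeg (g • x) (c.tr hc g) (c'.tr hc g) a := by
  obtain ⟨W, hW, hx, h⟩ := h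
  have hce : IsClosedEmbedding fun x : M => g • x :=
    (Homeomorph.mk (MulAction.toPerm g) (hc g) (hc g⁻¹)).isClosedEmbedding
  refine ⟨(g⁻¹ • ·) ⁻¹' W, hW.preimage (hc g⁻¹), by simpa using hx, fun z hz => ?_⟩
  have w := cellMap_wsq (S := plain M k) (e := fun x : M => g • x) (c := ()) (A := univ)
    (U := (g⁻¹ • ·) ⁻¹' W) hce isClosed_univ (fun _ _ => trivial) (hW.preimage (hc g⁻¹))
    (by rw [Set.image_univ, (MulAction.surjective g).range_eq]; exact subset_univ _)
  have hz' := w.map_cyc CoefSys.Cpl_isCx hz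
  have e : (fun x : M => g • x) ⁻¹' ((g⁻¹ • ·) ⁻¹' W) = W := by ext; simp
  rw [e] at hz'
  have key : ∀ c : Cell n M, c.pull k (cellMap k (fun x : M => g • x) () univ z) =
      (c.tr hc g).pull k z := fun c => by
    ext i l
    rw [pull, pull, cellMap_apply, cellMap_apply, cellMap_apply,
      inInd_of (P := univ) (l := l.map c.toFun) (fun _ _ => mem_univ _), one_mul,
      List.map_map]
    rfl
  rw [← key, ← key]
  exact h _ hz'

end

/-- An equivariant coefficient system with the homological properties of a closed manifold. -/
structure IsGood {M I k : Type*} [TopologicalSpace M] [Field k] (S : CoefSys M I k) (G : Type*)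
    [Group G] [MulAction G M] [MulAction G I] (D b : ℕ) : Prop extends IsEq S G where
  van : ∀ U, IsOpen U → ∀ i, D < i → hc cd (S.cs U) S.nul i = 0
  bound : ∀ m, hc cd (S.cs univ) S.nul m ≤ b
  fund : ∃ ν : (I → List M → k) →ₗ[k] k, (∀ z ∈ S.bc univ D, ν z = 0) ∧
    (∀ g : G, ∀ z ∈ S.zc univ D, ν (gop g z) = ν z) ∧
    ∀ x, ∀ W ∈ 𝓝 x, ∃ U ⊆ W, IsOpen U ∧ x ∈ U ∧ (∃ z ∈ S.zc U D, ν z ≠ 0) ∧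
      (∀ z ∈ S.zc U D, ν z = 0 → z ∈ S.bc U D) ∧ ∀ m, m ≠ D → hc cd (S.cs U) S.nul m = 0

section
variable {G : Type*} [CommGroup G] {M : Type*} [TopologicalSpace M] [T2Space M] [MulAction G M]
  {hcont : ∀ g : G, Continuous fun x : M => g • x} [MulAction G I] {C : I → Cell n M}
  {h : ∀ x, ∃ c, x ∈ (C c).core}

theorem cellSys_isEq (hC : ∀ (g : G) c, C (g • c) = (C c).tr hcont g) {p : ℕ} (hp : p.Prime) [CharP k p]
    (hG : ∀ g : G, g ^ p = 1) : IsEq (cellSys k C h) G where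
  cont := hcont
  core g {x c} hx := by
    change g • x ∈ (C (g • c)).core
    rw [hC]
    exact Cell.smul_mem_image.2 hx
  deg g {x c c'} hx hx' := by
    change Cell.deg k (g • x) (C (g • c)) (C (g • c')) = Cell.deg k x (C c) (C c')
    rw [hC, hC]
    exact Cell.deg_eq (Cell.smul_mem_image.2 ((C c).core_sub hx))
      (Cell.hasDeg_deg ((C c).core_sub hx) ((C c').core_sub hx')).tr
  deg_fix g {x c} hgx hx := by
    have := Fact.mk hp
    set S := cellSys k C h
    have hcore : ∀ i : ℕ, x ∈ (C (g ^ i • c)).core := by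
      intro i
      induction i with
      | zero => simpa using (show x ∈ (C c).core from hx)
      | succ i ih =>
        rw [pow_succ', mul_smul, hC]
        nth_rw 1 [← hgx]
        exact Cell.smul_mem_image.2 ih
    have hd : ∀ i : ℕ, S.deg x (g ^ (i + 1) • c) (g ^ i • c) = S.deg x (g • c) c := by
      intro i
      induction i with
      | zero => simp
      | succ i ih =>
        rw [← ih]
        have := Cell.deg_eq (k := k) (Cell.smul_mem_image.2 ((C (g ^ (i + 1) • c)).core_sub (hcore (i + 1))))
          (Cell.HasDeg.tr (hc := hcont) (g := g)
            (Cell.hasDeg_deg ((C (g ^ (i + 1) • c)).core_sub (hcore (i + 1)))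
              ((C (g ^ i • c)).core_sub (hcore i))))
        rw [← hC, ← hC, ← mul_smul, ← mul_smul, ← pow_succ', ← pow_succ', hgx] at this
        exact this
    have hpow : ∀ i : ℕ, S.deg x (g ^ i • c) c = S.deg x (g • c) c ^ i := by
      intro i
      induction i with
      | zero => simpa using S.deg_self ((C c).core_sub hx)
      | succ i ih =>
        rw [← S.deg_mul ((C _).core_sub (hcore (i + 1))) ((C _).core_sub (hcore i))
          ((C _).core_sub hx), hd, ih, pow_succ']
    have h1 := hpow p
    rw [hG, one_smul, S.deg_self ((C c).core_sub hx)] at h1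
    refine frobenius_inj k p ?_
    rw [frobenius_def, frobenius_def, one_pow, h1]

end

section
variable {G : Type*} [CommGroup G] {M : Type*} [MetricSpace M] [CompactSpace M] [MulAction G M]
  {hcont : ∀ g : G, Continuous fun x : M => g • x} {I : Type} [MulAction G I] [Finite I] {C : I → Cell n M}
  {k : Type} [Field k] {h : ∀ x, ∃ c, x ∈ (C c).core}

theorem IsEq.gop_cs {S : CoefSys M I k} (he : IsEq S G) (g : G) {U V : Set M}
    (hUV : ∀ x, x ∉ U → g⁻¹ • x ∉ V) {m : ℕ} {z : I → List M → k} (hz : z ∈ S.cs V m) :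
    gop g z ∈ S.cs U m := by
  rw [CoefSys.mem_cs] at hz ⊢
  refine ⟨fun c l hl => hz.1 _ _ (by simpa using hl), he.homog g hz.2.1, fun x hx => ?_⟩
  have := he.vanAt g (B := univ) (fun _ _ => mem_univ _) (hz.2.2 _ (hUV x hx))
  rwa [smul_inv_smul] at this

theorem IsEq.gop_zc {S : CoefSys M I k} (he : IsEq S G) (g : G) {U V : Set M}
    (hUV : ∀ x, x ∉ U → g⁻¹ • x ∉ V) {m : ℕ} {z : I → List M → k} (hz : z ∈ S.zc V m) :
    gop g z ∈ S.zc U m := by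
  refine ⟨he.gop_cs g hUV hz.1, ?_⟩
  have : cd z ∈ S.nul (m + 1) := hz.2
  change cd (gop g z) ∈ S.nul (m + 1)
  rw [← CoefSys.cs_empty] at this ⊢
  rw [cd_gop]
  exact he.gop_cs g (fun _ _ => Set.notMem_empty _) this

theorem IsEq.gop_bc {S : CoefSys M I k} (he : IsEq S G) (g : G) {m : ℕ} {z : I → List M → k}
    (hz : z ∈ S.bc univ m) : gop g z ∈ S.bc univ m := by
  obtain ⟨y, hy, hyz⟩ := mem_bdy.1 hz
  refine mem_bdy.2 ⟨gop g y, he.gop_cs g (by simp) hy, ?_⟩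
  rw [← CoefSys.cs_empty] at hyz ⊢
  rw [cd_gop, ← map_sub]
  exact he.gop_cs g (fun _ _ => Set.notMem_empty _) hyz

theorem cellInt_gop (hC : ∀ (g : G) c, C (g • c) = (C c).tr hcont g) (g : G) (c : I)
    (z : I → List M → k) : cellInt k C (g • c) (gop g z) = cellInt k C c z := by
  rw [cellInt, cellInt, comp_apply, comp_apply]
  congr 1
  ext i l
  rw [cellMap_apply, cellMap_apply, gop_apply, inv_smul_smul, List.map_map, hC]
  congr 3
  ext u
  exact inv_smul_smul g _

theorem cellSys_isGood (hC : ∀ (g : G) c, C (g • c) = (C c).tr hcont g) {p : ℕ} (hp : p.Prime) [CharP k p]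
    (hG : ∀ g : G, g ^ p = 1) (ho : ∀ x, ∃ c, x ∈ (C c).ocore) {b : ℕ}
    (hb : ∀ m, hc cd ((cellSys k C h).cs univ) (cellSys k C h).nul m ≤ b) :
    IsGood (cellSys k C h) G (n + 1) b where
  toIsEq := cellSys_isEq hC hp hG
  van U hU i hi := cellSys_hc_eq_zero ho hU hi
  bound := hb
  fund := by
    have he : IsEq (cellSys k C h) G := cellSys_isEq hC hp hG
    obtain ⟨ν, hν⟩ := exists_isFund (k := k) (h := h) ho
    refine ⟨ν, hν.1, fun g z hz => ?_, fun x W hW => hν.exists_local ho hW⟩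
    have hν' : IsFund k C h univ (ν ∘ₗ gop g) := by
      refine ⟨fun z hz => hν.1 _ (he.gop_bc g hz), fun x _ c hx => ?_⟩
      have hx' : g • x ∈ (C (g • c)).ocore := by
        rw [hC]
        exact Cell.smul_mem_image.2 hx
      obtain ⟨W, h1, h2, h3⟩ := hν.2 (g • x) trivial _ hx'
      refine ⟨(g • ·) ⁻¹' W, h1.preimage (hcont g), h2, fun z hz => ?_⟩
      rw [comp_apply, h3 _ (he.gop_zc g (fun y hy => by simpa using hy) hz),
        cellInt_gop hC]
    exact hν'.unique ho hν (by simpa using hz)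

end

/-- The index set of an equivariant family of cells. -/
def CellIdx (G : Type) (N : ℕ) := G × Fin N

instance {G : Type} [Finite G] {N : ℕ} : Finite (CellIdx G N) :=
  inferInstanceAs (Finite (G × Fin N))

instance {G : Type} [Group G] {N : ℕ} : MulAction G (CellIdx G N) where
  smul g c := (g * c.1, c.2)
  one_smul c := Prod.ext (one_mul c.1) rfl
  mul_smul g h c := Prod.ext (mul_assoc g h c.1) rfl

theorem exists_isGood (n : ℕ) (M : Type*) [MetricSpace M] [CompactSpace M]
    [ChartedSpace (EuclideanSpace ℝ (Fin n)) M] :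
    ∃ b : ℕ, ∀ (p : ℕ), p.Prime → ∀ (G : Type) [CommGroup G] [Finite G] [MulAction G M],
      (∀ g : G, g ^ p = 1) → (∀ g : G, Continuous fun x : M => g • x) →
      ∀ (k : Type) [Field k] [CharP k p],
      ∃ (I : Type) (_ : Finite I) (_ : MulAction G I) (S : CoefSys M I k), IsGood S G (n + 1) b := by
  obtain ⟨N, C₀, h₀⟩ := exists_cells (n := n) (M := M)
  obtain ⟨b, hb⟩ := exists_hc_bound C₀ h₀
  refine ⟨b, fun p hp G _ _ _ hG hcont k _ _ => ?_⟩
  let C : CellIdx G N → Cell n M := fun c => (C₀ c.2).tr hcont c.1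
  have h1 : ∀ i, C (1, i) = C₀ i := fun i => by
    change (C₀ i).tr hcont 1 = C₀ i
    simp [Cell.tr]
  have ho : ∀ x, ∃ c, x ∈ (C c).ocore := fun x => by
    obtain ⟨i, hi⟩ := h₀ x
    exact ⟨(1, i), by rwa [h1]⟩
  have h : ∀ x, ∃ c, x ∈ (C c).core := fun x => (ho x).imp fun c hc => (C c).ocore_sub hc
  have hC : ∀ (g : G) c, C (g • c) = (C c).tr hcont g := fun g c => by
    change (C₀ c.2).tr hcont (g * c.1) = ((C₀ c.2).tr hcont c.1).tr hcont g
    simp [Cell.tr, mul_smul]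
  exact ⟨CellIdx G N, inferInstance, inferInstance, cellSys k C h,
    cellSys_isGood hC hp hG ho fun m => hb k _ C h (fun i => (1, i)) h1 m⟩

theorem sum_pow_of_commute {R ι : Type*} [Ring R] {p : ℕ} (hp : p.Prime) (h0 : (p : R) = 0)
    (s : Finset ι) (f : ι → R) (hf : ∀ i j, Commute (f i) (f j)) :
    (∑ i ∈ s, f i) ^ p = ∑ i ∈ s, f i ^ p := by
  classical
  induction s using Finset.induction_on with
  | empty => simp [hp.ne_zero]
  | insert i s hi ih =>
    rw [Finset.sum_insert hi, Finset.sum_insert hi,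
      (Commute.sum_right _ _ _ fun j _ => hf i j).add_pow_prime_eq hp, ih, h0]
    simp

section
/-- The commutation relation of a Weyl algebra gives sections of powers. -/
theorem weyl_pow {t θ e : End k V} (h : t * θ = θ * t + e) (hte : t * e = e * t)
    (hθe : e * θ = θ) (hθe' : θ * e = θ) (hee : e * e = e) {P : Submodule k V}
    (hP : ∀ Q ∈ Algebra.adjoin k {t, θ, e}, ∀ f ∈ P, Q f ∈ P) (n : ℕ) :
    ∀ f, t f ∈ P → (t ^ n * θ ^ n * e - (n.factorial : k) • e) f ∈ P := by
  have mt : t ∈ Algebra.adjoin k {t, θ, e} := Algebra.subset_adjoin (by simp)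
  have mθ : θ ∈ Algebra.adjoin k {t, θ, e} := Algebra.subset_adjoin (by simp)
  have me : e ∈ Algebra.adjoin k {t, θ, e} := Algebra.subset_adjoin (by simp)
  have h1 : ∀ n : ℕ, t * θ ^ (n + 1) = θ ^ (n + 1) * t + ((n + 1 : ℕ) : k) • (θ ^ n * e) := by
    intro n
    induction n with
    | zero => simp [h]
    | succ n ih =>
      rw [pow_succ, ← mul_assoc, ih, add_mul, mul_assoc, h, mul_add, smul_mul_assoc, mul_assoc _ e θ,
        hθe, ← pow_succ, Nat.cast_succ (n + 1), add_smul, one_smul, ← mul_assoc, ← pow_succ,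
        pow_succ θ n, mul_assoc (θ ^ n), hθe']
      abel
  intro f hf
  have hfe : ∀ f, t f ∈ P → t (e f) ∈ P := fun f hf => by
    rw [← End.mul_apply, hte]
    exact hP _ me _ hf
  induction n with
  | zero => simp
  | succ n ih =>
    have : t ^ (n + 1) * θ ^ (n + 1) * e - ((n + 1).factorial : k) • e =
        ((n + 1 : ℕ) : k) • (t ^ n * θ ^ n * e - (n.factorial : k) • e) +
          t ^ n * θ ^ (n + 1) * e * t := by
      rw [pow_succ t, mul_assoc (t ^ n), h1, mul_add, add_mul, smul_sub, smul_smul, mul_smul_comm,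
        smul_mul_assoc, Nat.factorial_succ, Nat.cast_mul, mul_assoc _ _ e, mul_assoc (θ ^ (n+1)), hte]
      simp only [mul_assoc, hee]
      abel
    rw [this, LinearMap.add_apply]
    exact add_mem (P.smul_mem _ ih) (hP _ (mul_mem (mul_mem (pow_mem mt _) (pow_mem mθ _)) me) _ hf)

end

section

theorem mulOp_mul (φ ψ : List X → k) :
    (mulOp (fun l => φ l * ψ l) : COp I X k) = mulOp φ * mulOp ψ := by
  ext f c l
  simp [mulOp_apply, mul_assoc]

theorem mulOp_one : (mulOp (fun _ => 1) : COp I X k) = 1 := by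
  ext f c l
  simp [mulOp_apply]

theorem mulOp_pow (φ : List X → k) (n : ℕ) :
    (mulOp (fun l => φ l ^ n) : COp I X k) = mulOp φ ^ n := by
  induction n with
  | zero => simpa using mulOp_one
  | succ n ih => rw [pow_succ, ← ih, ← mulOp_mul]; simp only [pow_succ]

theorem mulOp_comm (φ ψ : List X → k) :
    Commute (mulOp φ : COp I X k) (mulOp ψ) := by
  rw [commute_iff_eq, ← mulOp_mul, ← mulOp_mul]
  simp only [mul_comm]

variable {G : Type*} [CommGroup G] [MulAction G X] [MulAction G I]

theorem gop_comm (g h : G) : Commute (gop g : COp I X k) (gop h) := by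
  rw [commute_iff_eq, ← gop_mul, ← gop_mul, mul_comm]

theorem gop_mulOp (g : G) (φ : List X → k) :
    (gop g * mulOp φ : COp I X k) =
      mulOp (fun l => φ (l.map (g⁻¹ • ·))) * gop g := by
  ext f c l
  simp [mulOp_apply, gop_apply]

theorem gop_mulOp_comm {g : G} {φ : List X → k} (h : ∀ l, φ (l.map (g⁻¹ • ·)) = φ l) :
    Commute (gop g : COp I X k) (mulOp φ) := by
  rw [commute_iff_eq, gop_mulOp]
  simp only [h]

variable [Fintype G]

/-- A combination of the operators `g - 1`. -/
def top (α : G → k) : COp I X k := ∑ g, α g • (gop g - 1)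

theorem top_comm_gop (α : G → k) (h : G) :
    Commute (top α : COp I X k) (gop h) :=
  Commute.sum_left _ _ _ fun g _ =>
    ((gop_comm g h).sub_left (Commute.one_left _)).smul_left _

theorem top_comm (α β : G → k) : Commute (top α : COp I X k) (top β) :=
  Commute.sum_right _ _ _ fun g _ =>
    ((top_comm_gop α g).sub_right (Commute.one_right _)).smul_right _

theorem top_cd (α : G → k) (f : I → List X → k) : cd (top α f) = top α (cd f) := by
  simp [top, map_sum, cd_gop]

theorem top_single [DecidableEq G] (g : G) :
    (top (Pi.single g 1) : COp I X k) = gop g - 1 := by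
  rw [top, Finset.sum_eq_single g]
  · simp
  · intro b _ hb
    simp [hb]
  · simp

theorem cast_end_eq_zero (p : ℕ) [CharP k p] : ((p : ℕ) : COp I X k) = 0 := by
  have : ((p : ℕ) : COp I X k) = algebraMap k _ (p : k) :=
    (map_natCast _ p).symm
  rw [this, CharP.cast_eq_zero, map_zero]

variable {p : ℕ} (hp : p.Prime) [CharP k p] (hG : ∀ g : G, g ^ p = 1)
include hp hG

theorem top_pow (α : G → k) : (top α : COp I X k) ^ p = 0 := by
  rw [top, sum_pow_of_commute hp (cast_end_eq_zero p)]
  · refine sum_eq_zero fun g _ => ?_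
    have h1 := sum_pow_of_commute hp (cast_end_eq_zero (k := k) (I := I) (X := X) p) Finset.univ
      (fun i : Bool => if i then gop g - 1 else (1 : COp I X k))
      (fun i j => by
        cases i <;> cases j <;> simp [commute_iff_eq])
    simp only [Fintype.sum_bool, if_true, Bool.false_eq_true, if_false, sub_add_cancel, one_pow] at h1
    rw [← gop_pow, hG, gop_one] at h1
    rw [smul_pow, left_eq_add.1 (h1.trans (add_comm _ _)), smul_zero]
  · intro g h
    exact ((((gop_comm g h).sub_left (Commute.one_left _)).sub_right
      ((Commute.one_right _))).smul_left _).smul_right _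

/-- The operators generated by the group and the functions of a color. -/
def colAlg (G : Type*) [CommGroup G] [MulAction G X] [MulAction G I] (c : List X → k)
    (χ : List X → G → k) : Subalgebra k (COp I X k) :=
  Algebra.adjoin k (Set.range (gop : G → _) ∪
    {Q | ∃ φ : List X → k, (∀ l l', c l = c l' → χ l = χ l' → φ l = φ l') ∧ Q = mulOp φ})

open Classical in
/-- A color which is shifted by the group gives a section of the top power of `top α`. -/
theorem exists_weyl (α : G → k) (c : List X → k) (χ : List X → G → k)
    (hc : ∀ (g : G) l, c (l.map (g⁻¹ • ·)) = c l - χ l g) (hχ : ∀ (g : G) l, χ (l.map (g⁻¹ • ·)) = χ l) :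
    ∃ Θ ∈ (colAlg G c χ : Subalgebra k (COp I X k)),
      ∀ P : Submodule k (I → List X → k), (∀ Q ∈ colAlg G c χ, ∀ f ∈ P, Q f ∈ P) →
      ∀ f, top α f ∈ P → (top α ^ (p - 1)) (Θ f) -
        mulOp (fun l => if ∑ g, α g * χ l g = 0 then 0 else 1) f ∈ P := by
  set lam : List X → k := fun l => ∑ g, α g * χ l g with hlam
  set A := (colAlg G c χ : Subalgebra k (COp I X k))
  have mg : ∀ g : G, gop g ∈ A := fun g => Algebra.subset_adjoin (Or.inl ⟨g, rfl⟩)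
  have mm : ∀ φ : List X → k, (∀ l l', c l = c l' → χ l = χ l' → φ l = φ l') → mulOp φ ∈ A :=
    fun φ h => Algebra.subset_adjoin (Or.inr ⟨φ, h, rfl⟩)
  have mt : top α ∈ A := sum_mem fun g _ => A.smul_mem (sub_mem (mg g) (one_mem _)) _
  set t : COp I X k := top α with ht
  set θ : COp I X k := mulOp c with hθ
  set u : COp I X k := ∑ g, α g • (mulOp (fun l => χ l g) * gop g) with hu
  have cχ : ∀ g h : G, Commute (gop g : COp I X k) (mulOp fun l => χ l h) :=
    fun g h => gop_mulOp_comm fun l => by rw [hχ]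
  have ctg : ∀ {Q : COp I X k}, (∀ g : G, Commute (gop g) Q) → Commute t Q :=
    fun h => Commute.sum_left _ _ _ fun g _ => ((h g).sub_left (Commute.one_left _)).smul_left _
  have cgu : ∀ g : G, Commute (gop g) u := fun g => Commute.sum_right _ _ _ fun h _ =>
    ((cχ g h).mul_right (gop_comm g h)).smul_right _
  have htθ : t * θ = θ * t - u := by
    rw [ht, top, Finset.sum_mul, Finset.mul_sum, hu, ← Finset.sum_sub_distrib]
    refine sum_congr rfl fun g _ => ?_
    have hd : (mulOp (fun l => c (l.map (g⁻¹ • ·))) : COp I X k) =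
        mulOp c - mulOp fun l => χ l g := by
      ext f i l
      simp [mulOp_apply, hc, sub_mul]
    have hg : (gop g - 1) * θ = θ * (gop g - 1) - mulOp (fun l => χ l g) * gop g := by
      rw [hθ, sub_mul, gop_mulOp, hd, sub_mul, mul_sub, one_mul, mul_one]
      abel
    rw [smul_mul_assoc, mul_smul_comm, hg]
    exact smul_sub _ _ _
  have hup : u ^ p = mulOp fun l => lam l ^ p := by
    rw [hu, sum_pow_of_commute hp (cast_end_eq_zero p)]
    · have := Fact.mk hp
      ext f i l
      rw [LinearMap.sum_apply, Finset.sum_apply, Finset.sum_apply, mulOp_apply, hlam]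
      simp only
      rw [sum_pow_char, Finset.sum_mul]
      refine sum_congr rfl fun g _ => ?_
      rw [smul_pow, ((cχ g g).symm).mul_pow, ← gop_pow, hG, gop_one, mul_one, ← mulOp_pow,
        LinearMap.smul_apply, Pi.smul_apply, Pi.smul_apply, mulOp_apply, smul_eq_mul, mul_pow,
        mul_assoc]
    · intro g h
      refine Commute.smul_left (Commute.smul_right ?_ _) _
      exact ((mulOp_comm _ _).mul_right (cχ h g).symm).mul_left ((cχ g h).mul_right (gop_comm g h))
  have hlamdep : ∀ l l', c l = c l' → χ l = χ l' → lam l = lam l' := fun l l' _ h => by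
    simp only [hlam, h]
  have hlaminv : ∀ (g : G) l, lam (l.map (g⁻¹ • ·)) = lam l := fun g l => by simp only [hlam, hχ]
  set e : COp I X k := mulOp fun l => if lam l = 0 then 0 else 1 with he
  set v : COp I X k := mulOp fun l => - (lam l ^ p)⁻¹ with hv
  have me : e ∈ A := mm _ fun l l' h h' => by rw [hlamdep l l' h h']
  have mv : v ∈ A := mm _ fun l l' h h' => by rw [hlamdep l l' h h']
  have mu : u ∈ A := sum_mem fun g _ => A.smul_mem
    (mul_mem (mm _ fun l l' _ h' => by rw [h']) (mg g)) _
  have mθ : θ ∈ A := mm _ fun l l' h _ => h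
  have cge : ∀ g : G, Commute (gop g) e := fun g => gop_mulOp_comm fun l => by rw [hlaminv]
  have cgv : ∀ g : G, Commute (gop g) v := fun g => gop_mulOp_comm fun l => by rw [hlaminv]
  have cue : Commute u e := Commute.sum_left _ _ _ fun g _ =>
    ((mulOp_comm _ _).mul_left (cge g)).smul_left _
  have cve : v * e = v := by
    rw [hv, he, ← mulOp_mul]
    congr 1
    ext l
    split_ifs with h <;> simp [h, hp.ne_zero]
  have hvu : v * u ^ p = - e := by
    rw [hup, hv, he, ← mulOp_mul]
    ext f i l
    rw [mulOp_apply, LinearMap.neg_apply, Pi.neg_apply, Pi.neg_apply, mulOp_apply]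
    split_ifs with h
    · simp [h, hp.ne_zero]
    · field_simp
  set ρ := v * u ^ (p - 1) with hρ
  have cgρ : ∀ g : G, Commute (gop g) ρ := fun g => (cgv g).mul_right ((cgu g).pow_right _)
  have hρe : ρ * e = ρ := by rw [hρ, mul_assoc, (cue.pow_left _).eq, ← mul_assoc, cve]
  have hρe' : Commute e ρ := (mulOp_comm _ _).mul_right (cue.symm.pow_right _)
  have huρ : u * ρ = - e := by
    have : Commute u v := Commute.sum_left _ _ _ fun g _ =>
      ((mulOp_comm _ _).mul_left (cgv g)).smul_left _
    rw [hρ, ← mul_assoc, this.eq, mul_assoc, ← pow_succ', Nat.sub_add_cancel hp.one_le, hvu]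
  set θ' := θ * ρ with hθ'
  have key : t * θ' = θ' * t + e := by
    rw [hθ', ← mul_assoc, htθ, sub_mul, huρ, mul_assoc, (ctg cgρ).eq, ← mul_assoc]
    abel
  have hee : e * e = e := by
    rw [he, ← mulOp_mul]
    congr 1
    ext l
    split_ifs <;> simp
  have mθ' : θ' ∈ A := mul_mem mθ (mul_mem mv (pow_mem mu _))
  have hfac : ((p - 1).factorial : k) ≠ 0 := by
    rw [Ne, CharP.cast_eq_zero_iff k p, hp.dvd_factorial]
    have := hp.one_le
    omega
  refine ⟨((p - 1).factorial : k)⁻¹ • (θ' ^ (p - 1) * e), A.smul_mem (mul_mem (pow_mem mθ' _) me) _,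
    fun P hP f hf => ?_⟩
  have cθe : Commute e θ := mulOp_comm _ _
  have hθe' : θ' * e = θ' := by rw [hθ', mul_assoc, hρe]
  have := weyl_pow key (ctg cge).eq (by rw [(cθe.mul_right hρe').eq, hθe']) hθe' hee
    (P := P) (fun Q hQ => hP Q (Algebra.adjoin_le (S := A) (by
      rintro Q (rfl | rfl | rfl)
      exacts [mt, mθ', me]) hQ)) (p - 1) f hf
  have h2 := P.smul_mem ((p - 1).factorial : k)⁻¹ this
  rw [LinearMap.sub_apply, smul_sub, LinearMap.smul_apply, smul_smul, inv_mul_cancel₀ hfac,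
    one_smul] at h2
  rw [LinearMap.smul_apply, map_smul, ← End.mul_apply, ← mul_assoc]
  exact h2

end

variable {G : Type*} [CommGroup G] [MulAction G X] [MulAction G I]

section
variable [Fintype G] {p : ℕ} {T : Set X} {α : G → k} {col : X → k} {χ : X → G → k}

/-- A color on an invariant set, shifted by the group through additive characters. -/
structure Color (T : Set X) (α : G → k) (col : X → k) (χ : X → G → k) : Prop where
  inv : ∀ (g : G), ∀ x ∈ T, g • x ∈ T
  col : ∀ (g : G), ∀ x ∈ T, col (g⁻¹ • x) = col x - χ x g
  chi : ∀ (g : G), ∀ x ∈ T, χ (g⁻¹ • x) = χ x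
  ne : ∀ x ∈ T, ∑ g, α g * χ x g ≠ 0

open Classical in
/-- The extension of a function to lists by its value on the first point in `T`. -/
def fst {β : Type*} [Zero β] (T : Set X) (f : X → β) (l : List X) : β :=
  (l.find? (· ∈ T)).elim 0 f

open Classical in
theorem fst_map {β : Type*} [Zero β] (hT : ∀ (g : G), ∀ x ∈ T, g • x ∈ T) (f : X → β) (g : G)
    (l : List X) : fst T f (l.map (g⁻¹ • ·)) = fst T (fun x => f (g⁻¹ • x)) l := by
  have : ((fun x => decide (x ∈ T)) ∘ fun x => g⁻¹ • x) = fun x => decide (x ∈ T) := by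
    funext x
    simp only [Function.comp_apply, decide_eq_decide]
    exact ⟨fun h => by simpa using hT g _ h, hT g⁻¹ x⟩
  rw [fst, List.find?_map, this, fst]
  cases l.find? (· ∈ T) <;> rfl

theorem fst_cases (T : Set X) (col : X → k) (χ : X → G → k) (l : List X) :
    (∃ x ∈ l, x ∈ T ∧ fst T col l = col x ∧ fst T χ l = χ x) ∨
      (∀ x ∈ l, x ∉ T) ∧ fst T χ l = 0 := by
  classical
  cases h : l.find? (· ∈ T) with
  | none =>
    right
    refine ⟨by simpa using h, ?_⟩
    rw [fst, show l.find? (fun x => decide (x ∈ T)) = none by convert h]; rfl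
  | some x =>
    left
    refine ⟨x, List.mem_of_find?_eq_some h, by simpa using List.find?_some h, ?_⟩
    rw [fst, fst, show l.find? (fun x => decide (x ∈ T)) = some x by convert h]
    exact ⟨rfl, rfl⟩

theorem Color.col_fst (hc : Color T α col χ) (g : G) (l : List X) :
    fst T col (l.map (g⁻¹ • ·)) = fst T col l - fst T χ l g := by
  classical
  rw [fst_map hc.inv, fst, fst, fst]
  cases h : l.find? (· ∈ T) with
  | none => simp
  | some x => exact hc.col g x (by simpa using List.find?_some h)

theorem Color.chi_fst (hc : Color T α col χ) (g : G) (l : List X) :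
    fst T χ (l.map (g⁻¹ • ·)) = fst T χ l := by
  classical
  rw [fst_map hc.inv, fst, fst]
  cases h : l.find? (· ∈ T) with
  | none => rfl
  | some x => exact hc.chi g x (by simpa using List.find?_some h)

variable [TopologicalSpace X] {S : CoefSys X I k}

theorem IsEq.colAlg_mem (hE : IsEq S G) {c : List X → k} {χ : List X → G → k}
    {Q : COp I X k} (hQ : Q ∈ colAlg G c χ) {Ψ : Set (Set X × Set X)}
    (hΨ : InvCond G Ψ) {m : ℕ} : ∀ f ∈ S.Cpl Ψ m, Q f ∈ S.Cpl Ψ m := by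
  induction hQ using Algebra.adjoin_induction with
  | mem Q hQ =>
    rcases hQ with ⟨g, rfl⟩ | ⟨φ, -, rfl⟩
    · exact fun f hf => hE.gop_mem hΨ g hf
    · exact fun f hf => CoefSys.mulOp_mem hf φ
  | algebraMap a => exact fun f hf => smul_mem _ a hf
  | add P Q _ _ hP hQ => exact fun f hf => add_mem (hP f hf) (hQ f hf)
  | mul P Q _ _ hP hQ => exact fun f hf => hP _ (hQ f hf)

theorem colAlg_comm {c : List X → k} {χ : List X → G → k} {h : G}
    (hc : ∀ l, c (l.map (h⁻¹ • ·)) = c l) (hχ : ∀ l, χ (l.map (h⁻¹ • ·)) = χ l)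
    {Q : COp I X k} (hQ : Q ∈ colAlg G c χ) : Commute (gop h) Q := by
  induction hQ using Algebra.adjoin_induction with
  | mem Q hQ =>
    rcases hQ with ⟨g, rfl⟩ | ⟨φ, hφ, rfl⟩
    · exact gop_comm h g
    · exact gop_mulOp_comm fun l => hφ _ _ (hc l) (hχ l)
  | algebraMap a => exact (Algebra.commutes a _).symm
  | add P Q _ _ hP hQ => exact hP.add_right hQ
  | mul P Q _ _ hP hQ => exact hP.mul_right hQ

theorem InvCond.rel (hT : ∀ (g : G), ∀ x ∈ T, g • x ∈ T) :
    InvCond G ({(univ, T)} : Set (Set X × Set X)) := by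
  rintro _ rfl g
  exact ⟨fun _ _ => trivial, hT g⟩

theorem invCond_empty : InvCond G (∅ : Set (Set X × Set X)) := fun _ h => h.elim

theorem IsEq.cd_colAlg (hE : IsEq S G) (hT : ∀ (g : G), ∀ x ∈ T, g • x ∈ T) {c : List X → k}
    {χ : List X → G → k} (hl : ∀ x, ∃ a b, ∀ᶠ l in nl x T, l ≠ [] → c l = a ∧ χ l = b)
    {Q : COp I X k} (hQ : Q ∈ colAlg G c χ) {m : ℕ} :
    ∀ f ∈ S.Cpl ∅ m, cd (Q f) - Q (cd f) ∈ S.rel T (m + 1) := by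
  induction hQ using Algebra.adjoin_induction with
  | mem Q hQ =>
    rcases hQ with ⟨g, rfl⟩ | ⟨φ, hφ, rfl⟩
    · exact fun f hf => by rw [cd_gop, sub_self]; exact zero_mem _
    · intro f hf
      have h0 : cd (mulOp φ f) - mulOp φ (cd f) ∈ S.Cpl ∅ (m + 1) :=
        sub_mem (CoefSys.Cpl_isCx.mem (CoefSys.mulOp_mem hf φ))
          (CoefSys.mulOp_mem (CoefSys.Cpl_isCx.mem hf) φ)
      refine CoefSys.mem_rel.2 ⟨h0.1, h0.2.1, fun x i hi => ?_⟩
      obtain ⟨a, b, h⟩ := hl x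
      filter_upwards [eventually_nl_sub h] with l hl
      rw [Pi.sub_apply, Pi.sub_apply, mulOp_apply, cd_apply, cd_apply, sub_eq_zero]
      refine dA_congr l fun l' h1 h2 => ?_
      rw [mulOp_apply]
      by_cases hn : l' = []
      · rw [hn, hf.1 i [] (Or.inr rfl), mul_zero, mul_zero]
      · have e1 := hl l' h1 hn
        have e2 := hl l (fun _ h => h) (by rintro rfl; simp at h2)
        rw [hφ l' l (e1.1.trans e2.1.symm) (e1.2.trans e2.2.symm)]
  | algebraMap a =>
    intro f hf
    rw [Module.algebraMap_end_apply, Module.algebraMap_end_apply, map_smul, sub_self]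
    exact zero_mem _
  | add P Q _ _ hP hQ =>
    intro f hf
    have := add_mem (hP f hf) (hQ f hf)
    rw [LinearMap.add_apply, LinearMap.add_apply, map_add]
    convert this using 1
    abel
  | mul P Q mP mQ hP hQ =>
    intro f hf
    have := add_mem (hP _ (hE.colAlg_mem mQ invCond_empty f hf))
      (hE.colAlg_mem mP (InvCond.rel hT) _ (hQ f hf))
    rw [map_sub] at this
    convert this using 1
    simp

open Classical in
/-- A colored set has a section of the top power of an operator. -/
theorem Color.exists_section (hc : Color T α col χ) (hp : p.Prime) [CharP k p]
    (hG : ∀ g : G, g ^ p = 1) (hE : IsEq S G) : ∃ Θ : COp I X k,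
    (∀ Ψ, InvCond G Ψ → ∀ m, ∀ f ∈ S.Cpl Ψ m, Θ f ∈ S.Cpl Ψ m) ∧
    (∀ h : G, (∀ x ∈ T, χ x h = 0) → Commute (gop h) Θ) ∧
    (∀ Ψ, InvCond G Ψ → ∀ m f, top α f ∈ S.Cpl Ψ m →
      (top α ^ (p - 1)) (Θ f) - mulOp (fun l => if ∃ x ∈ l, x ∈ T then 1 else 0) f ∈ S.Cpl Ψ m) ∧
    ((∀ x, ∃ a b, ∀ᶠ y in 𝓝[T] x, col y = a ∧ χ y = b) →
      ∀ m, ∀ f ∈ S.Cpl ∅ m, cd (Θ f) - Θ (cd f) ∈ S.rel T (m + 1)) := by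
  obtain ⟨Θ, hΘ, h⟩ := exists_weyl (I := I) hp hG α (fst T col) (fst T χ) hc.col_fst hc.chi_fst
  refine ⟨Θ, fun Ψ hΨ m => hE.colAlg_mem hΘ hΨ, fun g hg => ?_, fun Ψ hΨ m f hf => ?_, fun hl m => ?_⟩
  · refine colAlg_comm (fun l => ?_) (fun l => hc.chi_fst g l) hΘ
    rw [hc.col_fst]
    rcases fst_cases T col χ l with ⟨x, -, hx, -, e⟩ | ⟨-, e⟩
    · rw [e, hg x hx, sub_zero]
    · rw [e, Pi.zero_apply, sub_zero]
  · convert h (S.Cpl Ψ m) (fun Q hQ => hE.colAlg_mem hQ hΨ) f hf using 5 with l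
    rcases fst_cases T col χ l with ⟨x, h1, hx, -, e⟩ | ⟨h1, e⟩
    · rw [if_pos ⟨x, h1, hx⟩, e, if_neg (hc.ne x hx)]
    · rw [if_neg (by simpa using h1), e, if_pos (by simp)]
  · refine hE.cd_colAlg hc.inv (fun x => ?_) hΘ
    obtain ⟨a, b, h⟩ := hl x
    obtain ⟨U, hU, hx, hU'⟩ := mem_nhdsWithin.1 h
    refine ⟨a, b, eventually_nl.2 ⟨U, hU, hx, fun l hl hn => ?_⟩⟩
    rcases fst_cases T col χ l with ⟨y, h1, -, e⟩ | ⟨h1, e⟩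
    · rw [e.1, e.2]
      exact hU' (hl y h1)
    · obtain ⟨y, hy⟩ := List.exists_mem_of_ne_nil l hn
      exact absurd (hl y hy).2 (h1 y hy)

end

section
variable [Fintype G] {p : ℕ} {α : G → k} {e : Set G} {A B : Set X}

/-- The points of `B` outside `A` have additive characters which are trivial on the stabilizer
and on `e` and which are nonzero on the combination `α`. -/
def HasChar (α : G → k) (e : Set G) (A B : Set X) : Prop :=
  ∀ x ∈ B, x ∉ A → ∃ χ : G → k, (∀ g h, χ (g * h) = χ g + χ h) ∧ (∀ g : G, g • x = x → χ g = 0) ∧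
    (∀ h ∈ e, χ h = 0) ∧ ∑ g, α g * χ g ≠ 0

theorem HasChar.exists_color (h : HasChar α e A B) (hA : ∀ g : G, ∀ x ∈ A, g • x ∈ A)
    (hB : ∀ g : G, ∀ x ∈ B, g • x ∈ B) :
    ∃ col χ, Color (B \ A) α col χ ∧ ∀ x ∈ B \ A, ∀ g ∈ e, χ x g = 0 := by
  classical
  have inv : ∀ g : G, ∀ x ∈ B \ A, g • x ∈ B \ A := fun g x hx => ⟨hB g x hx.1, fun h' => hx.2 (by
    simpa using hA g⁻¹ _ h')⟩
  have : ∀ x, ∃ χ : G → k, x ∈ B \ A → (∀ g h, χ (g * h) = χ g + χ h) ∧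
      (∀ g : G, g • x = x → χ g = 0) ∧ (∀ h ∈ e, χ h = 0) ∧ ∑ g, α g * χ g ≠ 0 := fun x => by
    by_cases hx : x ∈ B \ A
    · obtain ⟨χ, h⟩ := h x hx.1 hx.2
      exact ⟨χ, fun _ => h⟩
    · exact ⟨0, fun h => absurd h hx⟩
  choose χ hχ using this
  let rep : X → X := fun x => (Quotient.mk (orbitRel G X) x).out
  have hrep : ∀ x, ∃ g : G, g • rep x = x := fun x =>
    (orbitRel G X).symm (Quotient.mk_out (s := orbitRel G X) x)
  have rep_smul : ∀ (g : G) x, rep (g • x) = rep x := fun g x =>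
    congrArg Quotient.out (Quotient.sound (s := orbitRel G X) ⟨g, rfl⟩)
  choose γ hγ using hrep
  have hr : ∀ x ∈ B \ A, rep x ∈ B \ A := fun x hx => by
    have := inv (γ x)⁻¹ x hx
    rwa [inv_smul_eq_iff.2 (hγ x).symm] at this
  refine ⟨fun x => χ (rep x) (γ x), fun x => χ (rep x), ⟨inv, fun g x hx => ?_, fun g x _ => ?_,
    fun x hx => (hχ _ (hr x hx)).2.2.2⟩, fun x hx => (hχ _ (hr x hx)).2.2.1⟩
  · obtain ⟨h1, h2, -, -⟩ := hχ _ (hr x hx)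
    have h3 := h2 ((γ x)⁻¹ * (g * γ (g⁻¹ • x))) (by
      have := hγ (g⁻¹ • x)
      rw [rep_smul] at this
      rw [mul_smul, mul_smul, this, smul_inv_smul, inv_smul_eq_iff, hγ])
    have h4 := h1 (γ x) ((γ x)⁻¹ * (g * γ (g⁻¹ • x)))
    rw [mul_inv_cancel_left, h3, add_zero, h1] at h4
    simp only [rep_smul]
    rw [← h4]; ring
  · simp only [rep_smul]

variable [TopologicalSpace X] [T2Space X] [RegularSpace X]

theorem HasChar.exists_tube (h : HasChar α e A B) (hc : ∀ g : G, Continuous fun x : X => g • x)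
    (hB : ∀ g : G, ∀ x ∈ B, g • x ∈ B) {x : X} (hxB : x ∈ B) (hxA : x ∉ A) :
    ∃ Z ⊆ B, ∃ U ∈ 𝓝 x, U ∩ B ⊆ Z ∧ ∃ col χ, Color Z α col χ ∧ (∀ x ∈ Z, ∀ g ∈ e, χ x g = 0) ∧
      ∀ x, ∃ a b, ∀ᶠ y in 𝓝[Z] x, col y = a ∧ χ y = b := by
  classical
  obtain ⟨χ, h1, h2, h3, h4⟩ := h x hxB hxA
  have : ∀ᶠ q : X × X in 𝓝 x ×ˢ 𝓝 x, ∀ g : G, g • q.1 = q.2 → g • x = x := by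
    rw [eventually_all]
    intro g
    by_cases hg : g • x = x
    · exact Eventually.of_forall fun _ _ => hg
    · rw [← nhds_prod_eq]
      filter_upwards [(isOpen_ne_fun ((hc g).comp continuous_fst) continuous_snd).mem_nhds
        (x := (x, x)) hg] with q hq h using absurd h hq
  obtain ⟨t, ht, htg⟩ := (eventually_prod_self_iff (r := fun y z => ∀ g : G, g • y = z → g • x = x)).1 this
  obtain ⟨V, hV, hVc, hVt⟩ := exists_mem_nhds_isClosed_subset ht
  have χi : ∀ g, χ g⁻¹ = - χ g := fun g => by
    have e1 := h1 g g⁻¹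
    have e2 := h2 1 (one_smul _ _)
    rw [mul_inv_cancel, e2] at e1
    linear_combination -e1
  have uniq : ∀ (z : X) (g h : G), g⁻¹ • z ∈ V → h⁻¹ • z ∈ V → χ g = χ h := fun z g h hg hh => by
    have := h2 _ (htg _ (hVt hg) _ (hVt hh) (h⁻¹ * g) (by rw [mul_smul, smul_inv_smul]))
    rw [h1, χi] at this
    linear_combination this
  obtain ⟨col, hcol⟩ : ∃ col : X → k, ∀ z (g : G), g⁻¹ • z ∈ V → col z = χ g := by
    refine ⟨fun z => if h : ∃ g : G, g⁻¹ • z ∈ V then χ h.choose else 0, fun z g hg => ?_⟩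
    have hz : ∃ g : G, g⁻¹ • z ∈ V := ⟨g, hg⟩
    simp only
    rw [dif_pos hz]
    exact uniq z _ _ hz.choose_spec hg
  refine ⟨{z | z ∈ B ∧ ∃ g : G, g⁻¹ • z ∈ V}, fun _ h => h.1, V, hV,
    fun y hy => ⟨hy.2, 1, by simpa using hy.1⟩, col, fun _ => χ,
    ⟨fun a z hz => ⟨hB a z hz.1, ?_⟩, fun a z hz => ?_, fun _ _ _ => rfl, fun _ _ => h4⟩,
    fun _ _ => h3, fun z => ⟨col z, χ, ?_⟩⟩
  · obtain ⟨g, hg⟩ := hz.2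
    exact ⟨a * g, by simpa [mul_smul] using hg⟩
  · obtain ⟨g, hg⟩ := hz.2
    rw [hcol z g hg, hcol (a⁻¹ • z) (a⁻¹ * g) (by rwa [mul_inv_rev, inv_inv, mul_smul,
      smul_inv_smul]), h1, χi]
    ring
  · have : ∀ᶠ y in 𝓝 z, ∀ g : G, g⁻¹ • y ∈ V → g⁻¹ • z ∈ V := by
      rw [eventually_all]
      intro g
      by_cases hg : g⁻¹ • z ∈ V
      · exact Eventually.of_forall fun _ _ => hg
      · filter_upwards [(hVc.isOpen_compl.preimage (hc g⁻¹)).mem_nhds hg] with y hy h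
          using absurd h hy
    filter_upwards [mem_nhdsWithin_of_mem_nhds this, self_mem_nhdsWithin] with y hy hyZ
    obtain ⟨g, hg⟩ := hyZ.2
    exact ⟨by rw [hcol y g hg, hcol z g (hy g hg)], rfl⟩

end

section
variable [Fintype G] {p : ℕ} {α : G → k} {e : Set G} {A B : Set X} [TopologicalSpace X]
  {S : CoefSys X I k} {Ψ : Set (Set X × Set X)} {m : ℕ} {x : I → List X → k}

/-- Cochains subject to vanishing conditions which are fixed by `e` modulo those vanishing on `B`. -/
def fixC (S : CoefSys X I k) (e : Set G) (Ψ : Set (Set X × Set X)) (B : Set X) (m : ℕ) :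
    Submodule k (I → List X → k) :=
  S.Cpl Ψ m ⊓ ⨅ h ∈ e, (S.rel B m).comap (gop h - 1)

theorem mem_fixC : x ∈ fixC S e Ψ B m ↔ x ∈ S.Cpl Ψ m ∧ ∀ h ∈ e, gop h x - x ∈ S.rel B m := by
  simp [fixC]

/-- Invariant conditions concerning tuples in `B`. -/
structure Adm (G : Type*) [Group G] [MulAction G X] (B : Set X) (Ψ : Set (Set X × Set X)) :
    Prop where
  inv : InvCond G Ψ
  sub : ∀ P ∈ Ψ, P.2 ⊆ B
  stab : ∀ (g : G), ∀ x ∈ B, g • x ∈ B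

theorem Adm.rel_le (hΨ : Adm G B Ψ) (m : ℕ) : S.rel B m ≤ S.Cpl Ψ m := fun _ hf =>
  ⟨hf.1, hf.2.1, fun P hP x _ => ((CoefSys.mem_rel.1 hf).2.2 x).mono (hΨ.sub P hP)⟩

theorem fixC_map {Q : COp I X k} (h1 : ∀ f ∈ S.Cpl Ψ m, Q f ∈ S.Cpl Ψ m)
    (h2 : ∀ f ∈ S.rel B m, Q f ∈ S.rel B m) (h3 : ∀ h ∈ e, Commute (gop h) Q)
    (hx : x ∈ fixC S e Ψ B m) : Q x ∈ fixC S e Ψ B m := by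
  rw [mem_fixC] at hx ⊢
  refine ⟨h1 _ hx.1, fun h hh => ?_⟩
  rw [← End.mul_apply, (h3 h hh).eq, End.mul_apply, ← map_sub]
  exact h2 _ (hx.2 h hh)

theorem fixC_cd (hx : x ∈ fixC S e Ψ B m) : cd x ∈ fixC S e Ψ B (m + 1) := by
  rw [mem_fixC] at hx ⊢
  refine ⟨CoefSys.Cpl_isCx.mem hx.1, fun h hh => ?_⟩
  rw [← cd_gop, ← map_sub]
  exact CoefSys.Cpl_isCx.mem (hx.2 h hh)

theorem IsEq.top_pow_mem (hE : IsEq S G) (hΨ : InvCond G Ψ) (n : ℕ) (hx : x ∈ S.Cpl Ψ m) :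
    (top α ^ n) x ∈ S.Cpl Ψ m := by
  set Al : Subalgebra k (COp I X k) :=
    colAlg G (fun _ : List X => (0 : k)) 0 with hAl
  have mg : ∀ g : G, (gop g : COp I X k) ∈ Al :=
    fun g => Algebra.subset_adjoin (Or.inl ⟨g, rfl⟩)
  have h : top α ∈ Al := sum_mem fun g _ => Al.smul_mem (sub_mem (mg g) (one_mem _)) _
  exact hE.colAlg_mem (pow_mem h n) hΨ x hx

variable (hp : p.Prime) [CharP k p] (hG : ∀ g : G, g ^ p = 1) (hE : IsEq S G)

theorem fixC_top_pow (hE : IsEq S G) (hΨ : Adm G B Ψ) (n : ℕ) (hx : x ∈ fixC S e Ψ B m) :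
    (top α ^ n) x ∈ fixC S e Ψ B m :=
  fixC_map (fun _ => hE.top_pow_mem hΨ.inv n) (fun _ => hE.top_pow_mem (InvCond.rel hΨ.stab) n)
    (fun h _ => ((top_comm_gop α h).pow_left n).symm) hx

theorem fixC_top (hE : IsEq S G) (hΨ : Adm G B Ψ) (hx : x ∈ fixC S e Ψ B m) :
    top α x ∈ fixC S e Ψ B m := by
  simpa using fixC_top_pow (α := α) hE hΨ 1 hx

theorem rel_top_pow (hE : IsEq S G) (hB : ∀ (g : G), ∀ x ∈ B, g • x ∈ B) (n : ℕ)
    (hx : x ∈ S.rel B m) : (top α ^ n) x ∈ S.rel B m := hE.top_pow_mem (InvCond.rel hB) n hx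

theorem rel_top (hE : IsEq S G) (hB : ∀ (g : G), ∀ x ∈ B, g • x ∈ B) (hx : x ∈ S.rel B m) :
    top α x ∈ S.rel B m := by simpa using rel_top_pow (α := α) hE hB 1 hx

theorem cd_top_comm (α : G → k) : Commute (cd : COp I X k) (top α) :=
  LinearMap.ext fun f => top_cd α f

include hp hG hE

theorem Adm.pcx (hΨ : Adm G B Ψ) :
    PCx cd (top α) (top α ^ (p - 1)) (fixC S e Ψ B) (S.rel B) where
  dd := cd_cd
  op :=
    { da := fun x => top_cd α x
      db := fun x => LinearMap.congr_fun ((cd_top_comm α).pow_right _).eq x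
      ab := fun x => by
        rw [← End.mul_apply, mul_pow_sub_one hp.ne_zero, top_pow hp hG]; rfl
      ba := fun x => by
        rw [← End.mul_apply, pow_sub_one_mul hp.ne_zero, top_pow hp hG]; rfl }
  cK := ⟨by rw [eq_bot_iff, ← CoefSys.Cpl_isCx (S := S) (Ψ := Ψ).zero]; exact inf_le_left, fixC_cd⟩
  cL := CoefSys.Cpl_isCx
  oK := ⟨fixC_top hE hΨ, fixC_top_pow hE hΨ _⟩
  oL := ⟨rel_top hE hΨ.stab, rel_top_pow hE hΨ.stab _⟩
  le := fun m x hx => mem_fixC.2 ⟨hΨ.rel_le m hx, fun h _ =>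
    sub_mem (hE.gop_mem (InvCond.rel hΨ.stab) h hx) hx⟩

open Classical in
theorem Adm.free (hΨ : Adm G B Ψ) (hA : (univ, A) ∈ Ψ) (hχ : HasChar α e A B) :
    Free (top α) (top α ^ (p - 1)) (fixC S e Ψ B) (S.rel B) := by
  refine Free.of_ker hp.two_le (fun m x => fixC_top hE hΨ) fun m x hx htx => ?_
  obtain ⟨col, χ, hc, hχe⟩ := hχ.exists_color (fun g => (hΨ.inv _ hA g).2) hΨ.stab
  obtain ⟨Θ, h1, h2, h3, -⟩ := hc.exists_section hp hG hE
  refine ⟨Θ x, fixC_map (h1 Ψ hΨ.inv m) (h1 _ (InvCond.rel hΨ.stab) m)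
    (fun h hh => h2 h fun y hy => hχe y hy h hh) hx, ?_⟩
  have h4 := h3 _ (InvCond.rel hΨ.stab) m x htx
  have hx1 := (mem_fixC.1 hx).1
  set φ : List X → k := fun l => if ∃ x ∈ l, x ∈ B \ A then 1 else 0 with hφ
  have h5 : x - mulOp φ x ∈ S.rel B m := by
    have h0 := sub_mem hx1 (CoefSys.mulOp_mem hx1 φ)
    refine CoefSys.mem_rel.2 ⟨h0.1, h0.2.1, fun y i hi => ?_⟩
    have h : ∀ᶠ l in nl y B, (∀ z ∈ l, z ∈ B) ∧ ((∀ z ∈ l, z ∈ A) → x i l = 0) := by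
      obtain ⟨U, hU, hyU, h⟩ := eventually_nl.1 (hx1.2.2 _ hA y trivial i hi)
      exact eventually_nl.2 ⟨U, hU, hyU, fun l hl => ⟨fun z hz => (hl z hz).2,
        fun hlA => h l fun z hz => ⟨(hl z hz).1, hlA z hz⟩⟩⟩
    filter_upwards [h] with l h
    rw [Pi.sub_apply, Pi.sub_apply, mulOp_apply, hφ]
    by_cases hl : ∃ z ∈ l, z ∈ B \ A
    · simp only [if_pos hl, one_mul, sub_self]
    · simp only [if_neg hl, zero_mul, sub_zero]
      push Not at hl
      exact h.2 fun z hz => by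
        by_contra hzA
        exact hl z hz ⟨h.1 z hz, hzA⟩
  have h6 : (top α ^ (p - 1)) (Θ x) - mulOp φ x ∈ S.rel B m := by
    convert h4 using 3
    · rfl
    · rw [hφ]
      congr! 3
  simpa only [sub_sub_sub_cancel_right] using sub_mem h5 h6

end

section
variable [Fintype G] {p : ℕ} {α : G → k} {e : Set G} {A B : Set X} [TopologicalSpace X]
  {S : CoefSys X I k} {Ψ : Set (Set X × Set X)}

/-- Cocycles of the total complex are annihilated by a shift. -/
def Kill (S : CoefSys X I k) (p : ℕ) (α : G → k) (e : Set G) (A B : Set X)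
    (Ψ : Set (Set X × Set X)) : Prop :=
  ∀ m, ∀ z ∈ tot (fixC S e Ψ B) m, totD cd (top α) (top α ^ (p - 1)) z ∈ tot (S.rel B) (m + 1) →
    ∃ N, ∃ Y ∈ tot (fixC S e {(univ, A)} B) (m + 2 * N - 1),
      sft (k := k) (2 * N) z - totD cd (top α) (top α ^ (p - 1)) Y ∈ tot (S.rel B) (m + 2 * N)

theorem Kill.of_le (h : ∀ m, S.Cpl Ψ m ≤ S.rel B m) : Kill S p α e A B Ψ := fun m z hz _ =>
  ⟨0, 0, zero_mem _, by
    rw [map_zero, sub_zero]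
    exact sft_mem_tot (mem_tot.2 fun a => h _ (mem_fixC.1 (mem_tot.1 hz a)).1)⟩

theorem fixC_mono {Ψ' : Set (Set X × Set X)} (h : Ψ ⊆ Ψ') (m : ℕ) :
    fixC S e Ψ' B m ≤ fixC S e Ψ B m := fun _ hx =>
  have hx := mem_fixC.1 hx
  mem_fixC.2 ⟨⟨hx.1.1, hx.1.2.1, fun P hP => hx.1.2.2 P (h hP)⟩, hx.2⟩

theorem sft_sft (a b : ℕ) (F : ℕ → I → List X → k) :
    sft (k := k) a (sft (k := k) b F) = sft (k := k) (b + a) F := by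
  funext c
  by_cases h : c < a
  · rw [sft_of_lt h, sft_of_lt (by omega)]
  · obtain ⟨c, rfl⟩ : ∃ c', c = c' + a := ⟨c - a, by omega⟩
    rw [sft_add]
    by_cases h' : c < b
    · rw [sft_of_lt h', sft_of_lt (by omega)]
    · obtain ⟨c, rfl⟩ : ∃ c', c = c' + b := ⟨c - b, by omega⟩
      rw [sft_add, add_assoc, sft_add]

theorem fixC_zero : fixC S e Ψ B 0 = ⊥ := by
  rw [eq_bot_iff, ← CoefSys.Cpl_isCx (S := S) (Ψ := Ψ).zero]
  exact inf_le_left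

theorem sft_mem_tot_pred {j r : ℕ} {Y : ℕ → I → List X → k} (hY : Y ∈ tot (fixC S e Ψ B) (j - 1)) :
    sft (k := k) r Y ∈ tot (fixC S e Ψ B) (j + r - 1) := by
  rcases j with _ | j
  · have : Y = 0 := funext fun a => by
      have := mem_tot.1 hY a
      rwa [Nat.zero_sub, fixC_zero, Submodule.mem_bot] at this
    rw [this, map_zero]
    exact zero_mem _
  · convert sft_mem_tot (r := r) hY using 2
    omega

/-- It suffices to annihilate a shift of a cohomologous cocycle. -/
theorem Kill.reduce {Ψ' : Set (Set X × Set X)} (hA : (univ, A) ∈ Ψ)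
    (h : Kill S p α e A B Ψ') (dd : ∀ F : ℕ → I → List X → k,
      totD cd (top α) (top α ^ (p - 1)) (totD cd (top α) (top α ^ (p - 1)) F) = 0) {m : ℕ}
    {z : ℕ → I → List X → k}
    (hdz : totD cd (top α) (top α ^ (p - 1)) z ∈ tot (S.rel B) (m + 1)) {M : ℕ}
    {Y : ℕ → I → List X → k} (hY : Y ∈ tot (fixC S e Ψ B) (m + 2 * M - 1))
    (hz : sft (k := k) (2 * M) z - totD cd (top α) (top α ^ (p - 1)) Y ∈
      tot (fixC S e Ψ' B) (m + 2 * M)) :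
    ∃ N, ∃ Y ∈ tot (fixC S e {(univ, A)} B) (m + 2 * N - 1),
      sft (k := k) (2 * N) z - totD cd (top α) (top α ^ (p - 1)) Y ∈ tot (S.rel B) (m + 2 * N) := by
  obtain ⟨N, W, hW, h⟩ := h _ _ hz (by
    rw [map_sub, dd, sub_zero, sft_totD, add_right_comm]
    exact sft_mem_tot hdz)
  refine ⟨M + N, sft (k := k) (2 * N) Y + W, add_mem ?_ ?_, ?_⟩
  · rw [mul_add, ← add_assoc]
    exact sft_mem_tot_pred (tot_mono (fixC_mono (Set.singleton_subset_iff.2 hA)) _ hY)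
  · convert hW using 2
    omega
  · rw [map_sub, ← sft_totD, sft_sft, sub_sub, ← map_add] at h
    rw [mul_add, ← add_assoc]
    exact h

variable (hp : p.Prime) [CharP k p] (hG : ∀ g : G, g ^ p = 1) (hE : IsEq S G)

theorem fixC_le_Cpl (m : ℕ) : fixC S e Ψ B m ≤ S.Cpl Ψ m := inf_le_left

theorem Adm.insert (hΨ : Adm G B Ψ) {Z : Set X} (hZ : Z ⊆ B)
    (hZi : ∀ (g : G), ∀ x ∈ Z, g • x ∈ Z) : Adm G B (insert (univ, Z) Ψ) where
  inv := by
    rintro P (rfl | hP) g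
    · exact ⟨fun _ _ => trivial, hZi g⟩
    · exact hΨ.inv P hP g
  sub := by
    rintro P (rfl | hP)
    · exact hZ
    · exact hΨ.sub P hP
  stab := hΨ.stab

include hp hG hE

theorem Kill.of_insert (hΨ : Adm G B Ψ) (hA : (univ, A) ∈ Ψ) (hχ : HasChar α e A B)
    {Z : Set X} (hZ : Z ⊆ B) {col : X → k} {χ : X → G → k} (hc : Color Z α col χ)
    (hχe : ∀ x ∈ Z, ∀ g ∈ e, χ x g = 0)
    (hl : ∀ x, ∃ a b, ∀ᶠ y in 𝓝[Z] x, col y = a ∧ χ y = b)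
    (h : Kill S p α e A B (insert (univ, Z) Ψ)) : Kill S p α e A B Ψ := by
  classical
  intro m z hz hdz
  have hpc := hΨ.pcx (e := e) (α := α) hp hG hE
  obtain ⟨Y, hY, hF⟩ := hpc.exists_sub_mem_iot (hΨ.free hp hG hE hA hχ) hz
    fun a => by simpa using mem_tot.1 hdz (a + 1)
  have dd := totD_totD cd_cd hpc.op
  set D := totD (cd : COp I X k) (top α) (top α ^ (p - 1)) with hD
  set F := z - D Y with hFz
  have hDF : D F ∈ tot (S.rel B) (m + 1) := by rw [hFz, map_sub, dd, sub_zero]; exact hdz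
  obtain ⟨Θ, h1, h2, h3, h4⟩ := hc.exists_section hp hG hE
  obtain ⟨hF0, hF1⟩ := mem_iot.1 hF
  obtain ⟨hy, hty⟩ := mem_fixd.1 hF0
  set y := F 0
  have hyC := fixC_le_Cpl m hy
  have hrZ : ∀ j, S.rel B j ≤ S.rel Z j := fun j => S.rel_anti hZ j
  have hdy : cd y ∈ S.rel B (m + 1) := by simpa [hD] using mem_tot.1 hDF 0
  have hw : Θ y ∈ fixC S e Ψ B m :=
    fixC_map (h1 Ψ hΨ.inv m) (h1 _ (InvCond.rel hΨ.stab) m) (fun h hh => h2 h fun x hx => hχe x hx h hh) hy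
  have hdw : cd (Θ y) ∈ S.rel Z (m + 1) := by
    have := add_mem (h4 hl m y ⟨hyC.1, hyC.2.1, fun _ h => h.elim⟩)
      (hrZ _ (h1 _ (InvCond.rel hΨ.stab) _ _ hdy))
    simpa using this
  have hyw : y - (top α ^ (p - 1)) (Θ y) ∈ S.rel Z m := by
    have h5 := hrZ _ (h3 _ (InvCond.rel hΨ.stab) m y hty)
    have h6 := sub_mem hyC (CoefSys.mulOp_mem hyC fun l => if ∃ x ∈ l, x ∈ Z then (1 : k) else 0)
    have h7 : y - mulOp (fun l => if ∃ x ∈ l, x ∈ Z then (1 : k) else 0) y ∈ S.rel Z m := by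
      refine CoefSys.mem_rel.2 ⟨h6.1, h6.2.1, fun x c _ => ?_⟩
      refine eventually_nl.2 ⟨univ, isOpen_univ, trivial, fun l hl => ?_⟩
      rw [Pi.sub_apply, Pi.sub_apply, mulOp_apply]
      rcases l with _ | ⟨x, l⟩
      · rw [hyC.1 c [] (Or.inr rfl), mul_zero, sub_zero]
      · have hx := (hl x mem_cons_self).2
        rw [if_pos ⟨x, mem_cons_self, hx⟩, one_mul, sub_self]
    have h8 : (top α ^ (p - 1)) (Θ y) -
        mulOp (fun l => if ∃ x ∈ l, x ∈ Z then (1 : k) else 0) y ∈ S.rel Z m := by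
      convert h5
    simpa only [sub_sub_sub_cancel_right] using sub_mem h7 h8
  have hins : ∀ {j x}, x ∈ fixC S e Ψ B j → x ∈ S.rel Z j →
      x ∈ fixC S e (insert (univ, Z) Ψ) B j := fun {j x} hx hxZ => by
    refine mem_fixC.2 ⟨⟨hxZ.1, hxZ.2.1, ?_⟩, (mem_fixC.1 hx).2⟩
    rintro P (rfl | hP)
    · exact hxZ.2.2 _ rfl
    · exact (fixC_le_Cpl _ hx).2.2 P hP
  refine Kill.reduce hA h dd hdz (M := 1)
    (Y := sft (k := k) (2 * 1) Y + Pi.single 1 (Θ y)) (add_mem (sft_mem_tot_pred hY) (single_mem_tot hw)) ?_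
  have hs : D (sft (k := k) (2 * 1) Y) = sft (k := k) (2 * 1) (D Y) := sft_totD 1 Y
  change _ - D _ ∈ _
  rw [map_add, hs, ← sub_sub, ← map_sub, ← hFz]
  refine mem_tot.2 fun a => ?_
  have hdo := hΨ.insert hZ hc.inv
  rcases a with _ | _ | _ | a
  · rw [Pi.sub_apply, sft_of_lt (by omega), hD, totD_single_of_ne _ (by omega) (by omega), sub_zero]
    exact zero_mem _
  · rw [Pi.sub_apply, sft_of_lt (by omega), hD, totD_single_self]
    simpa using hins (fixC_cd hw) hdw
  · rw [Pi.sub_apply, sft_add (a := 0), hD, totD_single_succ]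
    exact hins (sub_mem hy (fixC_top_pow hE hΨ _ hw)) hyw
  · rw [Pi.sub_apply, sft_add (a := a + 1), hD, totD_single_of_ne _ (by omega) (by omega), sub_zero]
    exact (hdo.pcx hp hG hE (α := α)).le _ (by convert hF1 a using 2; omega)

end

section
theorem hA_map (r s : X → X) (h : ∀ x, r (s x) = s (r x)) (l : List X) : ∀ f : List X → k,
    hA r (l.map s) f = hA r l fun m => f (m.map s) := by
  induction l with
  | nil => intro f; rfl
  | cons x l ih =>
    intro f
    rw [map_cons, hA, hA, ih]
    simp [comp_def, h]

theorem prism_gop {r : X → X} {g : G} (h : ∀ x, r (g⁻¹ • x) = g⁻¹ • r x) (f : I → List X → k) :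
    prism r (gop g f) = gop g (prism r f) := by
  ext c l
  rw [prism_apply, gop_apply, prism_apply, hA_map r _ h]
  rfl

theorem pb_gop {r : X → X} {g : G} (h : ∀ x, r (g⁻¹ • x) = g⁻¹ • r x) (f : I → List X → k) :
    pb id r (gop g f) = gop g (pb id r f) := by
  ext c l
  simp [pb_apply, gop_apply, comp_def, h]

variable [Fintype G] {p : ℕ} {α : G → k} {e : Set G} {A B : Set X} [MetricSpace X] [CompactSpace X]
  [Finite I] {S : CoefSys X I k}

theorem prism_top {r : X → X} (h : ∀ (g : G) x, r (g • x) = g • r x) (f : I → List X → k) :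
    prism r (top α f) = top α (prism r f) := by
  simp [top, LinearMap.sum_apply, prism_gop fun x => h _ x]

variable (hp : p.Prime) [CharP k p] (hG : ∀ g : G, g ^ p = 1) (hE : IsEq S G)

include hp hG hE

theorem Kill.of_finite {Ψ : Set (Set X × Set X)} (hΨ : Adm G B Ψ) (hA : (univ, A) ∈ Ψ)
    (hχ : HasChar α e A B) {T : Set (Set X)} (hT : T.Finite)
    (hc : ∀ Z ∈ T, Z ⊆ B ∧ ∃ col χ, Color Z α col χ ∧ (∀ x ∈ Z, ∀ g ∈ e, χ x g = 0) ∧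
      ∀ x, ∃ a b, ∀ᶠ y in 𝓝[Z] x, col y = a ∧ χ y = b)
    (h : ∀ m, S.Cpl (Ψ ∪ (fun Z => (univ, Z)) '' T) m ≤ S.rel B m) :
    Kill S p α e A B Ψ := by
  induction T, hT using Set.Finite.induction_on generalizing Ψ with
  | empty => exact Kill.of_le (by simpa using h)
  | @insert Z T _ _ ih =>
    obtain ⟨hZ, col, χ, h1, h2, h3⟩ := hc Z (Set.mem_insert _ _)
    refine Kill.of_insert hp hG hE hΨ hA hχ hZ h1 h2 h3 (ih (hΨ.insert hZ h1.inv) (Or.inr hA)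
      (fun Z hZ => hc Z (Or.inr hZ)) ?_)
    rwa [Set.image_insert_eq, Set.union_insert, ← Set.insert_union] at h

theorem kill (hA : ∀ g : G, ∀ x ∈ A, g • x ∈ A) (hB : ∀ g : G, ∀ x ∈ B, g • x ∈ B) (hAB : A ⊆ B)
    (hBc : IsClosed B) (hst : ∀ x ∈ B, x ∉ A → ∀ a ∈ A, ∀ g : G, g • x = x → g • a = a)
    (hχ : HasChar α e A B) : Kill S p α e A B {(univ, A)} := by
  classical
  have hΨ : Adm G B {(univ, A)} :=
    ⟨InvCond.rel hA, by rintro P rfl; exact hAB, hB⟩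
  have hcl : ∀ T : Set X, ∀ P ∈ ({(univ, T)} : Set (Set X × Set X)), IsClosed P.1 := by
    rintro T P rfl; exact isClosed_univ
  intro m z hz hdz
  have hpc := hΨ.pcx (e := e) (α := α) hp hG hE
  obtain ⟨Y, hY, hF⟩ := hpc.exists_sub_mem_iot (hΨ.free hp hG hE rfl hχ) hz
    fun a => by simpa using mem_tot.1 hdz (a + 1)
  have dd := totD_totD cd_cd hpc.op
  set D := totD (cd : COp I X k) (top α) (top α ^ (p - 1)) with hD
  set F := z - D Y with hFz
  have hDF : D F ∈ tot (S.rel B) (m + 1) := by rw [hFz, map_sub, dd, sub_zero]; exact hdz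
  obtain ⟨hF0, hF1⟩ := mem_iot.1 hF
  obtain ⟨hy, hty⟩ := mem_fixd.1 hF0
  set y := F 0
  have hyC := fixC_le_Cpl m hy
  have hdy : cd y ∈ S.rel B (m + 1) := by simpa [hD] using mem_tot.1 hDF 0
  have hye := (mem_fixC.1 hy).2
  obtain ⟨ε₁, hε₁, h1⟩ := exists_snap_radius (finite_singleton _) (hcl _) hyC
  obtain ⟨ε₂, hε₂, h2⟩ := exists_snap_radius (finite_singleton _) (hcl _) hdy
  obtain ⟨ε₃, hε₃, h3⟩ := exists_snap_radius (finite_singleton _) (hcl _) hty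
  obtain ⟨ε₄, hε₄, h4⟩ := exists_pos_forall (ι := e) (P := fun g ε => ∀ r : X → X,
      (∀ x, dist (r x) x < ε) → (∀ x ∈ B, r x ∈ B) →
      pb id r (gop (g : G) y - y) ∈ S.rel B m ∧ prism r (gop (g : G) y - y) ∈ S.rel B (m - 1))
    (fun g a b _ hab h r hr => h r fun x => (hr x).trans_le hab) fun g => by
      obtain ⟨ε, hε, h⟩ :=
        exists_snap_radius (finite_singleton _) (hcl _) (hye g g.2)
      refine ⟨ε, hε, fun r hr hrB => ?_⟩
      have := h r hr (by rintro P rfl; exact hrB)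
      exact ⟨this.1, this.2.1⟩
  obtain ⟨r, O, hr, hrA, hr', hrg, hO, hAO, hOB, -, hOg⟩ := exists_snap hE.cont hA hB hst
    (lt_min (lt_min hε₁ hε₂) (lt_min hε₃ hε₄))
  simp only [lt_min_iff] at hr
  have hrB : ∀ x ∈ B, r x ∈ B := fun x hx => (hr' x).elim (fun h => by rwa [h]) fun h => hAB h
  obtain ⟨a1, a2, a3⟩ := h1 r (fun x => (hr x).1.1)
    (by rintro P rfl x hx; exact (hrA x hx).symm ▸ hx)
  obtain ⟨-, b2, -⟩ := h2 r (fun x => (hr x).1.2) (by rintro P rfl; exact hrB)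
  obtain ⟨-, c2, -⟩ := h3 r (fun x => (hr x).2.1) (by rintro P rfl; exact hrB)
  have h4 := fun g : e => h4 g r (fun x => (hr x).2.2) hrB
  have hpy : prism r y ∈ fixC S e {(univ, A)} B (m - 1) :=
    mem_fixC.2 ⟨a2, fun g hg => by
      rw [← prism_gop fun x => hrg _ x, ← map_sub]; exact (h4 ⟨g, hg⟩).2⟩
  set Ψ : Set (Set X × Set X) := {(univ, A), (O, B)}
  have hΨ' : Adm G B Ψ := by
    refine ⟨?_, ?_, hB⟩
    · rintro P (rfl | rfl) g
      · exact ⟨fun _ _ => trivial, hA g⟩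
      · exact ⟨hOg g, hB g⟩
    · rintro P (rfl | rfl)
      · exact hAB
      · exact le_rfl
  have hpy' : pb id r y ∈ fixC S e Ψ B m := by
    refine mem_fixC.2 ⟨⟨a1.1, a1.2.1, ?_⟩, fun g hg => ?_⟩
    · rintro P (rfl | rfl)
      · exact a1.2.2 _ rfl
      · exact a3 O A B hO hOB rfl
    · rw [← pb_gop fun x => hrg _ x, ← map_sub]; exact (h4 ⟨g, hg⟩).1
  have hK : Kill S p α e A B Ψ := by
    have : ∀ x ∈ B \ O, ∃ Z ⊆ B, ∃ U ∈ 𝓝 x, U ∩ B ⊆ Z ∧ ∃ col χ, Color Z α col χ ∧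
        (∀ x ∈ Z, ∀ g ∈ e, χ x g = 0) ∧ ∀ x, ∃ a b, ∀ᶠ y in 𝓝[Z] x, col y = a ∧ χ y = b :=
      fun x hx => hχ.exists_tube hE.cont hB hx.1 fun h => hx.2 (hAO h)
    choose! Z hZB U hU hUZ hcol using this
    obtain ⟨t, ht, htU⟩ := (hBc.sdiff hO).isCompact.elim_nhds_subcover
      (fun x => interior (U x)) fun x hx => interior_mem_nhds.2 (hU x hx)
    refine Kill.of_finite hp hG hE hΨ' (Or.inl rfl) hχ (t.finite_toSet.image Z) ?_ ?_
    · rintro _ ⟨x, hx, rfl⟩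
      exact ⟨hZB x (ht x hx), hcol x (ht x hx)⟩
    · intro m f hf
      refine CoefSys.mem_rel.2 ⟨hf.1, hf.2.1, fun x => ?_⟩
      by_cases hxB : x ∈ B
      · by_cases hxO : x ∈ O
        · exact hf.2.2 (O, B) (Or.inl (Or.inr rfl)) x hxO
        · obtain ⟨x', hx', hxU⟩ := Set.mem_iUnion₂.1 (htU ⟨hxB, hxO⟩)
          have := hf.2.2 (univ, Z x') (Or.inr ⟨_, ⟨x', hx', rfl⟩, rfl⟩) x trivial
          intro c hc
          obtain ⟨V, hV, hxV, h⟩ := eventually_nl.1 (this c hc)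
          exact eventually_nl.2 ⟨V ∩ interior (U x'), hV.inter isOpen_interior, ⟨hxV, hxU⟩,
            fun l hl => h l fun w hw => ⟨(hl w hw).1.1,
              hUZ x' (ht x' hx') ⟨interior_subset (hl w hw).1.2, (hl w hw).2⟩⟩⟩
      · exact CoefSys.VanAt.of_notMem (by rwa [hBc.closure_eq]) fun c => hf.1 c [] (Or.inr rfl)
  refine Kill.reduce (Ψ := {(univ, A)}) rfl hK dd hdz (M := 0) (Y := Y - Pi.single 0 (prism r y))
    (sub_mem hY (single_mem_tot hpy)) ?_
  have hs : sft (k := k) (2 * 0) z = z := funext fun a => sft_add 0 a z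
  change _ - D _ ∈ _
  rw [map_sub, hs, ← sub_add, ← hFz]
  refine mem_tot.2 fun a => ?_
  rcases a with _ | _ | a
  · rw [Pi.add_apply, hD, totD_single_self, pow_zero, one_smul]
    have : F 0 + cd (prism r y) = pb id r y - prism r (cd y) := by
      rw [eq_sub_iff_add_eq, add_assoc, cd_prism]; abel
    rw [this]
    exact sub_mem hpy' ((hΨ'.pcx (e := e) hp hG hE (α := α)).le m b2)
  · rw [Pi.add_apply, hD, totD_single_succ]
    refine (hΨ'.pcx (e := e) hp hG hE (α := α)).le _ (add_mem (hF1 0) ?_)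
    rw [prism_top hrg] at c2
    exact c2
  · rw [Pi.add_apply, hD, totD_single_of_ne _ (by omega) (by omega), add_zero]
    exact (hΨ'.pcx (e := e) hp hG hE (α := α)).le _ (hF1 (a + 1))

end

section
/-- The operators `g - 1`. -/
def tg (g : ℕ → G) (l : ℕ) : COp I X k := gop (g l) - 1

variable [Fintype G] {p : ℕ} {e : Set G} {A B : Set X} {g : ℕ → G}

theorem top_tg [DecidableEq G] (l : ℕ) :
    top (Pi.single (g l) 1) = (tg g l : COp I X k) := top_single (g l)

theorem tg_fam (hp : p.Prime) [CharP k p] (hG : ∀ g : G, g ^ p = 1) :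
    Fam p (cd : COp I X k) (tg g) where
  dd := cd_cd
  dt l := by classical rw [← top_tg]; exact LinearMap.ext fun f => top_cd _ f
  tt i j := by classical rw [← top_tg, ← top_tg]; exact top_comm _ _
  tp l := by classical rw [← top_tg]; exact top_pow hp hG _
  p0 := hp.ne_zero

section
variable [TopologicalSpace X] {S : CoefSys X I k} {Ψ : Set (Set X × Set X)}

theorem Cpl_sCx (hE : IsEq S G) (hΨ : InvCond G Ψ) : SCx cd (tg g) (S.Cpl Ψ) where
  cx := CoefSys.Cpl_isCx
  st _ _ _ hx := sub_mem (hE.gop_mem hΨ _ hx) hx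

theorem rel_sCx (hE : IsEq S G) (hA : ∀ g : G, ∀ x ∈ A, g • x ∈ A) : SCx cd (tg g) (S.rel A) :=
  Cpl_sCx hE (InvCond.rel hA)

theorem fixC_sCx (hE : IsEq S G) (hΨ : Adm G B Ψ) : SCx cd (tg g) (fixC S e Ψ B) where
  cx := ⟨fixC_zero, fixC_cd⟩
  st _ _ _ hx := by
    classical
    rw [← top_tg]
    exact fixC_top hE hΨ hx

theorem fixC_empty : fixC S (∅ : Set G) Ψ B = S.Cpl Ψ := by
  funext m
  simp [fixC]

theorem Adm.le_fixC (hE : IsEq S G) (hΨ : Adm G B Ψ) (m : ℕ) : S.rel B m ≤ fixC S e Ψ B m :=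
  fun _ hx => mem_fixC.2 ⟨hΨ.rel_le m hx, fun h _ =>
    sub_mem (hE.gop_mem (InvCond.rel hΨ.stab) h hx) hx⟩

theorem fixd_fixC (l : ℕ) : fixd (tg g l) (fixC S (g '' Iio l) Ψ B) (S.rel B) =
    fixC S (g '' Iio (l + 1)) Ψ B := by
  funext m
  ext x
  rw [mem_fixd, mem_fixC, mem_fixC, and_assoc]
  refine and_congr_right fun _ => ?_
  simp only [Set.forall_mem_image, Set.mem_Iio, Nat.lt_succ_iff_lt_or_eq, or_imp, forall_and,
    forall_eq]
  rfl

end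

variable [MetricSpace X] [CompactSpace X] [Finite I] {S : CoefSys X I k}

/-- Closed invariant sets for which the action on the difference is controlled by characters. -/
structure FreeOn (G : Type*) [CommGroup G] [MulAction G X] (A B : Set X) : Prop where
  hA : ∀ g : G, ∀ x ∈ A, g • x ∈ A
  hB : ∀ g : G, ∀ x ∈ B, g • x ∈ B
  le : A ⊆ B
  closed : IsClosed B
  stab : ∀ x ∈ B, x ∉ A → ∀ a ∈ A, ∀ g : G, g • x = x → g • a = a

theorem FreeOn.adm (h : FreeOn G A B) : Adm G B {(univ, A)} :=
  ⟨InvCond.rel h.hA, by rintro P rfl; exact h.le, h.hB⟩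

variable (hp : p.Prime) [CharP k p] (hG : ∀ g : G, g ^ p = 1) (hE : IsEq S G)
include hp hG hE

open Classical in
theorem FreeOn.hc_fixC_eq_zero (h : FreeOn G A B) {q : ℕ}
    (hχ : ∀ l < q, HasChar (Pi.single (g l) (1 : k)) (g '' Iio l) A B) {D : ℕ}
    (hD : ∀ i, D < i → hc cd (S.rel A) (S.rel B) i = 0) {l : ℕ} (hl : l ≤ q) {i : ℕ} (hi : D < i) :
    hc cd (fixC S (g '' Iio l) {(univ, A)} B) (S.rel B) i = 0 := by
  induction l generalizing i with
  | zero =>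
    have : g '' Iio 0 = ∅ := by simp
    rw [this, fixC_empty]
    exact hD i hi
  | succ l ih =>
    have P := h.adm.pcx (e := g '' Iio l) (α := Pi.single (g l) 1) hp hG hE
    have hf := h.adm.free hp hG hE rfl (hχ l (by omega))
    rw [← fixd_fixC, ← top_tg, ← P.hc_tot_eq_fixd hf]
    exact P.hc_tot_eq_zero (fun i hi => ih (by omega) hi)
      (kill hp hG hE h.hA h.hB h.le h.closed h.stab (hχ l (by omega))) hi

open Classical in
theorem FreeOn.hT_eq_aux (h : FreeOn G A B) {q : ℕ}
    (hχ : ∀ l < q, HasChar (Pi.single (g l) (1 : k)) (g '' Iio l) A B) (n j r m : ℕ)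
    (hj : j + n ≤ q) :
    hT p (n + r) cd (fun i => tg g (j + i)) (fixC S (g '' Iio j) {(univ, A)} B)
      (S.rel B) m = hT p r cd (fun i => tg g (j + n + i))
      (fixC S (g '' Iio (j + n)) {(univ, A)} B) (S.rel B) m := by
  induction n generalizing j with
  | zero => rw [zero_add]; rfl
  | succ n ih =>
    have hf := h.adm.free hp hG hE rfl (hχ j (by omega))
    rw [top_tg] at hf
    have h2 := ih (j + 1) (by omega)
    rw [show j + (n + 1) = j + 1 + n by omega, show n + 1 + r = n + r + 1 by omega, ← h2]
    have hF : Fam p (cd : COp I X k) (fun i => tg g (j + i)) :=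
      tg_fam (g := fun i => g (j + i)) hp hG
    rw [hF.hT_free (fixC_sCx (g := fun i => g (j + i)) hE h.adm)
      (rel_sCx (g := fun i => g (j + i)) hE h.hB) (h.adm.le_fixC hE) hf]
    simp only [add_zero, fixd_fixC, add_assoc, add_comm 1]

open Classical in
/-- Operators acting freely may be replaced by the subcomplex of invariants. -/
theorem FreeOn.hT_eq (h : FreeOn G A B) {q : ℕ}
    (hχ : ∀ l < q, HasChar (Pi.single (g l) (1 : k)) (g '' Iio l) A B) (r m : ℕ) :
    hT p (q + r) cd (tg g) (S.rel A) (S.rel B) m = hT p r cd (fun i => tg g (q + i))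
      (fixC S (g '' Iio q) {(univ, A)} B) (S.rel B) m := by
  have := h.hT_eq_aux hp hG hE hχ q 0 r m (by omega)
  have h0 : g '' Iio 0 = ∅ := by simp
  rw [h0, fixC_empty] at this
  simp only [zero_add] at this
  exact this

open Classical in
theorem FreeOn.hT_eq_zero (h : FreeOn G A B) {q : ℕ}
    (hχ : ∀ l < q, HasChar (Pi.single (g l) (1 : k)) (g '' Iio l) A B) {D : ℕ}
    (hD : ∀ i, D < i → hc cd (S.rel A) (S.rel B) i = 0) {i : ℕ} (hi : D < i) :
    hT p q cd (tg g) (S.rel A) (S.rel B) i = 0 := by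
  have := h.hT_eq hp hG hE hχ 0 i
  rw [add_zero] at this
  rw [this]
  exact h.hc_fixC_eq_zero hp hG hE hχ hD le_rfl hi

end

theorem le_wt {D i : ℕ} (hi : i ≤ D) (f : ℕ → ℕ∞) : f i ≤ wt D f :=
  (single_le_sum (f := f) (fun _ _ => zero_le) (by simp; omega)).trans
    (single_le_sum (f := fun i => ∑ j ∈ Ico i (D + 1), f j) (fun _ _ => zero_le)
      (mem_range.2 D.succ_pos))

theorem wt_le {D : ℕ} {f : ℕ → ℕ∞} {b : ℕ} (h : ∀ i, f i ≤ b) :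
    wt D f ≤ ((D + 1) * ((D + 1) * b) : ℕ) := by
  refine (sum_le_card_nsmul _ _ (((D + 1) * b : ℕ) : ℕ∞) fun i _ =>
    (sum_le_card_nsmul _ _ (b : ℕ∞) fun j _ => h j).trans ?_).trans ?_
  · rw [nsmul_eq_mul, Nat.card_Ico]
    push_cast
    gcongr
    exact_mod_cast Nat.sub_le _ _
  · simp

theorem Pre_le_of {D : ℕ} {f : ℕ → ℕ∞} {b : ℕ} (h : ∀ i, f i ≤ b) (h0 : ∀ i, D < i → f i = 0)
    (m : ℕ) : Pre f m ≤ ((D + 1) * b : ℕ) := by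
  calc Pre f m ≤ ∑ j ∈ Finset.range (D + 1), f j := by
        rw [Pre, ← Finset.sum_filter_add_sum_filter_not _ (· ≤ D),
          sum_eq_zero (s := Finset.filter (fun j => ¬ j ≤ D) _) fun j hj =>
            h0 j (by simpa using (mem_filter.1 hj).2), add_zero]
        refine Finset.sum_le_sum_of_subset fun j hj => ?_
        simp at hj ⊢
        omega
    _ ≤ _ := by
        refine (sum_le_card_nsmul _ _ (b : ℕ∞) fun j _ => h j).trans ?_
        simp

theorem Pre_iter_le {f : ℕ → ℕ∞} {b : ℕ} (h : ∀ i, f i ≤ b) (q m : ℕ) :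
    Pre^[q] f m ≤ ((m + 1) ^ q * b : ℕ) := by
  induction q generalizing m with
  | zero => simpa using h m
  | succ q ih =>
    rw [Function.iterate_succ_apply']
    refine (sum_le_card_nsmul _ _ (((m + 1) ^ q * b : ℕ) : ℕ∞) fun j hj => (ih j).trans ?_).trans ?_
    · have : j + 1 ≤ m + 1 := by simp at hj; omega
      exact_mod_cast Nat.mul_le_mul_right b (Nat.pow_le_pow_left this q)
    · rw [nsmul_eq_mul, Finset.card_range, ← Nat.cast_mul, pow_succ']
      exact_mod_cast (mul_assoc _ _ _).ge

section
variable [TopologicalSpace X] {S : CoefSys X I k}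

theorem IsEq.subgroup (h : IsEq S G) (W : Subgroup G) : IsEq S W where
  cont g := h.cont g
  core g := h.core g
  deg g := h.deg g
  deg_fix g := h.deg_fix g

theorem IsGood.subgroup {D b : ℕ} (h : IsGood S G D b) (W : Subgroup G) : IsGood S W D b where
  toIsEq := h.toIsEq.subgroup W
  van := h.van
  bound := h.bound
  fund := by
    obtain ⟨ν, h1, h2, h3⟩ := h.fund
    exact ⟨ν, h1, fun g => h2 g, h3⟩

theorem CoefSys.rel_empty : S.rel ∅ = S.cs univ := by
  funext m
  ext f
  rw [mem_rel, mem_cs]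
  refine and_congr_right fun h => and_congr_right fun _ => ?_
  exact iff_of_true (fun x => VanAt.of_notMem (by simp) fun c => h c _ (Or.inr rfl))
    fun x hx => absurd trivial hx

end

section
variable [MetricSpace X] [CompactSpace X] [Finite I] {S : CoefSys X I k} {A B : Set X} {D b : ℕ}

/-- The weight of the cohomology of a subspace. -/
def wtOn (S : CoefSys X I k) (D : ℕ) (A : Set X) : ℕ∞ :=
  wt D (hc cd (S.rel ∅) (S.rel A))

theorem IsGood.hc_rel_eq_zero (h : IsGood S G D b) (hA : IsClosed A) (hB : IsClosed B) (hAB : A ⊆ B)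
    {i : ℕ} (hi : D < i) : hc cd (S.rel A) (S.rel B) i = 0 := by
  have := hc_le_add' (d := cd) cd_cd (L := S.nul) (K := S.rel B) (J := S.rel A) CoefSys.nul_le
    (rel_anti (S := S) hAB) i
  rw [CoefSys.hc_rel_eq_zero h.van hA hi, CoefSys.hc_rel_eq_zero h.van hB (by omega)] at this
  simpa using this

theorem IsGood.hc_rel_le (h : IsGood S G D b) (hA : IsClosed A) (hB : IsClosed B) (hAB : A ⊆ B)
    {w : ℕ} (wA : wtOn S D A ≤ w) (wB : wtOn S D B ≤ w) (m : ℕ) :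
    hc cd (S.rel A) (S.rel B) m ≤ (2 * w : ℕ) := by
  have key : ∀ C : Set X, IsClosed C → wtOn S D C ≤ w → ∀ m, hc cd (S.rel ∅) (S.rel C) m ≤ w := by
    intro C hC hw m
    by_cases hm : m ≤ D
    · exact (le_wt hm _).trans hw
    · rw [h.hc_rel_eq_zero isClosed_empty hC (empty_subset _) (by omega)]
      exact zero_le
  cases m with
  | zero =>
    have h0 : IsCx cd (S.rel A) := CoefSys.Cpl_isCx
    rw [h0.hc_zero]
    exact zero_le
  | succ m =>
    have := hc_succ_le_add (d := cd) cd_cd (J := S.rel ∅) (K := S.rel A) (L := S.rel B)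
      (rel_anti hAB) (rel_anti (empty_subset A)) m
    refine this.trans ?_
    rw [two_mul, Nat.cast_add]
    exact add_le_add (key B hB wB _) (key A hA wA _)

theorem IsGood.wtOn_univ_le (h : IsGood S G D b) :
    wtOn S D univ ≤ ((D + 1) * ((D + 1) * b) : ℕ) := by
  refine wt_le fun i => ?_
  rw [rel_empty, rel_univ]
  exact h.bound i

variable [Fintype G] {p : ℕ} (hp : p.Prime) [CharP k p] (hG : ∀ g : G, g ^ p = 1)
include hp hG

open Classical in
/-- Smith's inequality, for an element acting freely off its fixed points. -/
theorem IsGood.smith (h : IsGood S G D b) (hF : FreeOn G A B) (hA : IsClosed A) {g : G}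
    (hχ : HasChar (Pi.single g (1 : k)) ∅ A B) (hgA : ∀ a ∈ A, g • a = a) :
    wtOn S D A ≤ wtOn S D B ∧ (wtOn S D B ≠ ⊤ → wtOn S D A = wtOn S D B →
      ∀ i, hc cd (S.rel A) (S.rel B) i = 0) := by
  have hD : ∀ i, D < i → hc cd (S.rel A) (S.rel B) i = 0 :=
    fun i hi => h.hc_rel_eq_zero hA hF.closed hF.le hi
  have P := hF.adm.pcx (e := ∅) (α := Pi.single g 1) hp hG h.toIsEq
  have hf := hF.adm.free hp hG h.toIsEq rfl hχ
  have hD' := fun i (hi : D < i) => P.hc_tot_eq_zero (by rwa [fixC_empty])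
    (kill hp hG h.toIsEq hF.hA hF.hB hF.le hF.closed hF.stab hχ) hi
  have hJ : Adm G B {((univ : Set X), (∅ : Set X))} :=
    ⟨InvCond.rel fun _ _ hx => absurd hx (Set.notMem_empty _), by rintro P rfl; exact empty_subset _, hF.hB⟩
  have PJ := hJ.pcx (S := S) (e := ∅) (α := Pi.single g 1) hp hG h.toIsEq
  rw [fixC_empty] at P hf hD' PJ
  refine P.smith hf PJ (rel_anti (empty_subset _)) (fun m x hx => ?_) hD hD'
  have hx' := CoefSys.mulOp_mem hx (inInd k A)
  have ht : top (Pi.single g 1) (mulOp (inInd k A) x) ∈ S.nul m := by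
    have hc : Commute (gop g : COp I X k) (mulOp (inInd k A)) := by
      refine gop_mulOp_comm fun l => ?_
      by_cases hl : ∀ y ∈ l, y ∈ A
      · rw [inInd_of hl, inInd_of]
        simp only [List.forall_mem_map]
        exact fun y hy => hF.hA _ _ (hl y hy)
      · rw [inInd_of_not hl, inInd_of_not]
        simp only [List.forall_mem_map]
        exact fun h' => hl fun y hy => by simpa using hF.hA g _ (h' y hy)
    have e : top (Pi.single g 1) (mulOp (inInd k A) x) = mulOp (inInd k A) (gop g x - x) := by
      rw [top_single, LinearMap.sub_apply, End.one_apply, map_sub, ← End.mul_apply,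
        hc.eq, End.mul_apply]
    have h1 := sub_mem (h.gop_mem hJ.inv g hx) hx
    have h2 := CoefSys.mulOp_mem h1 (inInd k A)
    rw [e]
    refine CoefSys.mem_nul.2 ⟨h2.1, h2.2.1, fun y => CoefSys.VanAt.mulInd ?_⟩
    by_cases hy : y ∈ A
    · exact h.vanAt_sub g (hgA y hy) hgA hx.2.1
    · exact CoefSys.VanAt.of_notMem (by rwa [hA.closure_eq]) fun c => h1.1 c _ (Or.inr rfl)
  have ht' := CoefSys.nul_le (Ψ := {(univ, B)}) m ht
  refine ⟨_, hx', ht', ?_, ?_⟩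
  · rw [← Nat.sub_add_cancel (show 1 ≤ p - 1 by have := hp.two_le; omega), pow_succ,
      End.mul_apply]
    exact rel_top_pow h.toIsEq hF.hB _ ht'
  · have h1 := sub_mem hx hx'
    exact CoefSys.mem_rel.2 ⟨h1.1, h1.2.1, fun y => vanAt_sub_inInd⟩

end

section
variable [MetricSpace X] [CompactSpace X] [Finite I] {S : CoefSys X I k} {A B : Set X} {D b : ℕ}
  [Fintype G] {p : ℕ} {α : G → k} {ν : (I → List X → k) →ₗ[k] k}

theorem map_top_eq_zero (h : ∀ g : G, ∀ z ∈ S.zc univ D, ν (gop g z) = ν z)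
    {z : I → List X → k} (hz : z ∈ S.zc univ D) : ν (top α z) = 0 := by
  simp [top, LinearMap.sum_apply, map_sum, h _ z hz]

variable (hp : p.Prime) [CharP k p] (hG : ∀ g : G, g ^ p = 1)
include hp hG

theorem IsEq.pcx_cs (h : IsEq S G) {U : Set X} (hU : ∀ (g : G), ∀ x, g • x ∈ U ↔ x ∈ U) :
    PCx cd (top α) (top α ^ (p - 1)) (S.cs U) S.nul := by
  have : Adm G univ {(Uᶜ, univ)} :=
    ⟨by rintro P rfl g; exact ⟨fun x hx h => hx ((hU g x).1 h), fun _ _ => trivial⟩,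
      fun _ _ => subset_univ _, fun _ _ _ => trivial⟩
  have := this.pcx (S := S) (e := ∅) (α := α) hp hG h
  rwa [fixC_empty, rel_univ] at this

/-- A nonzero local class at a fixed point lifts to the total complex. -/
theorem IsEq.exists_lift (h : IsEq S G) (hD : 0 < D) {x : X} (hx : ∀ g : G, g • x = x)
    (h2 : ∀ g : G, ∀ z ∈ S.zc univ D, ν (gop g z) = ν z)
    (h3 : ∀ W ∈ 𝓝 x, ∃ U ⊆ W, IsOpen U ∧ x ∈ U ∧ (∃ z ∈ S.zc U D, ν z ≠ 0) ∧
      (∀ z ∈ S.zc U D, ν z = 0 → z ∈ S.bc U D) ∧ ∀ m, m ≠ D → hc cd (S.cs U) S.nul m = 0)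
    (a : ℕ) {W : Set X} (hW : W ∈ 𝓝 x) :
    ∃ F ∈ tot (S.cs W) D, ν (F 0) ≠ 0 ∧ (∀ b, a < b → F b = 0) ∧
      ∀ b ≤ a, totD cd (top α) (top α ^ (p - 1)) F b ∈ S.nul (D + 1 - b) := by
  induction a generalizing W with
  | zero =>
    obtain ⟨U, hUW, -, -, ⟨z, hz, hz0⟩, -⟩ := h3 W hW
    refine ⟨Pi.single 0 z, single_mem_tot (CoefSys.cs_mono hUW _ hz.1), by simpa using hz0,
      fun b hb => single_eq_of_ne hb.ne' _, fun b hb => ?_⟩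
    obtain rfl : b = 0 := by omega
    rw [totD_single_self, pow_zero, one_smul]
    exact hz.2
  | succ a ih =>
    obtain ⟨U, hUW, hU, hxU, -, hU2, hU3⟩ := h3 W hW
    set V : Set X := ⋂ g : G, (fun y => g • y) ⁻¹' U with hV
    have hVU : V ⊆ U := fun y hy => by simpa using mem_iInter.1 hy 1
    have hVo : IsOpen V := isOpen_iInter_of_finite fun g => hU.preimage (h.cont g)
    have hxV : x ∈ V := mem_iInter.2 fun g => by
      change g • x ∈ U
      rwa [hx]
    have hVi : ∀ (g : G), ∀ y, g • y ∈ V ↔ y ∈ V := fun g y => by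
      simp only [hV, mem_iInter, Set.mem_preimage, smul_smul]
      exact ⟨fun h g' => by simpa using h (g' * g⁻¹), fun h g' => h _⟩
    obtain ⟨F, hF, hν, hF0, hDF⟩ := ih (hVo.mem_nhds hxV)
    have P := h.pcx_cs (α := α) hp hG hVi
    have hw : alt (top α) (top α ^ (p - 1)) a (F a) ∈ S.cs V (D - a) := P.oK.alt a (mem_tot.1 hF a)
    have hcd : cd (alt (top α) (top α ^ (p - 1)) a (F a)) ∈ S.nul (D - a + 1) := by
      rcases Nat.lt_or_ge D a with ha | ha
      · have : F a = 0 := by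
          have := mem_tot.1 hF a
          rwa [Nat.sub_eq_zero_of_le ha.le, P.cK.zero, Submodule.mem_bot] at this
        rw [this, map_zero, map_zero]
        exact zero_mem _
      have h4 := P.oL.alt a (hDF a le_rfl)
      rw [P.op.d_alt, Nat.sub_add_comm ha |>.symm]
      cases a with
      | zero => simpa using h4
      | succ a =>
        rw [totD_succ, map_add, map_smul, P.op.alt_alt, add_zero] at h4
        exact (Submodule.smul_mem_iff _ (pow_ne_zero _ (neg_ne_zero.2 one_ne_zero))).1 h4
    have hb : alt (top α) (top α ^ (p - 1)) a (F a) ∈ S.bc U (D - a) := by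
      have hz : alt (top α) (top α ^ (p - 1)) a (F a) ∈ S.zc U (D - a) :=
        ⟨CoefSys.cs_mono hVU _ hw, hcd⟩
      cases a with
      | zero =>
        refine hU2 _ hz ?_
        exact map_top_eq_zero h2 (CoefSys.zc_mono (subset_univ V)
          ⟨mem_tot.1 hF 0, by simpa using hDF 0 le_rfl⟩)
      | succ a =>
        exact mem_bdy.2 (hc_eq_zero.1 (hU3 _ (by omega)) _ hz.1 hz.2)
    obtain ⟨y, hy, hwy⟩ := mem_bdy.1 hb
    have hy' : y ∈ S.cs W (D - (a + 1)) := CoefSys.cs_mono hUW _ (by rwa [Nat.sub_sub] at hy)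
    refine ⟨F - Pi.single (a + 1) ((-1 : k) ^ (a + 1) • y),
      sub_mem (tot_mono (CoefSys.cs_mono (hVU.trans hUW)) _ hF) (single_mem_tot
        (smul_mem _ _ hy')), by simpa using hν, fun b hb => ?_, fun b hb => ?_⟩
    · rw [Pi.sub_apply, hF0 b (by omega), single_eq_of_ne (by omega), sub_zero]
    · rw [map_sub, Pi.sub_apply]
      rcases Nat.lt_or_eq_of_le hb with hb | rfl
      · rw [totD_single_of_ne _ (by omega) (by omega), sub_zero]
        exact hDF b (by omega)
      · rw [totD_single_self, totD_succ, hF0 _ (by omega), map_zero, smul_zero, zero_add, map_smul,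
          smul_smul, ← mul_pow, neg_one_mul, neg_neg, one_pow, one_smul, Nat.add_sub_add_right]
        exact hwy

/-- The cohomology of a pair consisting of the fixed points and a proper closed subset does not
vanish. -/
theorem IsGood.hc_ne_zero (h : IsGood S G D b) (hD : 0 < D) (hA : IsClosed A) (hAB : A ⊆ B)
    (hB : ∀ x, x ∈ B ↔ ∀ g : G, g • x = x) (hχ : HasChar α ∅ B univ) {x : X} (hxB : x ∈ B)
    (hxA : x ∉ A) : ∃ i, hc cd (S.rel A) (S.rel B) i ≠ 0 := by
  by_contra! h0
  have hE := h.toIsEq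
  obtain ⟨ν, h1, h2, h3⟩ := h.fund
  have P := hE.pcx_cs (α := α) hp hG (U := univ) (by simp)
  set T := totD (cd : COp I X k) (top α) (top α ^ (p - 1)) with hT
  have gB : ∀ (g : G), ∀ x ∈ B, g • x = x := fun g x hx => (hB x).1 hx g
  have iB : ∀ (g : G), ∀ x ∈ B, g • x ∈ B := fun g x hx => by rwa [gB g x hx]
  have iA : ∀ (g : G), ∀ x ∈ A, g • x ∈ A := fun g x hx => by rwa [gB g x (hAB hx)]
  have aA : Adm G B {((univ : Set X), A)} := ⟨InvCond.rel iA, by rintro P rfl; exact hAB, iB⟩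
  have PA := aA.pcx (S := S) (e := ∅) (α := α) hp hG hE
  rw [fixC_empty] at PA
  obtain ⟨F, hF, hνF, -, hTF⟩ := hE.exists_lift (α := α) hp hG hD ((hB x).1 hxB) h2 (h3 x) D
    (hA.isOpen_compl.mem_nhds hxA)
  have hTF : T F ∈ tot S.nul (D + 1) := mem_tot.2 fun a => by
    by_cases ha : a ≤ D
    · exact hTF a ha
    · obtain ⟨a, rfl⟩ : ∃ c, a = c + 1 := ⟨a - 1, by omega⟩
      have hz : ∀ c, D ≤ c → F c = 0 := fun c hc => by
        have := mem_tot.1 hF c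
        rw [Nat.sub_eq_zero_of_le hc] at this
        simpa [(CoefSys.Cpl_isCx (S := S)).zero, cs] using this
      rw [hT, totD_succ, hz _ (by omega), hz _ (by omega), map_zero, map_zero, smul_zero, zero_add]
      exact zero_mem _
  have hFA := tot_mono (fun m => cs_le_rel (S := S) (A := A) (U := Aᶜ)
    (by rw [hA.closure_eq, compl_compl]) m) _ hF
  have ht0 : hc T (tot (S.rel A)) (tot (S.rel B)) D = 0 :=
    le_antisymm ((PA.hc_tot_le D).trans (sum_eq_zero fun i _ => h0 i).le) zero_le
  obtain ⟨Y, hY, hFY⟩ := hc_eq_zero.1 ht0 F hFA (tot_mono CoefSys.nul_le _ hTF)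
  have hK := kill (e := ∅) hp hG hE iB (by simp) (subset_univ B) isClosed_univ
    (fun x _ _ a ha g _ => gB g a ha) hχ
  rw [Kill, fixC_empty, rel_univ] at hK
  obtain ⟨N, Y₂, hY₂, hN⟩ := hK D _ hFY (by
    rw [map_sub, P.DD, sub_zero]
    exact hTF)
  have rle : ∀ C m, S.rel C m ≤ S.cs univ m := fun C => by
    rw [← rel_empty]
    exact rel_anti (empty_subset C)
  set G₁ := sft (k := k) (2 * N) Y + Y₂ with hG₁
  have hG₁m : G₁ ∈ tot (S.cs univ) (D + 2 * N - 1) := by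
    refine add_mem ?_ (tot_mono (rle B) _ hY₂)
    have := sft_mem_tot (r := 2 * N) (tot_mono (rle A) _ hY)
    rwa [show D - 1 + 2 * N = D + 2 * N - 1 by omega] at this
  have hTG : sft (k := k) (2 * N) F - T G₁ ∈ tot S.nul (D + 2 * N) := by
    convert hN using 1
    rw [hG₁, map_add, map_sub, ← sft_totD]
    abel
  have hνn : ∀ f ∈ S.nul D, ν f = 0 := fun f hf => h1 f (mem_bdy.2 ⟨0, zero_mem _, by simpa using hf⟩)
  have hνd : ∀ y ∈ S.cs univ (D - 1), ν (cd y) = 0 := fun y hy =>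
    h1 _ (mem_bdy.2 ⟨y, hy, by simp⟩)
  rcases Nat.eq_zero_or_pos N with rfl | hN0
  · have := hνn _ (by simpa using mem_tot.1 hTG 0)
    rw [hT, totD_zero, map_sub, hνd _ (by simpa using mem_tot.1 hG₁m 0), sub_zero] at this
    exact hνF (by simpa [sft] using this)
  obtain ⟨Y₃, -, hY₃⟩ := P.clear (D₀ := D) (A := 2 * N - 1) (fun i hi => by
    have := CoefSys.hc_rel_eq_zero h.van isClosed_empty hi
    rwa [rel_empty] at this) (by omega) hG₁m fun b hb => by
      have := mem_tot.1 hTG b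
      rw [Pi.sub_apply, sft_of_lt (by omega), zero_sub, neg_mem_iff] at this
      rwa [show D + 2 * N - 1 + 1 = D + 2 * N by omega]
  set G₂ := G₁ - T Y₃ with hG₂
  have hTG₂ : T G₂ = T G₁ := by rw [hG₂, map_sub, P.DD, sub_zero]
  rw [← hTG₂] at hTG
  obtain ⟨hG₂m, hG₂0⟩ := mem_totF.1 hY₃
  obtain ⟨N, rfl⟩ : ∃ c, N = c + 1 := ⟨N - 1, by omega⟩
  have hy := mem_tot.1 hG₂m (2 * N + 1)
  have hy' : cd (G₂ (2 * N + 1)) ∈ S.nul (D + 1) := by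
    have h4 := mem_tot.1 hTG (2 * N + 1)
    have h5 := P.oL.alt (2 * N) (hG₂0 (2 * N) (by omega))
    rw [Pi.sub_apply, sft_of_lt (by omega), zero_sub, neg_mem_iff, hT, totD_succ,
      show D + 2 * (N + 1) - (2 * N + 1) = D + 1 by omega] at h4
    rw [show D + 2 * (N + 1) - 1 - 2 * N = D + 1 by omega] at h5
    exact (Submodule.smul_mem_iff _ (pow_ne_zero _ (neg_ne_zero.2 one_ne_zero))).1
      ((Submodule.add_mem_iff_left _ h5).1 h4)
  rw [show D + 2 * (N + 1) - 1 - (2 * N + 1) = D by omega] at hy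
  have h6 := hνn _ (by
    have := mem_tot.1 hTG (2 * N + 1 + 1)
    rwa [show D + 2 * (N + 1) - (2 * N + 1 + 1) = D by omega] at this)
  have h7 := mem_tot.1 hG₂m (2 * N + 1 + 1)
  rw [show D + 2 * (N + 1) - 1 - (2 * N + 1 + 1) = D - 1 by omega] at h7
  have h8 : ν (alt (top α) (top α ^ (p - 1)) (2 * N + 1) (G₂ (2 * N + 1))) = 0 := by
    have : p - 1 = p - 2 + 1 := by have := hp.two_le; omega
    rw [alt, if_neg (by simp), this, pow_succ', End.mul_apply]
    refine map_top_eq_zero h2 ?_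
    generalize p - 2 = c
    induction c with
    | zero => exact ⟨hy, hy'⟩
    | succ c ih =>
      rw [pow_succ', End.mul_apply]
      refine ⟨P.oK.a ih.1, ?_⟩
      change cd (top α ((top α ^ c) (G₂ (2 * N + 1)))) ∈ S.nul (D + 1)
      rw [P.op.da]
      exact P.oL.a ih.2
  rw [hT, Pi.sub_apply, totD_succ, map_sub, map_add, map_smul, hνd _ h7, h8, smul_zero, zero_add,
    sub_zero, show 2 * N + 1 + 1 = 0 + 2 * (N + 1) by ring, sft_add] at h6
  exact hνF h6

end

section
variable {p : ℕ} [Fact p.Prime] (hG : ∀ g : G, g ^ p = 1)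
include hG

/-- Subgroups of an elementary abelian group are intersections of kernels of characters. -/
theorem exists_hom {W : Subgroup G} {g : G} (hg : g ∉ W) :
    ∃ χ : G →* Multiplicative (ZMod p), W ≤ χ.ker ∧ χ g ≠ 1 := by
  let : Module (ZMod p) (Additive G) := AddCommGroup.zmodModule hG
  obtain ⟨f, hf, hW⟩ := Submodule.exists_le_ker_of_notMem
    (p := AddSubgroup.toZModSubmodule p W.toAddSubgroup) (v := Additive.ofMul g) hg
  exact ⟨f.toAddMonoidHom.toMultiplicativeRight, fun x hx => hW (x := Additive.ofMul x) hx, hf⟩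

/-- A finite extension of subgroups is filled by a sequence of independent elements. -/
theorem exists_seq [Finite G] (P W : Subgroup G) : ∃ (q : ℕ) (g : ℕ → G), (∀ l, g l ∈ P) ∧
    (∀ l, q ≤ l → g l = 1) ∧ (∀ l < q, g l ∉ W ⊔ Subgroup.closure (g '' Iio l)) ∧
    P ≤ W ⊔ Subgroup.closure (g '' Iio q) ∧ Nat.card P ≤ p ^ q * Nat.card W := by
  induction W using WellFoundedGT.induction with
  | ind W ih =>
    by_cases h : P ≤ W
    · exact ⟨0, fun _ => 1, fun _ => one_mem _, fun _ _ => rfl, by simp, h.trans le_sup_left, by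
        rw [pow_zero, one_mul]
        exact Subgroup.card_le_of_le h⟩
    obtain ⟨g₀, hgP, hgW⟩ := SetLike.not_le_iff_exists.1 h
    obtain ⟨q, g, h1, h2, h3, h5, h4⟩ := ih (W ⊔ zpowers g₀)
      (left_lt_sup.2 fun h => hgW (h (Subgroup.mem_zpowers g₀)))
    have e : ∀ l, (fun l => Nat.casesOn (motive := fun _ => G) l g₀ g) '' Iio (l + 1) =
        {g₀} ∪ g '' Iio l := fun l => by
      ext x
      simp only [Set.mem_image, Set.mem_union, Set.mem_singleton_iff]
      constructor
      · rintro ⟨_ | i, hi, rfl⟩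
        exacts [Or.inl rfl, Or.inr ⟨i, by simpa using hi, rfl⟩]
      · rintro (rfl | ⟨i, hi, rfl⟩)
        exacts [⟨0, by simp, rfl⟩, ⟨i + 1, by simpa using hi, rfl⟩]
    refine ⟨q + 1, fun l => Nat.casesOn l g₀ g, ?_, ?_, ?_, ?_, h4.trans ?_⟩
    · rintro (_ | l); exacts [hgP, h1 l]
    · rintro (_ | l) hl; exacts [absurd hl (by simp), h2 l (by omega)]
    · rintro (_ | l) hl
      · simpa using hgW
      · rw [e, Subgroup.closure_union, ← Subgroup.zpowers_eq_closure, ← sup_assoc]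
        exact h3 l (by omega)
    · rwa [e, Subgroup.closure_union, ← Subgroup.zpowers_eq_closure, ← sup_assoc]
    · rw [pow_succ, mul_assoc]
      refine Nat.mul_le_mul_left _ ?_
      have := Set.natCard_mul_le (s := (zpowers g₀ : Set G)) (t := (W : Set G))
      rw [← Subgroup.mul_normal, sup_comm] at this
      refine le_trans (by exact this) (Nat.mul_le_mul_right _ ?_)
      rw [SetLike.coe_sort_coe, Nat.card_zpowers]
      exact Nat.le_of_dvd (Fact.out : p.Prime).pos (orderOf_dvd_of_pow_eq_one (hG g₀))

variable [Algebra (ZMod p) k] [Fintype G] {A B : Set X}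

open Classical in
theorem HasChar.single {g : G} {e : Set G}
    (h : ∀ x ∈ B, x ∉ A → g ∉ MulAction.stabilizer G x ⊔ Subgroup.closure e) :
    HasChar (Pi.single g (1 : k)) e A B := fun x hx hxA => by
  obtain ⟨χ, h1, h2⟩ := exists_hom hG (h x hx hxA)
  refine ⟨fun g => algebraMap (ZMod p) k (χ g).toAdd, fun g h => by simp, fun g hg => ?_,
    fun h hh => ?_, ?_⟩
  · simp [show χ g = 1 from h1 (Subgroup.mem_sup_left hg)]
  · simp [show χ h = 1 from h1 (Subgroup.mem_sup_right (Subgroup.subset_closure hh))]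
  · simpa [Pi.single_apply] using h2

theorem HasChar.of_linearIndependent {α : G → k} (hα : LinearIndependent (ZMod p) α)
    (h : ∀ x ∈ B, x ∉ A → MulAction.stabilizer G x ≠ ⊤) : HasChar α ∅ A B := fun x hx hxA => by
  obtain ⟨g, -, hg⟩ := SetLike.exists_of_lt (h x hx hxA).lt_top
  obtain ⟨χ, h1, h2⟩ := exists_hom hG hg
  refine ⟨fun g => algebraMap (ZMod p) k (χ g).toAdd, fun g h => by simp, fun g hg => ?_,
    fun h hh => absurd hh (Set.notMem_empty _), fun h0 => h2 ?_⟩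
  · simp [show χ g = 1 from h1 hg]
  · have := Fintype.linearIndependent_iff.1 hα (fun g => (χ g).toAdd) (by
      rw [← h0]
      exact sum_congr rfl fun g _ => by rw [Algebra.smul_def, mul_comm]) g
    exact this

end

section
/-- The fixed points of a subgroup. -/
def fx (X : Type*) {G : Type*} [Group G] [MulAction G X] (W : Subgroup G) : Set X :=
  {x | ∀ g ∈ W, g • x = x}

theorem mem_fx {W : Subgroup G} {x : X} : x ∈ fx X W ↔ W ≤ MulAction.stabilizer G x := Iff.rfl

theorem smul_mem_fx {W : Subgroup G} (g : G) : ∀ x ∈ fx X W, g • x ∈ fx X W := fun x hx h hh => by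
  rw [smul_smul, mul_comm, mul_smul, hx h hh]

theorem fx_anti {W V : Subgroup G} (h : W ≤ V) : fx X V ⊆ fx X W := fun _ hx g hg => hx g (h hg)

theorem fx_map {K : Subgroup G} (W : Subgroup K) : fx X (W.map K.subtype) = fx X W := by
  ext x
  simp only [mem_fx, Subgroup.map_le_iff_le_comap]
  rfl

theorem isClosed_fx [TopologicalSpace X] [T2Space X] (h : ∀ g : G, Continuous fun x : X => g • x)
    (W : Subgroup G) : IsClosed (fx X W) := by
  have : fx X W = ⋂ g ∈ W, {x | g • x = x} := by ext; simp [fx]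
  rw [this]
  exact isClosed_biInter fun g _ => isClosed_eq (h g) continuous_id

/-- The maximal proper stabilizers. -/
def MaxStab (X : Type*) {G : Type*} [Group G] [MulAction G X] (W : Subgroup G) : Prop :=
  Maximal (fun W => W ≠ ⊤ ∧ ∃ x : X, MulAction.stabilizer G x = W) W

theorem exists_maxStab [Finite G] {x : X} (h : MulAction.stabilizer G x ≠ ⊤) :
    ∃ W, MulAction.stabilizer G x ≤ W ∧ MaxStab X W :=
  (toFinite _).exists_le_maximal (s := {W | W ≠ ⊤ ∧ ∃ x : X, MulAction.stabilizer G x = W})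
    ⟨h, x, rfl⟩

theorem MaxStab.eq {W : Subgroup G} (h : MaxStab X W) {x : X} (hx : x ∈ fx X W)
    (h' : x ∉ fx X (⊤ : Subgroup G)) : MulAction.stabilizer G x = W :=
  (h.eq_of_le ⟨fun h => h' (mem_fx.2 h.ge), x, rfl⟩ hx).symm

end

section
variable [MetricSpace X] [CompactSpace X] [Finite I] {S : CoefSys X I k} {D b : ℕ}
  {p : ℕ} [Fact p.Prime] [CharP k p] [Algebra (ZMod p) k] (hG : ∀ g : G, g ^ p = 1)
  {W : Subgroup G}
include hG

omit hG in
theorem fx_freeOn (hE : IsEq S G) : FreeOn G (fx X (⊤ : Subgroup G)) (fx X W) where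
  hA := smul_mem_fx
  hB := smul_mem_fx
  le := fx_anti le_top
  closed := isClosed_fx hE.cont W
  stab _ _ _ _ ha g _ := ha g trivial

theorem MaxStab.hc_ne_zero [Finite G] (h : IsGood S G D b) (hD : 0 < D) (hW : MaxStab X W) {α : W → k}
    (hα : LinearIndependent (ZMod p) α) :
    ∃ i, hc cd (S.rel (fx X (⊤ : Subgroup G))) (S.rel (fx X W)) i ≠ 0 := by
  obtain ⟨⟨hWt, x, hx⟩, -⟩ := hW
  let : Fintype W := ofFinite W
  refine (h.subgroup W).hc_ne_zero (α := α) (x := x) (Fact.out) (fun g => Subtype.ext (hG g)) hD (isClosed_fx h.cont _)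
    (fx_anti le_top) (fun x => ⟨fun h g => h g g.2, fun h g hg => h ⟨g, hg⟩⟩)
    (HasChar.of_linearIndependent (fun g => Subtype.ext (hG g)) hα fun y _ hy hs => hy fun g hg => ?_)
    (mem_fx.2 hx.ge) fun hx' => hWt ?_
  · exact hs.ge (x := ⟨g, hg⟩) trivial
  · rw [← hx]
    exact top_le_iff.1 hx'

omit [CompactSpace X] [Finite I] in
open Classical in
theorem MaxStab.hasChar [Fintype G] (hW : MaxStab X W) {g : G} {e : Set G}
    (hg : g ∉ W ⊔ Subgroup.closure e) :
    HasChar (Pi.single g (1 : k)) e (fx X (⊤ : Subgroup G)) (fx X W) :=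
  HasChar.single hG fun x hx hxA => by rwa [hW.eq hx hxA]

theorem MaxStab.seq_le [Finite G] (h : IsGood S G D b) (hD : 0 < D) (hW : MaxStab X W) {α : W → k}
    (hα : LinearIndependent (ZMod p) α) {w : ℕ} (hw : wtOn S D (fx X W) ≤ w)
    (hw' : wtOn S D (fx X (⊤ : Subgroup G)) ≤ w) {q : ℕ} {g : ℕ → G} (g2 : ∀ l, q ≤ l → g l = 1)
    (g3 : ∀ l < q, g l ∉ W ⊔ Subgroup.closure (g '' Iio l)) :
    q ≤ (D + 1) * (2 * w) * (D + 1) := by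
  classical
  let := ofFinite G
  have hp : p.Prime := Fact.out
  have hF := fx_freeOn (W := W) h.toIsEq
  have hA := isClosed_fx h.cont (⊤ : Subgroup G)
  have hD' : ∀ i, D < i → hc cd (S.rel (fx X (⊤ : Subgroup G))) (S.rel (fx X W)) i = 0 :=
    fun i hi => h.hc_rel_eq_zero hA hF.closed hF.le hi
  exact (tg_fam (X := X) (I := I) (k := k) (g := g) hp hG).rank_le hp.two_le
    (fun i hi => by rw [tg, g2 i hi, gop_one, sub_self]) (rel_sCx h.toIsEq hF.hA)
    (rel_sCx h.toIsEq hF.hB) (rel_anti hF.le)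
    (fun i hi => hF.hT_eq_zero hp hG h.toIsEq (fun l hl => hW.hasChar hG (g3 l hl)) hD' hi)
    (Pre_le_of (h.hc_rel_le hA hF.closed hF.le hw' hw) hD') (hW.hc_ne_zero hG h hD hα)

/-- Passing to the fixed points of a maximal proper stabilizer decreases the weight and bounds the
index. -/
theorem MaxStab.step [Finite G] (h : IsGood S G D b) (hD : 0 < D) (hW : MaxStab X W) {α : W → k}
    (hα : LinearIndependent (ZMod p) α) {w : ℕ} (hw : wtOn S D (fx X W) ≤ w) :
    wtOn S D (fx X (⊤ : Subgroup G)) + 1 ≤ wtOn S D (fx X W) ∧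
      Nat.card G ≤ p ^ ((D + 1) * (2 * w) * (D + 1)) * Nat.card W := by
  classical
  let := ofFinite G
  have hp : p.Prime := Fact.out
  obtain ⟨i, hi⟩ := hW.hc_ne_zero hG h hD hα
  obtain ⟨g, -, hg⟩ := SetLike.exists_of_lt hW.1.1.lt_top
  obtain ⟨s1, s2⟩ := h.smith hp hG (fx_freeOn (W := W) h.toIsEq) (isClosed_fx h.cont _)
    (hW.hasChar hG (e := ∅) (by simpa using hg)) fun a ha => ha g trivial
  have hne : wtOn S D (fx X W) ≠ ⊤ := ne_top_of_le_ne_top (ENat.natCast_ne_top w) hw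
  have slt := lt_of_le_of_ne s1 fun e => hi (s2 hne e i)
  refine ⟨Order.add_one_le_of_lt slt, ?_⟩
  obtain ⟨q, g, -, g2, g3, -, g4⟩ := exists_seq hG (⊤ : Subgroup G) W
  have hq := hW.seq_le hG h hD hα hw (s1.trans hw) g2 g3
  rw [Nat.card_congr (Equiv.subtypeUnivEquiv (p := (· ∈ (⊤ : Subgroup G))) fun _ => trivial)] at g4
  exact g4.trans (Nat.mul_le_mul_right _ (Nat.pow_le_pow_right hp.pos hq))

/-- The rank of an effective action is bounded, and so is the cohomology of fixed point sets. -/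
theorem IsGood.rank_le [Finite G] (h : IsGood S G D b) (hD : 0 < D)
    {α : G → k} (hα : LinearIndependent (ZMod p) α) (he : ∀ g : G, (∀ x : X, g • x = x) → g = 1)
    {w : ℕ} (hw : wtOn S D univ ≤ w) (K : Subgroup G) :
    wtOn S D (fx X K) ≤ w ∧ Nat.card K ≤ p ^ ((D + 1) * (2 * w) * (D + 1) * w) := by
  suffices ∃ c : ℕ, wtOn S D (fx X K) + c ≤ w ∧
      Nat.card K ≤ p ^ ((D + 1) * (2 * w) * (D + 1) * c) by
    obtain ⟨c, h1, h2⟩ := this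
    exact ⟨le_self_add.trans h1, h2.trans (Nat.pow_le_pow_right (Fact.out : p.Prime).pos
      (Nat.mul_le_mul_left _ (by exact_mod_cast le_add_self.trans h1)))⟩
  induction K using WellFoundedLT.induction with
  | ind K ih =>
    by_cases hK : K = ⊥
    · subst hK
      refine ⟨0, ?_, by simp⟩
      have : fx X (⊥ : Subgroup G) = univ := by
        refine Set.eq_univ_of_forall fun x g hg => ?_
        rw [Subgroup.mem_bot.1 hg, one_smul]
      rw [this]
      simpa using hw
    obtain ⟨g, hg⟩ := Subgroup.ne_bot_iff_exists_ne_one.1 hK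
    obtain ⟨x, hx⟩ : ∃ x : X, (g : G) • x ≠ x := by
      by_contra! h'
      exact hg (Subtype.ext (he g h'))
    obtain ⟨W, -, hW⟩ := exists_maxStab (G := K) (x := x) fun h' => hx (h'.ge (x := g) trivial)
    have hlt : W.map K.subtype < K := by
      refine lt_of_le_of_ne (Subgroup.map_subtype_le W) fun h' => hW.1.1 ?_
      refine Subgroup.map_injective K.subtype_injective ?_
      rw [h', ← MonoidHom.range_eq_map, Subgroup.range_subtype]
    obtain ⟨c, h1, h2⟩ := ih _ hlt
    rw [fx_map] at h1
    have hα' : LinearIndependent (ZMod p) fun g : W => α (g : K) :=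
      hα.comp _ (val_injective.comp val_injective)
    obtain ⟨s1, s2⟩ := hW.step (fun g => Subtype.ext (hG g)) (h.subgroup K) hD hα' (le_self_add.trans h1)
    refine ⟨c + 1, ?_, s2.trans ?_⟩
    · rw [show fx X K = fx X (⊤ : Subgroup K) by
        rw [← fx_map, ← MonoidHom.range_eq_map, Subgroup.range_subtype]]
      refine le_trans ?_ h1
      push_cast
      rw [add_comm (c : ℕ∞), ← add_assoc]
      gcongr
    · rw [mul_add _ c, mul_one, pow_add, mul_comm,
        Nat.card_congr (W.equivMapOfInjective _ K.subtype_injective).toEquiv]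
      exact Nat.mul_le_mul_right _ h2

end

section
variable {p : ℕ}
  {d : End k V} {t : ℕ → End k V} {K L A B : ℕ → Submodule k V}

theorem Fam.hT_direct (h : Fam p d t) (hK : SCx d t K) (hA : SCx d t A) (hB : SCx d t B)
    (hAK : ∀ m, A m ≤ K m) (hBK : ∀ m, B m ≤ K m) (hL : ∀ m, L m = A m ⊓ B m)
    (hs : ∀ m, ∀ x ∈ K m, ∃ y ∈ A m, x - y ∈ B m) (q m : ℕ) :
    hT p q d t K A m + hT p q d t K B m ≤ hT p q d t K L m := by
  induction q generalizing V with
  | zero =>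
    have hs' : ∀ m, K m ≤ A m ⊔ B m := fun m x hx => by
      obtain ⟨y, hy, hxy⟩ := hs m x hx
      exact Submodule.mem_sup.2 ⟨y, hy, _, hxy, add_sub_cancel _ _⟩
    have e1 := hc_second_iso hB.cx hK.cx hA.cx hBK (C := L)
      (fun m x hx => by rw [hL]; exact ⟨fun h => ⟨h, hx⟩, And.left⟩) hs' m
    have e2 := hc_second_iso hA.cx hK.cx hB.cx hAK (C := L)
      (fun m x hx => by rw [hL]; exact ⟨fun h => ⟨hx, h⟩, And.right⟩)
      (fun m => (hs' m).trans (sup_comm _ _).le) m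
    have := hc_direct hA.cx hB.cx hK.cx (fun m => (hL m).trans_le inf_le_left)
      (fun m => (hL m).trans_le inf_le_right) hAK hBK (fun m => (hL m).ge) hs' m
    rw [e1, e2, add_comm] at this
    exact this
  | succ q ih =>
    refine ih h.lift (h.totC hK) (h.totC hA) (h.totC hB) (tot_mono hAK) (tot_mono hBK)
      (fun m => ?_) fun m F hF => ?_
    · ext F
      simp [mem_tot, hL, forall_and]
    · choose y h1 h2 using fun a => hs _ _ (mem_tot.1 hF a)
      exact ⟨y, mem_tot.2 h1, mem_tot.2 h2⟩

theorem Fam.one_le_hT (h : Fam p d t) (hp : 2 ≤ p) (hK : SCx d t K) (hL : SCx d t L)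
    (le : ∀ m, L m ≤ K m) (ht : ∀ i {m x}, x ∈ K m → t i x ∈ L m) {i m : ℕ}
    (hi : hc d K L i ≠ 0) (him : i ≤ m) : 1 ≤ hT p 1 d t K L m :=
  (Order.one_le_iff_ne_zero.2 hi).trans <| le_trans
    (single_le_sum (f := hc d K L) (fun _ _ => zero_le) (mem_range.2 (by omega)))
    (h.le_hT hp hK hL le ht 1 m)

end

section
variable [MetricSpace X] [CompactSpace X] [Finite I] [Finite G] {S : CoefSys X I k} {A B C : Set X}

theorem hc_inter_eq_zero (hc' : ∀ g : G, Continuous fun x : X => g • x) (hB : IsClosed B)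
    (hC : IsClosed C) (hA : B ∩ C = A) (hG : ∀ a ∈ A, ∀ g : G, g • a = a) (m : ℕ) :
    hc cd (S.Cpl {(univ, B), (univ, C)}) (S.rel (B ∪ C)) m = 0 := by
  rw [hc_eq_zero]
  intro z hz hdz
  have hz' : z ∈ S.Cpl {(univ, A), (univ, B), (univ, C)} m := ⟨hz.1, hz.2.1, by
    rintro P (rfl | hP) x hx
    exacts [(hz.2.2 _ (Or.inl rfl) x hx).mono (hA ▸ inter_subset_left), hz.2.2 P hP x hx]⟩
  obtain ⟨ε, hε, h1⟩ := exists_snap_radius (by simp) (by simp) hz'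
  obtain ⟨δ, hδ, h2⟩ := exists_snap_radius (by simp) (by simp) hdz
  obtain ⟨r, O, r1, -, r3, -, r5, r6, r7, -⟩ := exists_snap hc' (A := A) (B := univ)
    (fun g a ha => by rwa [hG a ha]) (fun _ _ _ => trivial) (fun _ _ _ a ha g _ => hG a ha g)
    (lt_min hε hδ)
  have rB : ∀ x ∈ B, r x ∈ B := fun x hx => (r3 x).elim (fun h => by rwa [h])
    fun h => (hA ▸ h : r x ∈ B ∩ C).1
  have rC : ∀ x ∈ C, r x ∈ C := fun x hx => (r3 x).elim (fun h => by rwa [h])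
    fun h => (hA ▸ h : r x ∈ B ∩ C).2
  obtain ⟨a1, a2, a3⟩ := h1 r (fun x => (r1 x).trans_le (min_le_left _ _)) (by
    rintro P (rfl | rfl | rfl) x hx
    exacts [hA ▸ ⟨rB x (hA ▸ hx : x ∈ B ∩ C).1, rC x (hA ▸ hx : x ∈ B ∩ C).2⟩, rB x hx, rC x hx])
  obtain ⟨-, b2, -⟩ := h2 r (fun x => (r1 x).trans_le (min_le_right _ _)) (by
    rintro P rfl x hx
    exact hx.imp (rB x) (rC x))
  refine ⟨-prism r z, neg_mem ⟨a2.1, a2.2.1, fun P hP => a2.2.2 P (Or.inr hP)⟩, ?_⟩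
  have e : z - cd (-prism r z) = pb id r z - prism r (cd z) := by
    rw [map_neg, sub_neg_eq_add]
    linear_combination (exp := 1) cd_prism r z
  rw [e]
  refine sub_mem (CoefSys.mem_rel.2 ⟨a1.1, a1.2.1, fun x => ?_⟩) b2
  by_cases hxC : x ∈ C
  · by_cases hxB : x ∈ B
    · exact a3 O A _ r5 (fun x hx _ => r7 x hx trivial) (Or.inl rfl) x (r6 (hA ▸ ⟨hxB, hxC⟩))
    · exact a3 Bᶜ C _ hB.isOpen_compl (fun x hx h => rC x (h.resolve_left hx))
        (Or.inr (Or.inr rfl)) x hxB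
  · exact a3 Cᶜ B _ hC.isOpen_compl (fun x hx h => rB x (h.resolve_right hx))
      (Or.inr (Or.inl rfl)) x hxC

/-- The iterated cohomology is superadditive for closed sets that only meet in fixed points. -/
theorem hT_union_le {p : ℕ} (hp : p.Prime) [CharP k p] (hp' : ∀ g : G, g ^ p = 1)
    (hE : IsEq S G) (hB : IsClosed B) (hC : IsClosed C) (iB : ∀ g : G, ∀ x ∈ B, g • x ∈ B)
    (iC : ∀ g : G, ∀ x ∈ C, g • x ∈ C) (hA : B ∩ C = A) (hG : ∀ a ∈ A, ∀ g : G, g • a = a)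
    (g : ℕ → G) (q m : ℕ) :
    hT p q cd (tg g) (S.rel A) (S.rel B) m + hT p q cd (tg g) (S.rel A) (S.rel C) m ≤
      hT p q cd (tg g) (S.rel A) (S.rel (B ∪ C)) m := by
  cases nonempty_fintype G
  have F := tg_fam (X := X) (I := I) (k := k) (g := g) hp hp'
  have cA : IsClosed A := hA ▸ hB.inter hC
  have hAB : A ⊆ B := hA ▸ inter_subset_left
  have hAC : A ⊆ C := hA ▸ inter_subset_right
  have hL : ∀ m, S.Cpl {(univ, B), (univ, C)} m = S.rel B m ⊓ S.rel C m := fun m => by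
    ext f
    simp only [mem_inf, mem_Cpl, CoefSys.mem_rel]
    simp
    tauto
  have i2 : InvCond G {((univ : Set X), B), (univ, C)} := by
    rintro P (rfl | rfl) g
    exacts [⟨fun _ _ => trivial, iB g⟩, ⟨fun _ _ => trivial, iC g⟩]
  have s1 := F.hT_direct (rel_sCx hE fun g a ha => by rwa [hG a ha]) (rel_sCx hE iB) (rel_sCx hE iC)
    (rel_anti hAB) (rel_anti hAC) hL (fun m f hf => by
      have hm := CoefSys.mulOp_mem hf (inInd k C)
      refine ⟨_, CoefSys.mem_rel.2 ⟨hm.1, hm.2.1, fun x => ?_⟩, ?_⟩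
      · intro c hc
        obtain ⟨U, hU, hx, h'⟩ := eventually_nl.1 ((CoefSys.mem_rel.1 hf).2.2 x c hc)
        refine eventually_nl.2 ⟨U, hU, hx, fun l hl => ?_⟩
        rw [mulOp_apply]
        by_cases hP : ∀ y ∈ l, y ∈ C
        · rw [h' l fun y hy => ⟨(hl y hy).1, hA ▸ ⟨(hl y hy).2, hP y hy⟩⟩, mul_zero]
        · rw [inInd_of_not hP, zero_mul]
      · have := sub_mem hf hm
        exact CoefSys.mem_rel.2 ⟨this.1, this.2.1, fun x => vanAt_sub_inInd⟩) q m
  have le : ∀ m, S.rel (B ∪ C) m ≤ S.Cpl {(univ, B), (univ, C)} m := fun m => by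
    rw [hL]
    exact le_inf (rel_anti Set.subset_union_left m)
      (rel_anti Set.subset_union_right m)
  have s2 := F.hT_le_add' (J := S.rel A) le
    (fun m => (hL m).trans_le (inf_le_left.trans (rel_anti hAB m))) q m
  rw [F.hT_eq_zero (Cpl_sCx hE i2) (rel_sCx hE fun g x hx => hx.imp (iB g x) (iC g x)) le
    (hc_inter_eq_zero hE.cont hB hC hA hG), add_zero] at s2
  exact s1.trans s2

omit [Finite G] in
theorem mem_of_mem_sup {P T C : Subgroup G} (h : P ⊓ T = ⊥)
    (hC : C ≤ P) {x : G} (hx : x ∈ P) (hx' : x ∈ T ⊔ C) : x ∈ C := by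
  obtain ⟨t, ht, c, hc, rfl⟩ := Subgroup.mem_sup.1 hx'
  have : t ∈ P ⊓ T := ⟨(P.mul_mem_cancel_right (hC hc)).1 hx, ht⟩
  rw [h, Subgroup.mem_bot] at this
  rwa [this, one_mul]

section
variable {D b : ℕ} {p : ℕ} [Fact p.Prime] [CharP k p] [Algebra (ZMod p) k]
  (hG : ∀ g : G, g ^ p = 1) {T P : Subgroup G}
include hG

omit hG [Fact p.Prime] [CharP k p] [Algebra (ZMod p) k] in
theorem gop_sub_mem_rel (h : IsEq S G) (h2 : P ⊔ T = ⊤) {e : Set G}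
    (g3 : P ≤ Subgroup.closure e) {m : ℕ} {x : I → List X → k}
    (hx : x ∈ fixC S e {(univ, fx X (⊤ : Subgroup G))} (fx X T) m) (a : G) :
    gop a x - x ∈ S.rel (fx X T) m := by
  have hF := fx_freeOn (W := T) h
  let := ofFinite G
  let H : Subgroup G :=
    { carrier := {a | gop a x - x ∈ S.rel (fx X T) m}
      one_mem' := by simp [gop_one]
      mul_mem' := fun {a c} ha hc => by
        have := add_mem (h.gop_mem (InvCond.rel hF.hB) a hc) ha
        rw [map_sub, sub_add_sub_cancel, ← End.mul_apply, ← gop_mul] at this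
        exact this
      inv_mem' := fun {a} ha => by
        have := neg_mem (h.gop_mem (InvCond.rel hF.hB) a⁻¹ ha)
        rw [map_sub, ← End.mul_apply, ← gop_mul, inv_mul_cancel, gop_one, neg_sub] at this
        exact this }
  have hx' := mem_fixC.1 hx
  have l1 : P ≤ H := g3.trans ((closure_le H).2 hx'.2)
  have l2 : T ≤ H := fun t ht => by
    have := sub_mem (h.gop_mem (InvCond.rel hF.hA) t hx'.1) hx'.1
    refine CoefSys.mem_rel.2 ⟨this.1, this.2.1, fun y => ?_⟩
    by_cases hy : y ∈ fx X T
    · exact h.vanAt_sub t (hy t ht) (fun z (hz : z ∈ fx X T) => hz t ht) hx'.1.2.1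
    · exact CoefSys.VanAt.of_notMem (by rwa [hF.closed.closure_eq])
        fun c => this.1 c _ (Or.inr rfl)
  exact (h2 ▸ sup_le l1 l2 : ⊤ ≤ H) trivial

theorem MaxStab.one_le_hT (h : IsGood S G D b) (hD : 0 < D) (hT' : MaxStab X T) {α : T → k}
    (hα : LinearIndependent (ZMod p) α) (h1 : P ⊓ T = ⊥) (h2 : P ⊔ T = ⊤) {q : ℕ} {g : ℕ → G}
    (g1 : ∀ l < q, g l ∈ P) (g2 : ∀ l < q, g l ∉ Subgroup.closure (g '' Iio l))
    (g3 : P ≤ Subgroup.closure (g '' Iio q)) (g4 : ∀ l, q + 1 ≤ l → g l = 1) :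
    1 ≤ hT p (q + 1) cd (tg g) (S.rel (fx X (⊤ : Subgroup G))) (S.rel (fx X T)) (D + 1) := by
  classical
  let := ofFinite G
  have hp : p.Prime := Fact.out
  have hF := fx_freeOn (W := T) h.toIsEq
  have F := tg_fam (X := X) (I := I) (k := k) (g := g) hp hG
  have hχ : ∀ l < q, HasChar (Pi.single (g l) (1 : k)) (g '' Iio l)
      (fx X (⊤ : Subgroup G)) (fx X T) := fun l hl => hT'.hasChar hG fun hg => by
    refine g2 l hl (mem_of_mem_sup h1 ((closure_le P).2 ?_) (g1 l hl) hg)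
    rintro _ ⟨i, hi, rfl⟩
    exact g1 i (lt_trans hi hl)
  obtain ⟨i, hi, hmin⟩ : ∃ i, hc cd (S.rel (fx X (⊤ : Subgroup G))) (S.rel (fx X T)) i ≠ 0 ∧
      ∀ j < i, hc cd (S.rel (fx X (⊤ : Subgroup G))) (S.rel (fx X T)) j = 0 := by
    have hi := hT'.hc_ne_zero hG h hD hα
    exact ⟨_, Nat.find_spec hi, fun j hj => not_not.1 (Nat.find_min hi hj)⟩
  have low := F.low hp.two_le (fun i hi => by rw [tg, g4 i hi, gop_one, sub_self])
    (rel_sCx h.toIsEq hF.hA) (rel_sCx h.toIsEq hF.hB) (rel_anti hF.le)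
    hmin hi q
  have hle : i ≤ D := not_lt.1 fun h' => hi
    (h.hc_rel_eq_zero (isClosed_fx h.cont _) hF.closed hF.le h')
  have e0 := hF.hT_eq hp hG h.toIsEq hχ 0 (i)
  rw [add_zero] at e0
  rw [e0] at low
  rw [hF.hT_eq hp hG h.toIsEq hχ 1]
  have F' : Fam p cd (fun i => (tg g (q + i) : COp I X k)) :=
    ⟨F.dd, fun i => F.dt _, fun i j => F.tt _ _, fun i => F.tp _, F.p0⟩
  have sK := fixC_sCx (g := g) (e := g '' Iio q) h.toIsEq hF.adm
  have sL := rel_sCx (g := g) h.toIsEq hF.hB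
  have sK' : SCx cd (fun i => (tg g (q + i) : COp I X k))
    (fixC S (g '' Iio q) {(univ, fx X (⊤ : Subgroup G))} (fx X T)) :=
    ⟨sK.cx, fun i => sK.st (q + i)⟩
  have sL' : SCx cd (fun i => (tg g (q + i) : COp I X k)) (S.rel (fx X T)) :=
    ⟨sL.cx, fun i => sL.st (q + i)⟩
  have ht : ∀ (i : ℕ) {m x}, x ∈ fixC S (g '' Iio q) {(univ, fx X (⊤ : Subgroup G))}
      (fx X T) m → tg g (q + i) x ∈ S.rel (fx X T) m := fun i m x hx =>
    gop_sub_mem_rel h.toIsEq h2 g3 hx _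
  have lef := hF.adm.le_fixC (e := g '' Iio q) h.toIsEq
  exact F'.one_le_hT hp.two_le sK' sL' lef ht low (hle.trans (Nat.le_succ D))

omit hG [CompactSpace X] [Finite I] [Finite G] [Fact p.Prime] [CharP k p] [Algebra (ZMod p) k] in
theorem isClosed_fx_union [Finite G] (hc : ∀ g : G, Continuous fun x : X => g • x)
    (Q : Subgroup G → Prop) : IsClosed {x | ∃ V : Subgroup G, Q V ∧ x ∈ fx X V} := by
  have : {x | ∃ V : Subgroup G, Q V ∧ x ∈ fx X V} = ⋃ V ∈ {V | Q V}, fx X V := by ext; simp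
  rw [this]
  exact (toFinite _).isClosed_biUnion fun V _ => isClosed_fx hc V

/-- The number of minimal subgroups which are maximal proper stabilizers and have a common complement
is bounded. -/
theorem IsGood.card_atom_le (h : IsGood S G D b) (hD : 0 < D) {α : G → k}
    (hα : LinearIndependent (ZMod p) α) {w : ℕ} (hw : ∀ K : Subgroup G, wtOn S D (fx X K) ≤ w)
    (hw' : wtOn S D univ ≤ w) {P : Subgroup G} {𝒯 : Finset (Subgroup G)}
    (h𝒯 : ∀ T ∈ 𝒯, MaxStab X T ∧ IsAtom T ∧ P ⊓ T = ⊥ ∧ P ⊔ T = ⊤) :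
    𝒯.card ≤ (D + 2) ^ ((D + 1) * (2 * w) * (D + 1) + 1) * (2 * w) := by
  classical
  let := ofFinite G
  have hp : p.Prime := Fact.out
  obtain rfl | ⟨T₀, hT₀⟩ := 𝒯.eq_empty_or_nonempty
  · simp
  have hαT : ∀ T : Subgroup G, LinearIndependent (ZMod p) fun g : T => α g := fun T =>
    hα.comp _ val_injective
  obtain ⟨q, g, g1, g2, g3, g4, -⟩ := exists_seq hG P ⊥
  simp only [bot_sup_eq] at g3 g4
  have hP : Subgroup.closure (g '' Iio q) ≤ P :=
    (closure_le P).2 (by rintro _ ⟨i, -, rfl⟩; exact g1 i)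
  obtain ⟨a, haT, ha⟩ : ∃ a ∈ T₀, a ∉ P := SetLike.not_le_iff_exists.1 fun hle => by
    obtain ⟨-, h2, h3, -⟩ := h𝒯 T₀ hT₀
    exact h2.1 (by rwa [inf_eq_right.2 hle] at h3)
  have hq : q ≤ (D + 1) * (2 * w) * (D + 1) := by
    obtain ⟨h1, -, h3, -⟩ := h𝒯 T₀ hT₀
    exact h1.seq_le hG h hD (hαT T₀) (hw _) (hw _) g2 fun l hl hg =>
      g3 l hl (mem_of_mem_sup h3 ((Subgroup.closure_mono (image_mono fun i hi =>
        lt_trans hi hl)).trans hP) (g1 l) hg)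
  set g' : ℕ → G := update g q a with hg'
  have e : ∀ l ≤ q, g' '' Iio l = g '' Iio l := fun l hl => Set.image_congr fun i hi =>
    update_of_ne (lt_of_lt_of_le hi hl).ne _ _
  have e' : ∀ l < q, g' l = g l := fun l hl => update_of_ne hl.ne _ _
  have F := tg_fam (X := X) (I := I) (k := k) (g := g') hp hG
  have cA := isClosed_fx h.cont (⊤ : Subgroup G)
  let C (𝒰 : Finset (Subgroup G)) : Set X := {x | ∃ V : Subgroup G, (V ≠ ⊥ ∧ V ∉ 𝒰) ∧ x ∈ fx X V}
  have cC : ∀ 𝒰, IsClosed (C 𝒰) := fun 𝒰 => isClosed_fx_union h.cont _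
  have iC : ∀ 𝒰, ∀ g : G, ∀ x ∈ C 𝒰, g • x ∈ C 𝒰 := fun 𝒰 g x ⟨V, hV, hx⟩ =>
    ⟨V, hV, smul_mem_fx g x hx⟩
  have key : ∀ 𝒰 ⊆ 𝒯, (𝒰.card : ℕ∞) + hT p (q + 1) cd (tg g') (S.rel (fx X (⊤ : Subgroup G)))
      (S.rel (C 𝒰)) (D + 1) ≤ hT p (q + 1) cd (tg g') (S.rel (fx X (⊤ : Subgroup G)))
      (S.rel (C ∅)) (D + 1) := by
    intro 𝒰
    induction 𝒰 using Finset.induction_on with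
    | empty => simp
    | insert T 𝒰 hT ih =>
      intro h𝒰
      obtain ⟨h1, h2, h3, h4⟩ := h𝒯 T (h𝒰 (Finset.mem_insert_self _ _))
      refine le_trans ?_ (ih fun V hV => h𝒰 (Finset.mem_insert_of_mem hV))
      have u : fx X T ∪ C (insert T 𝒰) = C 𝒰 := by
        ext x
        constructor
        · rintro (hx | ⟨V, ⟨hV, hV'⟩, hx⟩)
          exacts [⟨T, ⟨h2.1, hT⟩, hx⟩, ⟨V, ⟨hV, fun h => hV' (Finset.mem_insert_of_mem h)⟩, hx⟩]
        · rintro ⟨V, ⟨hV, hV'⟩, hx⟩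
          by_cases hVT : V = T
          · exact Or.inl (hVT ▸ hx)
          · exact Or.inr ⟨V, ⟨hV, by simp [hVT, hV']⟩, hx⟩
      have n : fx X T ∩ C (insert T 𝒰) = fx X (⊤ : Subgroup G) := by
        refine Set.Subset.antisymm ?_ fun x hx => ⟨fx_anti le_top hx, ⊤, ⟨?_, fun h => ?_⟩, hx⟩
        · rintro x ⟨hx, V, ⟨hV, hV'⟩, hxV⟩
          by_contra hx'
          have := h1.eq hx hx' ▸ mem_fx.1 hxV
          exact (h2.le_iff.1 this).elim hV fun h => hV' (h ▸ Finset.mem_insert_self _ _)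
        · exact fun h => h2.1 (le_bot_iff.1 (h ▸ le_top))
        · exact (h𝒯 _ (h𝒰 h)).1.1.1 rfl
      have s := hT_union_le hp hG h.toIsEq (isClosed_fx h.cont T) (cC (insert T 𝒰)) smul_mem_fx
        (iC _) n (fun a ha g => ha g trivial) g' (q + 1) (D + 1)
      rw [u] at s
      have s1 := h1.one_le_hT hG h hD (hαT T) h3 h4 (g := g') (q := q)
        (fun l hl => by rw [e' l hl]; exact g1 l)
        (fun l hl => by rw [e' l hl, e l hl.le]; exact g3 l hl) (by rwa [e q le_rfl])
        (fun l hl => by rw [hg', update_of_ne (by omega)]; exact g2 l (by omega))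
      rw [Finset.card_insert_of_notMem hT, Nat.cast_succ, add_assoc]
      exact add_le_add_right ((add_le_add_left s1 _).trans s) _
  have hF : FreeOn G (C ∅) univ := ⟨iC ∅, fun _ _ _ => trivial, subset_univ _, isClosed_univ,
    fun x _ hx a _ g hg => by
      have : MulAction.stabilizer G x = ⊥ := by
        by_contra h'
        exact hx ⟨_, ⟨h', notMem_empty _⟩, mem_fx.2 le_rfl⟩
      have hg' : g ∈ MulAction.stabilizer G x := hg
      rw [this, Subgroup.mem_bot] at hg'
      rw [hg', one_smul]⟩
  have z : hT p (q + 1) cd (tg g') (S.rel (C ∅)) (S.rel univ) (D + 1 + 1) = 0 := by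
    refine hF.hT_eq_zero hp hG h.toIsEq (fun l hl => HasChar.single hG fun x _ hx => ?_)
      (D := D) (fun i hi => h.hc_rel_eq_zero (cC _) isClosed_univ (subset_univ _) hi) (by omega)
    have : MulAction.stabilizer G x = ⊥ := by
      by_contra h'
      exact hx ⟨_, ⟨h', notMem_empty _⟩, mem_fx.2 le_rfl⟩
    rw [this, bot_sup_eq, e l (by omega)]
    obtain hl | rfl := Nat.lt_succ_iff_lt_or_eq.1 hl
    · rw [e' l hl]; exact g3 l hl
    · rw [hg', Function.update_self]; exact fun h => ha (hP h)
  have l1 := F.hT_le_add' (J := S.rel (fx X (⊤ : Subgroup G))) (K := S.rel (C ∅))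
    (L := S.rel univ) (rel_anti (subset_univ _))
    (rel_anti fun x hx => ⟨⊤, ⟨fun h => (h𝒯 T₀ hT₀).2.1.1 (le_bot_iff.1 (h ▸ le_top)),
      notMem_empty _⟩, hx⟩) (q + 1) (D + 1)
  have l2 := F.hT_le (K := S.rel (fx X (⊤ : Subgroup G))) (L := S.rel univ)
    (rel_sCx h.toIsEq smul_mem_fx) (rel_sCx h.toIsEq fun _ _ _ => trivial)
    (rel_anti (subset_univ _)) (q + 1) (D + 1)
  have l3 := Pre_iter_le (h.hc_rel_le cA isClosed_univ (subset_univ _) (hw _) hw') (q + 1) (D + 1)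
  rw [z, add_zero] at l1
  have := (le_self_add.trans (key 𝒯 subset_rfl)).trans (l1.trans (l2.trans l3))
  rw [Nat.cast_le] at this
  exact this.trans (Nat.mul_le_mul_right _ (Nat.pow_le_pow_right (by omega) (by omega)))

end
end

section
variable {p : ℕ} [Fact p.Prime] (hG : ∀ g : G, g ^ p = 1)

include hG in
/-- A small set of nontrivial elements avoids the kernel of some character. -/
theorem exists_hom_ne (s : Finset G) (hs : ∀ g ∈ s, g ≠ 1) (hp : s.card < p) :
    ∃ χ : G →* Multiplicative (ZMod p), ∀ g ∈ s, χ g ≠ 1 := by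
  classical
  induction s using Finset.induction_on with
  | empty => exact ⟨1, by simp⟩
  | insert g s hg ih =>
    rw [Finset.card_insert_of_notMem hg] at hp
    obtain ⟨χ, hχ⟩ := ih (fun g h => hs g (Finset.mem_insert_of_mem h)) (by omega)
    by_cases h : χ g = 1
    · obtain ⟨ψ, -, hψ⟩ := exists_hom hG (W := ⊥) (g := g) (by simpa using hs g)
      obtain ⟨c, hc⟩ : ∃ c : ZMod p, c ∉ s.image fun h => -(ψ h).toAdd / (χ h).toAdd := by
        by_contra! hc
        have := Finset.card_le_card (Finset.subset_iff.2 fun c (_ : c ∈ Finset.univ) => hc c)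
        rw [Finset.card_univ, ZMod.card] at this
        have := this.trans card_image_le
        omega
      refine ⟨ψ * χ ^ c.val, fun x hx hx1 => ?_⟩
      rw [MonoidHom.mul_apply, MonoidHom.pow_apply] at hx1
      obtain rfl | hx := mem_insert.1 hx
      · rw [h, one_pow, mul_one] at hx1
        exact hψ hx1
      · refine hc (mem_image.2 ⟨x, hx, ?_⟩)
        have h0 : (χ x).toAdd ≠ 0 := hχ x hx
        have h1 : (ψ x).toAdd + c.val • (χ x).toAdd = 0 := hx1
        rw [nsmul_eq_mul, ZMod.natCast_zmod_val] at h1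
        rw [div_eq_iff h0]
        linear_combination -h1
    · refine ⟨χ, fun x hx => ?_⟩
      obtain rfl | hx := mem_insert.1 hx
      exacts [h, hχ x hx]

theorem le_of_inf_ker_le {χ : G →* Multiplicative (ZMod p)} {a : G} {T V : Subgroup G}
    (haT : a ∈ T) (haV : a ∈ V) (ha : χ a ≠ 1) (h : T ⊓ χ.ker ≤ V) : T ≤ V := fun t ht => by
  have h0 : (χ a).toAdd ≠ 0 := ha
  have : t * a ^ (-(χ t).toAdd / (χ a).toAdd).val ∈ V := by
    refine h ⟨mul_mem ht (pow_mem haT _), ?_⟩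
    change χ _ = 1
    rw [map_mul, map_pow]
    change (χ t).toAdd + (_ : ℕ) • (χ a).toAdd = 0
    rw [nsmul_eq_mul, ZMod.natCast_zmod_val]
    field_simp
    ring
  exact (Subgroup.mul_mem_cancel_right _ (pow_mem haV _)).1 this

include hG in
theorem exists_compl {𝒯 : Finset (Subgroup G)} (h𝒯 : ∀ T ∈ 𝒯, IsAtom T) (hp : 𝒯.card < p) :
    ∃ P : Subgroup G, ∀ T ∈ 𝒯, P ⊓ T = ⊥ ∧ P ⊔ T = ⊤ := by
  classical
  choose! f hf hf' using fun (T : Subgroup G) hT => T.bot_or_exists_ne_one.resolve_left (h𝒯 T hT).1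
  obtain ⟨χ, hχ⟩ := exists_hom_ne hG (𝒯.image f) (Finset.forall_mem_image.2 hf')
    (card_image_le.trans_lt hp)
  have hχ : ∀ T ∈ 𝒯, χ (f T) ≠ 1 := fun T hT => hχ _ (Finset.mem_image_of_mem f hT)
  refine ⟨χ.ker, fun T hT => ⟨?_, ?_⟩⟩
  · exact ((h𝒯 T hT).le_iff.1 inf_le_right).resolve_right fun h =>
      hχ T hT (h.ge (hf T hT)).1
  · exact top_le_iff.1 (le_of_inf_ker_le (Subgroup.mem_top (f T)) (Subgroup.mem_sup_right (hf T hT))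
      (hχ T hT) (inf_le_right.trans le_sup_left))

include hG in
theorem exists_injOn_inf {𝒯 : Finset (Subgroup G)} (h0 : ∀ T ∈ 𝒯, T ≠ ⊥ ∧ ¬ IsAtom T)
    (h1 : IsAntichain (· ≤ ·) (𝒯 : Set (Subgroup G))) (hn : 𝒯.Nonempty)
    (hp : 𝒯.card * 𝒯.card < p) :
    ∃ P : Subgroup G, P ≠ ⊤ ∧ Set.InjOn (fun T => T ⊓ P) 𝒯 := by
  classical
  choose! f hf hf' using fun (q : Subgroup G × Subgroup G) (hq : q.1 ⊓ q.2 ≠ ⊥) =>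
    (q.1 ⊓ q.2).bot_or_exists_ne_one.resolve_left hq
  obtain ⟨χ, hχ⟩ := exists_hom_ne hG (((𝒯 ×ˢ 𝒯).filter fun q => q.1 ⊓ q.2 ≠ ⊥).image f)
    (Finset.forall_mem_image.2 fun q hq => hf' q (mem_filter.1 hq).2)
    (card_image_le.trans_lt ((Finset.card_filter_le _ _).trans_lt
      (by rwa [Finset.card_product])))
  have hχ : ∀ T ∈ 𝒯, ∀ T' ∈ 𝒯, T ⊓ T' ≠ ⊥ → χ (f (T, T')) ≠ 1 := fun T hT T' hT' h =>
    hχ _ (Finset.mem_image_of_mem f (mem_filter.2 ⟨Finset.mk_mem_product hT hT', h⟩))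
  refine ⟨χ.ker, fun h => ?_, fun T hT T' hT' h => ?_⟩
  · obtain ⟨T, hT⟩ := hn
    exact hχ T hT T hT (by simpa using (h0 T hT).1) (h.ge (Subgroup.mem_top _))
  · have h : T ⊓ χ.ker = T' ⊓ χ.ker := h
    by_cases hb : T ⊓ T' = ⊥
    · have hT0 : T ⊓ χ.ker = ⊥ := by
        rw [eq_bot_iff, ← hb]
        exact le_inf inf_le_left (h.le.trans inf_le_left)
      refine absurd ⟨(h0 T hT).1, fun V hV => ?_⟩ (h0 T hT).2
      by_contra hV0
      obtain ⟨v, hv, hv1⟩ := V.bot_or_exists_ne_one.resolve_left hV0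
      refine hV.not_ge (le_of_inf_ker_le (χ := χ) (hV.le hv) hv (fun h => hv1 ?_)
        (hT0.le.trans bot_le))
      exact Subgroup.mem_bot.1 (hT0.le ⟨hV.le hv, h⟩)
    · by_contra hne
      exact h1 hT hT' hne (le_of_inf_ker_le (hf (T, T') hb).1 (hf (T, T') hb).2
        (hχ T hT T' hT' hb) (h.le.trans inf_le_left))

end

section
variable [Finite G] [MetricSpace X] [CompactSpace X] [Finite I] {S : CoefSys X I k} {D b : ℕ}
  {p : ℕ} [Fact p.Prime] [CharP k p] [Algebra (ZMod p) k] (hG : ∀ g : G, g ^ p = 1)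

theorem ncard_stabilizer_le (X : Type*) {G : Type*} [Group G] [Finite G] [MulAction G X] {N : ℕ}
    (h : Nat.card G ≤ N) : (Set.range fun x : X => MulAction.stabilizer G x).ncard ≤ 2 ^ N := by
  refine (Set.ncard_le_card _).trans ((Nat.card_le_card_of_injective
    (fun H : Subgroup G => (H : Set G)) SetLike.coe_injective).trans ?_)
  have := ofFinite G
  rw [Nat.card_eq_fintype_card (α := Set G), Fintype.card_set, ← Nat.card_eq_fintype_card]
  exact Nat.pow_le_pow_right two_pos h

include hG in
theorem card_le_of_ne_top {W : Subgroup G} (hW : W ≠ ⊤) {r : ℕ} (h : Nat.card G ≤ p ^ (r + 1)) :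
    Nat.card W ≤ p ^ r := by
  have hp : p.Prime := Fact.out
  obtain ⟨n, hn⟩ := IsPGroup.iff_card.1 (show IsPGroup p W from
    fun g => ⟨1, Subtype.ext (by simpa using hG g)⟩)
  rw [hn]
  refine Nat.pow_le_pow_right hp.pos (Nat.lt_succ_iff.1 ((Nat.pow_lt_pow_iff_right hp.one_lt).1
    (lt_of_lt_of_le ?_ h)))
  rw [← hn]
  exact lt_of_le_of_ne (Subgroup.card_le_card_group W) fun h => hW (Subgroup.card_eq_iff_eq_top W |>.1 h)

open Classical in
include hG in
theorem IsGood.ncard_step (h : IsGood S G D b) (hD : 0 < D) {α : G → k}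
    (hα : LinearIndependent (ZMod p) α) (he : ∀ g : G, (∀ x : X, g • x = x) → g = 1)
    {C w N : ℕ} (hw : wtOn S D univ ≤ w)
    (hN : N = (D + 2) ^ ((D + 1) * (2 * w) * (D + 1) + 1) * (2 * w))
    (hC : ∀ W : Subgroup G, W ≠ ⊤ → (Set.range fun x : X => MulAction.stabilizer W x).ncard ≤ C)
    (hp : N + 1 + (C + 2) * (C + 2) < p) :
    (Set.range fun x : X => MulAction.stabilizer G x).ncard ≤ (N + (C + 1) + 1) * C + 1 := by
  have hst : ∀ (W : Subgroup G) (x : X),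
      MulAction.stabilizer W x = (MulAction.stabilizer G x).subgroupOf W := fun W x => rfl
  have hf := toFinite {W : Subgroup G | MaxStab X W}
  have hA : (hf.toFinset.filter IsAtom).card ≤ N := by
    by_contra! hlt
    obtain ⟨𝒯, h1, h2⟩ := Finset.exists_subset_card_eq (Nat.succ_le_of_lt hlt)
    have h1 : ∀ T ∈ 𝒯, MaxStab X T ∧ IsAtom T := fun T hT => by simpa using h1 hT
    obtain ⟨P, hP⟩ := exists_compl hG (fun T hT => (h1 T hT).2) (h2.trans_lt (by omega))
    have := h.card_atom_le hG hD hα (fun K => (h.rank_le hG hD hα he hw K).1) hw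
      (fun T hT => ⟨(h1 T hT).1, (h1 T hT).2, hP T hT⟩)
    omega
  have hB : (hf.toFinset.filter fun T => T ≠ ⊥ ∧ ¬ IsAtom T).card ≤ C + 1 := by
    by_contra! hlt
    obtain ⟨𝒯, h1, h2⟩ := Finset.exists_subset_card_eq (Nat.succ_le_of_lt hlt)
    have h1 : ∀ T ∈ 𝒯, MaxStab X T ∧ T ≠ ⊥ ∧ ¬ IsAtom T := fun T hT => by simpa using h1 hT
    obtain ⟨P, hP, hPi⟩ := exists_injOn_inf hG (fun T hT => (h1 T hT).2)
      (fun T hT T' hT' hne hle => hne ((h1 T hT).1.eq_of_le (h1 T' hT').1.prop hle))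
      (Finset.card_pos.1 (by omega)) (by rw [h2]; exact (Nat.le_add_left _ _).trans_lt hp)
    have := Set.ncard_le_ncard_of_injOn (s := 𝒯) (fun T => T.subgroupOf P) (fun T hT => ?_)
      (fun T hT T' hT' hh => hPi hT hT' ?_) (toFinite (Set.range fun x : X =>
        MulAction.stabilizer P x))
    · rw [Set.ncard_coe_finset] at this
      have := this.trans (hC P hP)
      omega
    · obtain ⟨x, rfl⟩ := (h1 T hT).1.prop.2
      exact ⟨x, rfl⟩
    · simpa using congrArg (Subgroup.map P.subtype) hh
  have hM : hf.toFinset.card ≤ N + (C + 1) + 1 := by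
    have : hf.toFinset ⊆ hf.toFinset.filter IsAtom ∪
        (hf.toFinset.filter fun T => T ≠ ⊥ ∧ ¬ IsAtom T) ∪ {⊥} := fun T hT => by
      simp only [Finset.mem_union, mem_filter, Finset.mem_singleton]
      tauto
    refine (Finset.card_le_card this).trans ((Finset.card_union_le _ _).trans ?_)
    grw [Finset.card_union_le, hA, hB, Finset.card_singleton]
  have hs : (Set.range fun x : X => MulAction.stabilizer G x) ⊆ (insert ⊤ (hf.toFinset.biUnion
      fun W => ((toFinite (Set.range fun x : X => MulAction.stabilizer W x)).toFinset.image
        (Subgroup.map W.subtype))) : Finset (Subgroup G)) := by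
    rintro _ ⟨x, rfl⟩
    simp only [Finset.coe_insert, Set.mem_insert_iff]
    by_cases hx : MulAction.stabilizer G x = ⊤
    · exact Or.inl hx
    · obtain ⟨W, hxW, hW⟩ := exists_maxStab hx
      refine Or.inr (Finset.mem_biUnion.2 ⟨W, by simpa using hW, mem_image.2
        ⟨_, (Set.Finite.mem_toFinset _).2 ⟨x, rfl⟩, ?_⟩⟩)
      exact Subgroup.map_subgroupOf_eq_of_le hxW
  refine (Set.ncard_le_ncard hs (Finset.finite_toSet _)).trans ?_
  rw [Set.ncard_coe_finset]
  refine (Finset.card_insert_le _ _).trans (Nat.succ_le_succ ((Finset.card_biUnion_le_card_mul _ _ C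
    fun W hW => ?_).trans (Nat.mul_le_mul_right _ hM)))
  have hW : MaxStab X W := by simpa using hW
  refine card_image_le.trans ?_
  rw [← Set.ncard_eq_toFinset_card]
  exact hC W hW.prop.1

end

theorem exists_ncard_le (X : Type*) [MetricSpace X] [CompactSpace X] {D : ℕ} (b : ℕ) (hD : 0 < D)
    (r : ℕ) : ∃ C : ℕ, ∀ (p : ℕ) [Fact p.Prime] (k G I : Type) [Field k] [CharP k p]
      [Algebra (ZMod p) k] [CommGroup G] [Finite G] [MulAction G X] [MulAction G I] [Finite I]
      (S : CoefSys X I k) (α : G → k), (∀ g : G, g ^ p = 1) → IsGood S G D b →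
      LinearIndependent (ZMod p) α → (∀ g : G, (∀ x : X, g • x = x) → g = 1) →
      Nat.card G ≤ p ^ r → (Set.range fun x : X => MulAction.stabilizer G x).ncard ≤ C := by
  induction r with
  | zero => exact ⟨2 ^ 1, fun p _ k G I _ _ _ _ _ _ _ _ S α _ _ _ _ h => ncard_stabilizer_le X h⟩
  | succ r ih =>
    obtain ⟨C, ih⟩ := ih
    obtain ⟨w, hw⟩ : ∃ w, w = (D + 1) * ((D + 1) * b) := ⟨_, rfl⟩
    obtain ⟨N, hN⟩ : ∃ N, N = (D + 2) ^ ((D + 1) * (2 * w) * (D + 1) + 1) * (2 * w) := ⟨_, rfl⟩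
    refine ⟨max (2 ^ (N + 1 + (C + 2) * (C + 2)) ^ (r + 1)) ((N + (C + 1) + 1) * C + 1),
      fun p _ k G I _ _ _ _ _ _ _ _ S α hG h hα he hc => ?_⟩
    by_cases hp : N + 1 + (C + 2) * (C + 2) < p
    · refine (h.ncard_step hG hD hα he (hw ▸ h.wtOn_univ_le) hN (fun W hW => ?_) hp).trans
        (le_max_right _ _)
      exact ih p k W I S (fun g => α g) (fun g => Subtype.ext (hG g)) (h.subgroup W)
        (hα.comp _ val_injective) (fun g hg => Subtype.ext (he g hg))
        (card_le_of_ne_top hG hW hc)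
    · exact (ncard_stabilizer_le X (hc.trans (Nat.pow_le_pow_left (not_lt.1 hp) _))).trans
        (le_max_left _ _)

end

end SmithTheory

/-- For a compact topological `n`-manifold `M` there is a constant `C` such that for
every prime `p` and every elementary abelian `p`-group `E` acting continuously and
effectively on `M`, the set of stabilizer subgroups is finite of size at most `C`. -/
theorem stabilizer_bound_of_elementary_abelian_action
    (n : ℕ) (M : Type*) [TopologicalSpace M] [T2Space M]
    [SecondCountableTopology M] [ChartedSpace (EuclideanSpace ℝ (Fin n)) M]
    [CompactSpace M] :
    ∃ C : ℕ, ∀ (p : ℕ), p.Prime →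
      ∀ (E : Type) [CommGroup E] [Finite E] [MulAction E M],
        (∀ g : E, g ^ p = 1) →
        (∀ g : E, Continuous fun x : M => g • x) →
        (∀ g : E, (∀ x : M, g • x = x) → g = 1) →
        (Set.range fun x : M => MulAction.stabilizer E x).Finite ∧
        (Set.range fun x : M => MulAction.stabilizer E x).ncard ≤ C := by
  let := TopologicalSpace.metrizableSpaceMetric M
  obtain ⟨b, hb⟩ := SmithTheory.exists_isGood n M
  obtain ⟨w, hw⟩ : ∃ w, w = (n + 1 + 1) * ((n + 1 + 1) * b) := ⟨_, rfl⟩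
  obtain ⟨C, hC⟩ := SmithTheory.exists_ncard_le M b n.succ_pos
    ((n + 1 + 1) * (2 * w) * (n + 1 + 1) * w)
  refine ⟨C, fun p hp E _ _ _ hE hcont he => ⟨toFinite _, ?_⟩⟩
  have : Fact p.Prime := ⟨hp⟩
  have e : Module.finrank (ZMod p) (GaloisField p (Nat.card E)) = Nat.card E :=
    GaloisField.finrank p Nat.card_pos.ne'
  obtain ⟨I, _, _, S, h⟩ := hb p hp E hE hcont (GaloisField p (Nat.card E))
  have hα := (Module.finBasisOfFinrankEq (ZMod p) _ e).linearIndependent.comp _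
    (Finite.equivFin E).injective
  refine hC p _ E I S _ hE h hα he ?_
  rw [← Subgroup.card_top]
  exact (h.rank_le hE n.succ_pos hα he (hw ▸ h.wtOn_univ_le) ⊤).2
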